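/- Let l > 5 be a prime with l ≡ 2 or 3 (mod 5). Let N be the number of elements a ∈ 𝔽_l such that the quartic gₐ(x) = x⁴ + a·x³ + (11a+2)·x² − a·x + 1 is irreducible in 𝔽_l[x] and divides the Hasse invariant Ĥ_{5,l}(x) in 𝔽_l[x]. Then: if l ≡ 1 (mod 4), 4·N = h(−5l); if l ≡ 3 (mod 8), 2·N = h(−5l) − 2; and if l ≡ 7 (mod 8), N = h(−5l) − 1. -/

import Mathlib

open Polynomial

/-- The Hasse invariant `Ĥ_{5,l}(x)` of the Tate normal form `E₅` in characteristic `l`. -/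
noncomputable def hasseInvariant5 (l : ℕ) : Polynomial (ZMod l) :=
  let n := l / 12
  let r := if l % 3 = 2 then 1 else 0
  let s := if l % 4 = 3 then 1 else 0
  let c4 : Polynomial (ZMod l) := X ^ 4 + 12 * X ^ 3 + 14 * X ^ 2 - 12 * X + 1
  let D : Polynomial (ZMod l) := X ^ 5 * (1 - 11 * X - X ^ 2)
  c4 ^ r * ((X ^ 2 + 1) * (X ^ 4 + 18 * X ^ 3 + 74 * X ^ 2 - 18 * X + 1)) ^ s *
    ∑ k ∈ Finset.range (n + 1),
      (Nat.choose (2 * n + s) (2 * k + s) : Polynomial (ZMod l)) *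
        (Nat.choose (2 * n - 2 * k) (n - k) : Polynomial (ZMod l)) *
        (-432 : Polynomial (ZMod l)) ^ (n - k) *
        (c4 ^ 3 - 1728 * D) ^ k * D ^ (n - k)

set_option linter.all false

namespace QH

/-- exponent `r` -/
def rr (l : ℕ) : ℕ := if l % 3 = 2 then 1 else 0
/-- exponent `s` -/
def ss (l : ℕ) : ℕ := if l % 4 = 3 then 1 else 0

/-- coefficients of the Hasse polynomial -/
def hc (l k : ℕ) : ℤ :=
  (Nat.choose (2 * (l/12) + ss l) (2 * k + ss l) : ℤ) *
    (Nat.choose (2 * (l/12) - 2 * k) ((l/12) - k) : ℤ) * (-432) ^ ((l/12) - k)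

/-- The polynomial whose zeros are the supersingular `j`-invariants. -/
noncomputable def Gp (l : ℕ) (R : Type*) [CommRing R] : R[X] :=
  X ^ (4 * rr l) * (X - 1728) ^ (6 * ss l) *
    (∑ k ∈ Finset.range (l / 12 + 1), (hc l k : R[X]) * (X - 1728) ^ k) ^ 12

lemma exp_sum {l : ℕ} (hl : l.Prime) (hl5 : 5 < l) :
    12 * (l / 12) + 4 * rr l + 6 * ss l = l - 1 := by
  have h2 : l % 2 = 1 := by
    rcases hl.eq_two_or_odd with h | h <;> omega
  have h3 : l % 3 ≠ 0 := by
    intro h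
    have := (Nat.prime_dvd_prime_iff_eq Nat.prime_three hl).1 (Nat.dvd_of_mod_eq_zero h)
    omega
  unfold rr ss
  split_ifs <;> omega

section
variable {l : ℕ} [Fact l.Prime] {k : Type*} [Field k] [Algebra (ZMod l) k]

lemma hasse_eval (hl5 : 5 < l) {x T : k} (hx : x ≠ 0) (hT0 : T ≠ 0) (hT : x * T = 1 - 11 * x - x ^ 2) :
    (aeval x (hasseInvariant5 l)) ^ 12 =
      (x ^ 6 * T) ^ (l - 1) * (Gp l k).eval ((T ^ 2 + 10 * T + 5) ^ 3 / T) := by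
  rw [← exp_sum Fact.out hl5]
  have hc4 : x ^ 4 + 12 * x ^ 3 + 14 * x ^ 2 - 12 * x + 1 = x ^ 2 * (T ^ 2 + 10 * T + 5) := by
    linear_combination (-(x * T) - 10 * x - (1 - 11 * x - x^2)) * hT
  have hc6 : ((x ^ 2 + 1) * (x ^ 4 + 18 * x ^ 3 + 74 * x ^ 2 - 18 * x + 1)) ^ 2 =
      (x ^ 2 * (T ^ 2 + 10 * T + 5)) ^ 3 - 1728 * (x ^ 6 * T) := by
    rw [← hc4]
    linear_combination (1728 * x ^ 5) * hT
  set c := T ^ 2 + 10 * T + 5 with hcdef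
  set j := c ^ 3 / T with hj
  have hcj : (x ^ 2 * c) ^ 3 = (x ^ 6 * T) * j := by
    rw [hj]; field_simp
  have hD : x ^ 5 * (1 - 11 * x - x ^ 2) = x ^ 6 * T := by rw [← hT]; ring
  have key : aeval x (hasseInvariant5 l) = (x ^ 2 * c) ^ (rr l) *
      ((x ^ 2 + 1) * (x ^ 4 + 18 * x ^ 3 + 74 * x ^ 2 - 18 * x + 1)) ^ (ss l) *
      ((x ^ 6 * T) ^ (l / 12) * ∑ k' ∈ Finset.range (l / 12 + 1), (hc l k' : k) * (j - 1728) ^ k') := by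
    unfold hasseInvariant5
    simp only [map_mul, map_pow, map_add, map_sub, map_one, aeval_X, map_sum, map_natCast, map_ofNat, map_neg]
    rw [hc4, hD, hcj]
    conv_rhs => rw [Finset.mul_sum]
    refine congrArg₂ _ rfl ?_
    apply Finset.sum_congr rfl
    intro i hi
    have hi' : i ≤ l / 12 := by simpa [Nat.lt_succ_iff] using hi
    obtain ⟨m, hm⟩ := Nat.exists_eq_add_of_le hi'
    have e1 : x ^ 6 * T * j - 1728 * (x ^ 6 * T) = (x ^ 6 * T) * (j - 1728) := by ring
    rw [e1, mul_pow]
    unfold hc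
    push_cast
    have : (x ^ 6 * T) ^ (l/12) = (x ^ 6 * T) ^ i * (x ^ 6 * T) ^ (l/12 - i) := by
      rw [← pow_add]; congr 1; omega
    rw [this]
    unfold ss
    ring
  rw [key]
  unfold Gp
  simp only [eval_mul, eval_pow, eval_X, eval_sub, eval_ofNat, eval_finsetSum, eval_intCast]
  generalize ∑ k' ∈ Finset.range (l / 12 + 1), (hc l k' : k) * (j - 1728) ^ k' = S
  generalize hD' : x ^ 6 * T = D at *
  have e2 : ((x ^ 2 * c) ^ rr l) ^ 12 = (D * j) ^ (4 * rr l) := by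
    rw [← hcj]; ring
  have e3 : (((x ^ 2 + 1) * (x ^ 4 + 18 * x ^ 3 + 74 * x ^ 2 - 18 * x + 1)) ^ ss l) ^ 12 = 
      (D * (j - 1728)) ^ (6 * ss l) := by
    have : D * (j - 1728) = ((x ^ 2 + 1) * (x ^ 4 + 18 * x ^ 3 + 74 * x ^ 2 - 18 * x + 1)) ^ 2 := by
      rw [hc6, hcj]; ring
    rw [this, ← pow_mul, ← pow_mul]; ring_nf
  rw [mul_pow, mul_pow, e2, e3, mul_pow D (j - 1728)]
  ring

lemma five_nonsq (hl5 : 5 < l) (hmod5 : l % 5 = 2 ∨ l % 5 = 3) : ¬ IsSquare (5 : ZMod l) := by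
  have n2 : ¬ IsSquare (2 : ZMod 5) := by decide
  have n3 : ¬ IsSquare (3 : ZMod 5) := by decide
  have : Fact (Nat.Prime 5) := ⟨by norm_num⟩
  have h := ZMod.exists_sq_eq_prime_iff_of_mod_four_eq_one (p := 5) (q := l) (by norm_num)
    (by omega)
  intro h5
  have h2 := h.2 (by exact_mod_cast h5)
  have h3 : (l : ZMod 5) = ((l % 5 : ℕ) : ZMod 5) := by simp
  rw [h3] at h2
  rcases hmod5 with h | h <;> rw [h] at h2
  · exact n2 (by exact_mod_cast h2)
  · exact n3 (by exact_mod_cast h2)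

lemma mem_prime {y : k} (hy : y ^ l = y) : ∃ a : ZMod l, algebraMap (ZMod l) k a = y := by
  have : CharP k l := charP_of_injective_algebraMap (algebraMap (ZMod l) k).injective l
  have h := (mem_bot_iff_intCast l k).1 ((Subfield.mem_bot_iff_pow_eq_self (F := k) l).2 hy)
  obtain ⟨n, hn⟩ := h
  exact ⟨n, by simp [hn]⟩

lemma pow_l_alg (a : ZMod l) : (algebraMap (ZMod l) k a) ^ l = algebraMap (ZMod l) k a := by
  rw [← map_pow, ZMod.pow_card]

/-- 125 is not the square of an element of the prime field -/
lemma nonsq125 (hl5 : 5 < l) (hmod5 : l % 5 = 2 ∨ l % 5 = 3) {y : k} (hy : y ^ l = y) {a : k} (ha : a ^ l = a)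
    (ha0 : a ≠ 0) : y ^ 2 ≠ 125 * a ^ 2 := by
  intro h
  obtain ⟨b, rfl⟩ := mem_prime hy
  obtain ⟨c, rfl⟩ := mem_prime ha
  have h' : b ^ 2 = 125 * c ^ 2 := by
    apply (algebraMap (ZMod l) k).injective
    rw [map_mul, map_ofNat]; simpa using h
  have hc : c ≠ 0 := by rintro rfl; simp at ha0
  apply five_nonsq hl5 hmod5
  have h5 : (5 : ZMod l) ≠ 0 := by
    have : ((5 : ℕ) : ZMod l) ≠ 0 := by
      rw [Ne, ZMod.natCast_eq_zero_iff]
      exact fun h => by have := Nat.le_of_dvd (by norm_num) h; omega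
    exact_mod_cast this
  refine ⟨b / (5 * c), ?_⟩
  field_simp
  rw [h']; ring

/-- the quartic -/
noncomputable def gq (a : ZMod l) : (ZMod l)[X] :=
  X ^ 4 + C a * X ^ 3 + C (11 * a + 2) * X ^ 2 - C a * X + 1

lemma gq_monic (a : ZMod l) : (gq a).Monic ∧ (gq a).natDegree = 4 := by
  unfold gq
  constructor
  · monicity!
  · compute_degree!

lemma cardk : Nat.card (ZMod l) = l := by simp

lemma not_zero_125 (hl5 : 5 < l) : (125 : k) ≠ 0 := by
  have h5 : (5 : ZMod l) ≠ 0 := by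
    have : ((5 : ℕ) : ZMod l) ≠ 0 := by
      rw [Ne, ZMod.natCast_eq_zero_iff]
      exact fun h => by have := Nat.le_of_dvd (by norm_num) h; omega
    exact_mod_cast this
  have h5' : (5 : k) ≠ 0 := by
    have := (_root_.map_ne_zero (algebraMap (ZMod l) k)).2 h5
    rwa [map_ofNat] at this
  have : (125 : k) = 5 ^ 3 := by norm_num
  rw [this]; exact pow_ne_zero _ h5'

lemma ofNat_pow_l (n : ℕ) : ((n : k)) ^ l = n := by
  have := pow_l_alg (k := k) (n : ZMod l)
  simpa using this

lemma gq_main [IsAlgClosed k] (hl5 : 5 < l) (hmod5 : l % 5 = 2 ∨ l % 5 = 3) {T : k}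
    (hT : T ^ (l + 1) = 125) {a : ZMod l} (ha0 : a ≠ 0)
    (ha : T ^ 2 + (22 - algebraMap (ZMod l) k a) * T + 125 = 0) :
    Irreducible (gq a) ∧
      (gq a ∣ hasseInvariant5 l ↔ (Gp l k).eval ((T ^ 2 + 10 * T + 5) ^ 3 / T) = 0) := by
  have : CharP k l := charP_of_injective_algebraMap (algebraMap (ZMod l) k).injective l
  have h125 := not_zero_125 (k := k) hl5
  have hT0 : T ≠ 0 := by rintro rfl; simp at hT; exact h125 hT.symm
  have c125 : (125 : k) ^ l = 125 := by exact_mod_cast ofNat_pow_l (l := l) (k := k) 125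
  have c11 : (11 : k) ^ l = 11 := by exact_mod_cast ofNat_pow_l (l := l) (k := k) 11
  have hTT : (T ^ l) ^ l = T := by
    have h1 : T ^ l * T = 125 := by rw [← pow_succ, hT]
    have h2 : (T ^ l) ^ l * T ^ l = 125 := by rw [← mul_pow, h1, c125]
    have h3 : T ^ l ≠ 0 := pow_ne_zero _ hT0
    apply mul_right_cancel₀ h3
    rw [h2, ← h1]; ring
  obtain ⟨x, hx⟩ := IsAlgClosed.exists_root
    (X ^ 2 + C (T + 11) * X - C (1 : k)) (by
      have : (X ^ 2 + C (T + 11) * X - C (1 : k)).degree = 2 := by compute_degree!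
      rw [this]; norm_num)
  rw [IsRoot.def] at hx
  simp only [eval_add, eval_sub, eval_pow, eval_X, eval_mul, eval_C] at hx
  have hx0 : x ≠ 0 := by rintro rfl; simp at hx
  set α := algebraMap (ZMod l) k a with hα
  have hα0 : α ≠ 0 := (_root_.map_ne_zero _).2 ha0
  have hgx : aeval x (gq a) = 0 := by
    unfold gq
    simp only [map_add, map_sub, map_mul, map_pow, aeval_X, aeval_C, map_ofNat, map_one, ← hα]
    have e : x ^ 2 - 1 = - (T + 11) * x := by linear_combination hx
    have e2 : x ^ 4 + α * x ^ 3 + (11 * α + 2) * x ^ 2 - α * x + 1 =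
      (x ^ 2 - 1) ^ 2 + 4 * x ^ 2 + α * x * (x ^ 2 - 1) + 11 * α * x ^ 2 := by ring
    rw [e2, e]
    linear_combination x ^ 2 * ha
  have frob_add : ∀ u v : k, (u + v) ^ l = u ^ l + v ^ l := fun u v => add_pow_char u v l
  have frob_sub : ∀ u v : k, (u - v) ^ l = u ^ l - v ^ l := fun u v => sub_pow_char u v
  have hxl2 : (x ^ l) ^ l = x ∨ (x ^ l) ^ l = - x⁻¹ := by
    have h1 : ((x ^ l) ^ l) ^ 2 + (T + 11) * ((x ^ l) ^ l) - 1 = 0 := by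
      have h := congrArg (fun y => (y ^ l) ^ l) hx
      simp only [frob_add, frob_sub, mul_pow, hTT, c11, one_pow] at h
      rw [zero_pow (NeZero.ne l), zero_pow (NeZero.ne l)] at h
      rw [← h]; ring
    have h2 : ((x ^ l) ^ l - x) * ((x ^ l) ^ l + x⁻¹) = 0 := by
      have e : T + 11 = x⁻¹ - x := by field_simp; linear_combination hx
      rw [e] at h1
      have : x * x⁻¹ = 1 := mul_inv_cancel₀ hx0
      linear_combination h1 - this
    rcases mul_eq_zero.1 h2 with h | h
    · left; linear_combination h
    · right; linear_combination h
  have hxne : (x ^ l) ^ l ≠ x := by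
    intro hxx
    set y := x + x⁻¹ with hy
    have hy2 : y ^ 2 = α * T := by
      have e : T = x⁻¹ - x - 11 := by field_simp; linear_combination hx
      have e1 : y ^ 2 = (x⁻¹ - x) ^ 2 + 4 := by rw [hy]; field_simp; ring
      rw [e1]
      have e2 : x⁻¹ - x = T + 11 := by rw [e]; ring
      rw [e2]; linear_combination ha
    have hyl : (y ^ l) ^ l = y := by
      rw [hy, frob_add, frob_add, inv_pow, inv_pow, hxx]
    apply nonsq125 hl5 hmod5 (k := k) (y := y * y ^ l) (a := α) _ (pow_l_alg a) hα0
    · calc (y * y ^ l) ^ 2 = y ^ 2 * (y ^ 2) ^ l := by ring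
        _ = α * α ^ l * T ^ (l + 1) := by rw [hy2]; ring
        _ = _ := by rw [hT, pow_l_alg a]; ring
    · rw [mul_pow, hyl, mul_comm]
  have hx4 : x ^ l ^ 4 = x := by
    have h : (x ^ l) ^ l = - x⁻¹ := hxl2.resolve_left hxne
    have e : x ^ l ^ 4 = ((((x ^ l) ^ l) ^ l) ^ l) := by
      rw [← pow_mul, ← pow_mul, ← pow_mul]; congr 1; ring
    have hodd : Odd l := (Fact.out : l.Prime).odd_of_ne_two (by omega)
    rw [e, h, Odd.neg_pow hodd, Odd.neg_pow hodd, inv_pow, inv_pow, h]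
    field_simp
  have hIntegral : IsIntegral (ZMod l) x := ⟨gq a, (gq_monic a).1, hgx⟩
  have hirr := minpoly.irreducible hIntegral
  have hcard : Nat.card (ZMod l) = l := by simp
  have d4 : (minpoly (ZMod l) x).natDegree ∣ 4 := by
    rw [hirr.natDegree_dvd_iff_dvd_X_pow_card_pow_sub_X, hcard]
    apply minpoly.dvd
    simp [hx4]
  have d2 : ¬ (minpoly (ZMod l) x).natDegree ∣ 2 := by
    rw [hirr.natDegree_dvd_iff_dvd_X_pow_card_pow_sub_X, hcard]
    rintro ⟨q, hq⟩
    have := congrArg (aeval x) hq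
    rw [map_mul, minpoly.aeval, zero_mul] at this
    simp only [map_sub, map_pow, aeval_X] at this
    apply hxne
    rw [← pow_mul, ← pow_two]
    linear_combination this
  have hdeg : (minpoly (ZMod l) x).natDegree = 4 := by
    have hle := Nat.le_of_dvd (by norm_num) d4
    interval_cases h : (minpoly (ZMod l) x).natDegree <;> simp_all
  have hmin : minpoly (ZMod l) x = gq a := by
    symm
    apply eq_of_monic_of_dvd_of_natDegree_le (minpoly.monic hIntegral) (gq_monic a).1 (minpoly.dvd _ _ hgx)
    rw [hdeg, (gq_monic a).2]
  refine ⟨hmin ▸ hirr, ?_⟩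
  rw [← hmin, minpoly.dvd_iff]
  have hev := hasse_eval (k := k) hl5 hx0 hT0 (by linear_combination hx)
  constructor
  · intro h
    rw [h, zero_pow (by norm_num)] at hev
    rcases mul_eq_zero.1 hev.symm with h' | h'
    · exact absurd h' (pow_ne_zero _ (mul_ne_zero (pow_ne_zero _ hx0) hT0))
    · exact h'
  · intro h
    rw [h, mul_zero] at hev
    exact pow_eq_zero_iff (by norm_num) |>.1 hev

lemma gq_irr_T [IsAlgClosed k] (hl5 : 5 < l) {a : ZMod l} (hirr : Irreducible (gq a)) :
    ∃ T : k, T ^ l ≠ T ∧ T ^ (l + 1) = 125 ∧ 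
      T ^ 2 + (22 - algebraMap (ZMod l) k a) * T + 125 = 0 := by
  have : CharP k l := charP_of_injective_algebraMap (algebraMap (ZMod l) k).injective l
  obtain ⟨x, hx⟩ := IsAlgClosed.exists_aeval_eq_zero k (gq a) (by
    rw [Polynomial.degree_eq_natDegree (gq_monic a).1.ne_zero, (gq_monic a).2]; norm_num)
  have hx0 : x ≠ 0 := by
    rintro rfl
    unfold gq at hx
    simp at hx
  set α := algebraMap (ZMod l) k a with hα
  have hgx := hx
  unfold gq at hgx
  simp only [map_add, map_sub, map_mul, map_pow, aeval_X, aeval_C, map_ofNat, map_one, ← hα] at hgx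
  set T := x⁻¹ - x - 11 with hT
  have hxT : x ^ 2 + (T + 11) * x - 1 = 0 := by rw [hT]; field_simp; ring
  have hTe : T ^ 2 + (22 - α) * T + 125 = 0 := by
    have : x ^ 2 * (T ^ 2 + (22 - α) * T + 125) = 0 := by
      rw [hT]; field_simp; rw [← hgx]; ring
    exact (mul_eq_zero.1 this).resolve_left (pow_ne_zero _ hx0)
  have hTl : T ^ l ≠ T := by
    intro h
    obtain ⟨τ, hτ⟩ := mem_prime h
    have hm : minpoly (ZMod l) x = gq a :=
      (minpoly.eq_of_irreducible_of_monic hirr hx (gq_monic a).1).symm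
    have hdvd : minpoly (ZMod l) x ∣ X ^ 2 + C (τ + 11) * X - 1 := by
      apply minpoly.dvd
      simp only [map_add, map_sub, map_mul, map_pow, aeval_X, aeval_C, map_ofNat, map_one, hτ]
      exact hxT
    have hd : (X ^ 2 + C (τ + 11) * X - 1 : (ZMod l)[X]).natDegree = 2 := by compute_degree!
    have := natDegree_le_of_dvd hdvd (by intro h; rw [h] at hd; simp at hd)
    rw [hm, hd, (gq_monic a).2] at this
    omega
  refine ⟨T, hTl, ?_, hTe⟩
  have frob_add : ∀ u v : k, (u + v) ^ l = u ^ l + v ^ l := fun u v => add_pow_char u v l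
  have frob_sub : ∀ u v : k, (u - v) ^ l = u ^ l - v ^ l := fun u v => sub_pow_char u v
  have c125 : (125 : k) ^ l = 125 := by exact_mod_cast ofNat_pow_l (l := l) (k := k) 125
  have c22 : (22 : k) ^ l = 22 := by exact_mod_cast ofNat_pow_l (l := l) (k := k) 22
  have h1 : (T ^ l) ^ 2 + (22 - α) * T ^ l + 125 = 0 := by
    have h := congrArg (fun y => y ^ l) hTe
    simp only [frob_add, frob_sub, mul_pow, c125, c22] at h
    rw [zero_pow (NeZero.ne l), hα, pow_l_alg, ← hα] at h
    rw [← h]; ring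
  have h2 : (T ^ l - T) * (T ^ l + T + (22 - α)) = 0 := by linear_combination h1 - hTe
  have h3 := (mul_eq_zero.1 h2).resolve_left (sub_ne_zero.2 hTl)
  rw [pow_succ]
  linear_combination T * h3 - hTe


/-- the set of supersingular fixed parameters -/
def SSet (l : ℕ) (k : Type*) [Field k] : Set k :=
  {T : k | T ^ (l + 1) = 125 ∧ (Gp l k).eval ((T ^ 2 + 10 * T + 5) ^ 3 / T) = 0}

lemma SSet_zero [IsAlgClosed k] (hl5 : 5 < l) (hmod5 : l % 5 = 2 ∨ l % 5 = 3) :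
    {T : k | T ∈ SSet l k ∧ T ^ 2 + 22 * T + 125 = 0}.ncard = if l % 4 = 3 then 2 else 0 := by
  have : CharP k l := charP_of_injective_algebraMap (algebraMap (ZMod l) k).injective l
  have hodd : Odd l := (Fact.out : l.Prime).odd_of_ne_two (by omega)
  have h125 := not_zero_125 (k := k) hl5
  obtain ⟨i, hi⟩ := IsAlgClosed.exists_pow_nat_eq (-1 : k) (n := 2) (by norm_num)
  have h2 : (2 : k) ≠ 0 := by
    have : ((2 : ℕ) : k) ≠ 0 := by
      rw [Ne, CharP.cast_eq_zero_iff k l]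
      exact fun h => by have := Nat.le_of_dvd (by norm_num) h; omega
    exact_mod_cast this
  have c11 : (11 : k) ^ l = 11 := by exact_mod_cast ofNat_pow_l (l := l) (k := k) 11
  have c2 : (2 : k) ^ l = 2 := by exact_mod_cast ofNat_pow_l (l := l) (k := k) 2
  have frob_add : ∀ u v : k, (u + v) ^ l = u ^ l + v ^ l := fun u v => add_pow_char u v l
  have frob_sub : ∀ u v : k, (u - v) ^ l = u ^ l - v ^ l := fun u v => sub_pow_char u v
  have hroots : ∀ T : k, T ^ 2 + 22 * T + 125 = 0 ↔ T = -11 + 2 * i ∨ T = -11 - 2 * i := by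
    intro T
    have : T ^ 2 + 22 * T + 125 = (T - (-11 + 2 * i)) * (T - (-11 - 2 * i)) := by
      linear_combination 4 * hi
    rw [this, mul_eq_zero, sub_eq_zero, sub_eq_zero]
  have hi0 : i ≠ 0 := by rintro rfl; simp at hi
  by_cases h43 : l % 4 = 3
  · rw [if_pos h43]
    have hil : i ^ l = - i := by
      have : l = 2 * (2 * (l / 4) + 1) + 1 := by omega
      rw [this, pow_succ, pow_mul, hi, pow_succ, pow_mul]; norm_num
    have : {T : k | T ∈ SSet l k ∧ T ^ 2 + 22 * T + 125 = 0} = {-11 + 2 * i, -11 - 2 * i} := by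
      ext T
      simp only [Set.mem_ofPred_eq, Set.mem_insert_iff, Set.mem_singleton_iff, ← hroots]
      refine ⟨fun h => h.2, fun h => ⟨⟨?_, ?_⟩, h⟩⟩
      · rcases (hroots T).1 h with rfl | rfl
        · rw [pow_succ, frob_add, mul_pow, Odd.neg_pow hodd, c11, c2, hil]
          linear_combination -4 * hi
        · rw [pow_succ, frob_sub, mul_pow, Odd.neg_pow hodd, c11, c2, hil]
          linear_combination -4 * hi
      · have hT0 : T ≠ 0 := by rintro rfl; apply h125; simpa using h
        have : (T ^ 2 + 10 * T + 5) ^ 3 / T = 1728 := by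
          rw [div_eq_iff hT0]
          linear_combination (T ^ 2 + 4 * T - 1) ^ 2 * h
        rw [this]
        unfold Gp
        have : ss l = 1 := by unfold ss; rw [if_pos h43]
        simp [this]
    rw [this, Set.ncard_pair]
    intro h
    have : 2 * 2 * i = 0 := by linear_combination h
    simp [h2, hi0] at this
  · rw [if_neg h43]
    have h41 : l % 4 = 1 := by
      obtain ⟨m, hm⟩ := hodd; omega
    have hil : i ^ l = i := by
      have : l = 2 * (2 * (l / 4)) + 1 := by omega
      rw [this, pow_succ, pow_mul, hi, pow_mul]; norm_num
    have : {T : k | T ∈ SSet l k ∧ T ^ 2 + 22 * T + 125 = 0} = ∅ := by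
      ext T
      simp only [Set.mem_ofPred_eq, Set.mem_empty_iff_false, iff_false, not_and]
      rintro ⟨hT, -⟩ h
      have hTl : T ^ l = T := by
        rcases (hroots T).1 h with rfl | rfl
        · rw [frob_add, mul_pow, Odd.neg_pow hodd, c11, c2, hil]
        · rw [frob_sub, mul_pow, Odd.neg_pow hodd, c11, c2, hil]
      apply nonsq125 hl5 hmod5 (k := k) hTl (a := 1) (by simp) (by simp)
      rw [pow_succ, hTl] at hT
      linear_combination hT
    rw [this, Set.ncard_empty]

theorem count_SS [IsAlgClosed k] (hl5 : 5 < l) (hmod5 : l % 5 = 2 ∨ l % 5 = 3) :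
    (SSet l k).ncard =
      2 * {a : ZMod l | Irreducible (gq a) ∧ gq a ∣ hasseInvariant5 l}.ncard +
        if l % 4 = 3 then 2 else 0 := by
  classical
  have : CharP k l := charP_of_injective_algebraMap (algebraMap (ZMod l) k).injective l
  have h125 := not_zero_125 (k := k) hl5
  have c125 : (125 : k) ^ l = 125 := by exact_mod_cast ofNat_pow_l (l := l) (k := k) 125
  have c22 : (22 : k) ^ l = 22 := by exact_mod_cast ofNat_pow_l (l := l) (k := k) 22
  have frob_add : ∀ u v : k, (u + v) ^ l = u ^ l + v ^ l := fun u v => add_pow_char u v l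
  have hfin : (SSet l k).Finite := by
    apply Set.Finite.subset (Polynomial.finite_setOfPred_isRoot (p := (X ^ (l + 1) - C 125 : k[X]))
      (X_pow_sub_C_ne_zero (by omega) _))
    rintro T ⟨hT, -⟩
    simp [hT]
  have hsplit : SSet l k = {T | T ∈ SSet l k ∧ T ^ 2 + 22 * T + 125 = 0} ∪
      {T | T ∈ SSet l k ∧ T ^ 2 + 22 * T + 125 ≠ 0} := by
    ext T; simp only [Set.mem_union, Set.mem_ofPred_eq]; tauto
  rw [hsplit, Set.ncard_union_eq (by
      rw [Set.disjoint_left]; rintro T ⟨_, h⟩ ⟨_, h'⟩; exact h' h)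
    (hfin.subset fun T h => h.1) (hfin.subset fun T h => h.1), SSet_zero hl5 hmod5, add_comm]
  congr 1
  set A : Set (ZMod l) := {a : ZMod l | Irreducible (gq a) ∧ gq a ∣ hasseInvariant5 l} with hA
  have hAfin : A.Finite := Set.toFinite _
  set B := {T : k | T ∈ SSet l k ∧ T ^ 2 + 22 * T + 125 ≠ 0} with hB
  have hBfin : B.Finite := hfin.subset fun T h => h.1
  -- zero is not in A
  have h0A : ∀ a ∈ A, a ≠ 0 := by
    rintro a ⟨ha, -⟩ rfl
    have e : gq (0 : ZMod l) = (X ^ 2 + 1) * (X ^ 2 + 1) := by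
      unfold gq; simp only [map_zero, mul_zero, zero_add, zero_mul, add_zero, sub_zero]
      rw [show (C (2 : ZMod l)) = 2 from rfl]; ring
    have hd : (X ^ 2 + 1 : (ZMod l)[X]).natDegree = 2 := by compute_degree!
    rw [e] at ha
    rcases ha.isUnit_or_isUnit rfl with h | h <;>
    · have := natDegree_eq_zero_of_isUnit h
      omega
  have hquad : ∀ a ∈ A, ∃ T1 T2 : k, T1 ≠ T2 ∧ T1 * T2 = 125 ∧ T1 ^ (l + 1) = 125 ∧ T2 ^ (l + 1) = 125 ∧
      ∀ T : k, T ^ 2 + (22 - algebraMap (ZMod l) k a) * T + 125 = 0 ↔ T = T1 ∨ T = T2 := by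
    rintro a ⟨ha, -⟩
    obtain ⟨T, h1, h2, h3⟩ := gq_irr_T (k := k) hl5 ha
    have hT0 : T ≠ 0 := by rintro rfl; apply h125; simpa using h3
    have h4 : T * T ^ l = 125 := by rw [← h2]; ring
    have h5 : T + T ^ l = algebraMap (ZMod l) k a - 22 := by
      apply mul_left_cancel₀ hT0
      linear_combination h3 + h4
    refine ⟨T, T ^ l, fun h => h1 h.symm, h4, h2, ?_, ?_⟩
    · rw [← pow_mul, mul_comm, pow_mul, h2, c125]
    · intro S
      have : S ^ 2 + (22 - algebraMap (ZMod l) k a) * S + 125 = (S - T) * (S - T ^ l) := by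
        linear_combination S * h5 - h4
      rw [this, mul_eq_zero, sub_eq_zero, sub_eq_zero]
  -- the map
  have hmap : ∀ T ∈ B, ∃ a ∈ A, T ^ 2 + (22 - algebraMap (ZMod l) k a) * T + 125 = 0 := by
    rintro T ⟨⟨hT, hG⟩, hne⟩
    have hT0 : T ≠ 0 := by rintro rfl; apply h125; simpa using hT.symm
    have hTT : (T ^ l) ^ l = T := by
      have h1 : T ^ l * T = 125 := by rw [← pow_succ, hT]
      have h2 : (T ^ l) ^ l * T ^ l = 125 := by rw [← mul_pow, h1, c125]
      have h3 : T ^ l ≠ 0 := pow_ne_zero _ hT0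
      apply mul_right_cancel₀ h3
      rw [h2, ← h1]; ring
    obtain ⟨a, ha⟩ := mem_prime (l := l) (y := T + T ^ l + 22) (by
      rw [frob_add, frob_add, hTT, c22]; ring)
    have hae : T ^ 2 + (22 - algebraMap (ZMod l) k a) * T + 125 = 0 := by
      rw [ha]; rw [pow_succ] at hT; linear_combination -hT
    have ha0 : a ≠ 0 := by
      rintro rfl
      apply hne
      simpa using hae
    have := gq_main hl5 hmod5 hT ha0 hae
    exact ⟨a, ⟨this.1, this.2.2 hG⟩, hae⟩
  choose! f hfA hfe using hmap
  have hfib : ∀ a ∈ hAfin.toFinset, (hBfin.toFinset.filter (fun T => f T = a)).card = 2 := by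
    intro a ha
    have haA : a ∈ A := hAfin.mem_toFinset.1 ha
    obtain ⟨T1, T2, hne, h12, hT1, hT2, hT⟩ := hquad a haA
    have hmem : ∀ T : k, T ^ (l + 1) = 125 → T ^ 2 + (22 - algebraMap (ZMod l) k a) * T + 125 = 0 →
        T ∈ B := by
      intro T h1 h2
      have hT0 : T ≠ 0 := by rintro rfl; apply h125; simpa using h2
      refine ⟨⟨h1, (gq_main hl5 hmod5 h1 (h0A a haA) h2).2.1 haA.2⟩, fun h => ?_⟩
      have : algebraMap (ZMod l) k a * T = 0 := by linear_combination h - h2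
      rcases mul_eq_zero.1 this with h' | h'
      · exact h0A a haA ((_root_.map_eq_zero _).1 h')
      · exact hT0 h'
    have : hBfin.toFinset.filter (fun T => f T = a) = {T1, T2} := by
      ext T
      simp only [Finset.mem_filter, Set.Finite.mem_toFinset, Finset.mem_insert, Finset.mem_singleton, ← hT]
      constructor
      · rintro ⟨hTB, rfl⟩
        exact hfe T hTB
      · intro h
        have hTB : T ∈ B := by
          apply hmem T _ h
          rcases (hT T).1 h with rfl | rfl
          · exact hT1
          · exact hT2
        refine ⟨hTB, ?_⟩
        have h3 := hfe T hTB
        have hT0 : T ≠ 0 := by rintro rfl; apply h125; simpa using h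
        have : (algebraMap (ZMod l) k (f T) - algebraMap (ZMod l) k a) * T = 0 := by
          linear_combination h - h3
        have := (mul_eq_zero.1 this).resolve_right hT0
        exact (algebraMap (ZMod l) k).injective (sub_eq_zero.1 this)
    rw [this, Finset.card_pair hne]
  rw [Set.ncard_eq_toFinset_card _ hBfin, Set.ncard_eq_toFinset_card _ hAfin,
    Finset.card_eq_sum_card_fiberwise (f := f) (t := hAfin.toFinset) (by
      intro T hT
      exact hAfin.mem_toFinset.2 (hfA T (hBfin.mem_toFinset.1 hT))), Finset.sum_congr rfl hfib]
  simp [mul_comm]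


end
end QH

namespace QH
section formal
open PowerSeries

/-- homogenisation of a polynomial `p` at `J/X` -/
noncomputable def hom {R : Type*} [CommRing R] (J : R⟦X⟧) (N : ℕ) (p : R[X]) : R⟦X⟧ :=
  ∑ i ∈ Finset.range (N + 1), PowerSeries.C (p.coeff i) * J ^ i * PowerSeries.X ^ (N - i)

variable {k : Type*} [Field k]

lemma hom_sub (J : k⟦X⟧) (N : ℕ) (p q : k[X]) : hom J N (p - q) = hom J N p - hom J N q := by
  unfold hom
  rw [← Finset.sum_sub_distrib]
  refine Finset.sum_congr rfl fun i _ => ?_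
  rw [Polynomial.coeff_sub, map_sub]; ring

lemma hom_eq_eval {K : Type*} [Field K] (ι : k⟦X⟧ →+* K) (hι : ι PowerSeries.X ≠ 0)
    (J : k⟦X⟧) (N : ℕ) (p : k[X]) (hp : p.natDegree ≤ N) :
    ι (hom J N p) = ι PowerSeries.X ^ N * p.eval₂ (ι.comp (PowerSeries.C)) (ι J / ι PowerSeries.X) := by
  rw [Polynomial.eval₂_eq_sum_range' _ (Nat.lt_succ_of_le hp), Finset.mul_sum, hom, map_sum]
  refine Finset.sum_congr rfl fun i hi => ?_
  have hi' : i ≤ N := by simpa [Nat.lt_succ_iff] using hi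
  rw [map_mul, map_mul, map_pow, map_pow, div_pow, RingHom.comp_apply]
  have : ι PowerSeries.X ^ N = ι PowerSeries.X ^ i * ι PowerSeries.X ^ (N - i) := by
    rw [← pow_add]; congr 1; omega
  rw [this]; field_simp

/-- if the homogenisation vanishes to high order then the polynomial is zero -/
lemma hom_zero (J : k⟦X⟧) (hJ : PowerSeries.constantCoeff J = 1) (N : ℕ) (p : k[X]) (hp : p.natDegree ≤ N)
    (h : PowerSeries.X ^ (N + 1) ∣ hom J N p) : p = 0 := by
  by_contra hp0
  set d := p.natDegree with hd
  have e : hom J N p = PowerSeries.X ^ (N - d) * hom J d p := by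
    unfold hom
    rw [Finset.mul_sum]
    symm
    have hsub : Finset.range (d + 1) ⊆ Finset.range (N + 1) := by
      intro i; simp only [Finset.mem_range]; omega
    rw [← Finset.sum_subset hsub]
    · refine Finset.sum_congr rfl fun i hi => ?_
      have hi' : i ≤ d := by simpa [Nat.lt_succ_iff] using hi
      have : N - i = (N - d) + (d - i) := by omega
      rw [this, pow_add]; ring
    · intro i _ hi
      have : d < i := by simp only [Finset.mem_range] at hi; omega
      rw [Polynomial.coeff_eq_zero_of_natDegree_lt this]; simp
  rw [e] at h
  have h2 : PowerSeries.X ∣ hom J d p := by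
    have h3 : (PowerSeries.X : k⟦X⟧) ^ (N - d) * PowerSeries.X ∣ PowerSeries.X ^ (N - d) * hom J d p := by
      refine dvd_trans ?_ h
      rw [← pow_succ]
      exact pow_dvd_pow _ (by omega)
    exact (mul_dvd_mul_iff_left (pow_ne_zero _ PowerSeries.X_ne_zero)).1 h3
  rw [PowerSeries.X_dvd_iff] at h2
  apply hp0
  rw [← Polynomial.leadingCoeff_eq_zero, Polynomial.leadingCoeff, ← hd]
  rw [← h2, hom, map_sum, Finset.sum_range_succ]
  rw [Finset.sum_eq_zero]
  · simp [hJ]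
  · intro i hi
    have : d - i ≠ 0 := by simp only [Finset.mem_range] at hi; omega
    simp [this]

/-- the theta operator -/
noncomputable def theta (f : k⟦X⟧) : k⟦X⟧ := PowerSeries.X * PowerSeries.derivative k f

lemma theta_add (f g : k⟦X⟧) : theta (f + g) = theta f + theta g := by
  simp [theta, mul_add]
lemma theta_sub (f g : k⟦X⟧) : theta (f - g) = theta f - theta g := by
  simp [theta, mul_sub]
lemma theta_mul (f g : k⟦X⟧) : theta (f * g) = f * theta g + g * theta f := by
  simp only [theta, Derivation.leibniz, smul_eq_mul]; ring
lemma theta_one : theta (1 : k⟦X⟧) = 0 := by simp [theta]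
lemma theta_nat (n : ℕ) : theta (n : k⟦X⟧) = 0 := by simp [theta]
lemma theta_int (n : ℤ) : theta (n : k⟦X⟧) = 0 := by simp [theta]
lemma theta_sum {ι : Type*} (s : Finset ι) (f : ι → k⟦X⟧) : theta (∑ i ∈ s, f i) = ∑ i ∈ s, theta (f i) := by
  simp [theta, Finset.mul_sum]
lemma theta_pow (f : k⟦X⟧) (n : ℕ) : f * theta (f ^ n) = n * f ^ n * theta f := by
  induction n with
  | zero => simp [theta_one]
  | succ n ih =>
    rw [pow_succ, theta_mul, mul_add, ← mul_assoc, mul_comm f (f ^ n), mul_comm f (theta (f^n)), ← mul_assoc,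
      mul_assoc f, mul_comm (theta (f^n)) f, ih]
    push_cast; ring

lemma coeff_theta (f : k⟦X⟧) (n : ℕ) : PowerSeries.coeff n (theta f) = n * PowerSeries.coeff n f := by
  unfold theta
  cases n with
  | zero => simp
  | succ n => 
    rw [PowerSeries.coeff_succ_X_mul, PowerSeries.coeff_derivative]; push_cast; ring

/-- Ramanujan data -/
structure Ram (E2 E4 E6 P : k⟦X⟧) : Prop where
  h2 : 12 * theta E2 = E2 ^ 2 - E4
  h4 : 3 * theta E4 = E2 * E4 - E6
  h6 : 2 * theta E6 = E2 * E6 - E4 ^ 2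
  hd : 1728 * (PowerSeries.X * P) = E4 ^ 3 - E6 ^ 2
  c4 : PowerSeries.constantCoeff E4 = 1
  c6 : PowerSeries.constantCoeff E6 = 1
  cP : PowerSeries.constantCoeff P = 1

variable {E2 E4 E6 P : k⟦X⟧}

lemma Ram.disc (H : Ram E2 E4 E6 P) (h2 : (2 : k) ≠ 0) (h3 : (3 : k) ≠ 0) :
    theta (PowerSeries.X * P) = E2 * (PowerSeries.X * P) := by
  have h := congrArg theta H.hd
  rw [theta_sub, show E4 ^ 3 = E4 * E4 * E4 by ring, show E6 ^ 2 = E6 * E6 by ring,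
    theta_mul (E4 * E4), theta_mul E4, theta_mul E6,
    show (1728 : k⟦X⟧) = ((1728 : ℕ) : k⟦X⟧) by norm_num, theta_mul ((1728 : ℕ) : k⟦X⟧), theta_nat] at h
  have hne : (1728 : k⟦X⟧) ≠ 0 := by
    have : (1728 : k) ≠ 0 := by
      rw [show (1728 : k) = 2 ^ 6 * 3 ^ 3 by norm_num]
      exact mul_ne_zero (pow_ne_zero _ h2) (pow_ne_zero _ h3)
    intro h
    apply this
    have := congrArg PowerSeries.constantCoeff h
    rwa [map_ofNat, map_zero] at this
  apply mul_left_cancel₀ hne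
  push_cast at h
  linear_combination h + E4 ^ 2 * H.h4 - E6 * H.h6 + E2 * H.hd * (-1)

lemma Ram.term (H : Ram E2 E4 E6 P) (h2 : (2 : k) ≠ 0) (h3 : (3 : k) ≠ 0) (r e m : ℕ) (hr : r = 0 ∨ r = 1)
    (hw : ((4 * r + 6 * e + 12 * m + 1 : ℕ) : k) = 0) :
    144 * theta (theta (E4 ^ r * (E6 ^ e * (PowerSeries.X * P) ^ m))) =
      (6 * (e : k⟦X⟧) + 1 + 4 * (r : k⟦X⟧)) ^ 2 * (E4 ^ (r + 1) * (E6 ^ e * (PowerSeries.X * P) ^ m)) +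
      432 * 144 * ((e : k⟦X⟧) * ((e : k⟦X⟧) - 1)) * (E4 ^ (r + 1) * (E6 ^ (e - 2) * (PowerSeries.X * P) ^ (m + 1))) := by
  have hD := H.disc h2 h3
  set Δ := PowerSeries.X * P with hΔ
  have hE4 : E4 ≠ 0 := by rintro rfl; have := H.c4; simp at this
  have hE6 : E6 ≠ 0 := by rintro rfl; have := H.c6; simp at this
  have hP : P ≠ 0 := by rintro rfl; have := H.cP; simp at this
  have hΔ0 : Δ ≠ 0 := mul_ne_zero PowerSeries.X_ne_zero hP
  have hw' : (4 * r + 6 * e + 12 * m + 1 : k⟦X⟧) = 0 := by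
    have := congrArg (PowerSeries.C (R := k)) hw
    rw [map_natCast, map_zero] at this
    push_cast at this
    exact this
  set f := E4 ^ r * (E6 ^ e * Δ ^ m) with hf
  set g := E4 * E6 with hg
  -- h with factor 12
  set h := - (E2 * E4 * E6) - 6 * e * E4 ^ 3 - 4 * r * E6 ^ 2 with hh
  have hgf : 12 * (g * theta f) = f * h := by
    apply mul_left_cancel₀ hΔ0
    have p4 := theta_pow E4 r
    have p6 := theta_pow E6 e
    have pD := theta_pow Δ m
    rw [hD] at pD
    rw [hf, theta_mul, theta_mul, hg, hh]
    linear_combination 12 * E6 * (E6 ^ e * Δ ^ (m + 1)) * p4 + 12 * E4 * E4 ^ r * Δ ^ (m + 1) * p6 +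
      12 * E4 * E6 * E4 ^ r * E6 ^ e * pD + 4 * r * E4 ^ r * E6 * (E6 ^ e * Δ ^ (m + 1)) * H.h4
      + 6 * e * E4 * E4 ^ r * Δ ^ (m + 1) * E6 ^ e * H.h6 + 
      E2 * E4 * E6 * E4 ^ r * E6 ^ e * Δ ^ (m + 1) * hw'
  have hth : 12 * theta h = -((E2 ^ 2 - E4) * E4 * E6 + 4 * E2 * (E2 * E4 - E6) * E6 + 6 * E2 * E4 * (E2 * E6 - E4 ^ 2))
      - 72 * e * E4 ^ 2 * (E2 * E4 - E6) - 48 * r * E6 * (E2 * E6 - E4 ^ 2) := by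
    rw [hh, theta_sub, theta_sub, show E6 ^ 2 = E6 * E6 by ring, show E4 ^ 3 = E4 * E4 * E4 by ring,
      show -(E2 * E4 * E6) = ((-1 : ℤ) : k⟦X⟧) * (E2 * E4 * E6) by push_cast; ring,
      show (6 : k⟦X⟧) * e = ((6 * e : ℕ) : k⟦X⟧) by push_cast; ring,
      show (4 : k⟦X⟧) * r = ((4 * r : ℕ) : k⟦X⟧) by push_cast; ring]
    simp only [theta_mul, theta_nat, theta_int]
    push_cast
    linear_combination - E4 * E6 * H.h2 - 4 * (E2 * E6) * H.h4 - 6 * E2 * E4 * H.h6 - 72 * e * E4 ^ 2 * H.h4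
      - 48 * r * E6 * H.h6
  have htg : 12 * theta g = 4 * E6 * (E2 * E4 - E6) + 6 * E4 * (E2 * E6 - E4 ^ 2) := by
    rw [hg, theta_mul]
    linear_combination 4 * E6 * H.h4 + 6 * E4 * H.h6
  have h2f : 12 * (g * theta (theta f) + theta f * theta g) = f * theta h + h * theta f := by
    have := congrArg theta hgf
    rw [show (12 : k⟦X⟧) = ((12 : ℕ) : k⟦X⟧) by norm_num, theta_mul ((12 : ℕ) : k⟦X⟧), theta_nat, theta_mul g, theta_mul f] at this
    push_cast at this
    linear_combination this
  have hr2 : (r : k⟦X⟧) * r = r := by rcases hr with rfl | rfl <;> simp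
  have hu : (e * (e - 1) : k⟦X⟧) * (E6 ^ 2 * E6 ^ (e - 2)) = (e * (e - 1) : k⟦X⟧) * E6 ^ e := by
    rcases e with _ | _ | e
    · simp
    · simp
    · rw [show e + 1 + 1 - 2 = e by omega, ← pow_add]; congr 2; ring
  have hg0 : 12 * g ^ 2 ≠ 0 := by
    have h12 : (12 : k⟦X⟧) ≠ 0 := by
      intro h
      have := congrArg PowerSeries.constantCoeff h
      rw [map_ofNat, map_zero, show (12 : k) = 2 ^ 2 * 3 by norm_num] at this
      exact mul_ne_zero (pow_ne_zero _ h2) h3 this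
    exact mul_ne_zero h12 (pow_ne_zero _ (mul_ne_zero hE4 hE6))
  apply mul_left_cancel₀ hg0
  have key : 12 * g ^ 2 * (144 * theta (theta f)) = 12 * f * h ^ 2 + 12 * g * f * (12 * theta h) - 12 * (12 * theta g) * (f * h) := by
    linear_combination 144 * g * h2f + (12 * h - 12 * 12 * theta g) * hgf
  rw [key, hth, htg]
  have e1 : E4 ^ (r + 1) * (E6 ^ e * Δ ^ m) = E4 * f := by rw [hf]; ring
  have e2 : 12 * g ^ 2 * (432 * 144 * (e * (e - 1)) * (E4 ^ (r + 1) * (E6 ^ (e - 2) * Δ ^ (m + 1)))) = 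
     12 * 36 * (e * (e - 1)) * E4 ^ 3 * f * (E4 ^ 3 - E6 ^ 2) := by
    rw [← H.hd, hg, hf]
    linear_combination 12 * 432 * 144 * E4 ^ 3 * E4 ^ r * Δ ^ (m + 1) * hu
  rw [mul_add (12 * g ^ 2), e1, e2, hg, hh]
  linear_combination (12 * 16 * E6 ^ 4 * f - 12 * 16 * E4 ^ 3 * E6 ^ 2 * f) * hr2

/-- coefficients -/
def cc (M m : ℕ) : ℤ := (M.choose (2 * m) : ℤ) * (m.centralBinom : ℤ) * (-432) ^ m

lemma cc_rec (M m : ℕ) :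
    ((m : ℤ) + 1) ^ 2 * cc M (m + 1) = -432 * (((M : ℤ) - 2 * m) * ((M : ℤ) - 2 * m - 1)) * cc M m := by
  have h1 : ((m : ℤ) + 1) * ((m + 1).centralBinom : ℤ) = 2 * (2 * m + 1) * m.centralBinom := by
    exact_mod_cast Nat.succ_mul_centralBinom_succ m
  have h2 : (M.choose (2 * (m + 1)) : ℤ) * ((2 * m + 2) * (2 * m + 1)) =
      (M.choose (2 * m) : ℤ) * (((M : ℤ) - 2 * m) * ((M : ℤ) - 2 * m - 1)) := by
    have a1 := Nat.choose_succ_right_eq M (2 * m)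
    have a2 := Nat.choose_succ_right_eq M (2 * m + 1)
    rcases lt_or_ge M (2 * m + 1) with h | h
    · have z1 : M.choose (2 * (m + 1)) = 0 := Nat.choose_eq_zero_of_lt (by omega)
      rcases lt_or_ge M (2 * m) with h' | h'
      · have z2 : M.choose (2 * m) = 0 := Nat.choose_eq_zero_of_lt (by omega)
        rw [z1, z2]; simp
      · have : M = 2 * m := by omega
        rw [z1, this]; push_cast; ring
    · have b1 : (M.choose (2 * m + 1) : ℤ) * (2 * m + 1) = M.choose (2 * m) * ((M : ℤ) - 2 * m) := by
        have := congrArg (Nat.cast (R := ℤ)) a1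
        push_cast [Nat.cast_sub (show 2 * m ≤ M by omega)] at this
        exact this
      have b2 : (M.choose (2 * m + 1 + 1) : ℤ) * (2 * m + 1 + 1) = M.choose (2 * m + 1) * ((M : ℤ) - (2 * m + 1)) := by
        have := congrArg (Nat.cast (R := ℤ)) a2
        push_cast [Nat.cast_sub (show 2 * m + 1 ≤ M by omega)] at this
        exact this
      rw [show 2 * (m + 1) = 2 * m + 1 + 1 by ring]
      linear_combination (2 * m + 1 : ℤ) * b2 + ((M : ℤ) - (2 * m + 1)) * b1
  unfold cc
  rw [pow_succ]
  have h3 : (M.choose (2 * (m + 1)) : ℤ) * (((m : ℤ) + 1) ^ 2 * ((m + 1).centralBinom : ℤ)) =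
     (M.choose (2 * m) : ℤ) * (((M : ℤ) - 2 * m) * ((M : ℤ) - 2 * m - 1)) * m.centralBinom := by
    linear_combination (M.choose (2 * (m + 1)) : ℤ) * (m + 1) * h1 + (m.centralBinom : ℤ) * h2
  linear_combination (-432) ^ m * (-432) * h3

/-- The Hasse invariant as a modular form mod `l`. -/
noncomputable def AA (l : ℕ) (E4 E6 P : k⟦X⟧) : k⟦X⟧ :=
  ∑ m ∈ Finset.range (l / 12 + 1), (cc (2 * (l / 12) + ss l) m : k⟦X⟧) *
    (E4 ^ rr l * (E6 ^ (2 * (l / 12) + ss l - 2 * m) * (PowerSeries.X * P) ^ m))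

lemma AA_theta {l : ℕ} [Fact l.Prime] [CharP k l] (hl5 : 5 < l) (H : Ram E2 E4 E6 P) :
    theta (theta (AA l E4 E6 P)) = 0 := by
  have hlk : ((l : ℕ) : k⟦X⟧) = 0 := by
    rw [← map_natCast (PowerSeries.C (R := k)), CharP.cast_eq_zero, map_zero]
  have hn2 : (2 : k) ≠ 0 := by
    have : ((2 : ℕ) : k) ≠ 0 := by
      rw [Ne, CharP.cast_eq_zero_iff k l]
      exact fun h => by have := Nat.le_of_dvd (by norm_num) h; omega
    exact_mod_cast this
  have hn3 : (3 : k) ≠ 0 := by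
    have : ((3 : ℕ) : k) ≠ 0 := by
      rw [Ne, CharP.cast_eq_zero_iff k l]
      exact fun h => by have := Nat.le_of_dvd (by norm_num) h; omega
    exact_mod_cast this
  have hsum := exp_sum (Fact.out : l.Prime) hl5
  set n := l / 12 with hn
  set M := 2 * n + ss l with hM
  set Δ := PowerSeries.X * P with hΔ
  have hs : ss l = 0 ∨ ss l = 1 := by unfold ss; split_ifs <;> simp
  have hr : rr l = 0 ∨ rr l = 1 := by unfold rr; split_ifs <;> simp
  have h144 : (144 : k⟦X⟧) ≠ 0 := by
    intro h
    have := congrArg PowerSeries.constantCoeff h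
    rw [map_ofNat, map_zero, show (144 : k) = 2 ^ 4 * 3 ^ 2 by norm_num] at this
    exact mul_ne_zero (pow_ne_zero _ hn2) (pow_ne_zero _ hn3) this
  apply mul_left_cancel₀ h144
  have hAA : AA l E4 E6 P = ∑ m ∈ Finset.range (n + 1), (cc M m : k⟦X⟧) *
    (E4 ^ rr l * (E6 ^ (M - 2 * m) * Δ ^ m)) := rfl
  have htc : ∀ (c : ℤ) (f : k⟦X⟧), theta ((c : k⟦X⟧) * f) = (c : k⟦X⟧) * theta f := by
    intro c f; rw [theta_mul, theta_int]; ring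
  rw [mul_zero, hAA, theta_sum, theta_sum, Finset.mul_sum]
  -- the k-valued weights
  have hlM : (6 * (M : k⟦X⟧) + 1 + 4 * (rr l : k⟦X⟧)) = 0 := by
    rw [← hlk]
    have : l = 6 * M + 1 + 4 * rr l := by
      have := (Fact.out : l.Prime).pos
      omega
    conv_rhs => rw [this]
    push_cast; ring
  have hterm : ∀ m ∈ Finset.range (n + 1), 144 * theta (theta ((cc M m : k⟦X⟧) * (E4 ^ rr l * (E6 ^ (M - 2 * m) * Δ ^ m)))) =
      E4 ^ (rr l + 1) * (144 * (m : k⟦X⟧) ^ 2 * (cc M m : k⟦X⟧) * (E6 ^ (M - 2 * m) * Δ ^ m)) - 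
      E4 ^ (rr l + 1) * (144 * ((m : k⟦X⟧) + 1) ^ 2 * (cc M (m + 1) : k⟦X⟧) * (E6 ^ (M - 2 * (m + 1)) * Δ ^ (m + 1))) := by
    intro m hm
    have hm' : m ≤ n := by simpa [Nat.lt_succ_iff] using hm
    have h2m : 2 * m ≤ M := by omega
    rw [htc, htc]
    have hT := H.term hn2 hn3 (rr l) (M - 2 * m) m hr (by
      rw [CharP.cast_eq_zero_iff k l]
      have : 4 * rr l + 6 * (M - 2 * m) + 12 * m + 1 = l := by
        have := (Fact.out : l.Prime).pos
        omega
      rw [this])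
    rw [← hΔ] at hT
    have hrec : ((m : k⟦X⟧) + 1) ^ 2 * (cc M (m + 1) : k⟦X⟧) =
        -432 * (((M : k⟦X⟧) - 2 * m) * ((M : k⟦X⟧) - 2 * m - 1)) * (cc M m : k⟦X⟧) := by
      have := congrArg (Int.cast (R := k⟦X⟧)) (cc_rec M m)
      push_cast at this
      exact this
    rw [Nat.cast_sub h2m] at hT
    push_cast at hT
    rw [show M - 2 * m - 2 = M - 2 * (m + 1) by omega] at hT
    generalize E6 ^ (M - 2 * m) * Δ ^ m = u at *
    generalize E6 ^ (M - 2 * (m + 1)) * Δ ^ (m + 1) = v at *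
    have e1 : E4 ^ rr l * u = E4 ^ rr l * u := rfl
    rw [pow_succ] at hT ⊢
    linear_combination (cc M m : k⟦X⟧) * hT + 144 * (E4 ^ rr l * E4 * v) * hrec + 
      (cc M m : k⟦X⟧) * (E4 ^ rr l * E4 * u) * (6 * ((M : k⟦X⟧) - 2 * m) + 1 + 4 * (rr l : k⟦X⟧) - 12 * m) * hlM
  rw [Finset.sum_congr rfl hterm]
  have tel := Finset.sum_range_sub' (fun m : ℕ => E4 ^ (rr l + 1) * (144 * (m : k⟦X⟧) ^ 2 * (cc M m : k⟦X⟧) * (E6 ^ (M - 2 * m) * Δ ^ m))) (n + 1)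
  push_cast at tel
  rw [tel]
  have : cc M (n + 1) = 0 := by
    unfold cc
    rw [Nat.choose_eq_zero_of_lt (by omega)]; simp
  rw [this]; simp

lemma AA_one {l : ℕ} [Fact l.Prime] [CharP k l] (hl5 : 5 < l) (H : Ram E2 E4 E6 P) :
    PowerSeries.X ^ l ∣ AA l E4 E6 P - 1 := by
  rw [PowerSeries.X_pow_dvd_iff]
  intro m hm
  rw [map_sub, sub_eq_zero, PowerSeries.coeff_one]
  split_ifs with h
  · subst h
    rw [PowerSeries.coeff_zero_eq_constantCoeff_apply, AA, map_sum, Finset.sum_range_succ']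
    rw [Finset.sum_eq_zero]
    · simp [H.c4, H.c6, cc]
    · intro m _
      simp
  · have h1 := AA_theta hl5 H
    have h2 := congrArg (PowerSeries.coeff m) h1
    rw [coeff_theta, coeff_theta, map_zero] at h2
    have hm0 : (m : k) ≠ 0 := by
      rw [Ne, CharP.cast_eq_zero_iff k l]
      exact fun h' => by have := Nat.le_of_dvd (by omega) h'; omega
    exact (mul_eq_zero.1 ((mul_eq_zero.1 h2).resolve_left hm0)).resolve_left hm0

lemma hc_cc (l m : ℕ) (hm : m ≤ l / 12) : hc l (l / 12 - m) = cc (2 * (l / 12) + ss l) m := by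
  unfold hc cc
  have e1 : 2 * (l / 12) + ss l - 2 * m = 2 * (l / 12 - m) + ss l := by omega
  rw [← e1, Nat.choose_symm (by omega), show 2 * (l / 12) - 2 * (l / 12 - m) = 2 * m by omega,
    show l / 12 - (l / 12 - m) = m by omega, Nat.centralBinom]

lemma Gp_deg {l : ℕ} [Fact l.Prime] (hl5 : 5 < l) : (Gp l k).natDegree ≤ l - 1 := by
  have hsum := exp_sum (Fact.out : l.Prime) hl5
  unfold Gp
  have hX : (Polynomial.X - 1728 : k[X]).natDegree ≤ 1 := by
    refine (natDegree_sub_le _ _).trans (max_le natDegree_X_le ?_)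
    rw [show (1728 : k[X]) = ((1728 : ℕ) : k[X]) by norm_num, natDegree_natCast]; norm_num
  have h1 : (∑ k_1 ∈ Finset.range (l / 12 + 1), ((hc l k_1 : ℤ) : k[X]) * (Polynomial.X - 1728) ^ k_1).natDegree ≤ l / 12 := by
    apply natDegree_sum_le_of_forall_le
    intro i hi
    have hi' : i ≤ l / 12 := by simpa [Nat.lt_succ_iff] using hi
    refine (natDegree_mul_le).trans ?_
    rw [natDegree_intCast, zero_add]
    refine (natDegree_pow_le).trans ?_
    nlinarith
  have h2 := natDegree_pow_le (p := ∑ k_1 ∈ Finset.range (l / 12 + 1), ((hc l k_1 : ℤ) : k[X]) * (Polynomial.X - 1728) ^ k_1) (n := 12)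
  have h3 := natDegree_pow_le (p := (Polynomial.X - 1728 : k[X])) (n := 6 * ss l)
  have h4 : (Polynomial.X ^ (4 * rr l) : k[X]).natDegree ≤ 4 * rr l := natDegree_X_pow_le _
  refine natDegree_mul_le.trans ((add_le_add natDegree_mul_le le_rfl).trans ?_)
  have h5 : 6 * ss l * (Polynomial.X - 1728 : k[X]).natDegree ≤ 6 * ss l := by nlinarith
  omega

theorem H_eq_Gp {l : ℕ} [Fact l.Prime] [CharP k l] (hl5 : 5 < l) (H : Ram E2 E4 E6 P)
    (Pi : k⟦X⟧) (hPi : P * Pi = 1) (Hp : k[X]) (hdeg : Hp.natDegree ≤ l - 1)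
    (hH : hom (E4 ^ 3 * Pi) (l - 1) Hp = Pi ^ (l - 1)) : Hp = Gp l k := by
  have hl1 : l - 1 + 1 = l := Nat.sub_add_cancel (Fact.out : l.Prime).one_le
  have hsum := exp_sum (Fact.out : l.Prime) hl5
  have hcPi : PowerSeries.constantCoeff Pi = 1 := by
    have := congrArg PowerSeries.constantCoeff hPi
    rw [map_mul, H.cP, one_mul, map_one] at this; exact this
  have hGdeg : (Gp l k).natDegree ≤ l - 1 := Gp_deg hl5
  -- compute hom of Gp
  have hG : hom (E4 ^ 3 * Pi) (l - 1) (Gp l k) = AA l E4 E6 P ^ 12 * Pi ^ (l - 1) := by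
    let ι := algebraMap k⟦X⟧ (FractionRing k⟦X⟧)
    have hinj : Function.Injective ι := IsFractionRing.injective _ _
    apply hinj
    have hX0 : ι PowerSeries.X ≠ 0 := by
      rw [Ne, map_eq_zero_iff ι hinj]; exact PowerSeries.X_ne_zero
    rw [hom_eq_eval ι hX0 _ _ _ hGdeg]
    have hPi' : ι P * ι Pi = 1 := by rw [← map_mul, hPi, map_one]
    have hP0 : ι P ≠ 0 := left_ne_zero_of_mul_eq_one hPi'
    have hPi0 : ι Pi ≠ 0 := right_ne_zero_of_mul_eq_one hPi'
    set j := ι (E4 ^ 3 * Pi) / ι PowerSeries.X with hj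
    have hΔj : ι (PowerSeries.X * P) * j = ι E4 ^ 3 := by
      rw [hj, map_mul, map_mul, map_pow]; field_simp; linear_combination ι E4 ^ 3 * hPi'
    have hd := congrArg ι H.hd
    rw [map_mul, map_ofNat, map_sub, map_pow, map_pow] at hd
    have hΔj2 : ι (PowerSeries.X * P) * (j - 1728) = ι E6 ^ 2 := by
      linear_combination hΔj - hd
    set δ := ι (PowerSeries.X * P) with hδ
    have hδ0 : δ ≠ 0 := by rw [hδ, map_mul]; exact mul_ne_zero hX0 hP0
    have hXδ : ι PowerSeries.X = δ * ι Pi := by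
      rw [hδ, map_mul]; linear_combination - ι PowerSeries.X * hPi'
    have hA : ι (AA l E4 E6 P) = ι E4 ^ rr l * ι E6 ^ ss l * 
        (δ ^ (l/12) * ∑ i ∈ Finset.range (l / 12 + 1), ((hc l i : ℤ) : FractionRing k⟦X⟧) * (j - 1728) ^ i) := by
      unfold AA
      rw [map_sum, Finset.mul_sum, Finset.mul_sum, ← Finset.sum_range_reflect]
      refine Finset.sum_congr rfl fun i hi => ?_
      have hi' : i ≤ l / 12 := by simpa [Nat.lt_succ_iff] using hi
      rw [show l / 12 + 1 - 1 - i = l / 12 - i by omega]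
      have e := hc_cc l (l / 12 - i) (by omega)
      rw [show l / 12 - (l / 12 - i) = i by omega] at e
      rw [← e]
      simp only [map_mul, map_pow, map_intCast]
      rw [← map_mul, ← hδ, show 2 * (l / 12) + ss l - 2 * (l / 12 - i) = 2 * i + ss l by omega]
      have e2 : δ ^ (l / 12) = δ ^ i * δ ^ (l / 12 - i) := by rw [← pow_add]; congr 1; omega
      rw [e2, pow_add, pow_mul, ← hΔj2, mul_pow]
      ring
    have hev : Polynomial.eval₂ (ι.comp (PowerSeries.C (R := k))) j (Gp l k) = 
       j ^ (4 * rr l) * (j - 1728) ^ (6 * ss l) *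
         (∑ i ∈ Finset.range (l / 12 + 1), ((hc l i : ℤ) : FractionRing k⟦X⟧) * (j - 1728) ^ i) ^ 12 := by
      have hic : ∀ z : ℤ, Polynomial.eval₂ (ι.comp (PowerSeries.C (R := k))) j (z : k[X]) = z := fun z => by
        rw [← Polynomial.coe_eval₂RingHom, map_intCast]
      unfold Gp
      simp only [Polynomial.eval₂_mul, Polynomial.eval₂_pow, Polynomial.eval₂_X, Polynomial.eval₂_sub, 
        Polynomial.eval₂_ofNat, Polynomial.eval₂_finsetSum, hic]
    rw [hev, map_mul, map_pow, map_pow, hA, hXδ]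
    generalize (∑ i ∈ Finset.range (l / 12 + 1), ((hc l i : ℤ) : FractionRing k⟦X⟧) * (j - 1728) ^ i) = S
    have a1 : (ι E4 ^ rr l) ^ 12 = (δ * j) ^ (4 * rr l) := by
      rw [hΔj, ← pow_mul, ← pow_mul]; congr 1; ring
    have a2 : (ι E6 ^ ss l) ^ 12 = (δ * (j - 1728)) ^ (6 * ss l) := by
      rw [hΔj2, ← pow_mul, ← pow_mul]; congr 1; ring
    rw [mul_pow (ι E4 ^ rr l * ι E6 ^ ss l), mul_pow (ι E4 ^ rr l), a1, a2, mul_pow δ j, mul_pow δ (j - 1728), mul_pow δ (ι Pi)]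
    have a3 : δ ^ (l - 1) = (δ ^ (l / 12)) ^ 12 * δ ^ (4 * rr l) * δ ^ (6 * ss l) := by
      rw [← pow_mul, ← pow_add, ← pow_add]; congr 1; omega
    rw [a3]; ring
  have hdiff : hom (E4 ^ 3 * Pi) (l - 1) (Gp l k - Hp) = (AA l E4 E6 P ^ 12 - 1) * Pi ^ (l - 1) := by
    rw [hom_sub, hG, hH]; ring
  have hz : Gp l k - Hp = 0 := by
    apply hom_zero (E4 ^ 3 * Pi) (by simp [H.c4, hcPi]) (l - 1) _ 
      ((natDegree_sub_le _ _).trans (max_le hGdeg hdeg))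
    rw [hl1, hdiff]
    apply Dvd.dvd.mul_right
    exact (AA_one hl5 H).trans (by simpa using sub_dvd_pow_sub_pow (AA l E4 E6 P) 1 12)
  exact (sub_eq_zero.1 hz).symm


end formal
end QH

namespace QH

/-- Power series over `ℂ` converging absolutely on the open unit disc. -/
def Conv : Subring (PowerSeries ℂ) where
  carrier := {F | ∀ x : ℂ, ‖x‖ < 1 → Summable fun n => ‖PowerSeries.coeff n F * x ^ n‖}
  mul_mem' := by
    intro F G hF hG x hx
    have := summable_norm_sum_mul_antidiagonal_of_summable_norm (hF x hx) (hG x hx)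
    refine this.congr fun n => ?_
    congr 1
    rw [PowerSeries.coeff_mul, Finset.sum_mul]
    refine Finset.sum_congr rfl fun p hp => ?_
    rw [← Finset.HasAntidiagonal.mem_antidiagonal.mp hp]; ring
  one_mem' := by
    intro x hx
    refine summable_of_ne_finset_zero (s := {0}) fun n hn => ?_
    have : n ≠ 0 := by simpa using hn
    simp [PowerSeries.coeff_one, this]
  add_mem' := by
    intro F G hF hG x hx
    refine Summable.of_norm_bounded ((hF x hx).add (hG x hx)) fun n => ?_
    rw [map_add, add_mul, norm_norm]
    exact norm_add_le _ _
  zero_mem' := by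
    intro x hx; simpa using summable_zero
  neg_mem' := by
    intro F hF x hx
    simpa using hF x hx

theorem mem_Conv {F : PowerSeries ℂ} :
    F ∈ Conv ↔ ∀ x : ℂ, ‖x‖ < 1 → Summable fun n => ‖PowerSeries.coeff n F * x ^ n‖ := Iff.rfl

/-- Evaluation of a power series at a point of the unit disc. -/
noncomputable def ev (F : PowerSeries ℂ) (x : ℂ) : ℂ := ∑' n, PowerSeries.coeff n F * x ^ n

theorem Conv.hasSum {F : PowerSeries ℂ} (hF : F ∈ Conv) {x : ℂ} (hx : ‖x‖ < 1) :
    HasSum (fun n => PowerSeries.coeff n F * x ^ n) (ev F x) := (hF x hx).of_norm.hasSum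

theorem ev_mul {F G : PowerSeries ℂ} (hF : F ∈ Conv) (hG : G ∈ Conv) {x : ℂ} (hx : ‖x‖ < 1) :
    ev (F * G) x = ev F x * ev G x := by
  unfold ev
  rw [tsum_mul_tsum_eq_tsum_sum_antidiagonal_of_summable_norm (hF x hx) (hG x hx)]
  congr 1; ext n
  rw [PowerSeries.coeff_mul, Finset.sum_mul]
  refine Finset.sum_congr rfl fun p hp => ?_
  rw [← Finset.HasAntidiagonal.mem_antidiagonal.mp hp]; ring

theorem ev_add {F G : PowerSeries ℂ} (hF : F ∈ Conv) (hG : G ∈ Conv) {x : ℂ} (hx : ‖x‖ < 1) :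
    ev (F + G) x = ev F x + ev G x := by
  unfold ev
  rw [← (hF x hx).of_norm.tsum_add (hG x hx).of_norm]
  simp [add_mul]

theorem ev_neg (F : PowerSeries ℂ) (x : ℂ) : ev (-F) x = - ev F x := by
  unfold ev
  rw [← tsum_neg]; simp

theorem ev_sub {F G : PowerSeries ℂ} (hF : F ∈ Conv) (hG : G ∈ Conv) {x : ℂ} (hx : ‖x‖ < 1) :
    ev (F - G) x = ev F x - ev G x := by
  rw [sub_eq_add_neg, ev_add hF (neg_mem hG) hx, ev_neg, sub_eq_add_neg]

theorem conv_C (c : ℂ) : PowerSeries.C c ∈ Conv := by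
  intro x hx
  refine summable_of_ne_finset_zero (s := {0}) fun n hn => ?_
  have : n ≠ 0 := by simpa using hn
  simp [PowerSeries.coeff_C, this]

theorem ev_C (c x : ℂ) : ev (PowerSeries.C c) x = c := by
  unfold ev
  rw [tsum_eq_single 0]
  · simp
  · intro n hn; simp [PowerSeries.coeff_C, hn]

theorem ev_one (x : ℂ) : ev 1 x = 1 := by
  have := ev_C 1 x
  rwa [map_one] at this

theorem conv_X : (PowerSeries.X : PowerSeries ℂ) ∈ Conv := by
  intro x hx
  refine summable_of_ne_finset_zero (s := {1}) fun n hn => ?_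
  have : n ≠ 1 := by simpa using hn
  simp [PowerSeries.coeff_X, this]

theorem ev_X (x : ℂ) : ev PowerSeries.X x = x := by
  unfold ev
  rw [tsum_eq_single 1]
  · simp
  · intro n hn; simp [PowerSeries.coeff_X, hn]

theorem ev_pow {F : PowerSeries ℂ} (hF : F ∈ Conv) {x : ℂ} (hx : ‖x‖ < 1) (n : ℕ) :
    ev (F ^ n) x = ev F x ^ n := by
  induction n with
  | zero => simp [ev_one]
  | succ n ih => rw [pow_succ, ev_mul (pow_mem hF n) hF hx, ih, pow_succ]

theorem ev_prod {ι : Type*} (s : Finset ι) (F : ι → PowerSeries ℂ) (hF : ∀ i ∈ s, F i ∈ Conv)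
    {x : ℂ} (hx : ‖x‖ < 1) : ev (∏ i ∈ s, F i) x = ∏ i ∈ s, ev (F i) x := by
  classical
  induction s using Finset.induction_on with
  | empty => simp [ev_one]
  | insert a s ha ih =>
    rw [Finset.prod_insert ha, Finset.prod_insert ha, ev_mul (hF a (by simp))
      (prod_mem fun i hi => hF i (by simp [hi])) hx, ih fun i hi => hF i (by simp [hi])]

theorem ev_sum {ι : Type*} (s : Finset ι) (F : ι → PowerSeries ℂ) (hF : ∀ i ∈ s, F i ∈ Conv)
    {x : ℂ} (hx : ‖x‖ < 1) : ev (∑ i ∈ s, F i) x = ∑ i ∈ s, ev (F i) x := by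
  classical
  induction s using Finset.induction_on with
  | empty => simp [ev]
  | insert a s ha ih =>
    rw [Finset.sum_insert ha, Finset.sum_insert ha, ev_add (hF a (by simp))
      (sum_mem fun i hi => hF i (by simp [hi])) hx, ih fun i hi => hF i (by simp [hi])]

theorem hasSum_expand {F : PowerSeries ℂ} (hF : F ∈ Conv) (p : ℕ) (hp : p ≠ 0) {x : ℂ}
    (hx : ‖x‖ < 1) :
    (Summable fun n => ‖PowerSeries.coeff n (PowerSeries.expand p hp F) * x ^ n‖) ∧
    HasSum (fun n => PowerSeries.coeff n (PowerSeries.expand p hp F) * x ^ n) (ev F (x ^ p)) := by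
  have hx' : ‖x ^ p‖ < 1 := by rw [norm_pow]; exact pow_lt_one₀ (norm_nonneg _) hx hp
  have hinj : Function.Injective (fun n : ℕ => p * n) := fun a b h => by
    simpa [hp] using h
  have h0 : ∀ n ∉ Set.range (fun n : ℕ => p * n),
      PowerSeries.coeff n (PowerSeries.expand p hp F) * x ^ n = 0 := by
    intro n hn
    rw [PowerSeries.coeff_expand_of_not_dvd, zero_mul]
    rintro ⟨m, rfl⟩; exact hn ⟨m, rfl⟩
  have e : ∀ n, PowerSeries.coeff (p * n) (PowerSeries.expand p hp F) * x ^ (p * n)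
      = PowerSeries.coeff n F * (x ^ p) ^ n := by
    intro n; rw [PowerSeries.coeff_expand_mul, pow_mul]
  constructor
  · rw [← hinj.summable_iff (fun n hn => by rw [h0 n hn, norm_zero])]
    refine (hF _ hx').congr fun n => ?_
    exact congrArg norm (e n).symm
  · rw [← hinj.hasSum_iff h0]
    refine (Conv.hasSum hF hx').congr_fun ?_ |> id
    intro n; exact e n

theorem conv_expand {F : PowerSeries ℂ} (hF : F ∈ Conv) (p : ℕ) (hp : p ≠ 0) :
    PowerSeries.expand p hp F ∈ Conv := fun _ hx => (hasSum_expand hF p hp hx).1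

theorem ev_expand {F : PowerSeries ℂ} (hF : F ∈ Conv) (p : ℕ) (hp : p ≠ 0) {x : ℂ}
    (hx : ‖x‖ < 1) : ev (PowerSeries.expand p hp F) x = ev F (x ^ p) :=
  (hasSum_expand hF p hp hx).2.tsum_eq

theorem conv_rescale {F : PowerSeries ℂ} (hF : F ∈ Conv) {a : ℂ} (ha : ‖a‖ = 1) :
    PowerSeries.rescale a F ∈ Conv := by
  intro x hx
  refine (hF (a * x) (by rw [norm_mul, ha, one_mul]; exact hx)).congr fun n => ?_
  rw [PowerSeries.coeff_rescale, mul_pow]; congr 1; ring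

theorem ev_rescale (F : PowerSeries ℂ) (a x : ℂ) :
    ev (PowerSeries.rescale a F) x = ev F (a * x) := by
  unfold ev
  congr 1; ext n
  rw [PowerSeries.coeff_rescale, mul_pow]; ring

theorem ev_hasFPowerSeriesAt {F : PowerSeries ℂ} (hF : F ∈ Conv) :
    HasFPowerSeriesAt (ev F)
      (FormalMultilinearSeries.ofScalars ℂ fun n => PowerSeries.coeff n F) 0 := by
  rw [hasFPowerSeriesAt_iff]
  filter_upwards [Metric.ball_mem_nhds (0 : ℂ) one_pos] with x hx
  have hx : ‖x‖ < 1 := by simpa using hx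
  simpa [mul_comm] using Conv.hasSum hF hx

theorem ev_zero_of {F : PowerSeries ℂ} (hF : F ∈ Conv)
    (h : ∀ x : ℂ, x ≠ 0 → ‖x‖ < 1 → ev F x = 0) : F = 0 := by
  have hp := ev_hasFPowerSeriesAt hF
  have h1 : ∀ᶠ x in nhdsWithin (0 : ℂ) {0}ᶜ, ev F x = 0 := by
    filter_upwards [self_mem_nhdsWithin, nhdsWithin_le_nhds (Metric.ball_mem_nhds (0 : ℂ) one_pos)]
      with x hx hx'
    exact h x hx (by simpa using hx')
  have h0 : ev F 0 = 0 := by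
    have c : Filter.Tendsto (ev F) (nhdsWithin 0 {0}ᶜ) (nhds (ev F 0)) :=
      hp.continuousAt.mono_left nhdsWithin_le_nhds
    exact tendsto_nhds_unique (c.congr' h1) tendsto_const_nhds
  have h2 : ∀ᶠ x in nhds (0 : ℂ), ev F x = 0 := by
    filter_upwards [Metric.ball_mem_nhds (0 : ℂ) one_pos] with x hx
    by_cases h' : x = 0
    · rw [h', h0]
    · exact h x h' (by simpa using hx)
  have h3 := hp.locally_zero_iff.mp h2
  ext n
  have := congrArg (fun p => p.coeff n) h3
  have h0 : (0 : FormalMultilinearSeries ℂ ℂ ℂ).coeff n = 0 := rfl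
  simpa [FormalMultilinearSeries.coeff_ofScalars, h0] using this

theorem ev_inj {F G : PowerSeries ℂ} (hF : F ∈ Conv) (hG : G ∈ Conv)
    (h : ∀ x : ℂ, x ≠ 0 → ‖x‖ < 1 → ev F x = ev G x) : F = G := by
  rw [← sub_eq_zero]
  refine ev_zero_of (sub_mem hF hG) fun x h0 hx => ?_
  rw [ev_sub hF hG hx, h x h0 hx, sub_self]

theorem exists_ev {f : ℂ → ℂ} (hf : DifferentiableOn ℂ f (Metric.ball 0 1)) :
    ∃ F ∈ Conv, (∀ x : ℂ, ‖x‖ < 1 → ev F x = f x) ∧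
      ∀ n, PowerSeries.coeff n F = (n.factorial : ℂ)⁻¹ * iteratedDeriv n f 0 := by
  refine ⟨PowerSeries.mk fun n => (n.factorial : ℂ)⁻¹ * iteratedDeriv n f 0, ?_, ?_, ?_⟩
  · intro x hx
    have := Complex.hasSum_taylorSeries_on_ball hf (z := x) (by simpa using hx)
    refine (this.summable.norm).congr fun n => ?_
    simp [mul_comm, mul_left_comm]
  · intro x hx
    have := Complex.hasSum_taylorSeries_on_ball hf (z := x) (by simpa using hx)
    rw [ev, ← this.tsum_eq]
    congr 1; ext n; simp; ring
  · intro n; simp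

theorem ev_differentiableOn {F : PowerSeries ℂ} (hF : F ∈ Conv) :
    DifferentiableOn ℂ (ev F) (Metric.ball 0 1) := by
  have hp : HasFPowerSeriesOnBall (ev F)
      (FormalMultilinearSeries.ofScalars ℂ fun n => PowerSeries.coeff n F) 0 1 := by
    refine ⟨?_, one_pos, ?_⟩
    · refine ENNReal.le_of_forall_nnreal_lt fun r hr => ?_
      refine FormalMultilinearSeries.le_radius_of_summable _ ?_
      have hr' : (r : ℝ) < 1 := by exact_mod_cast hr
      refine (hF (r : ℂ) (by simpa using hr')).congr fun n => ?_
      simp [FormalMultilinearSeries.ofScalars_norm]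
    · intro y hy
      have hy : ‖y‖ < 1 := by
        have : edist y 0 < 1 := hy
        rw [edist_zero_right, ← ofReal_norm_eq_enorm] at this
        exact (ENNReal.ofReal_lt_one).mp this
      simpa [mul_comm, FormalMultilinearSeries.ofScalars_apply_eq] using Conv.hasSum hF hy
  intro x hx
  have := hp.analyticAt_of_mem (y := x) (by
    have hx : ‖x‖ < 1 := by simpa using hx
    show edist x 0 < 1
    rw [edist_zero_right, ← ofReal_norm_eq_enorm]; exact ENNReal.ofReal_lt_one.mpr hx)
  exact this.differentiableAt.differentiableWithinAt

theorem coeff_eq_iteratedDeriv {F : PowerSeries ℂ} (hF : F ∈ Conv) (n : ℕ) :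
    PowerSeries.coeff n F = (n.factorial : ℂ)⁻¹ * iteratedDeriv n (ev F) 0 := by
  obtain ⟨G, hG, h1, h2⟩ := exists_ev (ev_differentiableOn hF)
  rw [ev_inj hF hG fun x _ hx => (h1 x hx).symm]
  rw [h2, ev_inj hF hG fun x _ hx => (h1 x hx).symm]

theorem conv_theta {F : PowerSeries ℂ} (hF : F ∈ Conv) :
    theta F ∈ Conv ∧ ∀ x : ℂ, ‖x‖ < 1 → ev (theta F) x = x * deriv (ev F) x := by
  obtain ⟨G, hG, h1, h2⟩ := exists_ev ((ev_differentiableOn hF).deriv Metric.isOpen_ball)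
  have e : PowerSeries.derivative ℂ F = G := by
    ext n
    rw [PowerSeries.coeff_derivative, h2, coeff_eq_iteratedDeriv hF, iteratedDeriv_succ',
      Nat.factorial_succ]
    have : (n : ℂ) + 1 ≠ 0 := by exact_mod_cast n.succ_ne_zero
    have := Nat.factorial_ne_zero n
    push_cast
    field_simp
  have : theta F = PowerSeries.X * G := by rw [theta, e]
  rw [this]
  refine ⟨mul_mem conv_X hG, fun x hx => ?_⟩
  rw [ev_mul conv_X hG hx, ev_X, h1 x hx]

theorem exists_inv {F : PowerSeries ℂ} (hF : F ∈ Conv) (h : ∀ x : ℂ, ‖x‖ < 1 → ev F x ≠ 0) :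
    ∃ G ∈ Conv, F * G = 1 ∧ ∀ x : ℂ, ‖x‖ < 1 → ev G x = (ev F x)⁻¹ := by
  obtain ⟨G, hG, h1, -⟩ := exists_ev (f := fun x => (ev F x)⁻¹)
    ((ev_differentiableOn hF).inv fun x hx => h x (by simpa using hx))
  refine ⟨G, hG, ?_, h1⟩
  refine ev_inj (mul_mem hF hG) (one_mem _) fun x _ hx => ?_
  rw [ev_mul hF hG hx, h1 x hx, ev_one, mul_inv_cancel₀ (h x hx)]

theorem conv_of_mul_eq_one {F G : PowerSeries ℂ} (hF : F ∈ Conv)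
    (h : ∀ x : ℂ, ‖x‖ < 1 → ev F x ≠ 0) (hFG : F * G = 1) :
    G ∈ Conv ∧ ∀ x : ℂ, ‖x‖ < 1 → ev G x = (ev F x)⁻¹ := by
  obtain ⟨G', h1, h2, h3⟩ := exists_inv hF h
  have : G = G' := by
    calc G = G * (F * G') := by rw [h2, mul_one]
      _ = (F * G) * G' := by ring
      _ = G' := by rw [hFG, one_mul]
  rw [this]; exact ⟨h1, h3⟩

end QH

namespace QH

/-- The nome `q = exp (2 π i z)`. -/
noncomputable def qq (z : ℂ) : ℂ := Complex.exp (2 * Real.pi * Complex.I * z)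

theorem qq_ne (z : ℂ) : qq z ≠ 0 := Complex.exp_ne_zero _

theorem norm_qq (z : ℂ) : ‖qq z‖ = Real.exp (-(2 * Real.pi * z.im)) := by
  rw [qq, Complex.norm_exp]; congr 1; simp [Complex.mul_re, Complex.mul_im]

theorem norm_qq_lt {z : ℂ} (hz : 0 < z.im) : ‖qq z‖ < 1 := by
  rw [norm_qq, Real.exp_lt_one_iff]
  have := Real.pi_pos
  have : 0 < 2 * Real.pi * z.im := by positivity
  linarith

theorem qq_surj {x : ℂ} (h0 : x ≠ 0) (hx : ‖x‖ < 1) : ∃ z : ℂ, 0 < z.im ∧ qq z = x := by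
  have hpi : (2 * Real.pi * Complex.I : ℂ) ≠ 0 := Complex.two_pi_I_ne_zero
  refine ⟨Complex.log x / (2 * Real.pi * Complex.I), ?_, ?_⟩
  · have e : qq (Complex.log x / (2 * Real.pi * Complex.I)) = x := by
      rw [qq, mul_div_cancel₀ _ hpi, Complex.exp_log h0]
    have h1 := norm_qq (Complex.log x / (2 * Real.pi * Complex.I))
    rw [e] at h1
    rw [h1, Real.exp_lt_one_iff] at hx
    have := Real.pi_pos
    by_contra h
    push Not at h
    nlinarith
  · rw [qq, mul_div_cancel₀ _ hpi, Complex.exp_log h0]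

theorem qq_add (z w : ℂ) : qq (z + w) = qq z * qq w := by
  rw [qq, qq, qq, ← Complex.exp_add]; ring_nf

theorem qq_pow (z : ℂ) (n : ℕ) : qq z ^ n = qq (n * z) := by
  rw [qq, qq, ← Complex.exp_nat_mul]; ring_nf

theorem qq_one : qq 1 = 1 := by rw [qq, mul_one, Complex.exp_two_pi_mul_I]

theorem qq_int (n : ℤ) : qq n = 1 := by
  rw [qq, mul_comm, Complex.exp_int_mul_two_pi_mul_I]

theorem qq_add_one (z : ℂ) : qq (z + 1) = qq z := by rw [qq_add, qq_one, mul_one]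

theorem qq_inv_isPrimitiveRoot (l : ℕ) (hl : l ≠ 0) : IsPrimitiveRoot (qq (1 / l)) l := by
  have := Complex.isPrimitiveRoot_exp l hl
  rwa [show qq (1 / l) = Complex.exp (2 * Real.pi * Complex.I / l) by rw [qq]; ring_nf]

theorem qq_differentiable : Differentiable ℂ qq := by unfold qq; fun_prop

theorem conv_of_X_mul {F : PowerSeries ℂ} (h : PowerSeries.X * F ∈ Conv) : F ∈ Conv := by
  intro x hx
  by_cases h0 : x = 0
  · subst h0
    refine summable_of_ne_finset_zero (s := {0}) fun n hn => ?_
    have : n ≠ 0 := by simpa using hn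
    simp [this]
  have h1 := (summable_nat_add_iff 1).mpr (h x hx)
  have h2 := h1.mul_left ‖x‖⁻¹
  refine h2.congr fun n => ?_
  have : ‖x‖ ≠ 0 := by simpa using h0
  rw [PowerSeries.coeff_succ_X_mul, pow_succ, norm_mul, norm_mul, norm_mul]
  field_simp

theorem ev_eq_C {F : PowerSeries ℂ} (hF : F ∈ Conv) (c : ℂ)
    (h : ∀ z : ℂ, 0 < z.im → ev F (qq z) = c) : F = PowerSeries.C c := by
  refine ev_inj hF (conv_C c) fun x h0 hx => ?_
  obtain ⟨z, hz, rfl⟩ := qq_surj h0 hx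
  rw [h z hz, ev_C]

theorem ev_inj_qq {F G : PowerSeries ℂ} (hF : F ∈ Conv) (hG : G ∈ Conv)
    (h : ∀ z : ℂ, 0 < z.im → ev F (qq z) = ev G (qq z)) : F = G := by
  refine ev_inj hF hG fun x h0 hx => ?_
  obtain ⟨z, hz, rfl⟩ := qq_surj h0 hx
  exact h z hz

theorem pabs {R : Type*} [CommRing R] (ι : R →+* ℂ) (hι : Function.Injective ι)
    (A : Subring (ℂ → ℂ)) (hAC : ∀ c : ℂ, (fun _ => c) ∈ A) (t : ℂ → ℂ) (htA : t ∈ A)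
    (U : PowerSeries R) (hU : PowerSeries.constantCoeff U = 1)
    (hUc : PowerSeries.map ι U ∈ Conv)
    (ht : ∀ z : ℂ, 0 < z.im → qq z * t z = ev (PowerSeries.map ι U) (qq z))
    (hconst : ∀ f ∈ A, ∀ F ∈ Conv, (∀ z : ℂ, 0 < z.im → f z = ev F (qq z)) →
      ∃ c : ℂ, ∀ z : ℂ, 0 < z.im → f z = c) (N : ℕ) :
    ∀ (F : PowerSeries R) (f : ℂ → ℂ), PowerSeries.map ι F ∈ Conv → f ∈ A →
      (∀ z : ℂ, 0 < z.im → qq z ^ N * f z = ev (PowerSeries.map ι F) (qq z)) →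
      ∃ p : R[X], p.natDegree ≤ N ∧ F = hom U N p ∧
        ∀ z : ℂ, 0 < z.im → f z = (p.map ι).eval (t z) := by
  induction N with
  | zero =>
    intro F f hF hf h
    obtain ⟨c, hc⟩ := hconst f hf _ hF fun z hz => by rw [← h z hz, pow_zero, one_mul]
    have h1 := ev_eq_C hF c fun z hz => by rw [← h z hz, pow_zero, one_mul, hc z hz]
    have h2 : ι (PowerSeries.constantCoeff F) = c := by
      have := congrArg (PowerSeries.coeff 0) h1
      rw [PowerSeries.coeff_map] at this
      simpa using this
    refine ⟨C (PowerSeries.constantCoeff F), by simp, ?_, ?_⟩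
    · have : Function.Injective (PowerSeries.map ι) := PowerSeries.map_injective ι hι
      apply this
      rw [h1, hom]
      simp [h2]
    · intro z hz; simp [hc z hz, h2]
  | succ N ih =>
    intro F f hF hf h
    set c := PowerSeries.constantCoeff F with hc
    obtain ⟨F', hF'⟩ : PowerSeries.X ∣ F - PowerSeries.C c * U ^ (N + 1) := by
      rw [PowerSeries.X_dvd_iff]; simp [hU, hc]
    have hcU : PowerSeries.map ι (PowerSeries.C c * U ^ (N + 1)) ∈ Conv := by
      rw [map_mul, map_pow, PowerSeries.map_C]
      exact mul_mem (conv_C _) (pow_mem hUc _)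
    have hF2 : PowerSeries.map ι F - PowerSeries.map ι (PowerSeries.C c * U ^ (N + 1))
        = PowerSeries.X * PowerSeries.map ι F' := by
      rw [← map_sub, hF', map_mul, PowerSeries.map_X]
    have hF'c : PowerSeries.map ι F' ∈ Conv := by
      apply conv_of_X_mul
      rw [← hF2]
      exact sub_mem hF hcU
    obtain ⟨p, hp1, hp2, hp3⟩ := ih F' (f - (fun _ => ι c) * t ^ (N + 1)) hF'c
      (sub_mem hf (mul_mem (hAC _) (pow_mem htA _))) (by
        intro z hz
        have hq := norm_qq_lt hz
        apply mul_left_cancel₀ (qq_ne z)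
        have e1 : ev (PowerSeries.X * PowerSeries.map ι F') (qq z)
            = qq z * ev (PowerSeries.map ι F') (qq z) := by
          rw [ev_mul conv_X hF'c hq, ev_X]
        rw [← e1, ← hF2, ev_sub hF hcU hq, ← h z hz, map_mul, map_pow, PowerSeries.map_C,
          ev_mul (conv_C _) (pow_mem hUc _) hq, ev_C, ev_pow hUc hq, ← ht z hz]
        simp only [Pi.sub_apply, Pi.mul_apply, Pi.pow_apply]
        ring)
    refine ⟨p + C c * X ^ (N + 1), ?_, ?_, ?_⟩
    · refine natDegree_add_le_of_degree_le (by omega) (natDegree_C_mul_X_pow_le _ _)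
    · have e : F = PowerSeries.C c * U ^ (N + 1) + PowerSeries.X * F' := by rw [← hF']; ring
      rw [e, hp2, hom, hom, Finset.sum_range_succ _ (N + 1), Finset.mul_sum, add_comm]
      congr 1
      · refine Finset.sum_congr rfl fun i hi => ?_
        have hi : i < N + 1 := Finset.mem_range.mp hi
        have : (p + C c * X ^ (N + 1)).coeff i = p.coeff i := by
          simp [coeff_X_pow, hi.ne]
        rw [this, show N + 1 - i = (N - i) + 1 by omega]; ring
      · have : (p + C c * X ^ (N + 1)).coeff (N + 1) = c := by
          rw [coeff_add, coeff_eq_zero_of_natDegree_lt (by omega)]; simp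
        rw [this]; simp
    · intro z hz
      have := hp3 z hz
      simp only [Pi.sub_apply, Pi.mul_apply, Pi.pow_apply] at this
      simp only [Polynomial.map_add, Polynomial.map_mul, Polynomial.map_pow, map_C, map_X,
        eval_add, eval_mul, eval_C, eval_pow, eval_X, ← this]
      ring

theorem descent {R : Type*} [CommRing R] (ι : R →+* ℂ) (hι : Function.Injective ι) (l : ℕ)
    (hl : l ≠ 0) (f : ℂ → ℂ) (hf : ∀ z : ℂ, 0 < z.im → f (z + 1) = f z) (N : ℕ)
    (F : PowerSeries R) (hF : PowerSeries.map ι F ∈ Conv)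
    (h : ∀ z : ℂ, 0 < z.im → qq (z / l) ^ (l * N) * f z = ev (PowerSeries.map ι F) (qq (z / l))) :
    ∃ F' : PowerSeries R, F = PowerSeries.expand l hl F' ∧ PowerSeries.map ι F' ∈ Conv ∧
      ∀ z : ℂ, 0 < z.im → qq z ^ N * f z = ev (PowerSeries.map ι F') (qq z) := by
  have hlC : (l : ℂ) ≠ 0 := by exact_mod_cast hl
  have hlpos : (0 : ℝ) < l := by exact_mod_cast Nat.pos_of_ne_zero hl
  have him : ∀ z : ℂ, 0 < z.im → 0 < (z / l).im := by
    intro z hz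
    rw [Complex.div_natCast_im]; positivity
  have hζ := qq_inv_isPrimitiveRoot l hl
  set ζ := qq (1 / l) with hζd
  have hζn : ‖ζ‖ = 1 := hζ.norm'_eq_one hl
  have hr : PowerSeries.rescale ζ (PowerSeries.map ι F) = PowerSeries.map ι F := by
    refine ev_inj (conv_rescale hF hζn) hF fun x h0 hx => ?_
    obtain ⟨w, hw, rfl⟩ := qq_surj h0 hx
    have hw' : 0 < (l * w).im := by
      rw [← Complex.ofReal_natCast, Complex.im_ofReal_mul]
      positivity
    have h1 := h (l * w) hw'
    have h2 := h (l * w + 1) (by simpa using hw')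
    have e1 : (l * w) / l = w := by field_simp
    have e2 : (l * w + 1) / l = 1 / l + w := by field_simp; ring
    rw [e1] at h1
    rw [e2, qq_add, ← hζd, hf _ hw', mul_pow, pow_mul ζ, hζ.pow_eq_one, one_pow, one_mul, h1] at h2
    rw [ev_rescale, h2]
  have hz : ∀ n, ¬ l ∣ n → PowerSeries.coeff n F = 0 := by
    intro n hn
    have h1 := congrArg (PowerSeries.coeff n) hr
    rw [PowerSeries.coeff_rescale, PowerSeries.coeff_map] at h1
    have h2 : (ζ ^ n - 1) * ι (PowerSeries.coeff n F) = 0 := by rw [sub_mul, h1]; ring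
    rcases mul_eq_zero.mp h2 with h3 | h3
    · exact absurd (hζ.dvd_of_pow_eq_one n (sub_eq_zero.mp h3)) hn
    · exact hι (by rw [h3, map_zero])
  set F' : PowerSeries R := PowerSeries.mk fun n => PowerSeries.coeff (l * n) F with hF'
  have hFF : F = PowerSeries.expand l hl F' := by
    ext n
    by_cases hn : l ∣ n
    · obtain ⟨m, rfl⟩ := hn
      rw [PowerSeries.coeff_expand_mul, hF', PowerSeries.coeff_mk]
    · rw [hz n hn, PowerSeries.coeff_expand_of_not_dvd _ _ _ hn]
  have hF'c : PowerSeries.map ι F' ∈ Conv := by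
    intro y hy
    obtain ⟨x, rfl⟩ := IsAlgClosed.exists_pow_nat_eq y (Nat.pos_of_ne_zero hl)
    have hx : ‖x‖ < 1 := by
      by_contra hx
      rw [norm_pow] at hy
      exact absurd hy (not_lt.mpr (one_le_pow₀ (not_lt.mp hx)))
    have hinj : Function.Injective (fun n : ℕ => l * n) := fun a b h => by simpa [hl] using h
    refine ((hF x hx).comp_injective hinj).congr fun n => ?_
    simp [hF', pow_mul]
  refine ⟨F', hFF, hF'c, fun z hz => ?_⟩
  have h1 := h z hz
  have e : qq (z / l) ^ l = qq z := by rw [qq_pow]; congr 1; field_simp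
  rw [hFF, PowerSeries.map_expand, ev_expand hF'c l hl (norm_qq_lt (him z hz)), pow_mul, e] at h1
  exact h1

end QH

namespace QH

theorem tlu_iterated {f : ℂ → ℂ} {F : ℕ → ℂ → ℂ}
    (h : TendstoLocallyUniformlyOn F f Filter.atTop (Metric.ball 0 1))
    (hF : ∀ n, Differentiable ℂ (F n)) (m : ℕ) :
    TendstoLocallyUniformlyOn (fun n => iteratedDeriv m (F n)) (iteratedDeriv m f) Filter.atTop
      (Metric.ball 0 1) ∧ ∀ n, Differentiable ℂ (iteratedDeriv m (F n)) := by
  induction m with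
  | zero => simpa using ⟨h, hF⟩
  | succ m ih =>
    have h1 := ih.1.deriv (Filter.Eventually.of_forall fun n => (ih.2 n).differentiableOn)
      Metric.isOpen_ball
    constructor
    · simpa only [iteratedDeriv_succ, Function.comp_def] using h1
    · intro n
      rw [iteratedDeriv_succ]
      have := (ih.2 n).differentiableOn (s := Set.univ) |>.deriv isOpen_univ
      exact differentiableOn_univ.mp this

theorem iteratedDeriv_poly (p : ℤ[X]) (n : ℕ) :
    (n.factorial : ℂ)⁻¹ * iteratedDeriv n (fun x : ℂ => aeval x p) 0 = (p.coeff n : ℤ) := by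
  have hc : PowerSeries.map (Int.castRingHom ℂ) (p : PowerSeries ℤ) ∈ Conv := by
    intro x hx
    refine summable_of_ne_finset_zero (s := p.support) fun n hn => ?_
    simp [Polynomial.notMem_support_iff.mp hn]
  have he : ev (PowerSeries.map (Int.castRingHom ℂ) (p : PowerSeries ℤ)) = fun x => aeval x p := by
    ext x
    rw [ev, aeval_eq_sum_range, tsum_eq_sum (s := Finset.range (p.natDegree + 1))]
    · refine Finset.sum_congr rfl fun i _ => ?_
      simp
    · intro n hn
      have : p.coeff n = 0 := coeff_eq_zero_of_natDegree_lt (by simpa using hn)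
      simp [this]
  have := coeff_eq_iteratedDeriv hc n
  rw [he] at this
  rw [← this]; simp

theorem exists_int_ev {f : ℂ → ℂ} {p : ℕ → ℤ[X]}
    (h : TendstoLocallyUniformlyOn (fun n x => aeval x (p n)) f Filter.atTop (Metric.ball 0 1))
    : ∃ F : PowerSeries ℤ, PowerSeries.map (Int.castRingHom ℂ) F ∈ Conv ∧
      ∀ x : ℂ, ‖x‖ < 1 → ev (PowerSeries.map (Int.castRingHom ℂ) F) x = f x := by
  have hd : ∀ n, Differentiable ℂ (fun x : ℂ => aeval x (p n)) := fun n =>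
    Polynomial.differentiable_aeval _
  have hf : DifferentiableOn ℂ f (Metric.ball 0 1) := h.differentiableOn
    (Filter.Eventually.of_forall fun n => (hd n).differentiableOn) Metric.isOpen_ball
  obtain ⟨G, hG, h1, h2⟩ := exists_ev hf
  have hIntegral : ∀ n, ∃ a : ℤ, (a : ℂ) = PowerSeries.coeff n G := by
    intro n
    have h3 := ((tlu_iterated h hd n).1.tendsto_at (Metric.mem_ball_self one_pos)).const_mul
      (n.factorial : ℂ)⁻¹
    simp_rw [iteratedDeriv_poly] at h3
    rw [← h2] at h3
    have hcl : IsClosed (Set.range ((↑) : ℤ → ℂ)) := Complex.isClosed_range_intCast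
    exact hcl.mem_of_tendsto h3 (Filter.Eventually.of_forall fun m => ⟨_, rfl⟩)
  choose a ha using hIntegral
  have : PowerSeries.map (Int.castRingHom ℂ) (PowerSeries.mk a) = G := by
    ext n; simp [ha]
  exact ⟨PowerSeries.mk a, by rwa [this], by rwa [this]⟩

theorem exists_phi : ∃ F : PowerSeries ℤ, PowerSeries.map (Int.castRingHom ℂ) F ∈ Conv ∧
      ∀ x : ℂ, ‖x‖ < 1 → ev (PowerSeries.map (Int.castRingHom ℂ) F) x
        = ∏' n : ℕ, (1 - x ^ (n + 1)) := by
  refine exists_int_ev (p := fun N => ∏ n ∈ Finset.range N, (1 - X ^ (n + 1))) ?_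
  have h := ModularForm.multipliableLocallyUniformlyOn_one_sub_pow.hasProdLocallyUniformlyOn
  have h2 := h.tendstoLocallyUniformlyOn_finsetRange
  refine h2.congr fun N x _ => ?_
  simp [map_prod]

/-- Euler's product `∏ (1 - X^n)` as an integral power series. -/
noncomputable def phi : PowerSeries ℤ := exists_phi.choose

/-- Its complex version. -/
noncomputable def phiC : PowerSeries ℂ := PowerSeries.map (Int.castRingHom ℂ) phi

theorem phiC_conv : phiC ∈ Conv := exists_phi.choose_spec.1

theorem ev_phiC {x : ℂ} (hx : ‖x‖ < 1) : ev phiC x = ∏' n : ℕ, (1 - x ^ (n + 1)) :=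
  exists_phi.choose_spec.2 x hx

theorem ev_zero (F : PowerSeries ℂ) : ev F 0 = PowerSeries.coeff 0 F := by
  unfold ev
  rw [tsum_eq_single 0]
  · simp
  · intro n hn; simp [hn]

theorem phi_const : PowerSeries.constantCoeff phi = 1 := by
  have h1 := ev_phiC (x := 0) (by simp)
  rw [ev_zero, phiC, PowerSeries.coeff_map] at h1
  simp at h1
  exact_mod_cast h1

theorem ev_phiC_ne {x : ℂ} (hx : ‖x‖ < 1) : ev phiC x ≠ 0 := by
  by_cases h0 : x = 0
  · subst h0
    rw [ev_zero, phiC, PowerSeries.coeff_map]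
    simp [phi_const]
  obtain ⟨z, hz, rfl⟩ := qq_surj h0 hx
  have := ModularForm.eta_tprod_ne_zero (z := z) hz
  rw [ev_phiC hx]
  convert this using 4 with n
  rw [ModularForm.eta_q_eq_pow, qq]

/-- Inverse of `phi`. -/
noncomputable def phinv : PowerSeries ℤ := PowerSeries.invOfUnit phi 1

theorem phi_mul_phinv : phi * phinv = 1 := PowerSeries.mul_invOfUnit _ _ (by simp [phi_const])

theorem phinv_const : PowerSeries.constantCoeff phinv = 1 := by
  have := congrArg PowerSeries.constantCoeff phi_mul_phinv
  simpa [phi_const] using this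

noncomputable def phinvC : PowerSeries ℂ := PowerSeries.map (Int.castRingHom ℂ) phinv

theorem phinvC_conv : phinvC ∈ Conv ∧ ∀ x : ℂ, ‖x‖ < 1 → ev phinvC x = (ev phiC x)⁻¹ := by
  refine conv_of_mul_eq_one phiC_conv (fun x hx => ev_phiC_ne hx) ?_
  rw [phiC, phinvC, ← map_mul, phi_mul_phinv, map_one]

open ModularForm in
theorem eta_eq {z : ℂ} (hz : 0 < z.im) : eta z = qq (z / 24) * ev phiC (qq z) := by
  rw [ModularForm.eta, ev_phiC (norm_qq_lt hz)]
  congr 1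
  · rw [Function.Periodic.qParam, qq]; congr 1; push_cast; ring
  · congr 1; ext n; rw [eta_q_eq_pow, qq]

open ModularForm in
theorem eta_ne {z : ℂ} (hz : 0 < z.im) : eta z ≠ 0 := eta_ne_zero hz

open ModularForm in
theorem eta_diff {z : ℂ} (hz : 0 < z.im) : DifferentiableAt ℂ eta z :=
  differentiableAt_eta_of_mem_upperHalfPlaneSet hz

open ModularForm in
theorem eta_S {z : ℂ} (hz : 0 < z.im) : ∃ s r : ℂ, s ^ 2 = z ∧ r ^ 2 = -Complex.I ∧
    (r = (Complex.sqrt Complex.I)⁻¹) ∧ ModularForm.eta (-1 / z) = r * s * ModularForm.eta z := by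
  have h0 : z ≠ 0 := by rintro rfl; simp at hz
  refine ⟨Complex.sqrt z, (Complex.sqrt Complex.I)⁻¹, ?_, ?_, rfl, ?_⟩
  · rw [Complex.sqrt, show (2⁻¹ : ℂ) = ((2 : ℕ) : ℂ)⁻¹ by norm_num,
      Complex.cpow_nat_inv_pow _ two_ne_zero]
  · rw [inv_pow, Complex.sqrt, show (2⁻¹ : ℂ) = ((2 : ℕ) : ℂ)⁻¹ by norm_num,
      Complex.cpow_nat_inv_pow _ two_ne_zero, Complex.inv_I]
  · have := eta_comp_eq_csqrt_I_inv (x := z) hz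
    simpa [mul_assoc] using this

/-- The modular discriminant, as the 24th power of the eta function. -/
noncomputable def Dl (z : ℂ) : ℂ := ModularForm.eta z ^ 24

theorem Dl_ne {z : ℂ} (hz : 0 < z.im) : Dl z ≠ 0 := pow_ne_zero _ (eta_ne hz)

theorem Dl_eq {z : ℂ} (hz : 0 < z.im) : Dl z = qq z * ev phiC (qq z) ^ 24 := by
  rw [Dl, eta_eq hz, mul_pow, qq_pow]
  congr 2; push_cast; ring

theorem Dl_T {z : ℂ} (hz : 0 < z.im) : Dl (z + 1) = Dl z := by
  rw [Dl_eq hz, Dl_eq (by simpa using hz), qq_add_one]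

theorem Dl_S {z : ℂ} (hz : 0 < z.im) : Dl (-1 / z) = z ^ 12 * Dl z := by
  obtain ⟨s, r, hs, hr, -, h⟩ := eta_S hz
  rw [Dl, Dl, h, mul_pow, mul_pow, show (24 : ℕ) = 2 * 12 by norm_num, pow_mul r, pow_mul s, hs, hr]
  have : (-Complex.I) ^ 12 = 1 := by
    rw [show (12 : ℕ) = 4 * 3 by norm_num, pow_mul]; simp [Even.neg_pow (by decide : Even 4)]
  rw [this, one_mul]

/-- The Hauptmodul for `Γ₀(5)`. -/
noncomputable def tt (z : ℂ) : ℂ := (ModularForm.eta z / ModularForm.eta (5 * z)) ^ 6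

theorem im5 {z : ℂ} (hz : 0 < z.im) : 0 < (5 * z).im := by
  simpa using hz

theorem imS {z : ℂ} (hz : 0 < z.im) : 0 < (-1 / z).im := by
  rw [neg_div, one_div, Complex.neg_im, Complex.inv_im]
  have h0 : z ≠ 0 := by rintro rfl; simp at hz
  have := Complex.normSq_pos.mpr h0
  rw [neg_div, neg_neg]; positivity

theorem tt_ne {z : ℂ} (hz : 0 < z.im) : tt z ≠ 0 :=
  pow_ne_zero _ (div_ne_zero (eta_ne hz) (eta_ne (im5 hz)))

theorem tt_W {z : ℂ} (hz : 0 < z.im) : tt (-1 / (5 * z)) = 125 / tt z := by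
  have h0 : z ≠ 0 := by rintro rfl; simp at hz
  obtain ⟨s, r, hs, hr, hr', h⟩ := eta_S hz
  obtain ⟨s', r', hs', hr1, hr1', h'⟩ := eta_S (im5 hz)
  have e : (5 : ℂ) * (-1 / (5 * z)) = -1 / z := by field_simp
  rw [tt, tt, e, h, h', hr1', ← hr']
  have hs6 : s ^ 6 = z ^ 3 := by rw [← hs]; ring
  have hs6' : s' ^ 6 = 125 * z ^ 3 := by
    calc s' ^ 6 = (s' ^ 2) ^ 3 := by ring
      _ = _ := by rw [hs']; ring
  have hr0 : r ≠ 0 := by rintro rfl; simp at hr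
  have n1 := eta_ne hz
  have n2 := eta_ne (im5 hz)
  have hs0 : s ≠ 0 := by rintro rfl; simp at hs; exact h0 hs.symm
  rw [div_pow, div_pow, mul_pow, mul_pow, mul_pow, mul_pow, hs6, hs6']
  field_simp

theorem tt_four {z : ℂ} (hz : 0 < z.im) : tt z ^ 4 = Dl z / Dl (5 * z) := by
  rw [tt, Dl, Dl, div_pow, div_pow]; ring

theorem tt_diff {z : ℂ} (hz : 0 < z.im) : DifferentiableAt ℂ tt z := by
  unfold tt
  have h1 := eta_diff hz
  have h2 : DifferentiableAt ℂ (fun z => ModularForm.eta (5 * z)) z :=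
    DifferentiableAt.comp z (eta_diff (im5 hz)) (by fun_prop)
  exact (h1.div h2 (eta_ne (im5 hz))).pow 6

/-- `q`-expansion of the Hauptmodul: `q t = U(q)`. -/
noncomputable def UU : PowerSeries ℤ := phi ^ 6 * PowerSeries.expand 5 (by norm_num) phinv ^ 6

theorem UU_const : PowerSeries.constantCoeff UU = 1 := by
  simp [UU, phi_const, phinv_const]

theorem UU_conv : PowerSeries.map (Int.castRingHom ℂ) UU ∈ Conv := by
  rw [UU, map_mul, map_pow, map_pow, PowerSeries.map_expand]
  exact mul_mem (pow_mem phiC_conv _) (pow_mem (conv_expand phinvC_conv.1 _ _) _)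

theorem ev_UU {z : ℂ} (hz : 0 < z.im) :
    qq z * tt z = ev (PowerSeries.map (Int.castRingHom ℂ) UU) (qq z) := by
  have hq := norm_qq_lt hz
  have hq5 : ‖qq z ^ 5‖ < 1 := by rw [norm_pow]; exact pow_lt_one₀ (norm_nonneg _) hq (by norm_num)
  have e5 : qq z ^ 5 = qq (5 * z) := by rw [qq_pow]; norm_num
  rw [UU, map_mul, map_pow, map_pow, PowerSeries.map_expand]
  change _ = ev (phiC ^ 6 * PowerSeries.expand 5 _ phinvC ^ 6) _
  rw [ev_mul (pow_mem phiC_conv _) (pow_mem (conv_expand phinvC_conv.1 _ _) _) hq, ev_pow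
    phiC_conv hq, ev_pow (conv_expand phinvC_conv.1 _ _) hq]
  rw [ev_expand phinvC_conv.1 _ _ hq, phinvC_conv.2 _ hq5, e5, tt, eta_eq hz, eta_eq (im5 hz)]
  have n1 := ev_phiC_ne (norm_qq_lt (im5 hz))
  have n2 := qq_ne (5 * z / 24)
  have e : qq (5 * z / 24) ^ 6 = qq z * qq (z / 24) ^ 6 := by
    rw [qq_pow, qq_pow, ← qq_add]; congr 1; push_cast; ring
  rw [div_pow, mul_pow, mul_pow, e]
  have n3 := qq_ne (z / 24)
  have n4 := qq_ne z
  field_simp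

theorem tt_T {z : ℂ} (hz : 0 < z.im) : tt (z + 1) = tt z := by
  apply mul_left_cancel₀ (qq_ne z)
  rw [ev_UU hz, ← qq_add_one, ev_UU (by simpa using hz)]

end QH

namespace QH

/-- Moebius transformation with integer coefficients. -/
noncomputable def mb (a b c d : ℤ) (z : ℂ) : ℂ := (a * z + b) / (c * z + d)

theorem den_ne {a b c d : ℤ} (h : 0 < a * d - b * c) {z : ℂ} (hz : 0 < z.im) :
    (c * z + d : ℂ) ≠ 0 := by
  intro h0
  have h1 : (c : ℝ) * z.im = 0 := by
    have := congrArg Complex.im h0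
    simpa using this
  have hc : c = 0 := by
    rcases mul_eq_zero.mp h1 with h | h
    · exact_mod_cast h
    · exact absurd h hz.ne'
  subst hc
  have hd : d = 0 := by
    have : (d : ℂ) = 0 := by simpa using h0
    exact_mod_cast this
  subst hd
  simp at h

theorem mb_im (a b c d : ℤ) (z : ℂ) :
    (mb a b c d z).im = (a * d - b * c : ℤ) * z.im / Complex.normSq (c * z + d) := by
  rw [mb, Complex.div_im]
  simp only [Complex.add_im, Complex.mul_im, Complex.intCast_re, Complex.intCast_im,
    Complex.add_re, Complex.mul_re]
  push_cast
  ring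

theorem im_mb {a b c d : ℤ} (h : 0 < a * d - b * c) {z : ℂ} (hz : 0 < z.im) :
    0 < (mb a b c d z).im := by
  rw [mb_im]
  have := Complex.normSq_pos.mpr (den_ne h hz)
  have h' : (0 : ℝ) < (a * d - b * c : ℤ) := by exact_mod_cast h
  positivity

theorem mb_comp {a b c d a' b' c' d' : ℤ} (h : 0 < a * d - b * c) (h' : 0 < a' * d' - b' * c')
    {z : ℂ} (hz : 0 < z.im) :
    mb a b c d (mb a' b' c' d' z) = mb (a * a' + b * c') (a * b' + b * d') (c * a' + d * c')
      (c * b' + d * d') z := by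
  have n1 := den_ne h (im_mb h' hz)
  have n2 := den_ne h' hz
  have n3 : ((c * a' + d * c' : ℤ) * z + (c * b' + d * d' : ℤ) : ℂ) ≠ 0 := by
    refine den_ne (a := a * a' + b * c') (b := a * b' + b * d') ?_ hz
    have : 0 < (a * d - b * c) * (a' * d' - b' * c') := mul_pos h h'
    nlinarith
  unfold mb at n1 ⊢
  push_cast at n3 ⊢
  set D : ℂ := c' * z + d' with hD
  have e1 : (a : ℂ) * ((a' * z + b') / D) + b = ((a * a' + b * c') * z + (a * b' + b * d')) / D := by
    rw [eq_div_iff n2, add_mul, mul_assoc, div_mul_cancel₀ _ n2, hD]; ring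
  have e2 : (c : ℂ) * ((a' * z + b') / D) + d = ((c * a' + d * c') * z + (c * b' + d * d')) / D := by
    rw [eq_div_iff n2, add_mul, mul_assoc, div_mul_cancel₀ _ n2, hD]; ring
  rw [e1, e2, div_div_div_cancel_right₀ n2]

theorem Dl_mb {a b c d : ℤ} (h : a * d - b * c = 1) {z : ℂ} (hz : 0 < z.im) :
    Dl (mb a b c d z) = (c * z + d) ^ 12 * Dl z := by
  let g : Matrix.SpecialLinearGroup (Fin 2) ℤ := ⟨!![a, b; c, d], by simp [Matrix.det_fin_two, h]⟩
  let zz : UpperHalfPlane := ⟨z, hz⟩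
  have hA : SlashAction.map (12 : ℤ) g ModularForm.discriminant = ModularForm.discriminant :=
    SlashInvariantForm.slash_action_generators_SL2Z ModularForm.discriminant_S_invariant
      ModularForm.discriminant_T_invariant g
  have := congrFun hA zz
  rw [ModularForm.SL_slash_apply] at this
  have e : ((g • zz : UpperHalfPlane) : ℂ) = mb a b c d z := by
    rw [UpperHalfPlane.specialLinearGroup_apply]
    simp [g, mb, zz]
  have e2 : UpperHalfPlane.denom g zz = c * z + d := by
    rw [ModularGroup.denom_apply]; simp [g, zz]
  rw [e2] at this
  have e3 : ∀ w : UpperHalfPlane, ModularForm.discriminant w = Dl w := fun w => rfl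
  rw [e3, e3, e, zpow_neg, ← div_eq_mul_inv,
    div_eq_iff (zpow_ne_zero _ (den_ne (a := a) (b := b) (by omega) hz))] at this
  rw [this, mul_comm]
  norm_cast

/-- Invariance under `Γ₀(5)`. -/
def Inv5 (f : ℂ → ℂ) : Prop := ∀ a b c d : ℤ, a * d - b * (5 * c) = 1 → ∀ z : ℂ, 0 < z.im →
  f (mb a b (5 * c) d z) = f z

theorem isPreconnected_H : IsPreconnected {z : ℂ | 0 < z.im} :=
  (convex_halfSpace_im_gt 0).isPreconnected

theorem isOpen_H : IsOpen {z : ℂ | 0 < z.im} := isOpen_lt continuous_const Complex.continuous_im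

theorem mb_cont {a b c d : ℤ} (h : 0 < a * d - b * c) {z : ℂ} (hz : 0 < z.im) :
    DifferentiableAt ℂ (mb a b c d) z := by
  unfold mb
  have := den_ne h hz
  fun_prop (disch := assumption)

theorem tt_mb_four {a b c d : ℤ} (h : a * d - b * (5 * c) = 1) {z : ℂ} (hz : 0 < z.im) :
    tt (mb a b (5 * c) d z) ^ 4 = tt z ^ 4 := by
  have h' : 0 < a * d - b * (5 * c) := by omega
  rw [tt_four (im_mb h' hz), tt_four hz]
  have e : 5 * mb a b (5 * c) d z = mb a (5 * b) c d (5 * z) := by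
    unfold mb; push_cast; ring
  rw [e, Dl_mb h hz, Dl_mb (by linarith) (im5 hz)]
  have n := den_ne h' hz
  have : ((5 * c : ℤ) * z + d : ℂ) = c * (5 * z) + d := by push_cast; ring
  rw [this] at n ⊢
  exact mul_div_mul_left _ _ (pow_ne_zero _ n)

theorem tt_char {a b c d : ℤ} (h : a * d - b * (5 * c) = 1) {z0 : ℂ} (hz0 : 0 < z0.im)
    (h0 : tt (mb a b (5 * c) d z0) = tt z0) {z : ℂ} (hz : 0 < z.im) :
    tt (mb a b (5 * c) d z) = tt z := by
  have h' : 0 < a * d - b * (5 * c) := by omega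
  let g : ℂ → ℂ := fun z => tt (mb a b (5 * c) d z) / tt z
  have hc : ContinuousOn g {z : ℂ | 0 < z.im} := by
    intro w hw
    have : ContinuousAt g w := by
      refine ContinuousAt.div ?_ (tt_diff hw).continuousAt (tt_ne hw)
      exact ContinuousAt.comp (tt_diff (im_mb h' hw)).continuousAt (mb_cont h' hw).continuousAt
    exact this.continuousWithinAt
  have hfin : (g '' {z : ℂ | 0 < z.im}).Finite := by
    refine Set.Finite.subset (Polynomial.finite_setOfPred_isRoot
      (p := (X ^ 4 - 1 : ℂ[X])) (X_pow_sub_C_ne_zero (by norm_num) 1)) ?_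
    rintro _ ⟨w, hw, rfl⟩
    have := tt_mb_four h hw
    have n := tt_ne hw
    simp only [Set.mem_ofPred_eq, IsRoot.def, eval_sub, eval_pow, eval_X, eval_one, g, div_pow, this]
    rw [div_self (pow_ne_zero _ n), sub_self]
  have hs := (isPreconnected_H.image g hc).isDiscrete_iff_subsingleton.mp hfin.isDiscrete
    ⟨z, hz, rfl⟩ ⟨z0, hz0, rfl⟩
  simp only [g, h0, div_self (tt_ne hz0)] at hs
  exact (div_eq_one_iff_eq (tt_ne hz)).mp hs

theorem tt_add_int (n : ℤ) {z : ℂ} (hz : 0 < z.im) : tt (z + n) = tt z := by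
  apply mul_left_cancel₀ (qq_ne z)
  have : qq (z + n) = qq z := by rw [qq_add, qq_int, mul_one]
  rw [ev_UU hz, ← this, ev_UU (by simpa using hz)]

theorem imW {z : ℂ} (hz : 0 < z.im) : 0 < (-1 / (5 * z)).im := imS (im5 hz)

theorem tt_V (ε : ℤ) {z : ℂ} (hz : 0 < z.im) : tt (mb 1 0 (5 * ε) 1 z) = tt z := by
  have h0 : z ≠ 0 := by rintro rfl; simp at hz
  have h : (0 : ℤ) < 1 * 1 - 0 * (5 * ε) := by norm_num
  have hy := im_mb h hz
  have n := den_ne h hz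
  have e : -1 / (5 * mb 1 0 (5 * ε) 1 z) = -1 / (5 * z) + (-ε : ℤ) := by
    unfold mb
    push_cast at n ⊢
    simp only [one_mul, add_zero]
    rw [mul_div_assoc', div_div_eq_mul_div, div_add' _ _ _ (by simpa using h0)]
    congr 1
    ring
  have h1 := tt_W hy
  rw [e, tt_add_int _ (imW hz), tt_W hz] at h1
  have n1 := tt_ne hy
  have n2 := tt_ne hz
  field_simp at h1
  exact h1

theorem tt_ell (ε : ℤ) (hε : ε = 1 ∨ ε = -1) {z : ℂ} (hz : 0 < z.im) :
    tt (mb (2 * ε) (-1) (5 * 1) (-2 * ε) z) = tt z := by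
  have hε2 : (ε : ℂ) ^ 2 = 1 := by rcases hε with rfl | rfl <;> norm_num
  have hε2' : ε ^ 2 = 1 := by rcases hε with rfl | rfl <;> norm_num
  have him : 0 < ((2 * ε + Complex.I) / 5 : ℂ).im := by
    rw [Complex.div_ofNat_im]; simp
  refine tt_char (z0 := (2 * ε + Complex.I) / 5) (by nlinarith) him ?_ hz
  congr 1
  unfold mb
  have : ((5 * 1 : ℤ) * ((2 * ε + Complex.I) / 5) + (-2 * ε : ℤ) : ℂ) = Complex.I := by
    push_cast; ring
  rw [this, div_eq_iff Complex.I_ne_zero]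
  push_cast
  linear_combination (4 / 5 : ℂ) * hε2 - (1/5 : ℂ) * Complex.I_sq

theorem tt_inv5 : Inv5 tt := by
  intro a b c d h
  induction hn : c.natAbs using Nat.strong_induction_on generalizing a b c d with
  | _ n ih =>
  subst hn
  intro z hz
  by_cases hc : c = 0
  · subst hc
    have had : a * d = 1 := by linarith
    have e : mb a b (5 * 0) d z = z + (a * b : ℤ) := by
      rcases Int.mul_eq_one_iff_eq_one_or_neg_one.mp had with ⟨rfl, rfl⟩ | ⟨rfl, rfl⟩ <;>
        simp [mb]
      ring
    rw [e, tt_add_int _ hz]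
  -- reduction of `d` modulo `5 c`
  obtain ⟨k, hk⟩ : ∃ k : ℤ, 2 * |d + 5 * c * k| ≤ 5 * |c| := by
    have hpos : 0 < 5 * |c| := by have := abs_pos.mpr hc; omega
    have hne : (5 * c) ≠ 0 := by omega
    refine ⟨-(round ((d : ℚ) / (5 * c : ℤ))), ?_⟩
    have h1 := abs_sub_round ((d : ℚ) / (5 * c : ℤ))
    have hcq : ((5 * c : ℤ) : ℚ) ≠ 0 := by exact_mod_cast hne
    have h2 : (|d + 5 * c * -(round ((d : ℚ) / (5 * c : ℤ)))| : ℚ)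
        = |(d : ℚ) / (5 * c : ℤ) - round ((d : ℚ) / (5 * c : ℤ))| * |((5 * c : ℤ) : ℚ)| := by
      rw [← abs_mul, sub_mul, div_mul_cancel₀ _ hcq]; congr 1; push_cast; ring
    have h3 : (2 : ℚ) * |(d : ℚ) + 5 * c * -(round ((d : ℚ) / (5 * c : ℤ)) : ℚ)| ≤ 5 * |(c : ℚ)| := by
      rw [h2]
      have : |((5 * c : ℤ) : ℚ)| = 5 * |(c : ℚ)| := by push_cast; rw [abs_mul]; norm_num
      rw [this]
      have := abs_nonneg (c : ℚ)
      nlinarith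
    exact_mod_cast h3
  set d' := d + 5 * c * k with hd'
  set b' := b + a * k with hb'
  have h2 : a * d' - b' * (5 * c) = 1 := by rw [hd', hb']; linarith
  -- it suffices to treat the reduced matrix
  suffices H : ∀ w : ℂ, 0 < w.im → tt (mb a b' (5 * c) d' w) = tt w by
    have hw : 0 < (z + (-k : ℤ)).im := by simpa using hz
    have := H _ hw
    rw [tt_add_int _ hz] at this
    rw [← this]
    congr 1
    unfold mb; rw [hd', hb']; push_cast; ring
  -- general step
  have step : ∀ x y v : ℤ, x * v - y * 5 = 1 → |c * x + d'| < |c| →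
      (∀ w : ℂ, 0 < w.im → tt (mb x y (5 * 1) v w) = tt w) →
      ∀ w : ℂ, 0 < w.im → tt (mb a b' (5 * c) d' w) = tt w := by
    intro x y v hxv hlt hδ w hw
    have hdet : (0 : ℤ) < v * x - (-y) * (-5) := by linarith
    have hdet' : (0 : ℤ) < x * v - y * (5 * 1) := by linarith
    have hw' := im_mb hdet hw
    have e1 : mb x y (5 * 1) v (mb v (-y) (-5) x w) = w := by
      rw [mb_comp hdet' hdet hw]
      have a1 : x * v + y * (-5) = 1 := by linarith
      have a2 : x * (-y) + y * x = 0 := by ring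
      have a3 : 5 * 1 * v + v * (-5) = 0 := by ring
      have a4 : 5 * 1 * (-y) + v * x = 1 := by linarith
      rw [a1, a2, a3, a4]; simp [mb]
    have h3 := ih (c * x + d').natAbs (by
        rw [Int.abs_eq_natAbs, Int.abs_eq_natAbs] at hlt; exact_mod_cast hlt) (a * x + b' * 5) (a * y + b' * v) (c * x + d')
      (5 * c * y + d' * v) (by
        have : (a * d' - b' * (5 * c)) * (x * v - y * 5) = 1 := by rw [h2, hxv]; norm_num
        linarith) rfl _ hw'
    have h4 := hδ _ hw'
    rw [e1] at h4
    rw [h4, ← h3]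
    conv_lhs => rw [← e1]
    rw [mb_comp (by linarith) hdet' hw']
    congr 2 <;> ring
  have hd0 : d' ≠ 0 := by
    intro h0; rw [h0, mul_zero] at h2
    have : (5 : ℤ) ∣ 1 := ⟨-(b' * c), by linarith⟩
    omega
  have hV : ∀ x : ℤ, (x = 1 ∨ x = -1) → ∀ w : ℂ, 0 < w.im → tt (mb x 0 (5 * 1) x w) = tt w := by
    intro x hx w hw
    rw [← tt_V x hw]
    congr 1
    rcases hx with rfl | rfl
    · rfl
    · unfold mb; push_cast
      rw [← neg_div_neg_eq]; congr 1 <;> ring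
  have hE : ∀ x : ℤ, (x = 1 ∨ x = -1) → ∀ w : ℂ, 0 < w.im →
      tt (mb (2 * x) (-1) (5 * 1) (-2 * x) w) = tt w := fun x hx w hw => tt_ell x hx hw
  have key : ∃ x : ℤ, (x = 1 ∨ x = -1) ∧ (|c * x + d'| < |c| ∨ |c * (2 * x) + d'| < |c|) := by
    by_cases hs : 0 < c
    · rw [abs_of_pos hs] at hk ⊢
      by_cases hd : 0 < d'
      · refine ⟨-1, by omega, ?_⟩
        rw [abs_of_pos hd] at hk
        rw [abs_lt, abs_lt]; omega
      · refine ⟨1, by omega, ?_⟩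
        rw [abs_of_nonpos (by omega)] at hk
        rw [abs_lt, abs_lt]; omega
    · rw [abs_of_nonpos (by omega : c ≤ 0)] at hk ⊢
      by_cases hd : 0 < d'
      · refine ⟨1, by omega, ?_⟩
        rw [abs_of_pos hd] at hk
        rw [abs_lt, abs_lt]; omega
      · refine ⟨-1, by omega, ?_⟩
        rw [abs_of_nonpos (by omega)] at hk
        rw [abs_lt, abs_lt]; omega
  obtain ⟨x, hx, hlt | hlt⟩ := key
  · exact step x 0 x (by rcases hx with rfl | rfl <;> norm_num) hlt (hV x hx)
  · exact step (2 * x) (-1) (-2 * x) (by rcases hx with rfl | rfl <;> norm_num) hlt (hE x hx)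

end QH

namespace QH

open UpperHalfPlane CongruenceSubgroup Matrix.SpecialLinearGroup

/-- bounded near `i∞` -/
def BddI (f : ℂ → ℂ) : Prop := ∃ B Y : ℝ, ∀ z : ℂ, Y < z.im → ‖f z‖ ≤ B

theorem slash0 (f : ℂ → ℂ) (g : Matrix.SpecialLinearGroup (Fin 2) ℤ) (z : UpperHalfPlane) :
    (SlashAction.map (0 : ℤ) g (fun z : UpperHalfPlane => f z)) z
      = f (mb (g 0 0) (g 0 1) (g 1 0) (g 1 1) z) := by
  rw [ModularForm.SL_slash_apply]
  simp only [neg_zero, zpow_zero, mul_one]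
  rw [UpperHalfPlane.specialLinearGroup_apply]
  simp [mb]

theorem bdd_cusp (f : ℂ → ℂ) (hi : Inv5 f) (hb : BddI f) (hb0 : BddI fun z => f (-1 / (5 * z)))
    (g : Matrix.SpecialLinearGroup (Fin 2) ℤ) :
    IsBoundedAtImInfty (SlashAction.map (0 : ℤ) g (fun z : UpperHalfPlane => f z)) := by
  rw [isBoundedAtImInfty_iff]
  obtain ⟨B, Y, hB⟩ := hb
  obtain ⟨B', Y', hB'⟩ := hb0
  have hdet : g 0 0 * g 1 1 - g 0 1 * g 1 0 = 1 := by
    have := g.det_coe; rwa [Matrix.det_fin_two] at this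
  set a := g 0 0
  set b := g 0 1
  set c := g 1 0
  set d := g 1 1
  by_cases hc : (5 : ℤ) ∣ c
  · obtain ⟨c', hc'⟩ := hc
    refine ⟨B, Y + 1, fun z hz => ?_⟩
    rw [slash0]
    change ‖f (mb a b c d z)‖ ≤ B
    rw [hc', hi a b c' d (by rw [← hc']; exact hdet) z z.im_pos]
    exact hB _ (by have : (z : ℂ).im = z.im := rfl; linarith)
  · obtain ⟨k, e, hk⟩ : ∃ k e : ℤ, d - c * k = 5 * e := by
      have hp : Prime (5 : ℤ) := by norm_num
      obtain ⟨x, y, hxy⟩ := (hp.coprime_iff_not_dvd).mpr hc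
      exact ⟨d * y, d * x, by linear_combination (-d) * hxy⟩
    refine ⟨B', 5 * |Y'| + 1, fun z hz => ?_⟩
    rw [slash0]
    change ‖f (mb a b c d z)‖ ≤ B'
    have hz0 := z.im_pos
    have hzi : (z : ℂ).im = z.im := rfl
    have e1 : mb a b c d z = mb (-(b - a * k)) a (5 * -e) c (mb 0 (-1) 1 k z) := by
      rw [mb_comp _ (by norm_num) hz0]
      · congr 1
        · ring
        · ring
        · ring
        · linarith
      · have : 5 * -e = -(d - c * k) := by linarith
        rw [this]; linarith
    rw [e1, hi _ _ _ _ (by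
      have : 5 * -e = -(d - c * k) := by linarith
      rw [this]; linarith) _ (im_mb (by norm_num) hz0)]
    have := hB' ((z + k) / 5) (by
      rw [Complex.div_ofNat_im]
      have := le_abs_self Y'
      simp only [Complex.add_im, Complex.intCast_im]
      linarith)
    convert this using 3
    unfold mb; push_cast
    ring

theorem const5 (f : ℂ → ℂ) (hd : DifferentiableOn ℂ f {z | 0 < z.im}) (hi : Inv5 f) (hb : BddI f)
    (hb0 : BddI fun z => f (-1 / (5 * z))) : ∃ c, ∀ z : ℂ, 0 < z.im → f z = c := by
  have key : ∀ g ∈ Gamma0 5, SlashAction.map (0 : ℤ) g (fun z : UpperHalfPlane => f z)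
      = (fun z : UpperHalfPlane => f z) := by
    intro g hg
    have hdet : g 0 0 * g 1 1 - g 0 1 * g 1 0 = 1 := by
      have := g.det_coe; rwa [Matrix.det_fin_two] at this
    ext z
    rw [slash0]
    rw [Gamma0_mem, ZMod.intCast_zmod_eq_zero_iff_dvd] at hg
    obtain ⟨c', hc'⟩ := hg
    push_cast at hc'
    rw [hc'] at hdet ⊢
    exact hi _ _ _ _ hdet _ z.im_pos
  let F : ModularForm ((Gamma0 5).map (mapGL ℝ)) 0 :=
    { toFun := fun z => f z
      slash_action_eq' := by
        rintro _ ⟨g, hg, rfl⟩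
        exact key g hg
      holo' := by
        rw [UpperHalfPlane.mdifferentiable_iff]
        refine hd.congr fun z hz => ?_
        simp [UpperHalfPlane.ofComplex_apply_of_im_pos hz]
      bdd_at_cusps' := by
        intro c hc
        rw [Subgroup.IsArithmetic.isCusp_iff_isCusp_SL2Z] at hc
        rw [OnePoint.isBoundedAt_iff_forall_SL2Z hc]
        intro g _
        exact bdd_cusp f hi hb hb0 g }
  obtain ⟨c, hc⟩ := ModularForm.eq_const_of_weight_zero F
  exact ⟨c, fun z hz => congrFun hc ⟨z, hz⟩⟩

end QH

namespace QH

open UpperHalfPlane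
open scoped MatrixGroups Manifold ModularForm

/-- Eisenstein-type series. -/
noncomputable def Eis (c : ℤ) (k : ℕ) : PowerSeries ℤ :=
  PowerSeries.mk fun m => if m = 0 then 1 else c * (ArithmeticFunction.sigma k m : ℤ)

noncomputable def EisC (c : ℤ) (k : ℕ) : PowerSeries ℂ := PowerSeries.map (Int.castRingHom ℂ) (Eis c k)

theorem coeff_EisC (c : ℤ) (k m : ℕ) : PowerSeries.coeff m (EisC c k) =
    if m = 0 then 1 else (c : ℂ) * (ArithmeticFunction.sigma k m : ℂ) := by
  simp only [EisC, Eis, PowerSeries.coeff_map, PowerSeries.coeff_mk]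
  split_ifs <;> simp

theorem EisC_conv (c : ℤ) (k : ℕ) : EisC c k ∈ Conv := by
  intro x hx
  by_cases h0 : x = 0
  · subst h0
    refine summable_of_ne_finset_zero (s := {0}) fun n hn => ?_
    have : n ≠ 0 := by simpa using hn
    simp [this]
  obtain ⟨z, hz, rfl⟩ := qq_surj h0 hx
  have h := EisensteinSeries.summable_sigma_mul_cexp_pow (k := k + 1) (by omega) ⟨z, hz⟩
  rw [← summable_nat_add_iff 1]
  have h' := ((summable_nat_add_iff 1).mpr (h.mul_left (c : ℂ))).norm
  refine h'.congr fun n => ?_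
  rw [coeff_EisC, if_neg (by omega)]
  simp only [Nat.add_sub_cancel, mul_assoc (c : ℂ)]
  rfl

theorem ev_EisC (c : ℤ) (k : ℕ) {z : ℂ} (hz : 0 < z.im) : ev (EisC c k) (qq z) =
    1 + c * ∑' n : ℕ+, (ArithmeticFunction.sigma k n : ℂ) *
      Complex.exp (2 * Real.pi * Complex.I * z) ^ (n : ℕ) := by
  have hx := norm_qq_lt hz
  unfold ev
  rw [(EisC_conv c k _ hx).of_norm.tsum_eq_zero_add]
  congr 1
  · simp [coeff_EisC]
  · rw [tsum_pnat_eq_tsum_succ (f := fun n => (ArithmeticFunction.sigma k n : ℂ) *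
      Complex.exp (2 * Real.pi * Complex.I * z) ^ n), ← tsum_mul_left]
    refine tsum_congr fun n => ?_
    rw [coeff_EisC, if_neg (by omega), mul_assoc]
    rfl

theorem ev_E2 (z : ℍ) : EisensteinSeries.E2 z = ev (EisC (-24) 1) (qq z) := by
  rw [ev_EisC _ _ z.im_pos, EisensteinSeries.E2_eq_tsum_cexp]
  push_cast; ring

theorem ev_E4 (z : ℍ) : ModularForm.E (k := 4) (by norm_num) z = ev (EisC 240 3) (qq z) := by
  rw [ev_EisC _ _ z.im_pos, EisensteinSeries.q_expansion_bernoulli _ ⟨2, rfl⟩]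
  norm_num [show _root_.bernoulli 4 = -1 / 30 by decide +kernel]

theorem ev_E6 (z : ℍ) : ModularForm.E (k := 6) (by norm_num) z = ev (EisC (-504) 5) (qq z) := by
  rw [ev_EisC _ _ z.im_pos, EisensteinSeries.q_expansion_bernoulli _ ⟨3, rfl⟩]
  norm_num [show _root_.bernoulli 6 = 1 / 42 by decide +kernel]
  rw [sub_eq_add_neg]

theorem ev_qq_diff {F : PowerSeries ℂ} (hF : F ∈ Conv) {z : ℂ} (hz : 0 < z.im) :
    DifferentiableAt ℂ (fun z => ev F (qq z)) z := by
  have h1 : DifferentiableAt ℂ (ev F) (qq z) :=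
    (ev_differentiableOn hF).differentiableAt (Metric.isOpen_ball.mem_nhds (by
      simpa using norm_qq_lt hz))
  exact h1.comp z qq_differentiable.differentiableAt

theorem mdiff_of_ev {F : PowerSeries ℂ} (hF : F ∈ Conv) {f : ℍ → ℂ}
    (hf : ∀ z : ℍ, f z = ev F (qq z)) : MDiff f := by
  rw [UpperHalfPlane.mdifferentiable_iff]
  refine DifferentiableOn.congr (f := fun z => ev F (qq z))
    (fun z hz => (ev_qq_diff hF hz).differentiableWithinAt) fun z hz => ?_
  simp [UpperHalfPlane.ofComplex_apply_of_im_pos hz, hf]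

theorem D_ev {F : PowerSeries ℂ} (hF : F ∈ Conv) {f : ℍ → ℂ}
    (hf : ∀ z : ℍ, f z = ev F (qq z)) (z : ℍ) :
    Derivative.normalizedDerivOfComplex f z = ev (theta F) (qq z) := by
  have hz := z.im_pos
  rw [(conv_theta hF).2 _ (norm_qq_lt hz), Derivative.normalizedDerivOfComplex]
  have e : (f ∘ UpperHalfPlane.ofComplex) =ᶠ[nhds (z : ℂ)] fun z => ev F (qq z) := by
    filter_upwards [isOpen_H.mem_nhds hz] with w hw
    simp [UpperHalfPlane.ofComplex_apply_of_im_pos hw, hf]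
  rw [e.deriv_eq]
  have h1 : HasDerivAt (ev F) (deriv (ev F) (qq z)) (qq z) :=
    ((ev_differentiableOn hF).differentiableAt (Metric.isOpen_ball.mem_nhds (by
      simpa using norm_qq_lt hz))).hasDerivAt
  have h2 : HasDerivAt qq (qq z * (2 * Real.pi * Complex.I)) z := by
    unfold qq
    simpa using ((hasDerivAt_id (z : ℂ)).const_mul (2 * Real.pi * Complex.I : ℂ)).cexp
  have h3 : deriv (fun z => ev F (qq z)) (z : ℂ) = _ := (h1.comp (z : ℂ) h2).deriv
  rw [h3]
  have := Complex.two_pi_I_ne_zero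
  field_simp

theorem tendsto_ev {F : PowerSeries ℂ} (hF : F ∈ Conv) :
    Filter.Tendsto (ev F) (nhds 0) (nhds (PowerSeries.coeff 0 F)) := by
  rw [← ev_zero]
  exact ((ev_differentiableOn hF).differentiableAt
    (Metric.isOpen_ball.mem_nhds (by simp))).continuousAt

theorem qq_small (δ : ℝ) (hδ : 0 < δ) : ∃ Y : ℝ, 0 < Y ∧ ∀ z : ℂ, Y ≤ z.im → ‖qq z‖ < δ := by
  refine ⟨max 1 (1 - Real.log δ), by positivity, fun z hz => ?_⟩
  rw [norm_qq, ← Real.lt_log_iff_exp_lt hδ]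
  have h1 := le_trans (le_max_left _ _) hz
  have h2 := le_trans (le_max_right _ _) hz
  have := Real.pi_gt_three
  nlinarith

theorem wt_zero (k : ℤ) (hk : k < 12) (f : ℍ → ℂ) {F : PowerSeries ℂ} (hF : F ∈ Conv)
    (hf : ∀ z : ℍ, f z = ev F (qq z)) (hinv : ∀ γ : SL(2, ℤ), f ∣[k] γ = f)
    (h0 : PowerSeries.coeff 0 F = 0) : F = 0 := by
  have hz : IsZeroAtImInfty f := by
    rw [isZeroAtImInfty_iff]
    intro ε hε
    have ht := tendsto_ev hF
    rw [h0, Metric.tendsto_nhds_nhds] at ht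
    obtain ⟨δ, hδ, h⟩ := ht ε hε
    obtain ⟨Y, -, hY⟩ := qq_small δ hδ
    refine ⟨Y, fun z hz => ?_⟩
    rw [hf]
    have := h (x := qq z) (by simpa using hY z hz)
    simpa using this.le
  let G : CuspForm 𝒮ℒ k :=
    { toFun := f
      slash_action_eq' := by
        rintro _ ⟨g, rfl⟩
        exact hinv g
      holo' := mdiff_of_ev hF hf
      zero_at_cusps' := by
        intro c hc
        rw [Subgroup.IsArithmetic.isCusp_iff_isCusp_SL2Z] at hc
        rw [OnePoint.isZeroAt_iff_forall_SL2Z hc]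
        intro g _
        rw [hinv g]
        exact hz }
  have hG : G = 0 := rank_zero_iff_forall_zero.mp (CuspForm.rank_eq_zero_of_weight_lt_twelve hk) G
  refine ev_inj_qq hF (zero_mem _) fun z hz => ?_
  have h1 : f ⟨z, hz⟩ = 0 := congrArg (fun g : CuspForm 𝒮ℒ k => g ⟨z, hz⟩) hG
  have h2 : ev F (qq z) = 0 := by rw [← h1, hf]
  rw [h2]; simp [ev]

theorem inv_E (k : ℕ) (hk : 3 ≤ k) (γ : SL(2, ℤ)) :
    (⇑(ModularForm.E hk) : ℍ → ℂ) ∣[(k : ℤ)] γ = ModularForm.E hk :=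
  SlashInvariantForm.slash_action_eqn (ModularForm.E hk) _ ⟨γ, rfl⟩

theorem const_EisC (c : ℤ) (k : ℕ) : PowerSeries.constantCoeff (EisC c k) = 1 := by
  rw [← PowerSeries.coeff_zero_eq_constantCoeff_apply, coeff_EisC]; simp

theorem ram4 : 3 * theta (EisC 240 3) = EisC (-24) 1 * EisC 240 3 - EisC (-504) 5 := by
  have c2 := EisC_conv (-24) 1
  have c4 := EisC_conv 240 3
  have c6 := EisC_conv (-504) 5
  have ct := (conv_theta c4).1
  have h3 : (3 : PowerSeries ℂ) ∈ Conv := conv_C 3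
  have hm4 := mdiff_of_ev c4 ev_E4
  refine sub_eq_zero.mp (wt_zero 6 (by norm_num)
    ((3 : ℂ) • Derivative.serreDerivative (4 : ℤ) (ModularForm.E (k := 4) (by norm_num))
      + ⇑(ModularForm.E (k := 6) (by norm_num))) (F := 3 * theta (EisC 240 3) -
      (EisC (-24) 1 * EisC 240 3 - EisC (-504) 5)) ?_ ?_ ?_ ?_)
  · exact sub_mem (mul_mem h3 ct) (sub_mem (mul_mem c2 c4) c6)
  · intro z
    have hx := norm_qq_lt z.im_pos
    have e3 : ev (3 : PowerSeries ℂ) (qq z) = 3 := ev_C 3 _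
    rw [ev_sub (mul_mem h3 ct) (sub_mem (mul_mem c2 c4) c6) hx, ev_sub (mul_mem c2 c4) c6 hx,
      ev_mul c2 c4 hx, ev_mul h3 ct hx, ← ev_E2, ← ev_E4, ← ev_E6, ← D_ev c4 ev_E4]
    simp only [Pi.add_apply, Pi.smul_apply, Derivative.serreDerivative_apply, smul_eq_mul, e3]
    push_cast
    ring
  · intro γ
    rw [SlashAction.add_slash, ModularForm.SL_smul_slash]
    have h1 := Derivative.serreDerivative_slash_invariant hm4 (inv_E 4 (by norm_num) γ)
    have h2 := inv_E 6 (by norm_num) γ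
    exact congrArg₂ (· + ·) (congrArg ((3 : ℂ) • ·) h1) h2
  · simp [theta, const_EisC]

theorem ram6 : 2 * theta (EisC (-504) 5) = EisC (-24) 1 * EisC (-504) 5 - EisC 240 3 ^ 2 := by
  have c2 := EisC_conv (-24) 1
  have c4 := EisC_conv 240 3
  have c6 := EisC_conv (-504) 5
  have ct := (conv_theta c6).1
  have h3 : (2 : PowerSeries ℂ) ∈ Conv := conv_C 2
  have hm6 := mdiff_of_ev c6 ev_E6
  refine sub_eq_zero.mp (wt_zero 8 (by norm_num)
    ((2 : ℂ) • Derivative.serreDerivative (6 : ℤ) (ModularForm.E (k := 6) (by norm_num))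
      + ⇑(ModularForm.E (k := 4) (by norm_num)) * ⇑(ModularForm.E (k := 4) (by norm_num)))
      (F := 2 * theta (EisC (-504) 5) -
      (EisC (-24) 1 * EisC (-504) 5 - EisC 240 3 ^ 2)) ?_ ?_ ?_ ?_)
  · exact sub_mem (mul_mem h3 ct) (sub_mem (mul_mem c2 c6) (pow_mem c4 2))
  · intro z
    have hx := norm_qq_lt z.im_pos
    have e3 : ev (2 : PowerSeries ℂ) (qq z) = 2 := ev_C 2 _
    rw [ev_sub (mul_mem h3 ct) (sub_mem (mul_mem c2 c6) (pow_mem c4 2)) hx,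
      ev_sub (mul_mem c2 c6) (pow_mem c4 2) hx,
      ev_mul c2 c6 hx, ev_mul h3 ct hx, ev_pow c4 hx, ← ev_E2, ← ev_E4, ← ev_E6, ← D_ev c6 ev_E6]
    simp only [Pi.add_apply, Pi.smul_apply, Pi.mul_apply,
      Derivative.serreDerivative_apply, smul_eq_mul, e3]
    push_cast
    ring
  · intro γ
    rw [SlashAction.add_slash, ModularForm.SL_smul_slash]
    have h1 := Derivative.serreDerivative_slash_invariant hm6 (inv_E 6 (by norm_num) γ)
    have h2 := inv_E 4 (by norm_num) γ
    have h4 := ModularForm.mul_slash_SL2 4 4 γ (⇑(ModularForm.E (k := 4) (by norm_num)))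
      (⇑(ModularForm.E (k := 4) (by norm_num)))
    refine congrArg₂ (· + ·) (congrArg ((2 : ℂ) • ·) h1) (h4.trans ?_)
    exact congrArg₂ (· * ·) h2 h2
  · simp [theta, const_EisC]

end QH

namespace QH
open UpperHalfPlane hiding I
open Complex Matrix.SpecialLinearGroup
open scoped MatrixGroups Manifold ModularForm

noncomputable def vfun (γ : SL(2, ℤ)) (z : ℍ) : ℂ := (γ 1 0 : ℂ) / denom γ z

theorem vfun_eventually (γ : SL(2, ℤ)) (z : ℂ) (hz : 0 < z.im) :
    (vfun γ ∘ ofComplex) =ᶠ[nhds z] fun w => (γ 1 0 : ℂ) / ((γ 1 0 : ℂ) * w + (γ 1 1 : ℂ)) := by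
  filter_upwards [isOpen_H.mem_nhds hz] with w hw
  rw [Function.comp, vfun, ModularGroup.denom_apply, ofComplex_apply_of_im_pos hw]

theorem vfun_deriv (γ : SL(2, ℤ)) (z : ℍ) :
    HasDerivAt (vfun γ ∘ ofComplex) (-(vfun γ z) ^ 2) z := by
  have hd : (γ 1 0 : ℂ) * z + (γ 1 1 : ℂ) ≠ 0 := by
    rw [← ModularGroup.denom_apply]; exact denom_ne_zero _ _
  have h := (((hasDerivAt_id (z : ℂ)).const_mul (γ 1 0 : ℂ)).add_const (γ 1 1 : ℂ)).inv hd
  have h2 := (h.const_mul (γ 1 0 : ℂ)).congr_of_eventuallyEq (f₁ := vfun γ ∘ ofComplex) (by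
    filter_upwards [vfun_eventually γ z z.im_pos] with w hw
    rw [hw, div_eq_mul_inv]; simp)
  refine h2.congr_deriv ?_
  rw [vfun, ModularGroup.denom_apply]
  simp only [id]
  rw [div_pow, ← mul_div_assoc, ← neg_div]; ring

theorem vfun_mdiff (γ : SL(2, ℤ)) : MDiff (vfun γ) := fun z =>
  UpperHalfPlane.mdifferentiableAt_iff.mpr (vfun_deriv γ z).differentiableAt

theorem D_vfun (γ : SL(2, ℤ)) (z : ℍ) :
    Derivative.normalizedDerivOfComplex (vfun γ) z = -(2 * Real.pi * I)⁻¹ * (vfun γ z) ^ 2 := by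
  rw [Derivative.normalizedDerivOfComplex, (vfun_deriv γ z).deriv]; ring

theorem ram2 : 12 * theta (EisC (-24) 1) = EisC (-24) 1 ^ 2 - EisC 240 3 := by
  have c2 := EisC_conv (-24) 1
  have c4 := EisC_conv 240 3
  have ct := (conv_theta c2).1
  have h3 : (12 : PowerSeries ℂ) ∈ Conv := conv_C 12
  have hm2 := mdiff_of_ev c2 ev_E2
  refine sub_eq_zero.mp (wt_zero 4 (by norm_num)
    ((12 : ℂ) • Derivative.normalizedDerivOfComplex EisensteinSeries.E2
      + ((-1 : ℂ) • (EisensteinSeries.E2 * EisensteinSeries.E2)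
        + ⇑(ModularForm.E (k := 4) (by norm_num))))
      (F := 12 * theta (EisC (-24) 1) -
      (EisC (-24) 1 ^ 2 - EisC 240 3)) ?_ ?_ ?_ ?_)
  · exact sub_mem (mul_mem h3 ct) (sub_mem (pow_mem c2 2) c4)
  · intro z
    have hx := norm_qq_lt z.im_pos
    have e3 : ev (12 : PowerSeries ℂ) (qq z) = 12 := ev_C 12 _
    rw [ev_sub (mul_mem h3 ct) (sub_mem (pow_mem c2 2) c4) hx,
      ev_sub (pow_mem c2 2) c4 hx,
      ev_mul h3 ct hx, ev_pow c2 hx, ← ev_E2, ← ev_E4, ← D_ev c2 ev_E2]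
    simp only [Pi.add_apply, Pi.smul_apply, Pi.mul_apply, smul_eq_mul, e3]
    ring
  · intro γ
    have hE := EisensteinSeries.E2_slash_action γ
    have hE' : EisensteinSeries.E2 ∣[(2 : ℤ)] γ
        = EisensteinSeries.E2 - (6 * I / Real.pi) • vfun γ := by
      rw [hE, riemannZeta_two]
      ext z
      have hd : denom γ z ≠ 0 := denom_ne_zero _ _
      have hp : (Real.pi : ℂ) ≠ 0 := by simp [Real.pi_ne_zero]
      simp only [Pi.sub_apply, Pi.smul_apply, EisensteinSeries.D2, vfun, smul_eq_mul]
      field_simp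
    have hD := Derivative.normalizedDerivOfComplex_SL_slash (k := 2) hm2 (γ := γ)
    rw [hE', Derivative.normalizedDerivOfComplex_sub _ _ hm2 ((vfun_mdiff γ).const_smul _),
      Derivative.normalizedDerivOfComplex_smul _ _ (vfun_mdiff γ)] at hD
    have h4 := inv_E 4 (by norm_num) γ
    have hm := ModularForm.mul_slash_SL2 2 2 γ EisensteinSeries.E2 EisensteinSeries.E2
    rw [SlashAction.add_slash, SlashAction.add_slash, ModularForm.SL_smul_slash,
      ModularForm.SL_smul_slash]
    have h4' : SlashAction.map (4 : ℤ) γ ⇑(ModularForm.E (k := 4) (by norm_num))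
      = ⇑(ModularForm.E (k := 4) (by norm_num)) := h4
    have hm' : SlashAction.map (4 : ℤ) γ (EisensteinSeries.E2 * EisensteinSeries.E2) = _ := hm
    rw [h4', hm', hE']
    ext z
    have hDz := congrFun hD z
    simp only [Pi.sub_apply, Pi.smul_apply, D_vfun, smul_eq_mul] at hDz
    simp only [Pi.add_apply, Pi.sub_apply, Pi.smul_apply, Pi.mul_apply, smul_eq_mul]
    have e : SlashAction.map (4 : ℤ) γ (Derivative.normalizedDerivOfComplex EisensteinSeries.E2) z
      = SlashAction.map (2 + 2 : ℤ) γ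
        (Derivative.normalizedDerivOfComplex EisensteinSeries.E2) z := rfl
    rw [e, ← sub_eq_zero]
    rw [← sub_eq_zero] at hDz
    have hp : (Real.pi : ℂ) ≠ 0 := by simp [Real.pi_ne_zero]
    have hv : (γ 1 0 : ℂ) / denom γ z = vfun γ z := rfl
    rw [hv] at hDz
    have hI : I ^ 2 = -1 := I_sq
    generalize vfun γ z = u at *
    generalize SlashAction.map (2 + 2 : ℤ) γ
        (Derivative.normalizedDerivOfComplex EisensteinSeries.E2) z = A at *
    push_cast at hDz
    have hin : (2 * (Real.pi : ℂ) * I)⁻¹ = -I / (2 * Real.pi) := by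
      rw [inv_eq_iff_eq_inv, inv_div, eq_div_iff (by simp)]
      linear_combination -2 * Real.pi * hI
    rw [hin] at hDz
    have hdd : (6 * I / Real.pi : ℂ) = 6 * (I / Real.pi) := by ring
    have hdd2 : (-I / (2 * Real.pi) : ℂ) = - (I / Real.pi) / 2 := by ring
    rw [hdd, hdd2] at hDz
    rw [hdd]
    linear_combination -12 * hDz
  · simp [theta, const_EisC]

end QH

namespace QH
open UpperHalfPlane hiding I
open Complex Matrix.SpecialLinearGroup
open scoped MatrixGroups Manifold ModularForm

theorem ramd : 1728 * (PowerSeries.X * phiC ^ 24) = EisC 240 3 ^ 3 - EisC (-504) 5 ^ 2 := by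
  have c4 := EisC_conv 240 3
  have c6 := EisC_conv (-504) 5
  have h3 : (1728 : PowerSeries ℂ) ∈ Conv := conv_C 1728
  have hX := mul_mem (conv_X) (pow_mem phiC_conv 24)
  refine ev_inj_qq (mul_mem h3 hX) (sub_mem (pow_mem c4 3) (pow_mem c6 2)) fun z hz => ?_
  have hx := norm_qq_lt hz
  have e3 : ev (1728 : PowerSeries ℂ) (qq z) = 1728 := ev_C 1728 _
  rw [ev_mul h3 hX hx, ev_sub (pow_mem c4 3) (pow_mem c6 2) hx, ev_pow c4 hx, ev_pow c6 hx,
    ev_mul conv_X (pow_mem phiC_conv 24) hx, ev_X, ev_pow phiC_conv hx, ← Dl_eq hz, e3]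
  have h4 := ev_E4 ⟨z, hz⟩
  have h6 := ev_E6 ⟨z, hz⟩
  have hd := ModularForm.discriminant_eq_E₄_cube_sub_E₆_sq ⟨z, hz⟩
  have e4 : ModularForm.E (k := 4) (by norm_num) ⟨z, hz⟩ = ev (EisC 240 3) (qq z) := h4
  have e6 : ModularForm.E (k := 6) (by norm_num) ⟨z, hz⟩ = ev (EisC (-504) 5) (qq z) := h6
  rw [← e4, ← e6]
  have hd' : Dl z = _ := hd
  rw [hd']; ring

theorem theta_map {k : Type*} [Field k] (F : PowerSeries ℤ) :
    theta (PowerSeries.map (Int.castRingHom k) F)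
      = PowerSeries.map (Int.castRingHom k) (PowerSeries.X * PowerSeries.derivative ℤ F) := by
  ext n
  rw [theta, PowerSeries.coeff_map]
  cases n with
  | zero => simp
  | succ n =>
    rw [PowerSeries.coeff_succ_X_mul, PowerSeries.coeff_succ_X_mul, PowerSeries.coeff_derivative,
      PowerSeries.coeff_derivative, PowerSeries.coeff_map]
    simp

theorem const_map {k : Type*} [Field k] {F : PowerSeries ℤ} (h : PowerSeries.constantCoeff F = 1) :
    PowerSeries.constantCoeff (PowerSeries.map (Int.castRingHom k) F) = 1 := by
  rw [← PowerSeries.coeff_zero_eq_constantCoeff_apply, PowerSeries.coeff_map,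
    PowerSeries.coeff_zero_eq_constantCoeff_apply, h, map_one]

theorem mapC_inj : Function.Injective (PowerSeries.map (Int.castRingHom ℂ)) :=
  PowerSeries.map_injective _ Int.cast_injective

theorem ramC : Ram (EisC (-24) 1) (EisC 240 3) (EisC (-504) 5) (phiC ^ 24) where
  h2 := ram2
  h4 := ram4
  h6 := ram6
  hd := ramd
  c4 := const_EisC _ _
  c6 := const_EisC _ _
  cP := by rw [phiC, map_pow, const_map phi_const, one_pow]

theorem const_Eis (c : ℤ) (k : ℕ) : PowerSeries.constantCoeff (Eis c k) = 1 := by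
  rw [← PowerSeries.coeff_zero_eq_constantCoeff_apply, Eis, PowerSeries.coeff_mk]; simp

theorem ram_field (k : Type*) [Field k] : Ram
    (PowerSeries.map (Int.castRingHom k) (Eis (-24) 1))
    (PowerSeries.map (Int.castRingHom k) (Eis 240 3))
    (PowerSeries.map (Int.castRingHom k) (Eis (-504) 5))
    (PowerSeries.map (Int.castRingHom k) (phi ^ 24)) := by
  have H := ramC
  have h2 := H.h2
  have h4 := H.h4
  have h6 := H.h6
  have hd := H.hd
  simp only [EisC, phiC, theta_map] at h2 h4 h6 hd
  have g2 : 12 * (PowerSeries.X * PowerSeries.derivative ℤ (Eis (-24) 1))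
      = Eis (-24) 1 ^ 2 - Eis 240 3 := mapC_inj (by simpa only [map_mul, map_sub, map_pow, map_ofNat] using h2)
  have g4 : 3 * (PowerSeries.X * PowerSeries.derivative ℤ (Eis 240 3))
      = Eis (-24) 1 * Eis 240 3 - Eis (-504) 5 := mapC_inj (by simpa only [map_mul, map_sub, map_pow, map_ofNat] using h4)
  have g6 : 2 * (PowerSeries.X * PowerSeries.derivative ℤ (Eis (-504) 5))
      = Eis (-24) 1 * Eis (-504) 5 - Eis 240 3 ^ 2 := mapC_inj (by simpa only [map_mul, map_sub, map_pow, map_ofNat] using h6)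
  have gd : 1728 * (PowerSeries.X * phi ^ 24) = Eis 240 3 ^ 3 - Eis (-504) 5 ^ 2 :=
    mapC_inj (by simpa only [map_mul, map_sub, map_pow, map_ofNat, PowerSeries.map_X] using hd)
  constructor
  · rw [theta_map]; simpa only [map_mul, map_sub, map_pow, map_ofNat] using congrArg (PowerSeries.map (Int.castRingHom k)) g2
  · rw [theta_map]; simpa only [map_mul, map_sub, map_pow, map_ofNat] using congrArg (PowerSeries.map (Int.castRingHom k)) g4
  · rw [theta_map]; simpa only [map_mul, map_sub, map_pow, map_ofNat] using congrArg (PowerSeries.map (Int.castRingHom k)) g6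
  · simpa only [map_mul, map_sub, map_pow, map_ofNat, PowerSeries.map_X] using congrArg (PowerSeries.map (Int.castRingHom k)) gd
  · exact const_map (const_Eis _ _)
  · exact const_map (const_Eis _ _)
  · rw [map_pow, map_pow, const_map phi_const, one_pow]

/-- the recursion for the Euler product -/
theorem phi_rec : 24 * (PowerSeries.X * PowerSeries.derivative ℤ phi) = (Eis (-24) 1 - 1) * phi := by
  apply mapC_inj
  rw [map_mul, ← theta_map, map_mul, map_sub, map_one, map_ofNat]
  change 24 * theta phiC = (EisC (-24) 1 - 1) * phiC
  have h := ramC.disc (by norm_num) (by norm_num)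
  rw [theta_mul] at h
  have hp := theta_pow phiC 24
  have hX : theta (PowerSeries.X : PowerSeries ℂ) = PowerSeries.X := by
    ext n; simp [theta]
  rw [hX] at h
  have hne : phiC ≠ 0 := by
    intro h0
    have : PowerSeries.constantCoeff phiC = 1 := const_map phi_const
    rw [h0] at this; simp at this
  have hXn : (PowerSeries.X : PowerSeries ℂ) ≠ 0 := PowerSeries.X_ne_zero
  have := mul_ne_zero hXn (pow_ne_zero 24 hne)
  apply mul_left_cancel₀ this
  push_cast at hp
  linear_combination phiC * h - PowerSeries.X * hp

theorem phi_rec_coeff (n : ℕ) : 24 * ((n : ℤ) * PowerSeries.coeff n phi) =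
    ∑ p ∈ Finset.HasAntidiagonal.antidiagonal n, (if p.1 = 0 then 0 else -24 * (ArithmeticFunction.sigma 1 p.1 : ℤ))
      * PowerSeries.coeff p.2 phi := by
  have h := congrArg (PowerSeries.coeff n) phi_rec
  rw [PowerSeries.coeff_mul n (Eis (-24) 1 - 1) phi] at h
  have e : PowerSeries.coeff n (24 * (PowerSeries.X * PowerSeries.derivative ℤ phi)) =
      24 * ((n : ℤ) * PowerSeries.coeff n phi) := by
    rw [show (24 : PowerSeries ℤ) = PowerSeries.C 24 from rfl, PowerSeries.coeff_C_mul]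
    cases n with
    | zero => simp
    | succ n =>
      rw [PowerSeries.coeff_succ_X_mul, PowerSeries.coeff_derivative]; push_cast; ring
  rw [← e, h]
  refine Finset.sum_congr rfl fun p _ => ?_
  congr 1
  rw [map_sub, Eis, PowerSeries.coeff_mk, PowerSeries.coeff_one]
  split_ifs <;> simp

theorem phi_coeffs : PowerSeries.coeff 0 phi = 1 ∧ PowerSeries.coeff 1 phi = -1 ∧
    PowerSeries.coeff 2 phi = -1 ∧ PowerSeries.coeff 3 phi = 0 ∧ PowerSeries.coeff 4 phi = 0 ∧
    PowerSeries.coeff 5 phi = 1 ∧ PowerSeries.coeff 6 phi = 0 := by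
  have s1 : ArithmeticFunction.sigma 1 1 = 1 := by decide +kernel
  have s2 : ArithmeticFunction.sigma 1 2 = 3 := by decide +kernel
  have s3 : ArithmeticFunction.sigma 1 3 = 4 := by decide +kernel
  have s4 : ArithmeticFunction.sigma 1 4 = 7 := by decide +kernel
  have s5 : ArithmeticFunction.sigma 1 5 = 6 := by decide +kernel
  have s6 : ArithmeticFunction.sigma 1 6 = 12 := by decide +kernel
  have h0 : PowerSeries.coeff 0 phi = 1 := by simp [phi_const]
  have h1 := phi_rec_coeff 1
  have h2 := phi_rec_coeff 2
  have h3 := phi_rec_coeff 3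
  have h4 := phi_rec_coeff 4
  have h5 := phi_rec_coeff 5
  have h6 := phi_rec_coeff 6
  simp only [Finset.Nat.antidiagonal_succ, Finset.Nat.antidiagonal_zero, Finset.sum_cons,
    Finset.map_singleton, Finset.map_cons, Finset.sum_singleton, Function.Embedding.prodMap,
    Function.Embedding.coeFn_mk, Prod.map, Nat.succ_eq_add_one, Function.Embedding.refl_apply,
    s1, s2, s3, s4, s5, s6, h0, zero_add, Nat.reduceAdd, if_true, one_ne_zero, if_false,
    OfNat.ofNat_ne_zero] at h1 h2 h3 h4 h5 h6
  push_cast at h1 h2 h3 h4 h5 h6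
  refine ⟨h0, ?_, ?_, ?_, ?_, ?_, ?_⟩ <;> omega

end QH

namespace QH

/-- The ring of functions which are convergent power series in `q`. -/
def EvR : Subring (ℂ → ℂ) where
  carrier := {f | ∃ F ∈ Conv, ∀ z : ℂ, 0 < z.im → f z = ev F (qq z)}
  mul_mem' := by
    rintro f g ⟨F, hF, h⟩ ⟨G, hG, h'⟩
    exact ⟨_, mul_mem hF hG, fun z hz => by
      rw [ev_mul hF hG (norm_qq_lt hz), Pi.mul_apply, h z hz, h' z hz]⟩
  one_mem' := ⟨1, one_mem _, fun z hz => (ev_one _).symm⟩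
  add_mem' := by
    rintro f g ⟨F, hF, h⟩ ⟨G, hG, h'⟩
    exact ⟨_, add_mem hF hG, fun z hz => by
      rw [ev_add hF hG (norm_qq_lt hz), Pi.add_apply, h z hz, h' z hz]⟩
  zero_mem' := ⟨0, zero_mem _, fun z hz => by simp [ev]⟩
  neg_mem' := by
    rintro f ⟨F, hF, h⟩
    exact ⟨_, neg_mem hF, fun z hz => by
      rw [ev_neg, Pi.neg_apply, h z hz]⟩

theorem mem_EvR {f : ℂ → ℂ} : f ∈ EvR ↔ ∃ F ∈ Conv, ∀ z : ℂ, 0 < z.im → f z = ev F (qq z) :=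
  Iff.rfl

theorem EvR_const (c : ℂ) : (fun _ => c) ∈ EvR := ⟨_, conv_C c, fun z _ => (ev_C c _).symm⟩

theorem EvR_bdd {f : ℂ → ℂ} (hf : f ∈ EvR) : BddI f := by
  obtain ⟨F, hF, h⟩ := hf
  have ht := tendsto_ev hF
  rw [Metric.tendsto_nhds_nhds] at ht
  obtain ⟨δ, hδ, h1⟩ := ht 1 one_pos
  obtain ⟨Y, hY0, hY⟩ := qq_small δ hδ
  refine ⟨1 + ‖PowerSeries.coeff 0 F‖, Y, fun z hz => ?_⟩
  rw [h z (hY0.trans hz)]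
  have h2 := h1 (x := qq z) (by simpa using hY z hz.le)
  rw [dist_eq_norm] at h2
  have := norm_add_le (ev F (qq z) - PowerSeries.coeff 0 F) (PowerSeries.coeff 0 F)
  rw [sub_add_cancel] at this
  linarith

theorem EvR_diff {f : ℂ → ℂ} (hf : f ∈ EvR) : DifferentiableOn ℂ f {z | 0 < z.im} := by
  obtain ⟨F, hF, h⟩ := hf
  exact DifferentiableOn.congr (fun z hz => (ev_qq_diff hF hz).differentiableWithinAt) h

theorem E4_mb {a b c d : ℤ} (h : a * d - b * c = 1) {z : ℂ} (hz : 0 < z.im) :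
    ev (EisC 240 3) (qq (mb a b c d z)) = (c * z + d) ^ 4 * ev (EisC 240 3) (qq z) := by
  let g : Matrix.SpecialLinearGroup (Fin 2) ℤ := ⟨!![a, b; c, d], by simp [Matrix.det_fin_two, h]⟩
  let zz : UpperHalfPlane := ⟨z, hz⟩
  have hA := inv_E 4 (by norm_num) g
  have := congrFun hA zz
  rw [ModularForm.SL_slash_apply] at this
  have e : ((g • zz : UpperHalfPlane) : ℂ) = mb a b c d z := by
    rw [UpperHalfPlane.specialLinearGroup_apply]
    simp [g, mb, zz]
  have e2 : UpperHalfPlane.denom g zz = c * z + d := by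
    rw [ModularGroup.denom_apply]; simp [g, zz]
  rw [e2] at this
  rw [ev_E4, ev_E4, e, zpow_neg, ← div_eq_mul_inv,
    div_eq_iff (zpow_ne_zero _ (den_ne (a := a) (b := b) (by omega) hz))] at this
  rw [this, mul_comm]
  norm_cast

/-- the modular invariant -/
noncomputable def jj (z : ℂ) : ℂ := ev (EisC 240 3) (qq z) ^ 3 / Dl z

theorem jj_mb {a b c d : ℤ} (h : a * d - b * c = 1) {z : ℂ} (hz : 0 < z.im) :
    jj (mb a b c d z) = jj z := by
  rw [jj, jj, E4_mb h hz, Dl_mb h hz, mul_pow, ← pow_mul]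
  exact mul_div_mul_left _ _ (pow_ne_zero _ (den_ne (a := a) (b := b) (by omega) hz))

noncomputable def JJ : PowerSeries ℤ := Eis 240 3 ^ 3 * phinv ^ 24

theorem JJ_const : PowerSeries.constantCoeff JJ = 1 := by
  rw [JJ, map_mul, map_pow, map_pow, const_Eis, phinv_const]; norm_num

theorem JJ_map : PowerSeries.map (Int.castRingHom ℂ) JJ = EisC 240 3 ^ 3 * phinvC ^ 24 := by
  rw [JJ, map_mul, map_pow, map_pow]; rfl

theorem JJ_conv : PowerSeries.map (Int.castRingHom ℂ) JJ ∈ Conv := by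
  rw [JJ_map]
  exact mul_mem (pow_mem (EisC_conv _ _) _) (pow_mem phinvC_conv.1 _)

theorem ev_JJ {z : ℂ} (hz : 0 < z.im) :
    qq z * jj z = ev (PowerSeries.map (Int.castRingHom ℂ) JJ) (qq z) := by
  have hx := norm_qq_lt hz
  rw [JJ_map, ev_mul (pow_mem (EisC_conv _ _) _) (pow_mem phinvC_conv.1 _) hx, ev_pow
    (EisC_conv _ _) hx, ev_pow phinvC_conv.1 hx, phinvC_conv.2 _ hx, jj, Dl_eq hz]
  have n1 := ev_phiC_ne hx
  have n2 := qq_ne z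
  field_simp

theorem jj_diff {z : ℂ} (hz : 0 < z.im) : DifferentiableAt ℂ jj z := by
  refine ((ev_qq_diff (EisC_conv _ _) hz).pow 3).div ((eta_diff hz).pow 24) (Dl_ne hz)

/-- inverse of `UU` -/
noncomputable def UUinv : PowerSeries ℤ := phinv ^ 6 * PowerSeries.expand 5 (by norm_num) phi ^ 6

theorem UU_mul_UUinv : UU * UUinv = 1 := by
  have h1 := phi_mul_phinv
  have h2 : PowerSeries.expand 5 (by norm_num) phinv * PowerSeries.expand 5 (by norm_num) phi = 1 := by
    rw [← map_mul, mul_comm phinv, h1, map_one]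
  rw [UU, UUinv, mul_mul_mul_comm, ← mul_pow, ← mul_pow, h1, h2]; norm_num

theorem UUinv_conv : PowerSeries.map (Int.castRingHom ℂ) UUinv ∈ Conv := by
  rw [UUinv, map_mul, map_pow, map_pow, PowerSeries.map_expand]
  exact mul_mem (pow_mem phinvC_conv.1 _) (pow_mem (conv_expand phiC_conv _ _) _)

theorem ev_UUinv {z : ℂ} (hz : 0 < z.im) :
    1 / tt z = qq z * ev (PowerSeries.map (Int.castRingHom ℂ) UUinv) (qq z) := by
  have h := congrArg (fun F => ev (PowerSeries.map (Int.castRingHom ℂ) F) (qq z)) UU_mul_UUinv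
  simp only [map_mul, map_one, ev_one] at h
  rw [ev_mul UU_conv UUinv_conv (norm_qq_lt hz), ← ev_UU hz] at h
  rw [div_eq_iff (tt_ne hz)]
  linear_combination -h

theorem inv_tt_EvR : (fun z => 1 / tt z) ∈ EvR :=
  ⟨_, mul_mem conv_X UUinv_conv, fun z hz => by
    rw [ev_mul conv_X UUinv_conv (norm_qq_lt hz), ev_X, ← ev_UUinv hz]⟩

theorem jj_div_tt_EvR : (fun z => jj z * (1 / tt z)) ∈ EvR :=
  ⟨_, mul_mem JJ_conv UUinv_conv, fun z hz => by
    rw [ev_mul JJ_conv UUinv_conv (norm_qq_lt hz), ← ev_JJ hz]; linear_combination jj z * ev_UUinv hz⟩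

theorem cg_mul {a b p q r s : PowerSeries ℤ} (h1 : (PowerSeries.X : PowerSeries ℤ) ^ 7 ∣ a - p)
    (h2 : (PowerSeries.X : PowerSeries ℤ) ^ 7 ∣ b - q) (h : p * q = r + PowerSeries.X ^ 7 * s) :
    (PowerSeries.X : PowerSeries ℤ) ^ 7 ∣ a * b - r := by
  obtain ⟨u, hu⟩ := h1
  obtain ⟨v, hv⟩ := h2
  exact ⟨u * b + p * v + s, by linear_combination b * hu + p * hv + h⟩

theorem cg_mul' {PX a b p q r s : PowerSeries ℤ} (hX : (PowerSeries.X : PowerSeries ℤ) = PX)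
    (h1 : PX ^ 7 ∣ a - p) (h2 : PX ^ 7 ∣ b - q) (h : p * q = r + PX ^ 7 * s) :
    PX ^ 7 ∣ a * b - r := by
  subst hX; exact cg_mul h1 h2 h

theorem coeff_phinv : PowerSeries.coeff 1 phinv = 1 := by
  have h := congrArg (PowerSeries.coeff 1) phi_mul_phinv
  rw [PowerSeries.coeff_mul] at h
  simp [Finset.Nat.antidiagonal_succ, phi_coeffs.2.1, phi_const, phinv_const,
    PowerSeries.coeff_one] at h
  omega

theorem dvd_sq_of {F : PowerSeries ℤ} (a : ℤ) (h0 : PowerSeries.coeff 0 F = 1)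
    (h1 : PowerSeries.coeff 1 F = a) :
    (PowerSeries.X : PowerSeries ℤ) ^ 2 ∣ F - (1 + PowerSeries.C a * PowerSeries.X) := by
  rw [PowerSeries.X_pow_dvd_iff]
  intro m hm
  interval_cases m
  · simp at h0; simp [h0]
  · simp [PowerSeries.coeff_one, h1]

theorem expand_cg {F : PowerSeries ℤ} {a : ℤ}
    (h : (PowerSeries.X : PowerSeries ℤ) ^ 2 ∣ F - (1 + PowerSeries.C a * PowerSeries.X)) :
    (PowerSeries.X : PowerSeries ℤ) ^ 7 ∣ PowerSeries.expand 5 (by norm_num) F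
      - (1 + PowerSeries.C a * PowerSeries.X ^ 5) := by
  obtain ⟨G, hG⟩ := h
  have := congrArg (PowerSeries.expand 5 (by norm_num)) hG
  simp only [map_sub, map_add, map_mul, map_one, map_pow, PowerSeries.expand_X,
    PowerSeries.expand_C] at this
  rw [this]
  exact ⟨PowerSeries.X ^ 3 * PowerSeries.expand 5 (by norm_num) G, by ring⟩

theorem dvd_sq_mul {F G : PowerSeries ℤ} {a b : ℤ}
    (h : (PowerSeries.X : PowerSeries ℤ) ^ 2 ∣ F - (1 + PowerSeries.C a * PowerSeries.X))
    (h' : (PowerSeries.X : PowerSeries ℤ) ^ 2 ∣ G - (1 + PowerSeries.C b * PowerSeries.X)) :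
    (PowerSeries.X : PowerSeries ℤ) ^ 2 ∣ F * G - (1 + PowerSeries.C (a + b) * PowerSeries.X) := by
  obtain ⟨u, hu⟩ := h
  obtain ⟨v, hv⟩ := h'
  refine ⟨u * G + (1 + PowerSeries.C a * PowerSeries.X) * v + PowerSeries.C a * PowerSeries.C b, ?_⟩
  rw [map_add]
  linear_combination G * hu + (1 + PowerSeries.C a * PowerSeries.X) * hv

theorem dvd_sq_pow {F : PowerSeries ℤ} {a : ℤ} (n : ℕ)
    (h : (PowerSeries.X : PowerSeries ℤ) ^ 2 ∣ F - (1 + PowerSeries.C a * PowerSeries.X)) :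
    (PowerSeries.X : PowerSeries ℤ) ^ 2 ∣ F ^ n - (1 + PowerSeries.C (n * a) * PowerSeries.X) := by
  induction n with
  | zero => simp
  | succ n ih =>
    have := dvd_sq_mul ih h
    rwa [← pow_succ, show (n : ℤ) * a + a = ((n + 1 : ℕ) : ℤ) * a by push_cast; ring] at this

set_option maxHeartbeats 1000000 in
theorem key7 : (PowerSeries.X : PowerSeries ℤ) ^ 7 ∣
    PowerSeries.expand 5 (by norm_num) JJ * UU
      - (UU * UU + UU * (10 * PowerSeries.X) + 5 * PowerSeries.X ^ 2)
        * (UU * UU + UU * (10 * PowerSeries.X) + 5 * PowerSeries.X ^ 2)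
        * (UU * UU + UU * (10 * PowerSeries.X) + 5 * PowerSeries.X ^ 2) := by
  have hv := dvd_sq_of 1 (by simp [phinv_const]) coeff_phinv
  have hE := dvd_sq_of (F := Eis 240 3) 240 (by simp [const_Eis])
    (by simp [Eis, PowerSeries.coeff_mk])
  have v6 := expand_cg (dvd_sq_pow 6 hv)
  have j5 := expand_cg (dvd_sq_mul (dvd_sq_pow 3 hE) (dvd_sq_pow 24 hv))
  have c6 : (PowerSeries.C ((6 : ℕ) * 1 : ℤ) : PowerSeries ℤ) = 6 := by norm_num
  have c744 : (PowerSeries.C ((3 : ℕ) * 240 + (24 : ℕ) * 1 : ℤ) : PowerSeries ℤ) = 744 := by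
    norm_num
  rw [c6] at v6
  rw [c744] at j5
  change _ ∣ PowerSeries.expand 5 _ JJ - _ at j5
  rw [map_pow] at v6
  have p1 : (PowerSeries.X : PowerSeries ℤ) ^ 7 ∣ phi -
      (1 - PowerSeries.X - PowerSeries.X ^ 2 + PowerSeries.X ^ 5) := by
    rw [PowerSeries.X_pow_dvd_iff]
    obtain ⟨h0, h1, h2, h3, h4, h5, h6⟩ := phi_coeffs
    intro m hm
    simp only [map_sub, map_add, PowerSeries.coeff_one, PowerSeries.coeff_X,
      PowerSeries.coeff_X_pow]
    interval_cases m <;> simp only [h0, h1, h2, h3, h4, h5, h6] <;> norm_num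
  generalize hX : (PowerSeries.X : PowerSeries ℤ) = PX at *
  have p2 := cg_mul' hX (r := ((1) + (-2)*PX + (-1)*PX^2 + (2)*PX^3 + (1)*PX^4 + (2)*PX^5 + (-2)*PX^6 : PowerSeries ℤ)) (s := ((-2) + (1)*PX^3 : PowerSeries ℤ)) p1 p1 (by ring)
  have p3 := cg_mul' hX (r := ((1) + (-3)*PX + (5)*PX^3 + (-7)*PX^6 : PowerSeries ℤ)) (s := ((-1) + (4)*PX + (1)*PX^2 + (2)*PX^3 + (-2)*PX^4 : PowerSeries ℤ)) p2 p1 (by ring)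
  have p6 := cg_mul' hX (r := ((1) + (-6)*PX + (9)*PX^2 + (10)*PX^3 + (-30)*PX^4 + (11)*PX^6 : PowerSeries ℤ)) (s := ((42) + (-70)*PX^2 + (49)*PX^5 : PowerSeries ℤ)) p3 p3 (by ring)
  have pu := cg_mul' hX (r := ((1) + (-6)*PX + (9)*PX^2 + (10)*PX^3 + (-30)*PX^4 + (6)*PX^5 + (-25)*PX^6 : PowerSeries ℤ)) (s := ((54) + (60)*PX + (-180)*PX^2 + (66)*PX^4 : PowerSeries ℤ)) p6 v6 (by ring)
  have hUU : phi * phi * phi * (phi * phi * phi) * PowerSeries.expand 5 (by norm_num) phinv ^ 6 = UU := by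
    rw [UU]; ring
  rw [hUU] at pu
  have c10 : PX ^ 7 ∣ 10 * PX - 10 * PX := by simp
  have u2 := cg_mul' hX (r := ((1) + (-12)*PX + (54)*PX^2 + (-88)*PX^3 + (-99)*PX^4 + (552)*PX^5 + (-562)*PX^6 : PowerSeries ℤ)) (s := ((-192) + (570)*PX + (-860)*PX^2 + (1536)*PX^3 + (-300)*PX^4 + (625)*PX^5 : PowerSeries ℤ)) pu pu (by ring)
  have u10 := cg_mul' hX (r := ((10)*PX + (-60)*PX^2 + (90)*PX^3 + (100)*PX^4 + (-300)*PX^5 + (60)*PX^6 : PowerSeries ℤ)) (s := ((-250) : PowerSeries ℤ)) pu c10 (by ring)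
  have pA : PX ^ 7 ∣ UU * UU + UU * (10 * PX) + 5 * PX ^ 2 - ((1) + (-2)*PX + (-1)*PX^2 + (2)*PX^3 + (1)*PX^4 + (252)*PX^5 + (-502)*PX^6 : PowerSeries ℤ) := by
    have := dvd_add u2 u10
    convert this using 1; ring
  have a2 := cg_mul' hX (r := ((1) + (-4)*PX + (2)*PX^2 + (8)*PX^3 + (-5)*PX^4 + (496)*PX^5 + (-2010)*PX^6 : PowerSeries ℤ)) (s := ((1508) + (2013)*PX + (-1504)*PX^2 + (62500)*PX^3 + (-253008)*PX^4 + (252004)*PX^5 : PowerSeries ℤ)) pA pA (by ring)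
  have a3 := cg_mul' hX (r := ((1) + (-6)*PX + (9)*PX^2 + (10)*PX^3 + (-30)*PX^4 + (750)*PX^5 + (-4489)*PX^6 : PowerSeries ℤ)) (s := ((6034) + (4009)*PX + (-8800)*PX^2 + (125492)*PX^3 + (-755512)*PX^4 + (1009020)*PX^5 : PowerSeries ℤ)) a2 pA (by ring)
  have ju := cg_mul' hX (r := ((1) + (-6)*PX + (9)*PX^2 + (10)*PX^3 + (-30)*PX^4 + (750)*PX^5 + (-4489)*PX^6 : PowerSeries ℤ)) (s := ((6696) + (7440)*PX + (-22320)*PX^2 + (4464)*PX^3 + (-18600)*PX^4 : PowerSeries ℤ)) j5 pu (by ring)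
  have := dvd_sub ju a3
  convert this using 1; ring

theorem jj5 {z : ℂ} (hz : 0 < z.im) : jj (5 * z) * tt z = (tt z ^ 2 + 10 * tt z + 5) ^ 3 := by
  obtain ⟨G, hG⟩ := key7
  have hG' := congrArg (PowerSeries.map (Int.castRingHom ℂ)) hG
  simp only [map_sub, map_mul, map_add, map_pow, map_ofNat, PowerSeries.map_X,
    PowerSeries.map_expand] at hG'
  set JC := PowerSeries.map (Int.castRingHom ℂ) JJ with hJC
  set UC := PowerSeries.map (Int.castRingHom ℂ) UU with hUC
  set GC := PowerSeries.map (Int.castRingHom ℂ) G with hGC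
  have cJ := JJ_conv
  have cU := UU_conv
  rw [← hJC] at cJ
  rw [← hUC] at cU
  have h10 : (10 : PowerSeries ℂ) ∈ Conv := conv_C 10
  have h5 : (5 : PowerSeries ℂ) ∈ Conv := conv_C 5
  have cJ5 := conv_expand cJ 5 (by norm_num)
  have c10 := mul_mem h10 conv_X
  have cX2 := mul_mem h5 (pow_mem conv_X 2)
  have cA := add_mem (add_mem (mul_mem cU cU) (mul_mem cU c10)) cX2
  have cL := sub_mem (mul_mem cJ5 cU) (mul_mem (mul_mem cA cA) cA)
  have cG : GC ∈ Conv := by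
    rw [hG'] at cL
    iterate 7 (first | (rw [pow_succ', mul_assoc] at cL; replace cL := conv_of_X_mul cL))
    simpa using cL
  let f : ℂ → ℂ := fun z => jj (5 * z) * tt z - (tt z ^ 2 + 10 * tt z + 5) ^ 3
  have hf : ∀ z : ℂ, 0 < z.im → f z = ev (PowerSeries.X * GC) (qq z) := by
    intro z hz
    have hx := norm_qq_lt hz
    have h := congrArg (fun F => ev F (qq z)) hG'
    have e10 : ev (10 : PowerSeries ℂ) (qq z) = 10 := ev_C 10 _
    have e5 : ev (5 : PowerSeries ℂ) (qq z) = 5 := ev_C 5 _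
    rw [ev_sub (mul_mem cJ5 cU) (mul_mem (mul_mem cA cA) cA) hx, ev_mul cJ5 cU hx,
      ev_mul (mul_mem cA cA) cA hx, ev_mul cA cA hx,
      ev_add (add_mem (mul_mem cU cU) (mul_mem cU c10)) cX2 hx,
      ev_add (mul_mem cU cU) (mul_mem cU c10) hx, ev_mul cU cU hx, ev_mul cU c10 hx,
      ev_mul h10 conv_X hx, ev_mul h5 (pow_mem conv_X 2) hx, ev_pow conv_X hx, ev_X, e10, e5,
      ev_mul (pow_mem conv_X 7) cG hx, ev_pow conv_X hx, ev_X, ev_expand cJ 5 _ hx,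
      show qq z ^ 5 = qq (5 * z) by rw [qq_pow]; norm_num, hJC, hUC, ← ev_JJ (im5 hz), ← ev_UU hz,
      show qq (5 * z) = qq z ^ 5 by rw [qq_pow]; norm_num] at h
    rw [ev_mul conv_X cG hx, ev_X]
    apply mul_left_cancel₀ (pow_ne_zero 6 (qq_ne z))
    simp only [f]
    linear_combination h
  have hfE : f ∈ EvR := ⟨_, mul_mem conv_X cG, hf⟩
  obtain ⟨c, hc⟩ := const5 f (EvR_diff hfE) (by
    intro a b c d h z hz
    have e : 5 * mb a b (5 * c) d z = mb a (5 * b) c d (5 * z) := by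
      have := den_ne (a := a) (b := b) (c := 5 * c) (d := d) (by omega) hz
      unfold mb
      push_cast at *
      rw [← mul_div_assoc]
      congr 1 <;> ring
    simp only [f]
    rw [tt_inv5 a b c d h z hz, e, jj_mb (by linarith) (im5 hz)]) (EvR_bdd hfE) (by
    have h1 : (fun z => 125 * (jj z * (1 / tt z)) - ((125 * (1 / tt z)) ^ 2 +
        10 * (125 * (1 / tt z)) + 5) ^ 3) ∈ EvR := by
      have a1 := inv_tt_EvR
      have a2 := jj_div_tt_EvR
      have b1 := mul_mem (EvR_const 125) a1
      exact sub_mem (mul_mem (EvR_const 125) a2) (pow_mem (add_mem (add_mem (pow_mem b1 2)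
        (mul_mem (EvR_const 10) b1)) (EvR_const 5)) 3)
    obtain ⟨B, Y, h2⟩ := EvR_bdd h1
    refine ⟨B, max Y 0, fun z hz => ?_⟩
    have hz0 : 0 < z.im := (le_max_right _ _).trans_lt hz
    have h3 := h2 z ((le_max_left _ _).trans_lt hz)
    have e : 5 * (-1 / (5 * z)) = mb 0 (-1) 1 0 z := by
      have : z ≠ 0 := by rintro rfl; simp at hz0
      unfold mb
      push_cast
      rw [zero_mul, zero_add, add_zero, one_mul, mul_div_assoc', mul_div_mul_left _ _ (by norm_num)]
    simp only [f]
    rw [e, jj_mb (by norm_num) hz0, tt_W hz0]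
    convert h3 using 2
    ring)
  have h0 := ev_eq_C (mul_mem conv_X cG) c fun z hz => by rw [← hf z hz, hc z hz]
  have hc0 : c = 0 := by
    have := congrArg PowerSeries.constantCoeff h0
    simpa using this.symm
  have := hc z hz
  rw [hc0] at this
  exact sub_eq_zero.mp this

end QH

namespace QH
open Topology Filter

section top
variable {Q : Type*} [TopologicalSpace Q] [T2Space Q] {τ : Q → ℂ}

theorem top_near (hc : Continuous τ)
    (hprop : ∀ c : ℂ, c ≠ 0 → ∃ K ∈ 𝓝 c, ∃ C : Set Q, IsCompact C ∧ τ ⁻¹' K ⊆ C)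
    {c : ℂ} (hc0 : c ≠ 0) (U : Set Q) (hU : IsOpen U) (h : ∀ q, τ q = c → q ∈ U) :
    ∃ N ∈ 𝓝 c, ∀ q, τ q ∈ N → q ∈ U := by
  obtain ⟨K, hK, C, hC, hKC⟩ := hprop c hc0
  have h1 : IsCompact (C \ U) := hC.diff hU
  have h2 : IsClosed (τ '' (C \ U)) := (h1.image hc).isClosed
  have h3 : c ∉ τ '' (C \ U) := by
    rintro ⟨q, hq, rfl⟩
    exact hq.2 (h q rfl)
  refine ⟨K ∩ (τ '' (C \ U))ᶜ, inter_mem hK (h2.isOpen_compl.mem_nhds h3), fun q hq => ?_⟩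
  by_contra hqU
  exact hq.2 ⟨q, ⟨hKC hq.1, hqU⟩, rfl⟩

theorem ncard_compl (E : Set ℂ) (hE : E.Countable) : IsConnected ((insert (0 : ℂ) E)ᶜ) :=
  ((hE.insert 0).isPathConnected_compl_of_one_lt_rank (by
    rw [Complex.rank_real_complex]; norm_num)).isConnected

theorem top_inj (hc : Continuous τ) (ho : IsOpenMap τ) (h0 : ∀ q, τ q ≠ 0)
    (hprop : ∀ c : ℂ, c ≠ 0 → ∃ K ∈ 𝓝 c, ∃ C : Set Q, IsCompact C ∧ τ ⁻¹' K ⊆ C)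
    (E : Set ℂ) (hE : E.Countable) (hloc : ∀ q, τ q ∉ E → ∃ U ∈ 𝓝 q, Set.InjOn τ U)
    (M : ℝ) (hbig : ∀ q q', M < ‖τ q‖ → τ q = τ q' → q = q') : Function.Injective τ := by
  let B : Set ℂ := {c | ∃ q q', q ≠ q' ∧ τ q = c ∧ τ q' = c}
  have hBo : IsOpen B := by
    rw [isOpen_iff_mem_nhds]
    rintro c ⟨q, q', hne, h1, h2⟩
    obtain ⟨u, v, hu, hv, hqu, hqv, hd⟩ := t2_separation hne
    refine mem_of_superset (inter_mem ((ho u hu).mem_nhds ⟨q, hqu, h1⟩)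
      ((ho v hv).mem_nhds ⟨q', hqv, h2⟩)) ?_
    rintro d ⟨⟨x, hx, hxd⟩, y, hy, hyd⟩
    refine ⟨x, y, ?_, hxd, hyd⟩
    rintro rfl
    exact hd.le_bot ⟨hx, hy⟩
  have hBc : IsOpen (Bᶜ ∩ (insert (0 : ℂ) E)ᶜ) ∨ True := Or.inr trivial
  have key : ∀ c ∈ (insert (0 : ℂ) E)ᶜ, c ∉ B → ∃ N ∈ 𝓝 c, Disjoint N B := by
    intro c hcE hcB
    have hc0 : c ≠ 0 := fun h => hcE (by simp [h])
    have hcE' : c ∉ E := fun h => hcE (Set.mem_insert_of_mem _ h)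
    by_cases hex : ∃ q, τ q = c
    · obtain ⟨q, hq⟩ := hex
      obtain ⟨U, hU, hinj⟩ := hloc q (by rwa [hq])
      obtain ⟨V, hVU, hV, hqV⟩ := mem_nhds_iff.mp hU
      obtain ⟨N, hN, h⟩ := top_near hc hprop hc0 V hV (fun q' hq' => by
        by_contra hq2
        refine hcB ⟨q, q', ?_, hq, hq'⟩
        rintro rfl
        exact hq2 hqV)
      refine ⟨N, hN, Set.disjoint_left.mpr ?_⟩
      rintro d hd ⟨x, y, hne, hx, hy⟩
      exact hne (hinj (hVU (h x (by rwa [hx]))) (hVU (h y (by rwa [hy]))) (by rw [hx, hy]))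
    · obtain ⟨N, hN, h⟩ := top_near hc hprop hc0 ∅ isOpen_empty (fun q hq => (hex ⟨q, hq⟩).elim)
      refine ⟨N, hN, Set.disjoint_left.mpr ?_⟩
      rintro d hd ⟨x, y, hne, hx, hy⟩
      exact h x (by rwa [hx])
  have hcl : closure B ∩ (insert (0 : ℂ) E)ᶜ ⊆ B := by
    rintro c ⟨h1, h2⟩
    by_contra h3
    obtain ⟨N, hN, hd⟩ := key c h2 h3
    obtain ⟨x, hx⟩ := mem_closure_iff_nhds.mp h1 N hN
    exact hd.le_bot hx
  have hconn := (ncard_compl E hE).isPreconnected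
  have hcount : ∀ O : Set ℂ, IsOpen O → O.Nonempty → (O ∩ (insert (0 : ℂ) E)ᶜ).Nonempty := by
    intro O hO hne
    exact ((hE.insert 0).dense_compl ℝ).inter_open_nonempty O hO hne
  have hBemp : ¬ (B ∩ (insert (0 : ℂ) E)ᶜ).Nonempty := by
    intro hne
    have h1 := hconn.subset_of_closure_inter_subset hBo (by rwa [Set.inter_comm]) hcl
    obtain ⟨c, hcM, hcE⟩ := hcount {z | M < ‖z‖} (isOpen_lt continuous_const continuous_norm)
      ⟨((|M| + 1 : ℝ) : ℂ), by
        simp only [Set.mem_setOf_eq, Complex.norm_real, Real.norm_eq_abs]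
        rw [abs_of_nonneg (by positivity)]
        linarith [le_abs_self M]⟩
    obtain ⟨q, q', hn, hq, hq'⟩ := h1 hcE
    exact hn (hbig q q' (by rw [hq]; exact hcM) (by rw [hq, hq']))
  intro q q' h
  by_contra hne
  exact hBemp (hcount B hBo ⟨τ q, q, q', hne, rfl, h.symm⟩)

theorem top_surj [Nonempty Q] (hc : Continuous τ) (ho : IsOpenMap τ) (h0 : ∀ q, τ q ≠ 0)
    (hprop : ∀ c : ℂ, c ≠ 0 → ∃ K ∈ 𝓝 c, ∃ C : Set Q, IsCompact C ∧ τ ⁻¹' K ⊆ C)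
    (c : ℂ) (hc0 : c ≠ 0) : ∃ q, τ q = c := by
  have hconn := (ncard_compl ∅ Set.countable_empty).isPreconnected
  have hop : IsOpen (Set.range τ) := ho.isOpen_range
  have h1 := hconn.subset_of_closure_inter_subset hop (by
      obtain ⟨q⟩ := ‹Nonempty Q›
      exact ⟨τ q, by simpa using h0 q, q, rfl⟩) (by
    rintro d ⟨hd, hd0⟩
    have hd0 : d ≠ 0 := by simpa using hd0
    by_contra hex
    obtain ⟨N, hN, h⟩ := top_near hc hprop hd0 ∅ isOpen_empty (fun q hq => (hex ⟨q, hq⟩).elim)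
    obtain ⟨x, hx, q, rfl⟩ := mem_closure_iff_nhds.mp hd N hN
    exact h q hx)
  exact h1 (by simpa using hc0)
end top

end QH

namespace QH

open Topology Filter

theorem loc_inj {f : ℂ → ℂ} {x : ℂ} (hf : AnalyticAt ℂ f x) (hd : deriv f x ≠ 0) :
    ∃ U ∈ 𝓝 x, Set.InjOn f U := by
  have h1 : HasStrictDerivAt f (deriv f x) x := hf.hasStrictDerivAt
  have h2 := h1.hasStrictFDerivAt_equiv hd
  refine ⟨(h2.toOpenPartialHomeomorph f).source,
    (h2.toOpenPartialHomeomorph f).open_source.mem_nhds h2.mem_toOpenPartialHomeomorph_source, ?_⟩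
  exact (h2.toOpenPartialHomeomorph f).injOn

theorem ev_bdd {F : PowerSeries ℂ} (hF : F ∈ Conv) {r : ℝ} (hr : r < 1) :
    ∃ B : ℝ, 0 < B ∧ ∀ x : ℂ, ‖x‖ ≤ r → ‖ev F x‖ ≤ B := by
  have hc : ContinuousOn (ev F) (Metric.closedBall 0 r) :=
    (ev_differentiableOn hF).continuousOn.mono (Metric.closedBall_subset_ball hr)
  obtain ⟨B, hB⟩ := (isCompact_closedBall (0:ℂ) r).exists_bound_of_continuousOn hc
  exact ⟨max B 1, by positivity, fun x hx => (hB x (by simpa using hx)).trans (le_max_left _ _)⟩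

theorem tt_analytic : AnalyticOnNhd ℂ tt {z : ℂ | 0 < z.im} :=
  DifferentiableOn.analyticOnNhd (fun z hz => (tt_diff hz).differentiableWithinAt) isOpen_H

theorem tt_not_const : ¬ ∃ c, ∀ z ∈ {z : ℂ | 0 < z.im}, tt z = c := by
  rintro ⟨c, hc⟩
  have := ev_inj_qq UU_conv (mul_mem conv_X (conv_C c)) (fun z hz => by
    rw [← ev_UU hz, hc z hz, ev_mul conv_X (conv_C c) (norm_qq_lt hz), ev_X, ev_C])
  have h := congrArg PowerSeries.constantCoeff this
  rw [← PowerSeries.coeff_zero_eq_constantCoeff_apply, PowerSeries.coeff_map,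
    PowerSeries.coeff_zero_eq_constantCoeff_apply, UU_const] at h
  simp at h

theorem tt_open (s : Set ℂ) (hs : s ⊆ {z : ℂ | 0 < z.im}) (ho : IsOpen s) : IsOpen (tt '' s) :=
  (tt_analytic.is_constant_or_isOpen isPreconnected_H).resolve_left tt_not_const s hs ho

theorem tt_crit_countable : {z : ℂ | 0 < z.im ∧ deriv tt z = 0}.Countable := by
  refine IsLindelof.countable (HereditarilyLindelofSpace.isLindelof _) ?_
  rw [discreteTopology_subtype_iff]
  rintro x ⟨hx, hx0⟩
  have hd : AnalyticOnNhd ℂ (deriv tt) {z : ℂ | 0 < z.im} := tt_analytic.deriv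
  rcases (hd x hx).eventually_eq_zero_or_eventually_ne_zero with h | h
  · exfalso
    have h0 := hd.eqOn_zero_of_preconnected_of_eventuallyEq_zero isPreconnected_H hx h
    apply tt_not_const
    refine ⟨tt x, fun z hz => ?_⟩
    exact isOpen_H.is_const_of_deriv_eq_zero isPreconnected_H
      (fun z hz => (tt_diff hz).differentiableWithinAt) h0 hz hx
  · rw [← _root_.disjoint_iff, Filter.disjoint_principal_right]
    filter_upwards [h] with y hy hy'
    exact hy hy'.2

theorem norm_qq_le {z : ℂ} (hz : 1 / 10 ≤ z.im) : ‖qq z‖ ≤ Real.exp (-(2 * Real.pi * (1 / 10))) := by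
  rw [norm_qq]
  apply Real.exp_le_exp.mpr
  have := Real.pi_pos
  nlinarith

theorem exp_r : Real.exp (-(2 * Real.pi * (1 / 10))) < 1 := by
  rw [Real.exp_lt_one_iff]
  have := Real.pi_pos
  nlinarith

/-- (i)-(ii) -/
theorem tt_small_inv : ∃ B : ℝ, 0 < B ∧ ∀ z : ℂ, 1 / 10 ≤ z.im →
    ‖qq z‖ ≤ B * ‖1 / tt z‖ ∧ ‖1 / tt z‖ ≤ B * ‖qq z‖ ∧ ‖1 / tt z‖ ≤ B := by
  obtain ⟨B, hB, h⟩ := ev_bdd UU_conv exp_r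
  obtain ⟨B', hB', h'⟩ := ev_bdd UUinv_conv exp_r
  refine ⟨max B B', by positivity, fun z hz => ?_⟩
  have hz0 : 0 < z.im := by linarith
  have h1 := h _ (norm_qq_le hz)
  have h2 := h' _ (norm_qq_le hz)
  have ht := tt_ne hz0
  have e1 := ev_UU hz0
  have e2 := ev_UUinv hz0
  have c2 : ‖1 / tt z‖ ≤ max B B' * ‖qq z‖ := by
    rw [e2, norm_mul, mul_comm]
    exact mul_le_mul_of_nonneg_right (h2.trans (le_max_right _ _)) (norm_nonneg _)
  refine ⟨?_, c2, c2.trans ?_⟩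
  · have : qq z = ev (PowerSeries.map (Int.castRingHom ℂ) UU) (qq z) * (1 / tt z) := by
      rw [← e1]; field_simp
    have h3 : ‖qq z‖ = ‖ev (PowerSeries.map (Int.castRingHom ℂ) UU) (qq z)‖ * ‖1 / tt z‖ := by
      rw [← norm_mul, ← this]
    rw [h3]
    exact mul_le_mul_of_nonneg_right (h1.trans (le_max_left _ _)) (norm_nonneg _)
  · have := norm_qq_lt hz0
    have hp : 0 < max B B' := by positivity
    nlinarith [norm_nonneg (qq z)]

theorem qq_inj {z w : ℂ} (h : qq z = qq w) : ∃ n : ℤ, z = w + n := by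
  rw [qq, qq, Complex.exp_eq_exp_iff_exists_int] at h
  obtain ⟨n, hn⟩ := h
  refine ⟨n, ?_⟩
  have := Complex.two_pi_I_ne_zero
  have h2 : (2 * (Real.pi:ℂ) * Complex.I) * (z - (w + n)) = 0 := by linear_combination hn
  rcases mul_eq_zero.mp h2 with h | h
  · exact (this h).elim
  · linear_combination h

theorem h_inj : ∃ δ : ℝ, 0 < δ ∧ ∀ z w : ℂ, 0 < z.im → 0 < w.im → ‖qq z‖ < δ → ‖qq w‖ < δ →
    tt z = tt w → ∃ n : ℤ, z = w + n := by
  set F := PowerSeries.map (Int.castRingHom ℂ) UUinv with hF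
  have hd : DifferentiableOn ℂ (ev F) (Metric.ball 0 1) := ev_differentiableOn UUinv_conv
  have hd2 : DifferentiableOn ℂ (fun x => x * ev F x) (Metric.ball 0 1) :=
    differentiableOn_id.mul hd
  have ha : AnalyticAt ℂ (fun x => x * ev F x) 0 :=
    hd2.analyticOnNhd Metric.isOpen_ball 0 (by simp)
  have hda : DifferentiableAt ℂ (ev F) 0 := hd.differentiableAt (Metric.ball_mem_nhds _ one_pos)
  have h0 : ev F 0 = 1 := by
    have h := congrArg (fun F => ev (PowerSeries.map (Int.castRingHom ℂ) F) 0) UU_mul_UUinv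
    simp only [map_mul, map_one, ev_one] at h
    rw [ev_mul UU_conv UUinv_conv (by simp)] at h
    rw [ev_zero] at h
    rw [PowerSeries.coeff_map, PowerSeries.coeff_zero_eq_constantCoeff_apply, UU_const] at h
    simpa using h
  have hder : deriv (fun x => x * ev F x) 0 ≠ 0 := by
    have h1 := ((hasDerivAt_id (0:ℂ)).mul hda.hasDerivAt).deriv
    have h2 : (id * ev F : ℂ → ℂ) = fun x => x * ev F x := rfl
    rw [h2] at h1
    rw [h1]; simp [h0]
  obtain ⟨U, hU, hi⟩ := loc_inj ha hder
  obtain ⟨δ, hδ, hb⟩ := Metric.mem_nhds_iff.mp hU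
  refine ⟨δ, hδ, fun z w hz hw hz' hw' h => qq_inj ?_⟩
  refine hi (hb (by simpa using hz')) (hb (by simpa using hw')) ?_
  change qq z * ev F (qq z) = qq w * ev F (qq w)
  rw [← ev_UUinv hz, ← ev_UUinv hw, h]

end QH

namespace QH

open Topology Filter UpperHalfPlane CongruenceSubgroup Matrix.SpecialLinearGroup

/-- `z` is a `Γ₀(5)`-translate of `w` -/
def Eq5 (z w : ℂ) : Prop := ∃ a b c d : ℤ, a * d - b * (5 * c) = 1 ∧ z = mb a b (5 * c) d w

theorem mb_id (z : ℂ) : mb 1 0 0 1 z = z := by simp [mb]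

theorem Eq5.refl (z : ℂ) : Eq5 z z := ⟨1, 0, 0, 1, by norm_num, by simp [mb]⟩

theorem Eq5.symm {z w : ℂ} (hw : 0 < w.im) (h : Eq5 z w) : Eq5 w z := by
  obtain ⟨a, b, c, d, h1, rfl⟩ := h
  refine ⟨d, -b, -c, a, by linarith, ?_⟩
  rw [mb_comp (by linarith) (by linarith) hw]
  have e1 : d * a + -b * (5 * c) = 1 := by linarith
  have e2 : d * b + -b * d = 0 := by ring
  have e3 : 5 * -c * a + a * (5 * c) = 0 := by ring
  have e4 : 5 * -c * b + a * d = 1 := by linarith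
  rw [e1, e2, e3, e4, mb_id]

theorem Eq5.trans {x y z : ℂ} (hz : 0 < z.im) (h : Eq5 x y) (h' : Eq5 y z) : Eq5 x z := by
  obtain ⟨a, b, c, d, h1, rfl⟩ := h
  obtain ⟨a', b', c', d', h1', rfl⟩ := h'
  refine ⟨a * a' + b * (5 * c'), a * b' + b * d', c * a' + d * c', 5 * c * b' + d * d', ?_, ?_⟩
  · linear_combination h1 * (a' * d' - b' * (5 * c')) + h1'
  · rw [mb_comp (by linarith) (by linarith) hz]
    congr 1; ring

theorem Eq5.im {z w : ℂ} (hw : 0 < w.im) (h : Eq5 z w) : 0 < z.im := by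
  obtain ⟨a, b, c, d, h1, rfl⟩ := h
  exact im_mb (by linarith) hw

theorem Eq5.tt {z w : ℂ} (hw : 0 < w.im) (h : Eq5 z w) : tt z = tt w := by
  obtain ⟨a, b, c, d, h1, rfl⟩ := h
  exact tt_inv5 a b c d h1 w hw

theorem Eq5.add_int (z : ℂ) (n : ℤ) : Eq5 (z + n) z := ⟨1, n, 0, 1, by norm_num, by simp [mb]⟩

theorem Eq5.W_add_int {z : ℂ} (hz : 0 < z.im) (n : ℤ) : Eq5 (-1 / (5 * (z + n))) (-1 / (5 * z)) := by
  refine ⟨1, 0, -n, 1, by norm_num, ?_⟩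
  have h0 : z ≠ 0 := fun h => by simp [h] at hz
  have h1 : z + n ≠ 0 := fun h => by
    have := congrArg Complex.im h; simp at this; linarith
  unfold mb
  push_cast
  have e : (5 * -(n:ℂ)) * (-1 / (5 * z)) + 1 = (z + n) / z := by field_simp; ring
  rw [e]; field_simp; ring

theorem sl_coe (g : Matrix.SpecialLinearGroup (Fin 2) ℤ) (z : UpperHalfPlane) :
    ((g • z : UpperHalfPlane) : ℂ) = mb (g 0 0) (g 0 1) (g 1 0) (g 1 1) z := by
  rw [UpperHalfPlane.specialLinearGroup_apply]
  simp [mb]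

theorem dichot {z : ℂ} (hz : 0 < z.im) : ∃ w : ℂ, 1 / 10 ≤ w.im ∧ |w.re| ≤ 1 / 2 ∧
    (Eq5 z w ∨ Eq5 z (-1 / (5 * w))) := by
  obtain ⟨γ, hγ⟩ := ModularGroup.exists_one_half_le_im_smul ⟨z, hz⟩
  set u : UpperHalfPlane := γ • ⟨z, hz⟩ with hu
  have hzu : z = ((γ⁻¹ • u : UpperHalfPlane) : ℂ) := by rw [hu, inv_smul_smul]
  rw [sl_coe] at hzu
  have hdet : γ⁻¹ 0 0 * γ⁻¹ 1 1 - γ⁻¹ 0 1 * γ⁻¹ 1 0 = 1 := by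
    have := γ⁻¹.det_coe; rwa [Matrix.det_fin_two] at this
  set a := γ⁻¹ 0 0
  set b := γ⁻¹ 0 1
  set c := γ⁻¹ 1 0
  set d := γ⁻¹ 1 1
  have hu0 : 0 < (u : ℂ).im := u.im_pos
  have hu1 : 1 / 2 ≤ (u : ℂ).im := hγ
  have hre : ∀ x : ℂ, |(x - round x.re : ℂ).re| ≤ 1 / 2 := fun x => by
    have := abs_sub_round x.re
    simpa using this
  by_cases hc : (5 : ℤ) ∣ c
  · obtain ⟨c', hc'⟩ := hc
    refine ⟨u - round (u : ℂ).re, by simp; linarith, hre _, Or.inl ?_⟩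
    have h1 : Eq5 z u := ⟨a, b, c', d, by rw [← hc']; exact hdet, by rw [← hc']; exact hzu⟩
    refine h1.trans (by simpa using hu0) ?_
    have := Eq5.add_int ((u:ℂ) - round (u : ℂ).re) (round (u : ℂ).re)
    simpa using this
  · obtain ⟨k, e, hk⟩ : ∃ k e : ℤ, d - c * k = 5 * e := by
      have hp : Prime (5 : ℤ) := by norm_num
      obtain ⟨x, y, hxy⟩ := (hp.coprime_iff_not_dvd).mpr hc
      exact ⟨d * y, d * x, by linear_combination (-d) * hxy⟩
    have e5 : 5 * -e = -(d - c * k) := by linarith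
    have e1 : z = mb (-(b - a * k)) a (5 * -e) c (mb 0 (-1) 1 k u) := by
      rw [mb_comp _ (by norm_num) hu0, hzu]
      · congr 1
        · ring
        · ring
        · ring
        · linarith
      · rw [e5]; linarith
    set v : ℂ := (u + k) / 5 with hv
    have hvi : v.im = (u : ℂ).im / 5 := by
      rw [hv]; simp [Complex.div_im, Complex.normSq]
    have e2 : mb 0 (-1) 1 k u = -1 / (5 * v) := by
      rw [hv]; unfold mb; push_cast; congr 1 <;> ring
    have h1 : Eq5 z (-1 / (5 * v)) := ⟨-(b - a * k), a, -e, c, by rw [e5]; linarith, by rw [← e2]; exact e1⟩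
    have hvn : (v - round v.re : ℂ).im = (u : ℂ).im / 5 := by rw [← hvi]; simp
    refine ⟨v - round v.re, by rw [hvn]; linarith, hre _, Or.inr ?_⟩
    have hv0 : 0 < (v - round v.re : ℂ).im := by rw [hvn]; linarith
    refine h1.trans (imW hv0) ?_
    have := Eq5.W_add_int hv0 (round v.re)
    simpa using this

/-- big values -/
theorem tt_big : ∃ M : ℝ, ∀ z w : ℂ, 0 < z.im → 0 < w.im → M < ‖tt z‖ → tt z = tt w → Eq5 z w := by
  obtain ⟨B, hB, h⟩ := tt_small_inv
  obtain ⟨δ, hδ, hi⟩ := h_inj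
  refine ⟨max (125 * B) (B / δ), ?_⟩
  have key : ∀ z : ℂ, 0 < z.im → max (125 * B) (B / δ) < ‖tt z‖ →
      ∃ z' : ℂ, 0 < z'.im ∧ Eq5 z z' ∧ ‖qq z'‖ < δ := by
    intro z hz hM
    obtain ⟨h1, h2⟩ := max_lt_iff.mp hM
    obtain ⟨z', hz', -, hor⟩ := dichot hz
    have hz0 : 0 < z'.im := by linarith
    obtain ⟨b1, b2, b3⟩ := h z' hz'
    rcases hor with he | he
    · refine ⟨z', hz0, he, b1.trans_lt ?_⟩
      rw [← he.tt hz0, norm_div, norm_one]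
      rw [mul_one_div, div_lt_iff₀ (by have : 0 < B / δ := by positivity
                                       linarith)]
      rw [div_lt_iff₀ hδ] at h2
      linarith
    · exfalso
      have := he.tt (imW hz0)
      rw [this, tt_W hz0, div_eq_mul_one_div, norm_mul] at h1
      norm_num at h1 b3
      linarith
  intro z w hz hw hM hzw
  obtain ⟨z', hz', ez, qz⟩ := key z hz hM
  obtain ⟨w', hw', ew, qw⟩ := key w hw (by rwa [← hzw])
  obtain ⟨n, hn⟩ := hi z' w' hz' hw' qz qw (by rw [← ez.tt hz', hzw, ew.tt hw'])
  refine ez.trans hw ?_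
  rw [hn]
  exact (Eq5.add_int w' n).trans hw (ew.symm hw')

theorem tt_proper {c : ℂ} (hc : c ≠ 0) : ∃ K ∈ 𝓝 c, ∃ Y : ℝ, ∀ z : ℂ, 0 < z.im → tt z ∈ K →
    ∃ w : ℂ, 1 / 10 ≤ w.im ∧ w.im ≤ Y ∧ |w.re| ≤ 1 / 2 ∧ (Eq5 z w ∨ Eq5 z (-1 / (5 * w))) := by
  obtain ⟨B, hB, h⟩ := tt_small_inv
  set n := ‖c‖ with hn
  have hn0 : 0 < n := norm_pos_iff.mpr hc
  -- on `K`, `n/2 < ‖t‖ < 2n`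
  set ε : ℝ := min (1 / (2 * n)) (n / 2 / 125) / B with hε
  have hε0 : 0 < ε := by positivity
  obtain ⟨Y, hY, hq⟩ := qq_small ε hε0
  refine ⟨{x | n / 2 < ‖x‖ ∧ ‖x‖ < 2 * n}, ?_, Y, ?_⟩
  · refine (IsOpen.inter (isOpen_lt continuous_const continuous_norm)
      (isOpen_lt continuous_norm continuous_const)).mem_nhds ⟨?_, ?_⟩
    · change n / 2 < ‖c‖; linarith
    · change ‖c‖ < 2 * n; linarith
  · rintro z hz ⟨h1, h2⟩
    obtain ⟨w, hw, hre, hor⟩ := dichot hz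
    have hw0 : 0 < w.im := by linarith
    refine ⟨w, hw, ?_, hre, hor⟩
    by_contra hY'
    push Not at hY'
    have hqw := hq w hY'.le
    obtain ⟨-, b2, -⟩ := h w hw
    have hlt : ‖1 / tt w‖ < min (1 / (2 * n)) (n / 2 / 125) := by
      refine b2.trans_lt ?_
      rw [hε, lt_div_iff₀ hB] at hqw
      linarith
    obtain ⟨l1, l2⟩ := lt_min_iff.mp hlt
    rcases hor with he | he
    · rw [he.tt hw0] at h1 h2
      rw [norm_div, norm_one] at l1
      have := one_div_lt_one_div_of_lt (by linarith) h2
      linarith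
    · rw [he.tt (imW hw0), tt_W hw0, div_eq_mul_one_div (125:ℂ), norm_mul] at h1
      norm_num at h1 l2
      linarith

end QH

namespace QH

open Topology Filter UpperHalfPlane CongruenceSubgroup Matrix.SpecialLinearGroup

abbrev GG : Subgroup (Matrix.GeneralLinearGroup (Fin 2) ℝ) := (Gamma0 5).map (mapGL ℝ)

theorem GG_smul (g : GG) : ∃ a b c d : ℤ, a * d - b * (5 * c) = 1 ∧
    ∀ z : ℍ, ((g • z : ℍ) : ℂ) = mb a b (5 * c) d z := by
  obtain ⟨_, γ, hγ, rfl⟩ := g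
  have hdet : γ 0 0 * γ 1 1 - γ 0 1 * γ 1 0 = 1 := by
    have := γ.det_coe; rwa [Matrix.det_fin_two] at this
  have hγ' : γ ∈ Gamma0 5 := hγ
  rw [Gamma0_mem, ZMod.intCast_zmod_eq_zero_iff_dvd] at hγ'
  obtain ⟨c', hc'⟩ := hγ'
  push_cast at hc'
  refine ⟨γ 0 0, γ 0 1, c', γ 1 1, by rw [← hc']; exact hdet, fun z => ?_⟩
  rw [← hc']
  exact sl_coe γ z

theorem GG_of {a b c d : ℤ} (h : a * d - b * (5 * c) = 1) :
    ∃ g : GG, ∀ z : ℍ, ((g • z : ℍ) : ℂ) = mb a b (5 * c) d z := by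
  let γ : Matrix.SpecialLinearGroup (Fin 2) ℤ := ⟨!![a, b; 5 * c, d], by
    rw [Matrix.det_fin_two_of]; exact h⟩
  have hγ : γ ∈ Gamma0 5 := by
    rw [Gamma0_mem, ZMod.intCast_zmod_eq_zero_iff_dvd]
    exact ⟨c, by simp [γ]⟩
  refine ⟨⟨mapGL ℝ γ, γ, hγ, rfl⟩, fun z => ?_⟩
  have := sl_coe γ z
  exact this

theorem GG_rel (z w : ℍ) : (MulAction.orbitRel GG ℍ) z w ↔ Eq5 z w := by
  rw [MulAction.orbitRel_apply]
  constructor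
  · rintro ⟨g, hg⟩
    obtain ⟨a, b, c, d, h, h'⟩ := GG_smul g
    exact ⟨a, b, c, d, h, by rw [← h' w, ← hg]⟩
  · rintro ⟨a, b, c, d, h, h'⟩
    obtain ⟨g, hg⟩ := GG_of h
    exact ⟨g, UpperHalfPlane.ext (by rw [h', ← hg w])⟩

abbrev QQ := Quotient (MulAction.orbitRel GG ℍ)

noncomputable def tau : QQ → ℂ := Quotient.lift (fun z : ℍ => tt z) (fun z w h =>
  Eq5.tt w.im_pos ((GG_rel z w).mp h))

theorem tau_mk (z : ℍ) : tau (Quotient.mk _ z) = tt z := rfl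

theorem tt_H_cont : Continuous (fun z : ℍ => tt z) := by
  rw [continuous_iff_continuousAt]
  intro z
  exact ContinuousAt.comp (f := UpperHalfPlane.coe) (g := tt) (tt_diff z.im_pos).continuousAt
    UpperHalfPlane.continuous_coe.continuousAt

theorem tau_cont : Continuous tau := tt_H_cont.quotient_lift _

theorem tau_open : IsOpenMap tau := by
  have h : IsOpenMap (fun z : ℍ => tt z) := by
    intro s hs
    have : (fun z : ℍ => tt z) '' s = tt '' (UpperHalfPlane.coe '' s) := by rw [Set.image_image]
    rw [this]
    refine tt_open _ ?_ (isOpenEmbedding_coe.isOpenMap s hs)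
    rintro _ ⟨z, -, rfl⟩
    exact z.im_pos
  intro s hs
  have : tau '' s = (fun z : ℍ => tt z) '' (Quotient.mk (MulAction.orbitRel GG ℍ) ⁻¹' s) := by
    ext x
    constructor
    · rintro ⟨q, hq, rfl⟩
      obtain ⟨z, rfl⟩ := Quotient.exists_rep q
      exact ⟨z, hq, rfl⟩
    · rintro ⟨z, hz, rfl⟩
      exact ⟨_, hz, rfl⟩
  rw [this]
  exact h _ (hs.preimage continuous_quotient_mk')

theorem tau_ne (q : QQ) : tau q ≠ 0 := by
  obtain ⟨z, rfl⟩ := Quotient.exists_rep q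
  exact tt_ne z.im_pos

theorem box_compact (Y : ℝ) : IsCompact {z : ℍ | 1 / 10 ≤ z.im ∧ z.im ≤ Y ∧ |z.re| ≤ 1 / 2} := by
  rw [isOpenEmbedding_coe.isInducing.isCompact_iff]
  have : UpperHalfPlane.coe '' {z : ℍ | 1 / 10 ≤ z.im ∧ z.im ≤ Y ∧ |z.re| ≤ 1 / 2}
      = (Set.Icc (-(1/2) : ℝ) (1/2)) ×ℂ (Set.Icc (1/10 : ℝ) Y) := by
    ext x
    constructor
    · rintro ⟨z, ⟨h1, h2, h3⟩, rfl⟩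
      rw [Complex.mem_reProdIm]
      exact ⟨abs_le.mp h3, h1, h2⟩
    · rw [Complex.mem_reProdIm]
      rintro ⟨h1, h2, h3⟩
      exact ⟨⟨x, by linarith⟩, ⟨h2, h3, abs_le.mpr h1⟩, rfl⟩
  rw [this]
  exact isCompact_Icc.reProdIm isCompact_Icc

noncomputable def WH (z : ℍ) : ℍ := ⟨-1 / (5 * z), imW z.im_pos⟩

theorem WH_cont : Continuous WH := by
  rw [isOpenEmbedding_coe.isInducing.continuous_iff]
  change Continuous fun z : ℍ => (-1 / (5 * (z:ℂ)))
  refine continuous_const.div (continuous_const.mul UpperHalfPlane.continuous_coe) fun z => ?_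
  exact mul_ne_zero (by norm_num) z.ne_zero

theorem tau_prop (c : ℂ) (hc : c ≠ 0) : ∃ K ∈ 𝓝 c, ∃ C : Set QQ, IsCompact C ∧ tau ⁻¹' K ⊆ C := by
  obtain ⟨K, hK, Y, h⟩ := tt_proper hc
  set D := {z : ℍ | 1 / 10 ≤ z.im ∧ z.im ≤ Y ∧ |z.re| ≤ 1 / 2} with hD
  refine ⟨K, hK, (Quotient.mk _) '' D ∪ (Quotient.mk _) '' (WH '' D),
    ((box_compact Y).image continuous_quotient_mk').union
      (((box_compact Y).image WH_cont).image continuous_quotient_mk'), ?_⟩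
  intro q hq
  obtain ⟨z, rfl⟩ := Quotient.exists_rep q
  obtain ⟨w, h1, h2, h3, hor⟩ := h z z.im_pos hq
  have hw : 0 < w.im := by linarith
  rcases hor with he | he
  · left
    exact ⟨⟨w, hw⟩, ⟨h1, h2, h3⟩, (Quotient.sound ((GG_rel z ⟨w, hw⟩).mpr he)).symm⟩
  · right
    refine ⟨_, ⟨⟨w, hw⟩, ⟨h1, h2, h3⟩, rfl⟩, (Quotient.sound ((GG_rel z _).mpr he)).symm⟩

theorem tau_inj : Function.Injective tau := by
  obtain ⟨M, hM⟩ := tt_big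
  refine top_inj tau_cont tau_open tau_ne tau_prop
    (tt '' {z : ℂ | 0 < z.im ∧ deriv tt z = 0}) (tt_crit_countable.image _) ?_ M ?_
  · intro q hq
    obtain ⟨z, rfl⟩ := Quotient.exists_rep q
    have hd : deriv tt z ≠ 0 := fun h => hq ⟨z, ⟨z.im_pos, h⟩, rfl⟩
    obtain ⟨U, hU, hi⟩ := loc_inj (tt_analytic z z.im_pos) hd
    refine ⟨(Quotient.mk _) '' (UpperHalfPlane.coe ⁻¹' U),
      (MulAction.isOpenQuotientMap_quotientMk (Γ := GG) (T := ℍ)).isOpenMap.image_mem_nhds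
        (UpperHalfPlane.continuous_coe.continuousAt.preimage_mem_nhds hU), ?_⟩
    rintro _ ⟨u, hu, rfl⟩ _ ⟨v, hv, rfl⟩ h
    have := hi hu hv h
    rw [UpperHalfPlane.ext this]
  · intro q q' h h'
    obtain ⟨z, rfl⟩ := Quotient.exists_rep q
    obtain ⟨w, rfl⟩ := Quotient.exists_rep q'
    exact Quotient.sound ((GG_rel z w).mpr (hM z w z.im_pos w.im_pos h h'))

theorem tt_inj {z w : ℂ} (hz : 0 < z.im) (hw : 0 < w.im) (h : tt z = tt w) : Eq5 z w := by
  have h2 : tau (Quotient.mk _ ⟨z, hz⟩) = tau (Quotient.mk _ ⟨w, hw⟩) := h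
  exact (GG_rel ⟨z, hz⟩ ⟨w, hw⟩).mp (Quotient.exact (tau_inj h2))

theorem tt_surj {c : ℂ} (hc : c ≠ 0) : ∃ z : ℂ, 0 < z.im ∧ tt z = c := by
  haveI : Nonempty QQ := ⟨Quotient.mk _ UpperHalfPlane.I⟩
  obtain ⟨q, hq⟩ := top_surj tau_cont tau_open tau_ne tau_prop c hc
  obtain ⟨z, rfl⟩ := Quotient.exists_rep q
  exact ⟨z, z.im_pos, hq⟩

theorem tt_deriv_of_inj {z0 : ℂ} (hz : 0 < z0.im) (U : Set ℂ) (hU : U ∈ 𝓝 z0) (hi : Set.InjOn tt U) :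
    deriv tt z0 ≠ 0 := by
  intro hd0
  have hd : AnalyticOnNhd ℂ (deriv tt) {z : ℂ | 0 < z.im} := tt_analytic.deriv
  have hev : ∀ᶠ z in 𝓝[≠] z0, deriv tt z ≠ 0 := by
    rcases (hd z0 hz).eventually_eq_zero_or_eventually_ne_zero with h | h
    · exfalso
      have h0 := hd.eqOn_zero_of_preconnected_of_eventuallyEq_zero isPreconnected_H hz h
      exact tt_not_const ⟨tt z0, fun z hz' => isOpen_H.is_const_of_deriv_eq_zero isPreconnected_H
        (fun z hz => (tt_diff hz).differentiableWithinAt) h0 hz' hz⟩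
    · exact h
  rw [eventually_nhdsWithin_iff] at hev
  obtain ⟨V, hVsub, hVo, hzV⟩ := _root_.mem_nhds_iff.mp
    (Filter.inter_mem (Filter.inter_mem hU hev) (isOpen_H.mem_nhds hz))
  set g := Function.invFunOn tt V with hg
  have hiV : Set.InjOn tt V := hi.mono fun x hx => (hVsub hx).1.1
  have hgu : ∀ u ∈ V, g (tt u) = u := fun u hu => hiV.leftInvOn_invFunOn hu
  have hnh : ∀ u ∈ V, ∀ N ∈ 𝓝 u, tt '' (N ∩ V) ∈ 𝓝 (tt u) := by
    intro u hu N hN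
    obtain ⟨N', hN', hNo, huN⟩ := _root_.mem_nhds_iff.mp hN
    refine Filter.mem_of_superset ((tt_open (N' ∩ V) (fun x hx => (hVsub hx.2).2)
      (hNo.inter hVo)).mem_nhds ⟨u, ⟨huN, hu⟩, rfl⟩) (Set.image_mono (Set.inter_subset_inter_left _ hN'))
  have hcont : ∀ u ∈ V, ContinuousAt g (tt u) := by
    intro u hu
    rw [ContinuousAt, hgu u hu, Filter.tendsto_def]
    intro N hN
    refine Filter.mem_of_superset (hnh u hu N hN) ?_
    rintro _ ⟨x, ⟨hx, hxV⟩, rfl⟩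
    change g (tt x) ∈ N
    rwa [hgu x hxV]
  have himg : tt '' V ∈ 𝓝 (tt z0) := by
    simpa using hnh z0 hzV Set.univ Filter.univ_mem
  have hdg : ∀ᶠ y in 𝓝[≠] (tt z0), DifferentiableAt ℂ g y := by
    rw [eventually_nhdsWithin_iff]
    filter_upwards [himg]
    rintro _ ⟨u, hu, rfl⟩ hne
    have hu0 : u ≠ z0 := fun h => hne (by rw [h]; rfl)
    have h1 : deriv tt u ≠ 0 := (hVsub hu).1.2 hu0
    have h2 : HasDerivAt tt (deriv tt u) (g (tt u)) := by
      rw [hgu u hu]; exact (tt_diff (hVsub hu).2).hasDerivAt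
    refine (HasDerivAt.of_local_left_inverse (hcont u hu) h2 h1 ?_).differentiableAt
    have : tt '' V ∈ 𝓝 (tt u) := by simpa using hnh u hu Set.univ Filter.univ_mem
    filter_upwards [this]
    rintro _ ⟨x, hx, rfl⟩
    rw [hgu x hx]
  have hga : DifferentiableAt ℂ g (tt z0) :=
    (Complex.analyticAt_of_differentiable_on_punctured_nhds_of_continuousAt hdg
      (hcont z0 hzV)).differentiableAt
  have h1 : HasDerivAt (g ∘ tt) (deriv g (tt z0) * deriv tt z0) z0 :=
    hga.hasDerivAt.comp z0 (tt_diff hz).hasDerivAt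
  have h2 : HasDerivAt (g ∘ tt) 1 z0 := by
    refine (hasDerivAt_id z0).congr_of_eventuallyEq ?_
    filter_upwards [hVo.mem_nhds hzV] with x hx
    exact hgu x hx
  have := h1.unique h2
  rw [hd0] at this
  simp at this

theorem tt_deriv_ne {z0 : ℂ} (hz : 0 < z0.im) (hst : ∀ a b c d : ℤ, a * d - b * (5 * c) = 1 →
    mb a b (5 * c) d z0 = z0 → b = 0 ∧ c = 0 ∧ a = d) : deriv tt z0 ≠ 0 := by
  obtain ⟨U, hU, h⟩ := ProperlyDiscontinuousSMul.exists_nhds_image_smul_eq_self GG (⟨z0, hz⟩ : ℍ)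
  refine tt_deriv_of_inj hz (UpperHalfPlane.coe '' U)
    (isOpenEmbedding_coe.isOpenMap.image_mem_nhds hU) ?_
  rintro _ ⟨u, hu, rfl⟩ _ ⟨v, hv, rfl⟩ huv
  obtain ⟨a, b, c, d, hdet, he⟩ := tt_inj u.im_pos v.im_pos huv
  obtain ⟨g, hg⟩ := GG_of hdet
  have hguv : g • v = u := UpperHalfPlane.ext (by rw [hg v, he])
  have := h g ⟨u, ⟨v, hv, hguv⟩, hu⟩
  have h2 := congrArg UpperHalfPlane.coe this
  rw [hg] at h2
  obtain ⟨rfl, rfl, rfl⟩ := hst a b c d hdet h2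
  rw [he]
  have ha : a * a = 1 := by linarith
  have ha0 : (a : ℂ) ≠ 0 := by
    intro h0
    have : a = 0 := by exact_mod_cast h0
    rw [this] at ha; norm_num at ha
  unfold mb
  push_cast
  rw [zero_mul, zero_add, add_zero, mul_div_cancel_left₀ _ ha0]

end QH

namespace QH

section reps
variable {l : ℕ}

/-- the representatives `(l 0; 0 1)`, `(1 k; 0 l)` -/
def rp : Option (Fin l) → ℤ | none => l | some _ => 1
def rq : Option (Fin l) → ℤ | none => 0 | some k => (k : ℕ)
def rs : Option (Fin l) → ℤ | none => 1 | some _ => l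

/-- `(a b; c d) = (α β; γ δ) * rep i` with `(α β; γ δ)` of determinant one and `M ∣ γ` -/
def Fac (M : ℤ) (a b c d : ℤ) (i : Option (Fin l)) : Prop :=
  ∃ α β γ δ : ℤ, α * δ - β * γ = 1 ∧ M ∣ γ ∧ a = α * rp i ∧ b = α * rq i + β * rs i ∧
    c = γ * rp i ∧ d = γ * rq i + δ * rs i

theorem rp_rs (i : Option (Fin l)) : rp i * rs i = l := by
  cases i <;> simp [rp, rs]

theorem rep_fac (hl : l.Prime) {M : ℤ} (hM : IsCoprime M (l : ℤ)) {a b c d : ℤ}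
    (h : a * d - b * c = l) (hc : M ∣ c) : ∃ i : Option (Fin l), Fac M a b c d i := by
  have hp : Prime (l : ℤ) := Nat.prime_iff_prime_int.mp hl
  have hl0 : (l : ℤ) ≠ 0 := hp.ne_zero
  by_cases hac : (l : ℤ) ∣ a ∧ (l : ℤ) ∣ c
  · obtain ⟨⟨a', rfl⟩, ⟨c', rfl⟩⟩ := hac
    refine ⟨none, a', b, c', d, ?_, hM.dvd_of_dvd_mul_left hc, ?_, ?_, ?_, ?_⟩
    · apply mul_left_cancel₀ hl0; linear_combination h
    · simp [rp]; ring
    · simp [rq, rs]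
    · simp [rp]; ring
    · simp [rq, rs]
  · have key : ∃ k : ℤ, (l : ℤ) ∣ b - a * k ∧ (l : ℤ) ∣ d - c * k := by
      by_cases ha : (l : ℤ) ∣ a
      · have hc' : ¬ (l : ℤ) ∣ c := fun h => hac ⟨ha, h⟩
        obtain ⟨x, y, hxy⟩ := (hp.coprime_iff_not_dvd).mpr hc'
        have h2 : (l : ℤ) ∣ d - c * (d * y) := ⟨d * x, by linear_combination (-d) * hxy⟩
        refine ⟨d * y, ?_, h2⟩
        have : (l : ℤ) ∣ c * (b - a * (d * y)) := by
          have e : c * (b - a * (d * y)) = a * (d - c * (d * y)) - l := by linear_combination -h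
          rw [e]; exact dvd_sub (h2.mul_left _) dvd_rfl
        exact (hp.dvd_or_dvd this).resolve_left hc'
      · obtain ⟨x, y, hxy⟩ := (hp.coprime_iff_not_dvd).mpr ha
        have h2 : (l : ℤ) ∣ b - a * (b * y) := ⟨b * x, by linear_combination (-b) * hxy⟩
        refine ⟨b * y, h2, ?_⟩
        have : (l : ℤ) ∣ a * (d - c * (b * y)) := by
          have e : a * (d - c * (b * y)) = c * (b - a * (b * y)) + l := by linear_combination h
          rw [e]; exact dvd_add (h2.mul_left _) dvd_rfl
        exact (hp.dvd_or_dvd this).resolve_left ha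
    obtain ⟨k, h1, h2⟩ := key
    have hkm : (k % l).toNat < l := by
      have := Int.emod_lt_of_pos k (by exact_mod_cast hl.pos : (0:ℤ) < l)
      have := Int.emod_nonneg k hl0
      omega
    have hk' : (((k % l).toNat : ℕ) : ℤ) = k - l * (k / l) := by
      rw [Int.toNat_of_nonneg (Int.emod_nonneg k hl0), Int.emod_def]
    obtain ⟨x, hx⟩ := h1
    obtain ⟨y, hy⟩ := h2
    refine ⟨some ⟨_, hkm⟩, a, x + a * (k / l), c, y + c * (k / l), ?_, hc, ?_, ?_, ?_, ?_⟩
    · apply mul_left_cancel₀ hl0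
      linear_combination h - a * hy + c * hx
    · simp [rp]
    · simp only [rq, rs]; rw [hk']; linear_combination hx
    · simp [rp]
    · simp only [rq, rs]; rw [hk']; linear_combination hy

theorem rep_uniq (hl : l.Prime) {i j : Option (Fin l)} (h : Fac 1 (rp i) (rq i) 0 (rs i) j) :
    i = j := by
  obtain ⟨α, β, γ, δ, h1, -, h2, h3, h4, h5⟩ := h
  have hl1 : (1 : ℤ) < l := by exact_mod_cast hl.one_lt
  have hunit : ∀ x : ℤ, (1 : ℤ) ≠ x * l := fun x hx => by
    have : (l : ℤ) ∣ 1 := ⟨x, by linarith⟩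
    have := Int.le_of_dvd one_pos this
    omega
  cases i with
  | none =>
    cases j with
    | none => rfl
    | some k =>
      simp [rp, rq, rs] at h2 h3 h4 h5
      rw [← h4] at h5
      exact (hunit δ (by linarith)).elim
  | some k =>
    cases j with
    | none =>
      simp [rp, rq, rs] at h2 h3 h4 h5
      exact (hunit α h2).elim
    | some k' =>
      simp [rp, rq, rs] at h2 h3 h4 h5
      subst h2
      congr 1
      apply Fin.ext
      have hk := k.2
      have hk' := k'.2
      have h6 : ((k : ℕ) : ℤ) = (k' : ℕ) + β * l := by linarith
      have hb : β = 0 := by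
        by_contra hb
        rcases lt_or_gt_of_ne hb with h | h
        · have : β * l ≤ -1 * l := by
            apply mul_le_mul_of_nonneg_right <;> omega
          omega
        · have : 1 * (l:ℤ) ≤ β * l := by
            apply mul_le_mul_of_nonneg_right <;> omega
          omega
      rw [hb] at h6
      omega

/-- right translation permutes the representatives -/
theorem rep_perm (hl : l.Prime) {M : ℤ} (hM : IsCoprime M (l : ℤ)) {a b c d : ℤ}
    (h : a * d - b * c = 1) (hc : M ∣ c) : ∃ π : Equiv.Perm (Option (Fin l)), ∀ i,
    Fac M (rp i * a + rq i * c) (rp i * b + rq i * d) (rs i * c) (rs i * d) (π i) := by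
  have h1 : ∀ i : Option (Fin l), ∃ j : Option (Fin l),
      Fac M (rp i * a + rq i * c) (rp i * b + rq i * d) (rs i * c) (rs i * d) j := fun i =>
    rep_fac hl hM (by rw [← rp_rs i]; linear_combination (rp i * rs i) * h) (hc.mul_left _)
  choose π hπ using h1
  have hinj : Function.Injective π := by
    intro i j hij
    obtain ⟨α, β, γ, δ, g1, g2, g3, g4, g5, g6⟩ := hπ i
    obtain ⟨α', β', γ', δ', f1, f2, f3, f4, f5, f6⟩ := hπ j
    rw [← hij] at f3 f4 f5 f6
    set P := rp (π i)
    set Q := rq (π i)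
    set S := rs (π i)
    -- rep i * g = A * R, rep j * g = A' * R; rep i = A A'^{-1} rep j
    refine rep_uniq hl ⟨α * δ' - β * γ', -α * β' + β * α', γ * δ' - δ * γ', -γ * β' + δ * α', ?_,
      one_dvd _, ?_, ?_, ?_, ?_⟩
    · linear_combination g1 * (α' * δ' - β' * γ') + f1
    all_goals
      have eP : P = δ' * (rp j * a + rq j * c) - β' * (rs j * c) := by
        linear_combination -P * f1 - δ' * f3 + β' * f5
      have e0 : 0 = -γ' * (rp j * a + rq j * c) + α' * (rs j * c) := by
        linear_combination γ' * f3 - α' * f5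
      have eQ : Q = δ' * (rp j * b + rq j * d) - β' * (rs j * d) := by
        linear_combination -Q * f1 - δ' * f4 + β' * f6
      have eS : S = -γ' * (rp j * b + rq j * d) + α' * (rs j * d) := by
        linear_combination -S * f1 + γ' * f4 - α' * f6
    · linear_combination d * g3 - c * g4 + α * d * eP - c * α * eQ - c * β * eS + β * d * e0
        + (-rp i + (α * δ' - β * γ') * rp j) * h
    · linear_combination -b * g3 + a * g4 - b * α * eP + a * α * eQ + a * β * eS - b * β * e0
        + (-rq i + (α * δ' - β * γ') * rq j + (-α * β' + β * α') * rs j) * h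
    · linear_combination d * g5 - c * g6 + γ * d * eP - c * γ * eQ - c * δ * eS + δ * d * e0
        + ((γ * δ' - δ * γ') * rp j) * h
    · linear_combination -b * g5 + a * g6 - b * γ * eP + a * γ * eQ + a * δ * eS - b * δ * e0
        + (-rs i + (γ * δ' - δ * γ') * rq j + (-γ * β' + δ * α') * rs j) * h
  exact ⟨Equiv.ofBijective π (Finite.injective_iff_bijective.mp hinj), hπ⟩

end reps
end QH

namespace QH

section
variable {l : ℕ}

noncomputable def Rz (i : Option (Fin l)) (z : ℂ) : ℂ := mb (rp i) (rq i) 0 (rs i) z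

theorem Rz_det (hl : l.Prime) (i : Option (Fin l)) : 0 < rp i * rs i - rq i * 0 := by
  rw [rp_rs]; simp [hl.pos]

theorem Rz_im (hl : l.Prime) (i : Option (Fin l)) {z : ℂ} (hz : 0 < z.im) : 0 < (Rz i z).im :=
  im_mb (Rz_det hl i) hz

theorem Rz_none (z : ℂ) : Rz (none : Option (Fin l)) z = l * z := by simp [Rz, mb, rp, rq, rs]

theorem Rz_some (k : Fin l) (z : ℂ) : Rz (some k) z = (z + (k : ℕ)) / l := by
  simp [Rz, mb, rp, rq, rs]

theorem Rz_im_ge (hl : l.Prime) (i : Option (Fin l)) (z : ℂ) (hz : 0 < z.im) : z.im / l ≤ (Rz i z).im := by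
  have hl1 : (1:ℝ) ≤ l := by exact_mod_cast hl.one_le
  cases i with
  | none =>
    rw [Rz_none]
    have : ((l : ℂ) * z).im = l * z.im := by simp
    rw [this, div_le_iff₀ (by linarith)]
    have h1 : 1 * z.im ≤ l * z.im := mul_le_mul_of_nonneg_right hl1 hz.le
    have h2 : (l * z.im) * 1 ≤ (l * z.im) * l := mul_le_mul_of_nonneg_left hl1 (by positivity)
    linarith
  | some k =>
    rw [Rz_some]
    have : ((z + (k : ℕ)) / (l : ℂ)).im = z.im / l := by
      rw [show (l : ℂ) = ((l : ℝ) : ℂ) by simp, Complex.div_ofReal_im]; simp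
    rw [this]

theorem mb_fac (hl : l.Prime) {M a b c d : ℤ} {i : Option (Fin l)} (h : Fac M a b c d i) {z : ℂ}
    (hz : 0 < z.im) : ∃ α β γ δ : ℤ, α * δ - β * γ = 1 ∧ M ∣ γ ∧ mb a b c d z = mb α β γ δ (Rz i z) ∧
      (c * z + d : ℂ) = rs i * (γ * Rz i z + δ) := by
  obtain ⟨α, β, γ, δ, h1, h2, rfl, rfl, rfl, rfl⟩ := h
  refine ⟨α, β, γ, δ, h1, h2, ?_, ?_⟩
  · rw [Rz, mb_comp (by linarith) (Rz_det hl i) hz]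
    congr 1 <;> ring
  · have hs : ((rs i : ℤ) : ℂ) ≠ 0 := by
      cases i
      · simp [rs]
      · simp [rs, hl.ne_zero]
    unfold Rz mb
    push_cast
    rw [zero_mul, zero_add, mul_add, mul_left_comm, mul_div_cancel₀ _ hs]
    ring

theorem tt_fac (hl : l.Prime) {a b c d : ℤ} {i : Option (Fin l)} (h : Fac 5 a b c d i) {z : ℂ}
    (hz : 0 < z.im) : tt (mb a b c d z) = tt (Rz i z) := by
  obtain ⟨α, β, γ, δ, h1, ⟨γ', rfl⟩, h3, -⟩ := mb_fac hl h hz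
  rw [h3]
  exact tt_inv5 α β γ' δ h1 _ (Rz_im hl i hz)

noncomputable def dlt (i : Option (Fin l)) (z : ℂ) : ℂ := (l / rs i) ^ 12 * Dl (Rz i z) / Dl z

theorem dlt_fac (hl : l.Prime) {M a b c d : ℤ} {i : Option (Fin l)} (h : Fac M a b c d i) {z : ℂ}
    (hz : 0 < z.im) : dlt i z = (l / (c * z + d)) ^ 12 * Dl (mb a b c d z) / Dl z := by
  obtain ⟨α, β, γ, δ, h1, -, h3, h4⟩ := mb_fac hl h hz
  have hn := den_ne (a := α) (b := β) (c := γ) (d := δ) (by linarith) (Rz_im hl i hz)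
  have hs : ((rs i : ℤ) : ℂ) ≠ 0 := by
    cases i
    · simp [rs]
    · simp [rs, hl.ne_zero]
  rw [dlt, h3, h4, Dl_mb h1 (Rz_im hl i hz)]
  rw [div_pow, div_pow, mul_pow]
  have hn12 := pow_ne_zero 12 hn
  have hs12 := pow_ne_zero 12 hs
  congr 1
  field_simp

theorem tt_perm (hl : l.Prime) (hl5 : 5 < l) (g : ℂ → ℂ → ℂ) : 
    Inv5 (fun z => ∏ i : Option (Fin l), g (tt z) (tt (Rz i z))) := by
  intro a b c d h z hz
  have hco : IsCoprime (5 : ℤ) (l : ℤ) := by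
    rw [show (5:ℤ) = ((5:ℕ):ℤ) by norm_num, Nat.isCoprime_iff_coprime, Nat.coprime_primes Nat.prime_five hl]
    omega
  obtain ⟨π, hπ⟩ := rep_perm (l := l) hl hco h ⟨c, rfl⟩
  simp only
  rw [tt_inv5 a b c d h z hz, ← Equiv.prod_comp π (fun i => g (tt z) (tt (Rz i z)))]
  refine Finset.prod_congr rfl fun i _ => ?_
  rw [← tt_fac hl (hπ i) hz, Rz, mb_comp (Rz_det hl i) (by linarith) hz]
  congr 2
  · ring_nf
  

theorem dlt_aux (A B N X D : ℂ) : A / B * X / (N * D) = A / (B * N) * X / D := by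
  rw [div_mul_eq_mul_div, div_div, div_mul_eq_mul_div, div_div, mul_assoc]

theorem dlt_perm (hl : l.Prime) {a b c d : ℤ} (h : a * d - b * c = 1) (x : ℂ) {z : ℂ} (hz : 0 < z.im) :
    ∏ i : Option (Fin l), (x - dlt i (mb a b c d z)) = ∏ i : Option (Fin l), (x - dlt i z) := by
  obtain ⟨π, hπ⟩ := rep_perm (l := l) (M := 1) hl isCoprime_one_left h (one_dvd _)
  rw [← Equiv.prod_comp π (fun i => x - dlt i z)]
  refine Finset.prod_congr rfl fun i _ => ?_
  rw [dlt_fac hl (hπ i) hz, dlt, Rz, mb_comp (Rz_det hl i) (by linarith) hz, Dl_mb h hz]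
  have hn := den_ne (a := a) (b := b) (c := c) (d := d) (by linarith) hz
  have hs : ((rs i : ℤ) : ℂ) ≠ 0 := by
    cases i
    · simp [rs]
    · simp [rs, hl.ne_zero]
  have e : ((rs i * c : ℤ) : ℂ) * z + ((rs i * d : ℤ) : ℂ) = rs i * (c * z + d) := by push_cast; ring
  have e2 : mb (rp i * a + rq i * c) (rp i * b + rq i * d) (0 * a + rs i * c) (0 * b + rs i * d) z =
    mb (rp i * a + rq i * c) (rp i * b + rq i * d) (rs i * c) (rs i * d) z := by
    rw [zero_mul, zero_mul, zero_add, zero_add]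
  rw [e, e2, div_pow, div_pow, mul_pow, dlt_aux]

end
end QH

namespace QH

theorem frob_int {l : ℕ} [Fact l.Prime] {k : Type*} [Field k] [CharP k l] (hl : l ≠ 0) (F : PowerSeries ℤ) :
    (PowerSeries.map (Int.castRingHom k) F) ^ l =
      PowerSeries.expand l hl (PowerSeries.map (Int.castRingHom k) F) := by
  haveI : ExpChar k l := ExpChar.prime Fact.out
  have h := MvPowerSeries.map_frobenius_expand (R := k) (σ := Unit) l hl
    (f := PowerSeries.map (Int.castRingHom k) F)
  rw [← h]
  have e1 : ∀ G : PowerSeries k, MvPowerSeries.expand l hl G = PowerSeries.expand l hl G := fun G => rfl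
  have e2 : ∀ G : PowerSeries k, MvPowerSeries.map (frobenius k l) G = PowerSeries.map (frobenius k l) G :=
    fun G => rfl
  rw [e1, e2, PowerSeries.map_expand]
  congr 1
  ext n
  rw [PowerSeries.coeff_map, PowerSeries.coeff_map]
  simp [frobenius_def]

theorem expand_inj {k : Type*} [CommRing k] {l : ℕ} (hl : l ≠ 0) {F G : PowerSeries k}
    (h : PowerSeries.expand l hl F = PowerSeries.expand l hl G) : F = G := by
  ext n
  have := congrArg (PowerSeries.coeff (l * n)) h
  rwa [PowerSeries.coeff_expand_mul, PowerSeries.coeff_expand_mul] at this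

theorem hom_map {R S : Type*} [CommRing R] [CommRing S] (ρ : R →+* S) (J : PowerSeries R) (N : ℕ) (p : R[X]) :
    PowerSeries.map ρ (hom J N p) = hom (PowerSeries.map ρ J) N (p.map ρ) := by
  unfold hom
  rw [map_sum]
  refine Finset.sum_congr rfl fun i _ => ?_
  rw [map_mul, map_mul, map_pow, map_pow, PowerSeries.map_C, PowerSeries.map_X, Polynomial.coeff_map]

theorem map_int {R S : Type*} [CommRing R] [CommRing S] (ρ : R →+* S) (F : PowerSeries ℤ) :
    PowerSeries.map ρ (PowerSeries.map (Int.castRingHom R) F) = PowerSeries.map (Int.castRingHom S) F := by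
  ext n; simp [PowerSeries.coeff_map]

theorem hom_inj {k : Type*} [Field k] (J : PowerSeries k) (hJ : PowerSeries.constantCoeff J = 1) (N : ℕ)
    (p q : k[X]) (hp : p.natDegree ≤ N) (hq : q.natDegree ≤ N) (h : hom J N p = hom J N q) : p = q := by
  rw [← sub_eq_zero]
  refine hom_zero J hJ N _ ((Polynomial.natDegree_sub_le _ _).trans (max_le hp hq)) ?_
  rw [hom_sub, h, sub_self]; exact dvd_zero _

/-- level five ring -/
def A5 : Subring (ℂ → ℂ) where
  carrier := {f | Inv5 f ∧ BddI fun z => f (-1 / (5 * z))}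
  mul_mem' := by
    rintro f g ⟨h1, B, Y, h2⟩ ⟨h3, B', Y', h4⟩
    refine ⟨fun a b c d h z hz => ?_, B * B', max Y Y', fun z hz => ?_⟩
    · simp only [Pi.mul_apply]; rw [h1 a b c d h z hz, h3 a b c d h z hz]
    · simp only [Pi.mul_apply]
      rw [norm_mul]
      have := h2 z (lt_of_le_of_lt (le_max_left _ _) hz)
      have := h4 z (lt_of_le_of_lt (le_max_right _ _) hz)
      gcongr
      exact (norm_nonneg _).trans (h2 z (lt_of_le_of_lt (le_max_left _ _) hz))
  one_mem' := ⟨fun a b c d h z hz => rfl, 1, 0, fun z hz => by simp⟩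
  add_mem' := by
    rintro f g ⟨h1, B, Y, h2⟩ ⟨h3, B', Y', h4⟩
    refine ⟨fun a b c d h z hz => ?_, B + B', max Y Y', fun z hz => ?_⟩
    · simp only [Pi.add_apply]; rw [h1 a b c d h z hz, h3 a b c d h z hz]
    · simp only [Pi.add_apply]
      exact (norm_add_le _ _).trans (add_le_add (h2 z (lt_of_le_of_lt (le_max_left _ _) hz))
        (h4 z (lt_of_le_of_lt (le_max_right _ _) hz)))
  zero_mem' := ⟨fun a b c d h z hz => rfl, 0, 0, fun z hz => by simp⟩
  neg_mem' := by
    rintro f ⟨h1, B, Y, h2⟩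
    refine ⟨fun a b c d h z hz => ?_, B, Y, fun z hz => ?_⟩
    · simp only [Pi.neg_apply]; rw [h1 a b c d h z hz]
    · simp only [Pi.neg_apply, norm_neg]; exact h2 z hz

theorem A5_const (c : ℂ) : (fun _ => c) ∈ A5 := ⟨fun _ _ _ _ _ _ _ => rfl, ‖c‖, 0, fun _ _ => le_rfl⟩

theorem inv_tt_bdd : ∃ B Y : ℝ, 0 < Y ∧ 0 ≤ B ∧ ∀ z : ℂ, Y ≤ z.im → ‖1 / tt z‖ ≤ B := by
  obtain ⟨B, hB, h⟩ := tt_small_inv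
  exact ⟨B, 1 / 10, by norm_num, hB.le, fun z hz => (h z hz).2.2⟩

theorem tt_A5 : tt ∈ A5 := by
  refine ⟨tt_inv5, ?_⟩
  obtain ⟨B, Y, hY, hB, h⟩ := inv_tt_bdd
  refine ⟨125 * B, Y, fun z hz => ?_⟩
  simp only
  rw [tt_W (by linarith), div_eq_mul_one_div, norm_mul]
  have := h z hz.le
  norm_num at this ⊢
  linarith

theorem A5_hconst : ∀ f ∈ A5, ∀ F ∈ Conv, (∀ z : ℂ, 0 < z.im → f z = ev F (qq z)) →
      ∃ c : ℂ, ∀ z : ℂ, 0 < z.im → f z = c := by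
  rintro f ⟨h1, h2⟩ F hF h
  have hf : f ∈ EvR := ⟨F, hF, h⟩
  exact const5 f (EvR_diff hf) h1 (EvR_bdd hf) h2

theorem P_mem_A5 {l : ℕ} (hl : l.Prime) (hl5 : 5 < l) :
    (fun z => ∏ i : Option (Fin l), (tt z * tt (Rz i z) - 125)) ∈ A5 := by
  refine ⟨tt_perm hl hl5 (fun x y => x * y - 125), ?_⟩
  obtain ⟨B, Y, hY, hB, h⟩ := inv_tt_bdd
  have hl1 : (1:ℝ) ≤ l := by exact_mod_cast hl.one_le
  have hco : IsCoprime (5 : ℤ) (l : ℤ) := by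
    rw [show (5:ℤ) = ((5:ℕ):ℤ) by norm_num, Nat.isCoprime_iff_coprime, Nat.coprime_primes Nat.prime_five hl]
    omega
  refine ⟨∏ i : Option (Fin l), (125 * B * (125 * B) + 125), l * Y, fun z hz => ?_⟩
  simp only
  rw [norm_prod]
  refine Finset.prod_le_prod (fun i _ => norm_nonneg _) fun i _ => ?_
  have hzY : Y ≤ z.im := by nlinarith
  have hz0 : 0 < z.im := by linarith
  obtain ⟨j, hj⟩ := rep_fac (l := l) hl hco (a := rs i) (b := 0) (c := 5 * -rq i) (d := rp i)
    (by rw [← rp_rs i]; ring) ⟨_, rfl⟩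
  have hdet : 0 < rs i * rp i - 0 * (5 * -rq i) := by
    have := Rz_det hl i; linarith
  have e1 : Rz i (-1 / (5 * z)) = -1 / (5 * mb (rs i) 0 (5 * -rq i) (rp i) z) := by
    have h1 : ∀ w : ℂ, -1 / (5 * w) = mb 0 (-1) 5 0 w := fun w => by simp [mb]
    rw [h1, h1, Rz, mb_comp (Rz_det hl i) (by norm_num) hz0, mb_comp (by norm_num) hdet hz0]
    unfold mb
    push_cast
    have h5 : (5:ℂ) ≠ 0 := by norm_num
    congr 1 <;> ring
  rw [e1, tt_W hz0, tt_W (im_mb hdet hz0), tt_fac hl hj hz0]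
  have b1 := h z hzY
  have b2 := h (Rz j z) (le_trans (by rw [le_div_iff₀ (by linarith)]; linarith) (Rz_im_ge hl j z hz0))
  refine (norm_sub_le _ _).trans ?_
  rw [norm_mul, div_eq_mul_one_div, norm_mul, div_eq_mul_one_div (125:ℂ) (tt (Rz j z)), norm_mul]
  have e5 : ‖(125:ℂ)‖ = 125 := by norm_num
  rw [e5]
  gcongr

end QH

namespace QH

theorem rescale_map' {R S : Type*} [CommRing R] [CommRing S] (ρ : R →+* S) (a : R) (F : PowerSeries R) :
    PowerSeries.map ρ (PowerSeries.rescale a F) = PowerSeries.rescale (ρ a) (PowerSeries.map ρ F) := by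
  ext n; simp [PowerSeries.coeff_rescale, PowerSeries.coeff_map]

theorem norm_qq_inv (l k : ℕ) : ‖qq (1 / l) ^ k‖ = 1 := by
  have h : ‖qq (1 / (l:ℂ))‖ = 1 := by
    have : (1 / (l:ℂ)).im = 0 := by
      rw [Complex.div_natCast_im]; simp
    rw [norm_qq, this]; simp
  rw [norm_pow, h, one_pow]

theorem zeta_pow {R : Type*} [CommRing R] (ι : R →+* ℂ) (hι : Function.Injective ι)
    {l : ℕ} (hl : l ≠ 0) (ζ : R) (hζ : ι ζ = qq (1 / l)) : ζ ^ l = 1 := by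
  apply hι
  rw [map_pow, hζ, map_one]; exact (qq_inv_isPrimitiveRoot l hl).pow_eq_one

theorem zeta_red {R : Type*} [CommRing R] (ι : R →+* ℂ) (hι : Function.Injective ι)
    {l : ℕ} [Fact l.Prime] (ζ : R) (hζ : ι ζ = qq (1 / l))
    {k : Type*} [Field k] [CharP k l] (ρ : R →+* k) : ρ ζ = 1 := by
  have h := zeta_pow ι hι (Fact.out : l.Prime).ne_zero ζ hζ
  have h2 : (ρ ζ - 1) ^ l = 0 := by
    rw [sub_pow_char, ← map_pow, h, map_one, one_pow, sub_self]
  exact sub_eq_zero.mp (pow_eq_zero_iff (Fact.out : l.Prime).ne_zero |>.mp h2)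

theorem qq_zeta (l k : ℕ) (z : ℂ) : qq (1 / l) ^ k * qq (z / l) = qq ((z + k) / l) := by
  rw [qq_pow, ← qq_add]; congr 1; ring

/-- factors for P -/
noncomputable def PF {R : Type*} [CommRing R] (l : ℕ) (hl : l ≠ 0) (ζ : R) (i : Option (Fin l)) : PowerSeries R :=
  match i with
  | none => PowerSeries.expand l hl (PowerSeries.map (Int.castRingHom R) UU *
      PowerSeries.expand l hl (PowerSeries.map (Int.castRingHom R) UU) -
      PowerSeries.C 125 * PowerSeries.X ^ (l + 1))
  | some k => PowerSeries.C (ζ ^ ((l - 1) * (k : ℕ))) * PowerSeries.expand l hl (PowerSeries.map (Int.castRingHom R) UU) *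
      PowerSeries.rescale (ζ ^ (k : ℕ)) (PowerSeries.map (Int.castRingHom R) UU) -
      PowerSeries.C 125 * PowerSeries.X ^ (l + 1)

theorem PF_map {R S : Type*} [CommRing R] [CommRing S] (ρ : R →+* S) (l : ℕ) (hl : l ≠ 0) (ζ : R)
    (i : Option (Fin l)) : PowerSeries.map ρ (PF l hl ζ i) = PF l hl (ρ ζ) i := by
  rcases i with _ | k
  · simp only [PF, map_sub, map_mul, PowerSeries.map_expand, map_int, PowerSeries.map_C, map_pow,
      PowerSeries.map_X, map_ofNat]
  · simp only [PF, map_sub, map_mul, PowerSeries.map_expand, map_int, PowerSeries.map_C, map_pow,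
      PowerSeries.map_X, rescale_map', map_ofNat]

theorem PF_conv (l : ℕ) (hl : l ≠ 0) (i : Option (Fin l)) : PF l hl (qq (1 / l)) i ∈ Conv := by
  rcases i with _ | k
  · exact conv_expand (sub_mem (mul_mem UU_conv (conv_expand UU_conv _ _)) (mul_mem (conv_C _) (pow_mem conv_X _))) _ _
  · exact sub_mem (mul_mem (mul_mem (conv_C _) (conv_expand UU_conv _ _)) (conv_rescale UU_conv (norm_qq_inv _ _)))
      (mul_mem (conv_C _) (pow_mem conv_X _))

theorem PF_ev {l : ℕ} (hl : l.Prime) (i : Option (Fin l)) {z : ℂ} (hz : 0 < z.im) :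
    ev (PF l hl.ne_zero (qq (1 / l)) i) (qq (z / l)) =
      (match i with | none => qq z ^ (l + 1) | some _ => qq (z / l) ^ (l + 1)) *
        (tt z * tt (Rz i z) - 125) := by
  have hlC : (l : ℂ) ≠ 0 := by exact_mod_cast hl.ne_zero
  have hlpos : (0 : ℝ) < l := by exact_mod_cast hl.pos
  have him : ∀ z : ℂ, 0 < z.im → 0 < (z / l).im := by
    intro z hz
    rw [Complex.div_natCast_im]; positivity
  have hx := norm_qq_lt (him z hz)
  have hxl : qq (z / l) ^ l = qq z := by rw [qq_pow]; congr 1; field_simp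
  have hq := norm_qq_lt hz
  rcases i with _ | k
  · simp only [PF]
    have c1 := conv_expand UU_conv l hl.ne_zero
    have c2 : (PowerSeries.C (125:ℂ) * PowerSeries.X ^ (l + 1)) ∈ Conv := mul_mem (conv_C _) (pow_mem conv_X _)
    rw [ev_expand (sub_mem (mul_mem UU_conv c1) c2) l _ hx, hxl, ev_sub (mul_mem UU_conv c1) c2 hq,
      ev_mul UU_conv c1 hq, ev_mul (conv_C _) (pow_mem conv_X _) hq, ev_C, ev_pow conv_X hq, ev_X,
      ev_expand UU_conv l _ hq, ← ev_UU hz, qq_pow, ← ev_UU (by simpa [Rz_none] using Rz_im hl none hz), Rz_none, ← qq_pow]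
    ring
  · simp only [PF]
    have c0 := conv_expand UU_conv l hl.ne_zero
    have c1 := mul_mem (conv_C (qq (1 / l) ^ ((l - 1) * (k:ℕ)))) c0
    have c2 : (PowerSeries.C (125:ℂ) * PowerSeries.X ^ (l + 1)) ∈ Conv := mul_mem (conv_C _) (pow_mem conv_X _)
    have c3 := conv_rescale UU_conv (norm_qq_inv l k)
    have hk := Rz_im hl (some k) hz
    rw [Rz_some] at hk
    rw [ev_sub (mul_mem c1 c3) c2 hx, ev_mul c1 c3 hx, ev_mul (conv_C _) c0 hx,
      ev_mul (conv_C _) (pow_mem conv_X _) hx, ev_C, ev_C, ev_pow conv_X hx, ev_X,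
      ev_expand UU_conv l _ hx, hxl, ← ev_UU hz, ev_rescale, qq_zeta, ← ev_UU hk, Rz_some, ← qq_zeta, pow_succ, hxl]
    have h1 : qq (1 / (l:ℂ)) ^ ((l - 1) * (k:ℕ)) * qq (1 / l) ^ (k:ℕ) = 1 := by
      rw [← pow_add, ← Nat.succ_mul, Nat.succ_eq_add_one, Nat.sub_add_cancel hl.one_le, pow_mul,
        (qq_inv_isPrimitiveRoot l hl.ne_zero).pow_eq_one, one_pow]
    linear_combination (qq z * tt z * qq (z / l) * tt ((z + (k:ℕ)) / l)) * h1

theorem P_poly {R : Type*} [CommRing R] (ι : R →+* ℂ) (hι : Function.Injective ι)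
    {l : ℕ} [Fact l.Prime] (hl5 : 5 < l) (ζ : R) (hζ : ι ζ = qq (1 / l))
    {k : Type*} [Field k] [CharP k l] (ρ : R →+* k) :
    ∃ p : R[X], p.natDegree ≤ 2 * (l + 1) ∧
      (∀ z : ℂ, 0 < z.im → ∏ i : Option (Fin l), (tt z * tt (Rz i z) - 125) = (p.map ι).eval (tt z)) ∧
      p.map ρ = (X ^ (l + 1) - C 125) ^ 2 := by
  have hlp : l.Prime := Fact.out
  set f : ℂ → ℂ := fun z => ∏ i : Option (Fin l), (tt z * tt (Rz i z) - 125) with hf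
  have hfA : f ∈ A5 := P_mem_A5 hlp hl5
  set F : PowerSeries R := ∏ i, PF l hlp.ne_zero ζ i with hF
  have hFm : PowerSeries.map ι F = ∏ i, PF l hlp.ne_zero (qq (1 / l)) i := by
    rw [hF, map_prod]; exact Finset.prod_congr rfl fun i _ => by rw [PF_map, hζ]
  have hFc : PowerSeries.map ι F ∈ Conv := by
    rw [hFm]; exact prod_mem fun i _ => PF_conv _ _ _
  have hlC : (l : ℂ) ≠ 0 := by exact_mod_cast hlp.ne_zero
  obtain ⟨F', e1, c1, h1⟩ := descent ι hι l hlp.ne_zero f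
    (fun z hz => by
      have := hfA.1 1 1 0 1 (by norm_num) z hz
      simpa [mb] using this) (2 * (l + 1)) F hFc
    (fun z hz => by
      have hx : ‖qq (z / l)‖ < 1 := norm_qq_lt (by
        rw [Complex.div_natCast_im]; have : (0 : ℝ) < l := by exact_mod_cast hlp.pos
        positivity)
      have hxl : qq (z / l) ^ l = qq z := by rw [qq_pow]; congr 1; field_simp
      rw [hFm, ev_prod _ _ (fun i _ => PF_conv _ _ _) hx, Finset.prod_congr rfl (fun i _ => PF_ev hlp i hz),
        Finset.prod_mul_distrib]
      congr 1
      rw [Fintype.prod_option]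
      simp only [Finset.prod_const, Finset.card_univ, Fintype.card_fin]
      rw [← hxl]; ring)
  obtain ⟨p, hp1, hp2, hp3⟩ := pabs ι hι A5 A5_const tt tt_A5 (PowerSeries.map (Int.castRingHom R) UU)
    (by rw [← PowerSeries.coeff_zero_eq_constantCoeff_apply, PowerSeries.coeff_map,
          PowerSeries.coeff_zero_eq_constantCoeff_apply, UU_const, map_one])
    (by rw [map_int]; exact UU_conv) (fun z hz => by rw [map_int]; exact ev_UU hz) A5_hconst (2 * (l + 1)) F' f c1 hfA h1
  refine ⟨p, hp1, hp3, ?_⟩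
  have hz1 := zeta_red ι hι ζ hζ ρ
  set V : PowerSeries ℤ := UU ^ (l + 1) - PowerSeries.C 125 * PowerSeries.X ^ (l + 1) with hV
  set Ub : PowerSeries k := PowerSeries.map (Int.castRingHom k) UU with hUb
  have hVm : PowerSeries.map (Int.castRingHom k) V = Ub ^ (l + 1) - PowerSeries.C 125 * PowerSeries.X ^ (l + 1) := by
    rw [hV, map_sub, map_pow, map_mul, map_pow, PowerSeries.map_C, PowerSeries.map_X]; simp [hUb]
  have hUl : Ub ^ l = PowerSeries.expand l hlp.ne_zero Ub := frob_int _ _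
  have hFr : PowerSeries.map ρ F = PowerSeries.expand l hlp.ne_zero (PowerSeries.map (Int.castRingHom k) (V ^ 2)) := by
    rw [hF, map_prod, Finset.prod_congr rfl (fun i _ => PF_map ρ l _ ζ i), hz1, Fintype.prod_option]
    simp only [PF, one_pow, map_one, one_mul, PowerSeries.rescale_one, RingHom.id_apply, ← hUb, ← hUl,
      ← pow_succ, ← pow_succ', ← hVm, Finset.prod_const, Finset.card_univ, Fintype.card_fin]
    rw [map_pow (PowerSeries.map _), map_pow (PowerSeries.expand l _), ← frob_int]; ring
  rw [e1, PowerSeries.map_expand] at hFr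
  have h2 := expand_inj _ hFr
  rw [hp2, hom_map, map_int, ← hUb, map_pow, hVm] at h2
  have hd : ((X ^ (l + 1) - C 125 : k[X]) ^ 2).natDegree ≤ 2 * (l + 1) := by
    refine natDegree_pow_le.trans ?_
    gcongr
    exact (natDegree_X_pow_sub_C).le
  refine hom_inj Ub (by rw [hUb, const_map UU_const]) (2 * (l + 1)) _ _
    ((natDegree_map_le).trans hp1) hd ?_
  rw [h2]
  have hinj : Function.Injective (algebraMap (PowerSeries k) (FractionRing (PowerSeries k))) :=
    IsFractionRing.injective _ _
  have hX : algebraMap (PowerSeries k) (FractionRing (PowerSeries k)) PowerSeries.X ≠ 0 := by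
    rw [map_ne_zero_iff _ hinj]; exact PowerSeries.X_ne_zero
  apply hinj
  rw [hom_eq_eval _ hX _ _ _ hd, eval₂_pow, eval₂_sub, eval₂_X_pow, eval₂_C, RingHom.comp_apply,
    div_pow, pow_mul', ← mul_pow, mul_sub, mul_div_cancel₀ _ (pow_ne_zero _ hX), map_pow, map_sub, map_mul, map_pow, map_pow]
  ring

end QH

namespace QH

/-- level one ring -/
def A1 : Subring (ℂ → ℂ) where
  carrier := {f | ∀ a b c d : ℤ, a * d - b * c = 1 → ∀ z : ℂ, 0 < z.im → f (mb a b c d z) = f z}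
  mul_mem' := by
    intro f g h1 h3 a b c d h z hz
    simp only [Pi.mul_apply]; rw [h1 a b c d h z hz, h3 a b c d h z hz]
  one_mem' := fun a b c d h z hz => rfl
  add_mem' := by
    intro f g h1 h3 a b c d h z hz
    simp only [Pi.add_apply]; rw [h1 a b c d h z hz, h3 a b c d h z hz]
  zero_mem' := fun a b c d h z hz => rfl
  neg_mem' := by
    intro f h1 a b c d h z hz
    simp only [Pi.neg_apply]; rw [h1 a b c d h z hz]

theorem A1_const (c : ℂ) : (fun _ => c) ∈ A1 := fun _ _ _ _ _ _ _ => rfl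

theorem jj_A1 : jj ∈ A1 := fun _ _ _ _ h _ hz => jj_mb h hz

theorem A1_hconst : ∀ f ∈ A1, ∀ F ∈ Conv, (∀ z : ℂ, 0 < z.im → f z = ev F (qq z)) →
      ∃ c : ℂ, ∀ z : ℂ, 0 < z.im → f z = c := by
  intro f h1 F hF h
  have hf : f ∈ EvR := ⟨F, hF, h⟩
  refine const5 f (EvR_diff hf) (fun a b c d h z hz => h1 a b (5 * c) d (by linarith) z hz) (EvR_bdd hf) ?_
  obtain ⟨B, Y, hB⟩ := EvR_bdd hf
  refine ⟨B, max Y 0, fun z hz => ?_⟩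
  have hz0 : 0 < z.im := lt_of_le_of_lt (le_max_right _ _) hz
  have hzY : Y < z.im := lt_of_le_of_lt (le_max_left _ _) hz
  have : f (-1 / (5 * z)) = f (5 * z) := by
    have := h1 0 (-1) 1 0 (by norm_num) (5 * z) (im5 hz0)
    rw [← this]; simp [mb]
  simp only
  rw [this]
  exact hB _ (by simp; linarith)

/-- factors for Q -/
noncomputable def QF {R : Type*} [CommRing R] (l : ℕ) (hl : l ≠ 0) (e : ℕ) (u : R) (ζ : R)
    (i : Option (Fin l)) : PowerSeries R :=
  match i with
  | none => PowerSeries.expand l hl (PowerSeries.C u - PowerSeries.C ((l : R) ^ (12 - e)) * PowerSeries.X ^ (l - 1) *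
      PowerSeries.expand l hl (PowerSeries.map (Int.castRingHom R) phi) ^ 24 *
      PowerSeries.map (Int.castRingHom R) phinv ^ 24)
  | some k => PowerSeries.C ((l : R) ^ e * u) * PowerSeries.X ^ (l - 1) - PowerSeries.C (ζ ^ (k : ℕ)) *
      PowerSeries.rescale (ζ ^ (k : ℕ)) (PowerSeries.map (Int.castRingHom R) phi) ^ 24 *
      PowerSeries.expand l hl (PowerSeries.map (Int.castRingHom R) phinv) ^ 24

theorem QF_map {R S : Type*} [CommRing R] [CommRing S] (ρ : R →+* S) (l : ℕ) (hl : l ≠ 0) (e : ℕ) (u : R) (ζ : R)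
    (i : Option (Fin l)) : PowerSeries.map ρ (QF l hl e u ζ i) = QF l hl e (ρ u) (ρ ζ) i := by
  rcases i with _ | k
  · simp only [QF, map_sub, map_mul, PowerSeries.map_expand, map_int, PowerSeries.map_C, map_pow,
      PowerSeries.map_X, map_natCast]
  · simp only [QF, map_sub, map_mul, PowerSeries.map_expand, map_int, PowerSeries.map_C, map_pow,
      PowerSeries.map_X, rescale_map', map_natCast]

theorem QF_conv (l : ℕ) (hl : l ≠ 0) (e : ℕ) (u : ℂ) (i : Option (Fin l)) : QF l hl e u (qq (1 / l)) i ∈ Conv := by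
  rcases i with _ | k
  · exact conv_expand (sub_mem (conv_C _) (mul_mem (mul_mem (mul_mem (conv_C _) (pow_mem conv_X _))
      (pow_mem (conv_expand phiC_conv _ _) _)) (pow_mem phinvC_conv.1 _))) _ _
  · exact sub_mem (mul_mem (conv_C _) (pow_mem conv_X _)) (mul_mem (mul_mem (conv_C _) (pow_mem
      (conv_rescale phiC_conv (norm_qq_inv _ _)) _)) (pow_mem (conv_expand phinvC_conv.1 _ _) _))

/-- function factors for Q -/
noncomputable def Qf (l e : ℕ) (u : ℂ) (i : Option (Fin l)) (z : ℂ) : ℂ :=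
  match i with
  | none => u - l ^ (12 - e) * Dl (l * z) / Dl z
  | some k => l ^ e * u - Dl ((z + (k:ℕ)) / l) / Dl z

theorem QF_ev {l : ℕ} (hl : l.Prime) (e : ℕ) (u : ℂ) (i : Option (Fin l)) {z : ℂ} (hz : 0 < z.im) :
    ev (QF l hl.ne_zero e u (qq (1 / l)) i) (qq (z / l)) =
      (match i with | none => 1 | some _ => qq (z / l) ^ (l - 1)) * Qf l e u i z := by
  have hlC : (l : ℂ) ≠ 0 := by exact_mod_cast hl.ne_zero
  have hlpos : (0 : ℝ) < l := by exact_mod_cast hl.pos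
  have him : ∀ z : ℂ, 0 < z.im → 0 < (z / l).im := by
    intro z hz
    rw [Complex.div_natCast_im]; positivity
  have hx := norm_qq_lt (him z hz)
  have hxl : qq (z / l) ^ l = qq z := by rw [qq_pow]; congr 1; field_simp
  have hq := norm_qq_lt hz
  have hql : qq z ^ l = qq z ^ (l - 1) * qq z := by rw [← pow_succ, Nat.sub_add_cancel hl.one_le]
  have hP := ev_phiC_ne hq
  have hq0 := qq_ne z
  rcases i with _ | k
  · simp only [QF, Qf]
    have c1 := pow_mem (conv_expand phiC_conv l hl.ne_zero) 24
    have c2 := pow_mem phinvC_conv.1 24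
    have c3 := mul_mem (conv_C ((l : ℂ) ^ (12 - e))) (pow_mem conv_X (l - 1))
    have hlz : 0 < ((l:ℂ) * z).im := by simpa [Rz_none] using Rz_im hl none hz
    change ev (PowerSeries.expand l hl.ne_zero (PowerSeries.C u - PowerSeries.C ((l : ℂ) ^ (12 - e)) * PowerSeries.X ^ (l - 1) *
      PowerSeries.expand l hl.ne_zero phiC ^ 24 * phinvC ^ 24)) _ = _
    rw [ev_expand (sub_mem (conv_C _) (mul_mem (mul_mem c3 c1) c2)) l _ hx, hxl,
      ev_sub (conv_C _) (mul_mem (mul_mem c3 c1) c2) hq, ev_mul (mul_mem c3 c1) c2 hq, ev_mul c3 c1 hq,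
      ev_mul (conv_C _) (pow_mem conv_X _) hq, ev_C, ev_C, ev_pow conv_X hq, ev_X, ev_pow phinvC_conv.1 hq,
      phinvC_conv.2 _ hq, ev_pow (conv_expand phiC_conv l hl.ne_zero) hq, ev_expand phiC_conv l _ hq, qq_pow z l,
      Dl_eq hz, Dl_eq hlz, ← qq_pow z l, hql]
    rw [one_mul, inv_pow]
    congr 1
    rw [eq_div_iff (mul_ne_zero hq0 (pow_ne_zero _ hP))]
    field_simp
  · simp only [QF, Qf]
    have c0 := conv_rescale phiC_conv (norm_qq_inv l k)
    have c1 := mul_mem (conv_C (qq (1 / (l:ℂ)) ^ (k:ℕ))) (pow_mem c0 24)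
    have c2 := pow_mem (conv_expand phinvC_conv.1 l hl.ne_zero) 24
    have c3 := mul_mem (conv_C ((l : ℂ) ^ e * u)) (pow_mem conv_X (l - 1))
    have hk := Rz_im hl (some k) hz
    rw [Rz_some] at hk
    change ev (PowerSeries.C ((l : ℂ) ^ e * u) * PowerSeries.X ^ (l - 1) - PowerSeries.C (qq (1 / l) ^ (k : ℕ)) *
      PowerSeries.rescale (qq (1 / l) ^ (k : ℕ)) phiC ^ 24 * PowerSeries.expand l hl.ne_zero phinvC ^ 24) _ = _
    rw [ev_sub c3 (mul_mem c1 c2) hx, ev_mul (conv_C _) (pow_mem conv_X _) hx, ev_mul c1 c2 hx,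
      ev_mul (conv_C _) (pow_mem c0 24) hx, ev_C, ev_C, ev_pow conv_X hx, ev_X, ev_pow c0 hx, ev_rescale,
      ev_pow (conv_expand phinvC_conv.1 l hl.ne_zero) hx, ev_expand phinvC_conv.1 l _ hx, hxl, phinvC_conv.2 _ hq,
      Dl_eq hz, Dl_eq hk, qq_zeta, ← qq_zeta l k z]
    have hx0 := qq_ne (z / l)
    have hql' : qq z = qq (z / l) ^ (l - 1) * qq (z / l) := by rw [← pow_succ, Nat.sub_add_cancel hl.one_le, hxl]
    rw [inv_pow, mul_sub, mul_comm (qq (z / l) ^ (l - 1)) ((l:ℂ) ^ e * u)]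
    congr 1
    rw [← mul_div_assoc, eq_div_iff (mul_ne_zero hq0 (pow_ne_zero _ hP))]
    generalize ev phiC (qq z) = P at *
    rw [hql']
    field_simp

theorem Qf_prod {l : ℕ} (hl : l.Prime) {e : ℕ} (he : e ≤ 11) (u : ℂ) {z : ℂ} (hz : 0 < z.im) :
    (l : ℂ) ^ e * ∏ i, Qf l e u i z = ∏ i : Option (Fin l), (l ^ e * u - dlt i z) := by
  have hlC : (l : ℂ) ≠ 0 := by exact_mod_cast hl.ne_zero
  have h0 : (l:ℂ) ^ e * Qf l e u none z = l ^ e * u - dlt (none : Option (Fin l)) z := by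
    have : (l:ℂ) ^ 12 = l ^ e * l ^ (12 - e) := by rw [← pow_add]; congr 1; omega
    have h1 : dlt (none : Option (Fin l)) z = (l:ℂ) ^ 12 * Dl (l * z) / Dl z := by
      rw [dlt, Rz_none]
      have : ((rs (none : Option (Fin l)) : ℤ) : ℂ) = 1 := by simp [rs]
      rw [this, div_one]
    rw [h1, this, Qf, mul_sub, mul_assoc, mul_div_assoc, mul_div_assoc, mul_div_assoc]
  have h1 : ∀ k : Fin l, Qf l e u (some k) z = l ^ e * u - dlt (some k) z := fun k => by
    have : ((rs (some k : Option (Fin l)) : ℤ) : ℂ) = l := by simp [rs]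
    rw [Qf, dlt, Rz_some, this, div_self hlC, one_pow, one_mul]
  rw [Fintype.prod_option, Fintype.prod_option, ← mul_assoc, h0, Finset.prod_congr rfl fun k _ => h1 k]

theorem hom_C {k : Type*} [Field k] (J : PowerSeries k) (N : ℕ) (c : k) :
    hom J N (C c) = PowerSeries.C c * PowerSeries.X ^ N := by
  unfold hom
  rw [Finset.sum_eq_single 0]
  · simp
  · intro b _ hb; rw [coeff_C, if_neg hb]; simp
  · simp

theorem hom_C_mul {k : Type*} [Field k] (J : PowerSeries k) (N : ℕ) (c : k) (p : k[X]) :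
    hom J N (C c * p) = PowerSeries.C c * hom J N p := by
  unfold hom
  rw [Finset.mul_sum]
  refine Finset.sum_congr rfl fun i _ => ?_
  rw [coeff_C_mul, map_mul]; ring

theorem Q_poly {R : Type*} [CommRing R] (ι : R →+* ℂ) (hι : Function.Injective ι)
    {l : ℕ} [Fact l.Prime] (hl5 : 5 < l) (ζ : R) (hζ : ι ζ = qq (1 / l))
    {k : Type*} [Field k] [CharP k l] (ρ : R →+* k) {e : ℕ} (he : e ≤ 11) (u : R) (hu : ρ u ≠ 0) :
    ∃ p : R[X], (∀ z : ℂ, 0 < z.im → ∏ i, Qf l e (ι u) i z = (p.map ι).eval (jj z)) ∧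
      p.map ρ = C (ρ u) * (C (ρ ((l : R) ^ e * u) ^ l) - Gp l k) := by
  have hlp : l.Prime := Fact.out
  have hlC : (l : ℂ) ≠ 0 := by exact_mod_cast hlp.ne_zero
  set f : ℂ → ℂ := fun z => ∏ i, Qf l e (ι u) i z with hf
  have hfA : f ∈ A1 := by
    intro a b c d h z hz
    have h1 := Qf_prod hlp he (ι u) hz
    have h2 := Qf_prod hlp he (ι u) (im_mb (a := a) (b := b) (c := c) (d := d) (by omega) hz)
    rw [dlt_perm hlp h _ hz, ← h1] at h2
    exact mul_left_cancel₀ (pow_ne_zero _ hlC) h2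
  set F : PowerSeries R := ∏ i, QF l hlp.ne_zero e u ζ i with hF
  have hFm : PowerSeries.map ι F = ∏ i, QF l hlp.ne_zero e (ι u) (qq (1 / l)) i := by
    rw [hF, map_prod]; exact Finset.prod_congr rfl fun i _ => by rw [QF_map, hζ]
  have hFc : PowerSeries.map ι F ∈ Conv := by
    rw [hFm]; exact prod_mem fun i _ => QF_conv _ _ _ _ _
  obtain ⟨F', e1, c1, h1⟩ := descent ι hι l hlp.ne_zero f
    (fun z hz => by
      have := hfA 1 1 0 1 (by norm_num) z hz
      simpa [mb] using this) (l - 1) F hFc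
    (fun z hz => by
      have hx : ‖qq (z / l)‖ < 1 := norm_qq_lt (by
        rw [Complex.div_natCast_im]; have : (0 : ℝ) < l := by exact_mod_cast hlp.pos
        positivity)
      rw [hFm, ev_prod _ _ (fun i _ => QF_conv _ _ _ _ _) hx, Finset.prod_congr rfl (fun i _ => QF_ev hlp e (ι u) i hz),
        Finset.prod_mul_distrib]
      congr 1
      rw [Fintype.prod_option]
      simp only [Finset.prod_const, Finset.card_univ, Fintype.card_fin]
      rw [one_mul, ← pow_mul, mul_comm])
  obtain ⟨p, hp1, hp2, hp3⟩ := pabs ι hι A1 A1_const jj jj_A1 (PowerSeries.map (Int.castRingHom R) JJ)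
    (by rw [← PowerSeries.coeff_zero_eq_constantCoeff_apply, PowerSeries.coeff_map,
          PowerSeries.coeff_zero_eq_constantCoeff_apply, JJ_const, map_one])
    (by rw [map_int]; exact JJ_conv) (fun z hz => by rw [map_int]; exact ev_JJ hz) A1_hconst (l - 1) F' f c1 hfA h1
  refine ⟨p, hp3, ?_⟩
  have hz1 := zeta_red ι hι ζ hζ ρ
  set Pb : PowerSeries k := PowerSeries.map (Int.castRingHom k) phi with hPb
  set Pib : PowerSeries k := PowerSeries.map (Int.castRingHom k) phinv with hPib
  have hPP : Pb * Pib = 1 := by rw [hPb, hPib, ← map_mul, phi_mul_phinv, map_one]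
  have hPil : Pib ^ l = PowerSeries.expand l hlp.ne_zero Pib := frob_int _ _
  set c := ρ ((l : R) ^ e * u) with hc
  have hl0 : (l : k) = 0 := CharP.cast_eq_zero k l
  have hc2 : (l : k) ^ e * ρ u = c := by rw [hc, map_mul, map_pow, map_natCast]
  have hfac : Pb ^ 24 * (Pib ^ l) ^ 24 = Pib ^ (24 * (l - 1)) := by
    have : Pib ^ l = Pib * Pib ^ (l - 1) := by rw [← pow_succ', Nat.sub_add_cancel hlp.one_le]
    rw [this, mul_pow, ← mul_assoc, ← mul_pow, hPP, one_pow, one_mul, ← pow_mul, mul_comm]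
  haveI : CharP (PowerSeries k) l := charP_of_injective_ringHom (f := (PowerSeries.C : k →+* PowerSeries k)) PowerSeries.C_injective l
  have hFr : PowerSeries.map ρ F = PowerSeries.expand l hlp.ne_zero (PowerSeries.C (ρ u) *
      (PowerSeries.C (c ^ l) * PowerSeries.X ^ (l - 1) - Pib ^ (24 * (l - 1)))) := by
    rw [hF, map_prod, Finset.prod_congr rfl (fun i _ => QF_map ρ l _ e u ζ i), hz1, Fintype.prod_option]
    have h12 : (l : k) ^ (12 - e) = 0 := by rw [hl0]; exact zero_pow (by omega)
    simp only [QF, one_pow, map_one, one_mul, PowerSeries.rescale_one, RingHom.id_apply, ← hPb, ← hPib, ← hPil,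
      h12, map_zero, zero_mul, sub_zero, hc2, hfac, Finset.prod_const, Finset.card_univ, Fintype.card_fin]
    rw [map_mul, sub_pow_char, map_sub, map_mul, map_pow (PowerSeries.expand l _) Pib, ← hPil, map_pow (PowerSeries.expand l _),
      PowerSeries.expand_X, mul_pow, ← map_pow]
    have hC : ∀ a : k, PowerSeries.expand l hlp.ne_zero (PowerSeries.C a) = PowerSeries.C a := fun a => by
      first | exact PowerSeries.expand_C _ _ _ | simp
    rw [hC, hC]; ring
  rw [e1, PowerSeries.map_expand] at hFr
  have h2 := expand_inj _ hFr
  rw [hp2, hom_map, map_int] at h2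
  have key := H_eq_Gp hl5 (ram_field k) (Pib ^ 24) (by rw [map_pow, ← hPb, ← mul_pow, hPP, one_pow])
    (C (c ^ l) - C ((ρ u)⁻¹) * p.map ρ)
    (by
      refine (natDegree_sub_le _ _).trans (max_le (by simp) ?_)
      refine (natDegree_C_mul_le _ _).trans (natDegree_map_le.trans hp1))
    (by
      have : PowerSeries.map (Int.castRingHom k) (Eis 240 3) ^ 3 * Pib ^ 24 = PowerSeries.map (Int.castRingHom k) JJ := by
        rw [JJ, map_mul, map_pow, map_pow]
      rw [this, hom_sub, hom_C, hom_C_mul, h2, ← mul_assoc, ← map_mul, inv_mul_cancel₀ hu, map_one, one_mul, ← pow_mul]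
      ring)
  rw [← key, sub_sub_cancel, ← mul_assoc, ← C_mul, mul_inv_cancel₀ hu, C_1, one_mul]

end QH

namespace QH

/-- CM relation -/
def CM (l : ℕ) (z : ℂ) (a b c d : ℤ) : Prop :=
  5 * a * d - b * c = l ∧ (5 * a * z + b : ℂ) = z * (5 * c * z + 5 * d)

theorem quad_prop {A B C A' B' C' : ℤ} {z : ℂ} (hz : 0 < z.im) (h : (A * z ^ 2 + B * z + C : ℂ) = 0)
    (h' : (A' * z ^ 2 + B' * z + C' : ℂ) = 0) : A * B' = A' * B ∧ A * C' = A' * C ∧ B * C' = B' * C := by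
  have key : ∀ x y : ℤ, (x * z + y : ℂ) = 0 → x = 0 ∧ y = 0 := by
    intro x y hxy
    have h1 := congrArg Complex.im hxy
    simp at h1
    have hx : x = 0 := h1.resolve_right hz.ne'
    subst hx
    simpa using hxy
  have h1 := key (A' * B - A * B') (A' * C - A * C') (by push_cast; linear_combination (A':ℂ) * h - A * h')
  have hz0 : z ≠ 0 := by rintro rfl; simp at hz
  have h2 := key (C' * A - C * A') (C' * B - C * B') (by
    push_cast
    apply mul_left_cancel₀ hz0
    linear_combination (C' : ℂ) * h - C * h')
  refine ⟨?_, ?_, ?_⟩ <;> linarith [h1.1, h1.2, h2.2]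

theorem CM.quad {l : ℕ} {z : ℂ} {a b c d : ℤ} (h : CM l z a b c d) :
    (((5 * c : ℤ) : ℂ) * z ^ 2 + ((5 * d - 5 * a : ℤ) : ℂ) * z + ((-b : ℤ) : ℂ)) = 0 := by
  push_cast; linear_combination -h.2

theorem CM.c_ne {l : ℕ} (hl : l.Prime) (hl5 : 5 < l) {z : ℂ} (hz : 0 < z.im) {a b c d : ℤ} (h : CM l z a b c d) : c ≠ 0 := by
  rintro rfl
  have h1 := h.quad
  have h2 := congrArg Complex.im h1
  simp at h2
  have hd : (d:ℝ) = a := by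
    rcases h2 with h2 | h2
    · linarith
    · exact absurd h2 hz.ne'
  have hd' : d = a := by exact_mod_cast hd
  have h3 := h.1
  rw [hd'] at h3 h1
  simp at h1
  rw [h1] at h3
  have : (5:ℤ) ∣ l := ⟨a * a, by linarith⟩
  have h5 : 5 ∣ l := by exact_mod_cast this
  have h6 : 5 = l := (Nat.prime_dvd_prime_iff_eq Nat.prime_five hl).mp h5
  omega

theorem CM.disc {l : ℕ} (hl : l.Prime) (hl5 : 5 < l) {z : ℂ} (hz : 0 < z.im) {a b c d : ℤ} (h : CM l z a b c d) :
    5 * (a + d) ^ 2 < 4 * (l : ℤ) := by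
  have hc := h.c_ne hl hl5 hz
  have hq := h.quad
  have h1 := congrArg Complex.im hq
  have h2 := congrArg Complex.re hq
  simp [pow_two] at h1 h2
  have hcR : (c:ℝ) ≠ 0 := by exact_mod_cast hc
  have e1 : 10 * c * z.re + (5 * d - 5 * a) = 0 := by
    apply mul_left_cancel₀ hz.ne'
    linarith
  have h3 : (5 * a * d - b * c : ℝ) = l := by exact_mod_cast h.1
  have h4 : (4 * l - 5 * (a + d) ^ 2 : ℝ) = 20 * (c * z.im) ^ 2 := by
    rw [← h3]
    linear_combination 4 * c * h2 - (1/5) * (10 * c * z.re + 5 * d - 5 * a) * e1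
  have h5 : 0 < 20 * (c * z.im) ^ 2 := by positivity
  have : (5 * (a + d) ^ 2 : ℝ) < 4 * l := by linarith
  exact_mod_cast this

theorem CM.not_dvd {l : ℕ} (hl : l.Prime) (hl5 : 5 < l) {z : ℂ} (hz : 0 < z.im) {a b c d : ℤ} (h : CM l z a b c d)
    (hs : a + d ≠ 0) : ¬ (l : ℤ) ∣ a + d := by
  rintro ⟨x, hx⟩
  have h1 := h.disc hl hl5 hz
  have hx0 : x ≠ 0 := by rintro rfl; exact hs (by rw [hx]; ring)
  have hx1 : 1 ≤ x ^ 2 := by have := pow_pos (abs_pos.mpr hx0) 2; rw [sq_abs] at this; linarith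
  rw [hx] at h1
  have hl' : (5:ℤ) < l := by exact_mod_cast hl5
  rw [mul_pow] at h1
  nlinarith [mul_le_mul_of_nonneg_left hx1 (by positivity : (0:ℤ) ≤ (l:ℤ)^2)]

theorem CM.adj {l : ℕ} {z : ℂ} {a b c d : ℤ} (h : CM l z a b c d) : CM l z d (-b) (-c) a := by
  refine ⟨by linarith [h.1], ?_⟩
  push_cast; linear_combination -h.2

theorem CM.mu_ne {l : ℕ} (hl : l.Prime) (hl5 : 5 < l) {z : ℂ} (hz : 0 < z.im) {a b c d : ℤ} (h : CM l z a b c d) :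
    (5 * c * z + 5 * d : ℂ) ≠ 0 := by
  have hc := h.c_ne hl hl5 hz
  intro h0
  have := congrArg Complex.im h0
  simp at this
  exact this.elim hc hz.ne'

theorem CM.mu_eq {l : ℕ} {z : ℂ} {a b c d : ℤ} (h : CM l z a b c d) :
    (5 * c * z + 5 * d : ℂ) * (5 * (a + d) - (5 * c * z + 5 * d)) = 5 * l := by
  have h1 : (5 * a * d - b * c : ℂ) = l := by exact_mod_cast h.1
  rw [← h1]
  linear_combination (5 * c : ℂ) * h.2

theorem CM.dlt {l : ℕ} (hl : l.Prime) (hl5 : 5 < l) {z : ℂ} (hz : 0 < z.im) {a b c d : ℤ} (h : CM l z a b c d) :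
    ∃ i : Option (Fin l), dlt i (5 * z) = (l / (5 * c * z + 5 * d)) ^ 12 * tt z ^ 4 := by
  obtain ⟨i, hi⟩ := rep_fac (l := l) (M := 1) hl isCoprime_one_left (a := -c) (b := -5 * d) (c := a) (d := b)
    (by linarith [h.1]) (one_dvd _)
  refine ⟨i, ?_⟩
  have hmu := h.mu_ne hl hl5 hz
  have hz0 : z ≠ 0 := by rintro rfl; simp at hz
  have e1 : (a * (5 * z) + b : ℂ) = z * (5 * c * z + 5 * d) := by rw [← h.2]; ring
  have e2 : mb (-c) (-5 * d) a b (5 * z) = -1 / z := by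
    rw [mb, e1, div_eq_div_iff (mul_ne_zero hz0 hmu) hz0]; push_cast; ring
  rw [dlt_fac hl hi (im5 hz), e1, e2, Dl_S hz, tt_four hz, mul_comm z, ← div_div, div_pow, mul_div_assoc,
    mul_div_assoc, div_mul_eq_mul_div, mul_div_assoc, ← mul_div_assoc (z ^ 12), mul_div_assoc (z^12), mul_div_cancel_left₀ _ (pow_ne_zero _ hz0)]

theorem cop5 {l : ℕ} (hl : l.Prime) (hl5 : 5 < l) : IsCoprime (5 : ℤ) (l : ℤ) := by
  rw [show (5:ℤ) = ((5:ℕ):ℤ) by norm_num, Nat.isCoprime_iff_coprime, Nat.coprime_primes Nat.prime_five hl]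
  omega

theorem CM.mz {l : ℕ} (hl : l.Prime) (hl5 : 5 < l) {z : ℂ} (hz : 0 < z.im) {a b c d : ℤ} (h : CM l z a b c d) :
    mb (-c) (-d) (5 * a) b z = -1 / (5 * z) := by
  have hmu := h.mu_ne hl hl5 hz
  have hz0 : z ≠ 0 := by rintro rfl; simp at hz
  have e1 : (((5 * a : ℤ) : ℂ) * z + b : ℂ) = z * (5 * c * z + 5 * d) := by rw [← h.2]; push_cast; ring
  rw [mb, e1, div_eq_div_iff (mul_ne_zero hz0 hmu) (mul_ne_zero (by norm_num) hz0)]; push_cast; ring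

theorem CM.fac {l : ℕ} (hl : l.Prime) (hl5 : 5 < l) {z : ℂ} {a b c d : ℤ} (h : CM l z a b c d) :
    ∃ i : Option (Fin l), Fac 5 (-c) (-d) (5 * a) b i :=
  rep_fac hl (cop5 hl hl5) (by linarith [h.1]) ⟨_, rfl⟩

theorem CM.tt_eq {l : ℕ} (hl : l.Prime) (hl5 : 5 < l) {z : ℂ} (hz : 0 < z.im) {a b c d : ℤ} (h : CM l z a b c d)
    {i : Option (Fin l)} (hi : Fac 5 (-c) (-d) (5 * a) b i) : tt z * tt (Rz i z) = 125 := by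
  rw [← tt_fac hl hi hz, h.mz hl hl5 hz, tt_W hz, mul_div_cancel₀ _ (tt_ne hz)]

theorem root_CM {l : ℕ} (hl : l.Prime) {z : ℂ} (hz : 0 < z.im) {i : Option (Fin l)}
    (h : tt z * tt (Rz i z) = 125) : ∃ a b c d : ℤ, CM l z a b c d ∧ Fac 5 (-c) (-d) (5 * a) b i := by
  have hz0 : z ≠ 0 := by rintro rfl; simp at hz
  have hR := Rz_im hl i hz
  have h1 : tt (-1 / (5 * z)) = tt (Rz i z) := by
    rw [tt_W hz, ← h, mul_div_cancel_left₀ _ (tt_ne hz)]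
  obtain ⟨α, β, γ, δ, hd, he⟩ := tt_inj (imW hz) hR h1
  have hrs := rp_rs i
  refine ⟨γ * rp i, 5 * γ * rq i + δ * rs i, -(α * rp i), -(α * rq i + β * rs i), ⟨?_, ?_⟩, α, β, 5 * γ, δ, hd, ⟨_, rfl⟩,
    by ring, by ring, by ring, by ring⟩
  · rw [← hrs]; linear_combination (rp i * rs i) * hd
  · have hden := den_ne (a := α) (b := β) (c := 5 * γ) (d := δ) (by omega) hR
    have hden2 := den_ne (Rz_det hl i) hz
    have e2 := mb_comp (a := α) (b := β) (c := 5 * γ) (d := δ) (by omega) (Rz_det hl i) hz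
    rw [← Rz, ← he] at e2
    have hd3 := den_ne (a := α * rp i + β * 0) (b := α * rq i + β * rs i) (c := 5 * γ * rp i + δ * 0) (d := 5 * γ * rq i + δ * rs i)
      (by have : (0:ℤ) < l := by exact_mod_cast hl.pos
          rw [← hrs] at this
          linear_combination this - (rp i * rs i) * hd) hz
    rw [mb, div_eq_div_iff (mul_ne_zero (by norm_num) hz0) hd3] at e2
    push_cast at e2 ⊢
    linear_combination -e2

end QH

namespace QH

theorem no_sq {l : ℕ} (hl : l.Prime) {n m x y : ℤ} (hn : ¬ (l:ℤ) ∣ n) (hm : ¬ (l:ℤ) ∣ m)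
    (h : n * x ^ 2 = l * m * y ^ 2) : y = 0 := by
  haveI := Fact.mk hl
  by_contra hy
  have hm0 : m ≠ 0 := by rintro rfl; exact hm (dvd_zero _)
  have hn0 : n ≠ 0 := by rintro rfl; exact hn (dvd_zero _)
  have hl0 : (l:ℤ) ≠ 0 := by exact_mod_cast hl.ne_zero
  have hx : x ≠ 0 := by
    rintro rfl
    have : (l:ℤ) * m * y ^ 2 ≠ 0 := mul_ne_zero (mul_ne_zero hl0 hm0) (pow_ne_zero _ hy)
    apply this; rw [← h]; ring
  have h1 := congrArg (padicValInt l) h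
  rw [pow_two, pow_two, padicValInt.mul hn0 (mul_ne_zero hx hx), padicValInt.mul hx hx,
    padicValInt.mul (mul_ne_zero hl0 hm0) (mul_ne_zero hy hy), padicValInt.mul hl0 hm0, padicValInt.mul hy hy,
    padicValInt.eq_zero_of_not_dvd hn, padicValInt.eq_zero_of_not_dvd hm, padicValInt.self hl.one_lt] at h1
  omega

theorem CM.stab {l : ℕ} (hl : l.Prime) (hl5 : 5 < l) {z : ℂ} (hz : 0 < z.im) {a b c : ℤ} (h : CM l z a b c (-a))
    {a' b' c' d' : ℤ} (hd : a' * d' - b' * (5 * c') = 1) (hf : mb a' b' (5 * c') d' z = z) :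
    b' = 0 ∧ c' = 0 ∧ a' = d' := by
  have hc := h.c_ne hl hl5 hz
  have hden := den_ne (a := a') (b := b') (c := 5 * c') (d := d') (by omega) hz
  rw [mb, div_eq_iff hden] at hf
  obtain ⟨h1, h2, -⟩ := quad_prop (A' := 5 * c') (B' := d' - a') (C' := -b') hz h.quad (by
    push_cast at hf ⊢; linear_combination -hf)
  have e1 : c * (d' - a') = -10 * a * c' := by linarith
  have e2 : c * b' = c' * b := by linarith
  suffices hc0 : c' = 0 by
    subst hc0
    refine ⟨?_, rfl, ?_⟩
    · have : c * b' = 0 := by rw [e2]; ring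
      exact (mul_eq_zero.mp this).resolve_left hc
    · have : c * (d' - a') = 0 := by rw [e1]; ring
      have := (mul_eq_zero.mp this).resolve_left hc
      omega
  have key : (4 - (a' + d') ^ 2) * c ^ 2 = l * 20 * c' ^ 2 := by
    have : (4 - (a' + d') ^ 2) = -((d' - a') ^ 2 + 20 * b' * c') := by linear_combination -4 * hd
    have hl1 := h.1
    rw [this, ← hl1]
    have e3 : (c * (d' - a')) ^ 2 = (-10 * a * c') ^ 2 := by rw [e1]
    linear_combination -e3 - 20 * c * c' * e2
  have hlZ : (5:ℤ) < l := by exact_mod_cast hl5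
  have hp : Prime (l : ℤ) := Nat.prime_iff_prime_int.mp hl
  have small : ∀ x : ℤ, 0 < x → x ≤ 5 → ¬ (l:ℤ) ∣ x := fun x hx hx5 hd => by
    have := Int.le_of_dvd hx hd; omega
  have h20 : ¬ (l:ℤ) ∣ 20 := by
    rw [show (20:ℤ) = 4 * 5 by norm_num]
    intro hd
    rcases hp.dvd_or_dvd hd with hd | hd
    · exact small 4 (by norm_num) (by norm_num) hd
    · exact small 5 (by norm_num) (by norm_num) hd
  have hc2 : 0 < c ^ 2 := by positivity
  have hge : 0 ≤ 4 - (a' + d') ^ 2 := by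
    by_contra hlt
    push Not at hlt
    have : (4 - (a' + d') ^ 2) * c ^ 2 < 0 := mul_neg_of_neg_of_pos hlt hc2
    have h3 : 0 ≤ (l:ℤ) * 20 * c' ^ 2 := by positivity
    omega
  rcases hge.eq_or_lt with h0 | h0
  · rw [← h0, zero_mul] at key
    have hl20 : (l:ℤ) * 20 ≠ 0 := by omega
    exact pow_eq_zero_iff (two_ne_zero) |>.mp ((mul_eq_zero.mp key.symm).resolve_left hl20)
  · exact no_sq hl (small _ h0 (by nlinarith [sq_nonneg (a' + d')])) h20 key

theorem CM.uniq {l : ℕ} (hl : l.Prime) (hl5 : 5 < l) {z : ℂ} (hz : 0 < z.im) {a b c : ℤ} (h : CM l z a b c (-a))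
    {a' b' c' d' : ℤ} (h' : CM l z a' b' c' d') :
    ∃ ε : ℤ, ε * ε = 1 ∧ a' = ε * a ∧ b' = ε * b ∧ c' = ε * c ∧ d' = ε * -a := by
  have hc := h.c_ne hl hl5 hz
  have hp : Prime (l : ℤ) := Nat.prime_iff_prime_int.mp hl
  have hlZ : (5:ℤ) < l := by exact_mod_cast hl5
  obtain ⟨h1, h2, h3⟩ := quad_prop hz h.quad h'.quad
  have e1 : c * (d' - a') = -2 * a * c' := by linarith
  have e2 : c * b' = c' * b := by linarith
  have e3 : 2 * a * b' = -(d' - a') * b := by linarith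
  have hl1 := h.1
  have hl2 := h'.1
  have k1 : 5 * (c * (a' + d')) ^ 2 = 4 * l * (c ^ 2 - c' ^ 2) := by
    have e4 : (c * (d' - a')) ^ 2 = (-2 * a * c') ^ 2 := by rw [e1]
    linear_combination 5 * e4 + 4 * c * c' * e2 + 4 * c ^ 2 * hl2 - 4 * c' ^ 2 * hl1
  have k2 : 5 * (b * (a' + d')) ^ 2 = 4 * l * (b ^ 2 - b' ^ 2) := by
    have e4 : (2 * a * b') ^ 2 = (-(d' - a') * b) ^ 2 := by rw [e3]
    linear_combination -5 * e4 - 4 * b * b' * e2 + 4 * b ^ 2 * hl2 - 4 * b' ^ 2 * hl1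
  have h5 : ¬ (l:ℤ) ∣ 5 := fun hd => by have := Int.le_of_dvd (by norm_num) hd; omega
  have hs : a' + d' = 0 := by
    by_contra hs
    have hnd := h'.not_dvd hl hl5 hz hs
    have aux : ∀ x y : ℤ, 5 * (x * (a' + d')) ^ 2 = 4 * l * y → (l:ℤ) ∣ x := by
      intro x y hxy
      have : (l:ℤ) ∣ 5 * (x * (a' + d')) ^ 2 := ⟨4 * y, by rw [hxy]; ring⟩
      have := hp.dvd_of_dvd_pow ((hp.dvd_or_dvd this).resolve_left h5)
      exact (hp.dvd_or_dvd this).resolve_right hnd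
    obtain ⟨c1, hc1⟩ := aux c _ k1
    obtain ⟨b1, hb1⟩ := aux b _ k2
    have ha : (l:ℤ) ∣ 5 * a ^ 2 := ⟨-1 - b1 * c1 * l, by rw [hc1, hb1] at hl1; linear_combination -hl1⟩
    obtain ⟨a1, ha1⟩ := hp.dvd_of_dvd_pow ((hp.dvd_or_dvd ha).resolve_left h5)
    rw [ha1, hb1, hc1] at hl1
    have : (l:ℤ) * (l * (-5 * a1 ^ 2 - b1 * c1)) = l * 1 := by linear_combination hl1
    have := mul_left_cancel₀ hp.ne_zero this
    exact hp.not_isUnit (IsUnit.of_mul_eq_one _ this)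
  have hcc : c ^ 2 = c' ^ 2 := by
    rw [hs] at k1
    have : 4 * (l:ℤ) * (c ^ 2 - c' ^ 2) = 0 := by rw [← k1]; ring
    have := (mul_eq_zero.mp this).resolve_left (by omega)
    linarith
  have hd' : d' = -a' := by linarith
  subst hd'
  rcases sq_eq_sq_iff_eq_or_eq_neg.mp hcc with hcc | hcc
  · refine ⟨1, by norm_num, ?_, ?_, ?_, ?_⟩
    · apply mul_left_cancel₀ hc; rw [← hcc] at e1; linarith
    · apply mul_left_cancel₀ hc; rw [← hcc] at e2; linarith
    · linarith
    · apply mul_left_cancel₀ hc; rw [← hcc] at e1; linarith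
  · have hcc' : c' = -c := by linarith
    rw [hcc'] at e1 e2
    refine ⟨-1, by norm_num, ?_, ?_, ?_, ?_⟩
    · apply mul_left_cancel₀ hc; linarith
    · apply mul_left_cancel₀ hc; linarith
    · linarith
    · apply mul_left_cancel₀ hc; linarith

theorem fac_eq {l : ℕ} (hl : l.Prime) {M M' A B C' D ε : ℤ} (hε : ε * ε = 1) {i j : Option (Fin l)}
    (hi : Fac M A B C' D i) (hj : Fac M' (ε * A) (ε * B) (ε * C') (ε * D) j) : i = j := by
  obtain ⟨α, β, γ, δ, h1, -, h2, h3, h4, h5⟩ := hi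
  obtain ⟨α', β', γ', δ', h1', -, h2', h3', h4', h5'⟩ := hj
  have mm : ∀ x y : ℤ, ε * x = y → x = ε * y := fun x y h => by rw [← h, ← mul_assoc, hε, one_mul]
  have g1 := mm _ _ h2'
  have g2 := mm _ _ h3'
  have g3 := mm _ _ h4'
  have g4 := mm _ _ h5'
  refine rep_uniq hl ⟨ε * (δ * α' - β * γ'), ε * (δ * β' - β * δ'), ε * (-γ * α' + α * γ'), ε * (-γ * β' + α * δ'),
    ?_, one_dvd _, ?_, ?_, ?_, ?_⟩
  · linear_combination (ε * ε) * (α * δ - β * γ) * h1' + (ε * ε) * h1 + hε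
  · linear_combination (-rp i) * h1 - δ * h2 + β * h4 + δ * g1 - β * g3
  · linear_combination (-rq i) * h1 - δ * h3 + β * h5 + δ * g2 - β * g4
  · linear_combination γ * h2 - α * h4 - γ * g1 + α * g3
  · linear_combination (-rs i) * h1 + γ * h3 - α * h5 - γ * g2 + α * g4

theorem CM.mu_sq {l : ℕ} {z : ℂ} {a b c : ℤ} (h : CM l z a b c (-a)) : (5 * c * z - 5 * a : ℂ) ^ 2 = -(5 * l) := by
  have := h.mu_eq
  push_cast at this
  linear_combination -this

theorem CM.simple {l : ℕ} (hl : l.Prime) (hl5 : 5 < l) {z : ℂ} (hz : 0 < z.im) {a b c : ℤ} (h : CM l z a b c (-a))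
    (P : ℂ[X]) (hP : ∀ z : ℂ, 0 < z.im → ∏ i : Option (Fin l), (tt z * tt (Rz i z) - 125) = P.eval (tt z)) :
    P.eval (tt z) = 0 ∧ P.derivative.eval (tt z) ≠ 0 := by
  have hlC : (l : ℂ) ≠ 0 := by exact_mod_cast hl.ne_zero
  obtain ⟨i, hi⟩ := h.fac hl hl5
  have hi0 := h.tt_eq hl hl5 hz hi
  have h0 : P.eval (tt z) = 0 := by
    rw [← hP z hz]; exact Finset.prod_eq_zero (Finset.mem_univ i) (by rw [hi0, sub_self])
  refine ⟨h0, fun hder => ?_⟩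
  have hother : ∀ j, j ≠ i → tt z * tt (Rz j z) - 125 ≠ 0 := by
    intro j hj h0
    apply hj
    obtain ⟨a', b', c', d', h', hf⟩ := root_CM hl hz (sub_eq_zero.mp h0)
    obtain ⟨ε, hε, rfl, rfl, rfl, rfl⟩ := h.uniq hl hl5 hz h'
    refine (fac_eq hl hε hi (M' := 5) (j := j) ?_).symm
    convert hf using 1 <;> ring
  have hRd : ∀ j : Option (Fin l), DifferentiableAt ℂ (fun w => tt (Rz j w)) z := by
    intro j
    refine DifferentiableAt.comp z (tt_diff (Rz_im hl j hz)) ?_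
    unfold Rz mb
    simp only [Int.cast_zero, zero_mul, zero_add]
    fun_prop
  have hnh : ∀ᶠ w in nhds z, 0 < w.im := (isOpen_H.mem_nhds hz)
  set G : ℂ → ℂ := fun w => ∏ j ∈ Finset.univ.erase i, (tt w * tt (Rz j w) - 125) with hG
  have hGd : DifferentiableAt ℂ G z := by
    refine DifferentiableAt.fun_finset_prod fun j _ => ?_
    exact ((tt_diff hz).mul (hRd j)).sub_const _
  have hG0 : G z ≠ 0 := Finset.prod_ne_zero_iff.mpr fun j hj => hother j (Finset.ne_of_mem_erase hj)
  have ht' : deriv tt z ≠ 0 := tt_deriv_ne hz fun a' b' c' d' hd hf => h.stab hl hl5 hz hd hf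
  have ht0 := tt_ne hz
  have htd : HasDerivAt tt (deriv tt z) z := (tt_diff hz).hasDerivAt
  have hmu := h.mu_ne hl hl5 hz
  push_cast at hmu
  -- the involution
  have hdet : 0 < 5 * a * (-5 * a) - b * (5 * c) := by
    have h1 := h.1
    have : (0:ℤ) < l := by exact_mod_cast hl.pos
    linarith
  set w : ℂ → ℂ := mb (5 * a) b (5 * c) (-5 * a) with hw
  have hwz : w z = z := by
    rw [hw, mb, div_eq_iff (den_ne hdet hz)]; push_cast; have := h.2; push_cast at this; linear_combination this
  have hwd : HasDerivAt w (-1) z := by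
    have hd1 : HasDerivAt (fun x : ℂ => ((5 * a : ℤ) : ℂ) * x + (b:ℂ)) ((5 * a : ℤ) : ℂ) z := by
      simpa using ((hasDerivAt_id z).const_mul ((5 * a : ℤ) : ℂ)).add_const (b:ℂ)
    have hd2 : HasDerivAt (fun x : ℂ => ((5 * c : ℤ) : ℂ) * x + ((-5 * a : ℤ):ℂ)) ((5 * c : ℤ) : ℂ) z := by
      simpa using ((hasDerivAt_id z).const_mul ((5 * c : ℤ) : ℂ)).add_const ((-5 * a : ℤ):ℂ)
    have hd3 := hd1.div hd2 (den_ne hdet hz)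
    refine hd3.congr_deriv ?_
    rw [div_eq_iff (pow_ne_zero _ (den_ne hdet hz))]
    have hl1 : (5 * a * (-a) - b * c : ℂ) = l := by exact_mod_cast h.1
    push_cast
    linear_combination h.mu_sq + 5 * hl1
  have hgi : (fun x => tt x * tt (Rz i x) - 125) =ᶠ[nhds z] fun x => 125 * (tt x / tt (w x)) - 125 := by
    filter_upwards [hnh] with x hx
    have hwx : 0 < (w x).im := im_mb hdet hx
    have e : mb (-c) (- -a) (5 * a) b x = -1 / (5 * w x) := by
      have hd2 : 0 < -c * b - - -a * (5 * a) := by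
        have h1 := h.1
        have h2 : (0:ℤ) < l := by exact_mod_cast hl.pos
        linarith
      have n1 := den_ne hd2 hx
      have n2 := den_ne hdet hx
      rw [hw, mb, mb, ← mul_div_assoc, div_div_eq_mul_div, div_eq_div_iff n1 (mul_ne_zero (by norm_num) n1)]
      push_cast; ring
    rw [← tt_fac hl hi hx, e, tt_W hwx]; ring
  have hgd : HasDerivAt (fun x => tt x * tt (Rz i x) - 125) (250 * deriv tt z / tt z) z := by
    refine HasDerivAt.congr_of_eventuallyEq ?_ hgi
    have htw : HasDerivAt (fun x => tt (w x)) (deriv tt z * (-1)) z := by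
      refine HasDerivAt.comp z (h₂ := tt) ?_ hwd
      rw [hwz]; exact htd
    have := ((htd.div htw (by rw [hwz]; exact ht0)).const_mul 125).sub_const 125
    refine this.congr_deriv ?_
    rw [hwz, ← mul_div_assoc, div_eq_div_iff (pow_ne_zero _ ht0) ht0]
    ring
  have hprod := hgd.mul hGd.hasDerivAt
  have hcomp : HasDerivAt (fun x => P.eval (tt x)) (P.derivative.eval (tt z) * deriv tt z) z :=
    (P.hasDerivAt (tt z)).comp z htd
  have heq : (fun x => P.eval (tt x)) =ᶠ[nhds z] (fun x => tt x * tt (Rz i x) - 125) * G := by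
    filter_upwards [hnh] with x hx
    rw [← hP x hx, Pi.mul_apply, hG]
    simp only
    exact (Finset.mul_prod_erase Finset.univ (fun j => tt x * tt (Rz j x) - 125) (Finset.mem_univ i)).symm
  have hun := hcomp.unique (hprod.congr_of_eventuallyEq heq)
  rw [hder, zero_mul, hi0, sub_self, zero_mul, add_zero] at hun
  exact mul_ne_zero (div_ne_zero (mul_ne_zero (by norm_num) ht') ht0) hG0 hun.symm

end QH

namespace QH

theorem exists_place (l : ℕ) [Fact l.Prime] : ∃ V : ValuationSubring ℂ, ¬ IsUnit (l : V) := by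
  set W := (Rat.padicValuation l).valuationSubring with hW
  set f : W →+* ℂ := (algebraMap ℚ ℂ).comp W.subtype with hf
  obtain ⟨V, hV, hloc⟩ := LocalSubring.exists_le_valuationSubring (LocalSubring.range f)
  refine ⟨V, fun hu => ?_⟩
  have h1 : IsUnit ((l : (LocalSubring.range f).toSubring)) := by
    apply hloc.map_nonunit
    rw [map_natCast]; exact hu
  obtain ⟨⟨w, x, hx⟩, hw⟩ := h1.exists_right_inv
  have h2 : (l : ℂ) * f x = 1 := by
    have := congrArg Subtype.val hw
    rw [hx]; simpa using this
  have h3 : (l : ℚ) * (x : ℚ) = 1 := by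
    have h4 : ((((l : ℚ) * (x : ℚ)) : ℚ) : ℂ) = ((1 : ℚ) : ℂ) := by
      push_cast
      simpa [hf] using h2
    exact_mod_cast h4
  have h5 : Rat.padicValuation l (x : ℚ) ≤ 1 := x.2
  have h6 := congrArg (Rat.padicValuation l) h3
  rw [map_mul, Rat.padicValuation_self, map_one] at h6
  have : WithZero.exp (-1 : ℤ) * Rat.padicValuation l (x : ℚ) ≤ WithZero.exp (-1 : ℤ) * 1 := by gcongr
  rw [h6, mul_one] at this
  rw [← WithZero.exp_zero, WithZero.exp_le_exp] at this
  omega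

section
variable {V : ValuationSubring ℂ}

theorem mem_V_of_integral {x : ℂ} (h : IsIntegral V x) : x ∈ V := by
  obtain ⟨y, hy⟩ := IsIntegrallyClosed.isIntegral_iff.mp h
  rw [← hy]; exact y.2

theorem mem_V_of_monic {x : ℂ} (q : V[X]) (hq : q.Monic) (h : (q.map V.subtype).eval x = 0) : x ∈ V :=
  mem_V_of_integral ⟨q, hq, by rw [eval_map] at h; exact h⟩

theorem charP_V {l : ℕ} [Fact l.Prime] (hV : ¬ IsUnit (l : V)) : CharP (IsLocalRing.ResidueField V) l := by
  have h0 : ((l : ℕ) : IsLocalRing.ResidueField V) = 0 := by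
    rw [← map_natCast (IsLocalRing.residue V), IsLocalRing.residue_eq_zero_iff]
    exact hV
  have h1 := (Nat.dvd_prime (Fact.out : l.Prime)).mp (ringChar.dvd h0)
  rcases h1 with h1 | h1
  · exact absurd h1 CharP.ringChar_ne_one
  · rw [← h1]; exact ringChar.charP _

theorem algClosed_V : IsAlgClosed (IsLocalRing.ResidueField V) := by
  apply IsAlgClosed.of_exists_root
  intro p hp hirr
  obtain ⟨q, hq, hd, hm⟩ := lifts_and_natDegree_eq_and_monic
    (f := IsLocalRing.residue V) (p := p) (by
      rw [lifts_iff_coeff_lifts]; intro n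
      exact IsLocalRing.residue_surjective _) hp
  have hdeg : (q.map V.subtype).degree ≠ 0 := by
    intro h1
    have h2 : (q.map V.subtype).natDegree = 0 := natDegree_eq_of_degree_eq_some h1
    rw [hm.natDegree_map, hd] at h2
    have := hirr.natDegree_pos
    omega
  obtain ⟨x, hx⟩ := IsAlgClosed.exists_root _ hdeg
  have hxV := mem_V_of_monic q hm hx
  refine ⟨IsLocalRing.residue V ⟨x, hxV⟩, ?_⟩
  rw [← hq, eval_map, eval₂_hom]
  have : q.eval ⟨x, hxV⟩ = 0 := by
    apply Subtype.val_injective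
    have : V.subtype (q.eval ⟨x, hxV⟩) = 0 := by
      rw [← eval₂_hom, ← eval_map]; exact hx
    exact this
  rw [this, map_zero]

theorem unit_V {x : V} (h : IsLocalRing.residue V x ≠ 0) : IsUnit x := by
  by_contra hx
  exact h ((IsLocalRing.residue_eq_zero_iff x).mpr hx)

theorem inv_V {x : V} (h : IsLocalRing.residue V x ≠ 0) : ∃ y : V, (y : ℂ) = (x : ℂ)⁻¹ ∧
    IsLocalRing.residue V y = (IsLocalRing.residue V x)⁻¹ := by
  obtain ⟨y, hy⟩ := (unit_V h).exists_right_inv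
  refine ⟨y, ?_, ?_⟩
  · apply eq_inv_of_mul_eq_one_right
    have := congrArg Subtype.val hy
    simpa using this
  · apply eq_inv_of_mul_eq_one_right
    rw [← map_mul, hy, map_one]

theorem int_unit {l : ℕ} [Fact l.Prime] (hV : ¬ IsUnit (l : V)) {n : ℤ} (hn : ¬ (l : ℤ) ∣ n) :
    IsLocalRing.residue V (n : V) ≠ 0 := by
  haveI := charP_V hV
  rw [map_intCast]
  intro h
  exact hn ((CharP.intCast_eq_zero_iff _ l n).mp h)

/-- splitting a polynomial with unit leading coefficient over a valuation ring of `ℂ` -/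
theorem split_V (p : V[X]) {n : ℕ} (hd : p.natDegree ≤ n) (q : (IsLocalRing.ResidueField V)[X]) (hq : q.Monic)
    (hqd : q.natDegree = n) (h : p.map (IsLocalRing.residue V) = q) :
    ∃ s : Multiset V, s.map V.subtype = (p.map V.subtype).roots ∧
      s.map (IsLocalRing.residue V) = q.roots := by
  have hco : IsLocalRing.residue V (p.coeff n) = 1 := by
    rw [← coeff_map, h, ← hqd]; exact hq
  have hpn : p.natDegree = n := by
    apply le_antisymm hd
    apply le_natDegree_of_ne_zero
    intro h0; rw [h0, map_zero] at hco; exact zero_ne_one hco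
  have hlc : IsLocalRing.residue V p.leadingCoeff = 1 := by rw [leadingCoeff, hpn, hco]
  obtain ⟨u, hu⟩ := unit_V (x := p.leadingCoeff) (by rw [hlc]; exact one_ne_zero)
  set p' : V[X] := C (↑u⁻¹ : V) * p with hp'
  have hm : p'.Monic := by
    rw [Monic, leadingCoeff_mul, leadingCoeff_C, ← hu]; simp
  have hinj : Function.Injective V.subtype := Subtype.val_injective
  have hroots : ∀ x ∈ (p.map V.subtype).roots, x ∈ V := by
    intro x hx
    apply mem_V_of_monic p' hm
    have := (mem_roots'.mp hx).2
    rw [hp', Polynomial.map_mul, eval_mul, this.eq_zero, mul_zero]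
  obtain ⟨s, hs⟩ : ∃ s : Multiset V, s.map V.subtype = (p.map V.subtype).roots := by
    revert hroots
    induction (p.map V.subtype).roots using Multiset.induction with
    | empty => intro _; exact ⟨0, rfl⟩
    | cons a m ih =>
      intro hr
      obtain ⟨s, hs⟩ := ih fun x hx => hr x (Multiset.mem_cons_of_mem hx)
      exact ⟨⟨a, hr a (Multiset.mem_cons_self _ _)⟩ ::ₘ s, by rw [Multiset.map_cons, hs]; rfl⟩
  refine ⟨s, hs, ?_⟩
  have hp : p = C p.leadingCoeff * (s.map fun a => X - C a).prod := by
    apply Polynomial.map_injective _ hinj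
    rw [(IsAlgClosed.splits (p.map V.subtype)).eq_prod_roots, ← hs, Polynomial.map_mul, map_C,
      leadingCoeff_map_of_injective hinj, Polynomial.map_multiset_prod, Multiset.map_map, Multiset.map_map]
    congr 2
    apply Multiset.map_congr rfl
    intro a _
    simp
  rw [← h, hp, Polynomial.map_mul, map_C, hlc, Polynomial.map_multiset_prod, C_1, one_mul]
  have : ((s.map fun a => X - C a).map (Polynomial.map (IsLocalRing.residue V))) =
      ((s.map (IsLocalRing.residue V)).map fun a => X - C a) := by
    rw [Multiset.map_map, Multiset.map_map]
    apply Multiset.map_congr rfl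
    intro a _
    simp
  rw [this, roots_multiset_prod_X_sub_C]

end
end QH

namespace QH

section
variable {V : ValuationSubring ℂ}

theorem zeta_V (l : ℕ) (hl : l ≠ 0) : ∃ ζ : V, V.subtype ζ = qq (1 / l) := by
  have h : qq (1 / l) ^ l = 1 := by
    rw [qq_pow, mul_one_div_cancel (by exact_mod_cast hl)]
    simp [qq, Complex.exp_two_pi_mul_I]
  refine ⟨⟨qq (1 / l), mem_V_of_integral ?_⟩, rfl⟩
  exact IsIntegral.of_pow (Nat.pos_of_ne_zero hl) (by rw [h]; exact isIntegral_one)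

theorem qstep {l : ℕ} [Fact l.Prime] (hl5 : 5 < l) (hV : ¬ IsUnit (l : V)) {z : ℂ} (hz : 0 < z.im) (c : V)
    (hc : IsLocalRing.residue V c ≠ 0) (hct : (c : ℂ) = tt z) {e : ℕ} (he : e ≤ 11) (u : V)
    (hu : IsLocalRing.residue V u ≠ 0)
    (hd : ∃ i : Option (Fin l), dlt i (5 * z) = (l : ℂ) ^ e * u) :
    (Gp l (IsLocalRing.ResidueField V)).eval
      ((IsLocalRing.residue V c ^ 2 + 10 * IsLocalRing.residue V c + 5) ^ 3 / IsLocalRing.residue V c) =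
      IsLocalRing.residue V ((l : V) ^ e * u) ^ l := by
  haveI := charP_V hV
  have hlp : l.Prime := Fact.out
  have hlC : (l : ℂ) ≠ 0 := by exact_mod_cast hlp.ne_zero
  obtain ⟨ζ, hζ⟩ := zeta_V (V := V) l hlp.ne_zero
  obtain ⟨y, hy, hy'⟩ := inv_V hc
  have hinj : Function.Injective V.subtype := Subtype.val_injective
  obtain ⟨p, hp, hpr⟩ := Q_poly V.subtype hinj hl5 ζ hζ (IsLocalRing.residue V) he u hu
  set J : V := (c ^ 2 + 10 * c + 5) ^ 3 * y with hJ
  have hJJ : V.subtype J = jj (5 * z) := by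
    have h1 := jj5 hz
    rw [hJ]
    simp only [map_mul, map_pow, map_add, map_ofNat]
    show ((c:ℂ) ^ 2 + 10 * c + 5) ^ 3 * (y:ℂ) = _
    rw [hy, hct, ← h1, mul_assoc, mul_inv_cancel₀ (tt_ne hz), mul_one]
  have h0 : ∏ i : Option (Fin l), Qf l e (V.subtype u) i (5 * z) = 0 := by
    have h1 := Qf_prod hlp he (V.subtype u) (im5 hz)
    obtain ⟨i, hi⟩ := hd
    have h2 : ∏ i : Option (Fin l), ((l:ℂ) ^ e * V.subtype u - dlt i (5 * z)) = 0 :=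
      Finset.prod_eq_zero (Finset.mem_univ i) (by rw [hi]; exact sub_self _)
    rw [h2] at h1
    exact (mul_eq_zero.mp h1).resolve_left (pow_ne_zero _ hlC)
  have h1 : p.eval J = 0 := by
    apply hinj
    rw [← eval₂_hom, ← eval_map, hJJ, ← hp _ (im5 hz), h0, map_zero]
  have h2 : (p.map (IsLocalRing.residue V)).eval (IsLocalRing.residue V J) = 0 := by
    rw [eval_map, eval₂_hom, h1, map_zero]
  rw [hpr, eval_mul, eval_C, eval_sub, eval_C] at h2
  have h3 := (mul_eq_zero.mp h2).resolve_left hu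
  have hJr : IsLocalRing.residue V J =
      (IsLocalRing.residue V c ^ 2 + 10 * IsLocalRing.residue V c + 5) ^ 3 / IsLocalRing.residue V c := by
    rw [hJ]
    simp only [map_mul, map_pow, map_add, map_ofNat]
    rw [hy']; rfl
  rw [← hJr]
  exact (sub_eq_zero.mp h3).symm

theorem CM.ss {l : ℕ} [Fact l.Prime] (hl5 : 5 < l) (hV : ¬ IsUnit (l : V)) {z : ℂ} (hz : 0 < z.im) (t : V)
    (ht : IsLocalRing.residue V t ≠ 0) (hct : (t : ℂ) = tt z) {a b c : ℤ} (h : CM l z a b c (-a)) :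
    (Gp l (IsLocalRing.ResidueField V)).eval
      ((IsLocalRing.residue V t ^ 2 + 10 * IsLocalRing.residue V t + 5) ^ 3 / IsLocalRing.residue V t) = 0 := by
  have hlp : l.Prime := Fact.out
  haveI := charP_V hV
  have hlC : (l : ℂ) ≠ 0 := by exact_mod_cast hlp.ne_zero
  have h5 : IsLocalRing.residue V ((5:ℤ) : V) ≠ 0 := int_unit hV (by
    intro h; have := Int.le_of_dvd (by norm_num) h; omega)
  obtain ⟨y, hy, hy'⟩ := inv_V h5
  rw [qstep hl5 hV hz t ht hct (e := 6) (by norm_num) (y ^ 6 * t ^ 4) (by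
    rw [map_mul, map_pow, map_pow, hy']
    exact mul_ne_zero (pow_ne_zero _ (inv_ne_zero h5)) (pow_ne_zero _ ht))]
  · rw [map_mul, map_pow, map_natCast, CharP.cast_eq_zero, zero_pow (by norm_num), zero_mul, zero_pow hlp.ne_zero]
  · obtain ⟨i, hi⟩ := h.dlt hlp hl5 hz
    refine ⟨i, ?_⟩
    have h1 := h.mu_sq
    have h2 : (5 * c * z + 5 * ((-a : ℤ) : ℂ)) ^ 12 = (5 * l) ^ 6 := by
      push_cast
      calc (5 * c * z + 5 * (-a : ℂ)) ^ 12 = ((5 * c * z - 5 * a : ℂ) ^ 2) ^ 6 := by ring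
        _ = _ := by rw [h1]; ring
    rw [hi, div_pow, h2]
    have hcc : ((y ^ 6 * t ^ 4 : V) : ℂ) = (y : ℂ) ^ 6 * (t : ℂ) ^ 4 := rfl
    rw [hcc, hy, hct]
    have : (((5:ℤ) : V) : ℂ) = 5 := rfl
    rw [this]
    have h6 : ((5:ℂ) * l) ^ 6 ≠ 0 := pow_ne_zero _ (mul_ne_zero (by norm_num) hlC)
    field_simp

theorem CM.ord {l : ℕ} [Fact l.Prime] (hl5 : 5 < l) (hV : ¬ IsUnit (l : V)) {z : ℂ} (hz : 0 < z.im) (t : V)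
    (ht : IsLocalRing.residue V t ≠ 0) (hct : (t : ℂ) = tt z) {a b c d : ℤ} (h : CM l z a b c d) (hs : a + d ≠ 0) :
    (Gp l (IsLocalRing.ResidueField V)).eval
      ((IsLocalRing.residue V t ^ 2 + 10 * IsLocalRing.residue V t + 5) ^ 3 / IsLocalRing.residue V t) ≠ 0 := by
  have hlp : l.Prime := Fact.out
  haveI := charP_V hV
  have hlC : (l : ℂ) ≠ 0 := by exact_mod_cast hlp.ne_zero
  have h5n : ¬ (l:ℤ) ∣ 5 := by
    intro h; have := Int.le_of_dvd (by norm_num) h; omega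
  have h5 : IsLocalRing.residue V ((5:ℤ) : V) ≠ 0 := int_unit hV h5n
  obtain ⟨y, hy, hy'⟩ := inv_V h5
  -- main step
  have main : ∀ {a b c d : ℤ}, CM l z a b c d → ∀ m : V, (m : ℂ) = 5 * (a + d) - (5 * c * z + 5 * d) →
      IsLocalRing.residue V m ≠ 0 → (Gp l (IsLocalRing.ResidueField V)).eval
      ((IsLocalRing.residue V t ^ 2 + 10 * IsLocalRing.residue V t + 5) ^ 3 / IsLocalRing.residue V t) ≠ 0 := by
    intro a b c d h m hm hmr
    have hu : IsLocalRing.residue V ((m * y) ^ 12 * t ^ 4) ≠ 0 := by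
      rw [map_mul, map_pow, map_pow, map_mul, hy']
      exact mul_ne_zero (pow_ne_zero _ (mul_ne_zero hmr (inv_ne_zero h5))) (pow_ne_zero _ ht)
    rw [qstep hl5 hV hz t ht hct (e := 0) (by norm_num) ((m * y) ^ 12 * t ^ 4) hu]
    · rw [pow_zero, one_mul]; exact pow_ne_zero _ hu
    · obtain ⟨i, hi⟩ := h.dlt hlp hl5 hz
      refine ⟨i, ?_⟩
      have hmu := h.mu_ne hlp hl5 hz
      have h1 := h.mu_eq
      have h2 : (l : ℂ) / (5 * c * z + 5 * d) = m * y := by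
        rw [hy, div_eq_iff hmu, hm]
        have : (((5:ℤ) : V) : ℂ) = 5 := rfl
        rw [this]
        linear_combination -(1/5) * h1
      rw [hi, h2, pow_zero, one_mul, ← hct]
      rfl
  -- mu integral
  have hmi : (5 * c * z + 5 * d : ℂ) ∈ V := by
    have hq : (X ^ 2 + C (((-(5 * (a + d)) : ℤ)) : V) * X + C ((5 * l : ℤ) : V) : V[X]).Monic := by
      monicity!
    refine mem_V_of_monic _ hq ?_
    have e1 : ∀ n : ℤ, V.subtype (n : V) = (n : ℂ) := fun n => map_intCast _ n
    rw [Polynomial.map_add, Polynomial.map_add, Polynomial.map_mul, Polynomial.map_pow, map_X, map_C, map_C, e1, e1,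
      eval_add, eval_add, eval_mul, eval_pow, eval_X, eval_C, eval_C]
    push_cast
    linear_combination -h.mu_eq
  set m : V := ⟨_, hmi⟩ with hm
  set m' : V := ((5 * (a + d) : ℤ) : V) - m with hm'
  have hsum : IsLocalRing.residue V m + IsLocalRing.residue V m' ≠ 0 := by
    rw [← map_add, hm', add_sub_cancel]
    apply int_unit hV
    intro hd
    rcases (Nat.prime_iff_prime_int.mp hlp).dvd_or_dvd hd with h1 | h1
    · exact h5n h1
    · exact h.not_dvd hlp hl5 hz hs h1
  have hmv : (m : ℂ) = 5 * c * z + 5 * d := rfl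
  have hmv' : (m' : ℂ) = 5 * (a + d) - (5 * c * z + 5 * d) := by
    rw [hm']; push_cast; rw [hmv]; congr 1
  by_cases h0 : IsLocalRing.residue V m' = 0
  · rw [h0, add_zero] at hsum
    refine main h.adj m ?_ hsum
    rw [hmv]; push_cast; ring
  · exact main h m' hmv' h0

end
end QH

namespace QH

/-- the `t`-values of the points with complex multiplication by `√(-5l)` -/
def tX (l : ℕ) : Set ℂ := {t | ∃ z : ℂ, 0 < z.im ∧ (∃ a b c : ℤ, CM l z a b c (-a)) ∧ tt z = t}

theorem tX_count_aux {l : ℕ} [Fact l.Prime] (hl5 : 5 < l) {V : ValuationSubring ℂ} (hV : ¬ IsUnit (l : V)) :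
    (tX l).ncard = 2 * (SSet l (IsLocalRing.ResidueField V)).ncard := by
  classical
  have hlp : l.Prime := Fact.out
  haveI := charP_V hV
  haveI := algClosed_V (V := V)
  set k := IsLocalRing.ResidueField V with hk
  set ρ := IsLocalRing.residue V with hρ
  obtain ⟨ζ, hζ⟩ := zeta_V (V := V) l hlp.ne_zero
  have hinj : Function.Injective V.subtype := Subtype.val_injective
  obtain ⟨p, hpd, hpe, hpr⟩ := P_poly V.subtype hinj hl5 ζ hζ ρ
  have hm1 : (X ^ (l + 1) - C 125 : k[X]).Monic := monic_X_pow_sub_C _ (by omega)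
  obtain ⟨s, hs1, hs2⟩ := split_V p hpd _ (hm1.pow 2) (by
    rw [hm1.natDegree_pow, natDegree_X_pow_sub_C]) hpr
  rw [roots_pow] at hs2
  have h125 : (125 : k) ≠ 0 := by
    have := int_unit hV (n := 125) (by
      intro h
      have h1 : (l:ℤ) ∣ 5 ^ 3 := by simpa using h
      have h2 := (Nat.prime_iff_prime_int.mp hlp).dvd_of_dvd_pow h1
      have := Int.le_of_dvd (by norm_num) h2; omega)
    rw [map_intCast] at this
    exact_mod_cast this
  have hP0 : p.map V.subtype ≠ 0 := by
    intro h0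
    rw [Polynomial.map_eq_zero_iff hinj] at h0
    rw [h0, Polynomial.map_zero] at hpr
    exact (hm1.pow 2).ne_zero hpr.symm
  have hlC0 : ((l + 1 : ℕ) : k) ≠ 0 := by
    push_cast; rw [CharP.cast_eq_zero]; simp
  have hsep : (X ^ (l + 1) - C 125 : k[X]).Separable := separable_X_pow_sub_C _ hlC0 h125
  have hnd : (X ^ (l + 1) - C 125 : k[X]).roots.Nodup := nodup_roots hsep
  -- facts on members of s
  have hmem : ∀ c ∈ s, ρ c ^ (l + 1) = 125 := by
    intro c hc
    have h1 : ρ c ∈ s.map ρ := Multiset.mem_map_of_mem _ hc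
    rw [hs2, Multiset.mem_nsmul] at h1
    have h2 := (mem_roots'.mp h1.2).2
    rw [IsRoot, eval_sub, eval_pow, eval_X, eval_C, sub_eq_zero] at h2
    exact h2
  have hne : ∀ c ∈ s, ρ c ≠ 0 := by
    intro c hc h0
    have := hmem c hc
    rw [h0, zero_pow (by omega)] at this
    exact h125 this.symm
  have hroot : ∀ c : V, c ∈ s ↔ (p.map V.subtype).eval (c:ℂ) = 0 := by
    intro c
    have h1 : c ∈ s ↔ V.subtype c ∈ s.map V.subtype := (Multiset.mem_map_of_injective hinj).symm
    rw [h1, hs1, mem_roots hP0]; rfl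
  have hgood : ∀ c ∈ s, ((c : ℂ) ∈ tX l ↔ ρ c ∈ SSet l k) := by
    intro c hc
    have hc0 : (c : ℂ) ≠ 0 := by
      intro h0
      have : c = 0 := Subtype.val_injective h0
      exact hne c hc (by rw [this, map_zero])
    constructor
    · rintro ⟨z, hz, ⟨a, b, c', h⟩, ht⟩
      exact ⟨hmem c hc, h.ss hl5 hV hz c (hne c hc) ht.symm⟩
    · rintro ⟨-, hG⟩
      obtain ⟨z, hz, ht⟩ := tt_surj hc0
      have h1 := (hroot c).mp hc
      rw [← ht, ← hpe z hz, Finset.prod_eq_zero_iff] at h1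
      obtain ⟨i, -, hi⟩ := h1
      obtain ⟨a, b, c', d, h, -⟩ := root_CM hlp hz (sub_eq_zero.mp hi)
      by_cases had : a + d = 0
      · obtain rfl : d = -a := by omega
        exact ⟨z, hz, ⟨a, b, c', h⟩, ht⟩
      · exact absurd hG (h.ord hl5 hV hz c (hne c hc) ht.symm had)
  have hsimple : ∀ t ∈ tX l, (p.map V.subtype).eval t = 0 ∧ (p.map V.subtype).derivative.eval t ≠ 0 := by
    rintro t ⟨z, hz, ⟨a, b, c, h⟩, rfl⟩
    exact h.simple hlp hl5 hz _ hpe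
  -- tX is the image of the filtered multiset
  have hset : tX l = ((((p.map V.subtype).roots.filter (· ∈ tX l)).toFinset : Finset ℂ) : Set ℂ) := by
    ext t
    rw [Finset.mem_coe, Multiset.mem_toFinset, Multiset.mem_filter, mem_roots hP0]
    exact ⟨fun h => ⟨(hsimple t h).1, h⟩, fun h => h.2⟩
  have hnd2 : ((p.map V.subtype).roots.filter (· ∈ tX l)).Nodup := by
    rw [Multiset.nodup_iff_count_le_one]
    intro t
    by_cases ht : t ∈ tX l
    · rw [Multiset.count_filter_of_pos ht, count_roots]
      obtain ⟨h1, h2⟩ := hsimple t ht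
      by_contra hlt
      push Not at hlt
      have := (one_lt_rootMultiplicity_iff_isRoot hP0).mp hlt
      exact h2 this.2
    · rw [Multiset.count_filter_of_neg ht]; exact Nat.zero_le _
  have c1 : (tX l).ncard = ((p.map V.subtype).roots.filter (· ∈ tX l)).card := by
    conv_lhs => rw [hset]
    rw [Set.ncard_coe_finset, Multiset.toFinset_card_of_nodup hnd2]
  have c2 : ((p.map V.subtype).roots.filter (· ∈ tX l)).card = ((s.map ρ).filter (· ∈ SSet l k)).card := by
    rw [← hs1, Multiset.filter_map, Multiset.filter_map, Multiset.card_map, Multiset.card_map]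
    congr 1
    apply Multiset.filter_congr
    intro c hc
    exact hgood c hc
  have c3 : (SSet l k) = ((((X ^ (l + 1) - C 125 : k[X]).roots.filter (· ∈ SSet l k)).toFinset : Finset k) : Set k) := by
    ext t
    rw [Finset.mem_coe, Multiset.mem_toFinset, Multiset.mem_filter, mem_roots hm1.ne_zero]
    refine ⟨fun h => ⟨?_, h⟩, fun h => h.2⟩
    rw [IsRoot, eval_sub, eval_pow, eval_X, eval_C, sub_eq_zero]
    exact h.1
  have c4 : (SSet l k).ncard = ((X ^ (l + 1) - C 125 : k[X]).roots.filter (· ∈ SSet l k)).card := by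
    conv_lhs => rw [c3]
    rw [Set.ncard_coe_finset, Multiset.toFinset_card_of_nodup (hnd.filter _)]
  rw [c1, c2, c4, hs2, Multiset.filter_nsmul, Multiset.card_nsmul]

theorem tX_count {l : ℕ} [Fact l.Prime] (hl5 : 5 < l) (hmod5 : l % 5 = 2 ∨ l % 5 = 3) :
    (tX l).ncard = 4 * {a : ZMod l | Irreducible (gq a) ∧ gq a ∣ hasseInvariant5 l}.ncard +
      if l % 4 = 3 then 4 else 0 := by
  obtain ⟨V, hV⟩ := exists_place l
  haveI := charP_V hV
  haveI := algClosed_V (V := V)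
  letI := ZMod.algebra (IsLocalRing.ResidueField V) l
  rw [tX_count_aux hl5 hV, count_SS hl5 hmod5]
  split_ifs <;> ring

end QH

namespace QH

section
variable {K : Type*} [Field K] [CharZero K] {θ : K} {l : ℕ} {σ : K →+* ℂ}

/-- `θ`-stable lattices in `K` -/
structure Lat (θ : K) (L : AddSubgroup K) : Prop where
  st : ∀ v ∈ L, θ * v ∈ L
  ne : ∃ v ∈ L, v ≠ 0
  fin : ∃ n : ℤ, n ≠ 0 ∧ ∀ v ∈ L, ∃ p q : ℤ, (n : K) * v = p + q * θ

theorem indep (hσ : 0 < (σ θ).im) {p q : ℤ} (h : (p + q * θ : K) = 0) : p = 0 ∧ q = 0 := by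
  have h1 := congrArg σ h
  rw [map_add, map_mul, map_intCast, map_intCast, map_zero] at h1
  have h2 := congrArg Complex.im h1
  simp at h2
  have hq : q = 0 := by
    rcases h2 with h2 | h2
    · exact h2
    · exact absurd h2 hσ.ne'
  subst hq
  simp at h
  exact ⟨h, rfl⟩

theorem indep2 (hσ : 0 < (σ θ).im) {p q p' q' : ℤ} (h : (p + q * θ : K) = p' + q' * θ) : p = p' ∧ q = q' := by
  have := indep (p := p - p') (q := q - q') hσ (by push_cast; linear_combination h)
  omega

theorem form1 (hθ : θ ^ 2 = -((5 * l : ℕ) : K)) (hσ : 0 < (σ θ).im) {L : AddSubgroup K} (hL : Lat θ L) :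
    ∃ b c : ℤ, c ∣ b ^ 2 + 5 * l ∧ ∃ x : K, x ≠ 0 ∧ ∀ v, v ∈ L ↔ ∃ m k : ℤ, x * v = c * m + k * (b + θ) := by
  obtain ⟨n, hn, hfin⟩ := hL.fin
  have hnK : (n : K) ≠ 0 := by exact_mod_cast hn
  push_cast at hθ
  let G : AddSubgroup ℤ :=
    { carrier := {q | ∃ p : ℤ, ∃ v ∈ L, (n : K) * v = p + q * θ}
      zero_mem' := ⟨0, 0, L.zero_mem, by simp⟩
      add_mem' := by
        rintro q q' ⟨p, v, hv, h⟩ ⟨p', v', hv', h'⟩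
        exact ⟨p + p', v + v', L.add_mem hv hv', by push_cast; linear_combination h + h'⟩
      neg_mem' := by
        rintro q ⟨p, v, hv, h⟩
        exact ⟨-p, -v, L.neg_mem hv, by push_cast; linear_combination -h⟩ }
  let H : AddSubgroup ℤ :=
    { carrier := {p | ∃ v ∈ L, (n : K) * v = p}
      zero_mem' := ⟨0, L.zero_mem, by simp⟩
      add_mem' := by
        rintro p p' ⟨v, hv, h⟩ ⟨v', hv', h'⟩
        exact ⟨v + v', L.add_mem hv hv', by push_cast; linear_combination h + h'⟩
      neg_mem' := by
        rintro p ⟨v, hv, h⟩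
        exact ⟨-v, L.neg_mem hv, by push_cast; linear_combination -h⟩ }
  obtain ⟨g, hg⟩ := Int.subgroup_cyclic G
  obtain ⟨c, hc⟩ := Int.subgroup_cyclic H
  have hG : ∀ q, q ∈ G ↔ ∃ k : ℤ, q = g * k := by
    intro q
    rw [hg, AddSubgroup.mem_closure_singleton]
    constructor
    · rintro ⟨k, hk⟩; exact ⟨k, by rw [← hk, smul_eq_mul, mul_comm]⟩
    · rintro ⟨k, hk⟩; exact ⟨k, by rw [hk, smul_eq_mul, mul_comm]⟩
  have hH : ∀ q, q ∈ H ↔ ∃ k : ℤ, q = c * k := by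
    intro q
    rw [hc, AddSubgroup.mem_closure_singleton]
    constructor
    · rintro ⟨k, hk⟩; exact ⟨k, by rw [← hk, smul_eq_mul, mul_comm]⟩
    · rintro ⟨k, hk⟩; exact ⟨k, by rw [hk, smul_eq_mul, mul_comm]⟩
  obtain ⟨b, v0, hv0, h0⟩ : g ∈ G := (hG g).mpr ⟨1, by ring⟩
  obtain ⟨v1, hv1, h1⟩ : c ∈ H := (hH c).mpr ⟨1, by ring⟩
  obtain ⟨c', hc'⟩ := (hG c).mp ⟨0, θ * v1, hL.st _ hv1, by push_cast; linear_combination θ * h1⟩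
  obtain ⟨b', hb'⟩ := (hG b).mp ⟨-(5 * l * g), θ * v0, hL.st _ hv0, by
    push_cast; linear_combination θ * h0 + g * hθ⟩
  have hg0 : g ≠ 0 := by
    rintro rfl
    obtain ⟨v, hv, hvn⟩ := hL.ne
    obtain ⟨p, q, hpq⟩ := hfin v hv
    obtain ⟨k, hk⟩ := (hG q).mp ⟨p, v, hv, hpq⟩
    obtain ⟨k', hk'⟩ := (hG p).mp ⟨-(5 * l * q), θ * v, hL.st _ hv, by
      push_cast; linear_combination θ * hpq + q * hθ⟩
    rw [zero_mul] at hk hk'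
    subst hk hk'
    rw [Int.cast_zero, zero_mul, add_zero] at hpq
    exact (mul_ne_zero hnK hvn) hpq
  have hgK : (g : K) ≠ 0 := by exact_mod_cast hg0
  subst hc' hb'
  push_cast at h0 h1
  have key : ∀ v, v ∈ L ↔ ∃ m k : ℤ, (n / g : K) * v = c' * m + k * (b' + θ) := by
    intro v
    constructor
    · intro hv
      obtain ⟨p, q, hpq⟩ := hfin v hv
      obtain ⟨k, hk⟩ := (hG q).mp ⟨p, v, hv, hpq⟩
      subst hk
      push_cast at hpq
      obtain ⟨m, hm⟩ := (hH (p - k * (g * b'))).mp ⟨v - k * v0, L.sub_mem hv (by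
        have := L.zsmul_mem hv0 k; rwa [zsmul_eq_mul] at this), by push_cast; linear_combination hpq - k * h0⟩
      have hm' : (p - k * (g * b') : K) = g * c' * m := by exact_mod_cast hm
      refine ⟨m, k, ?_⟩
      rw [div_mul_eq_mul_div, div_eq_iff hgK]
      linear_combination hpq + hm'
    · rintro ⟨m, k, h⟩
      rw [div_mul_eq_mul_div, div_eq_iff hgK] at h
      have : v = m * v1 + k * v0 := by
        apply mul_left_cancel₀ hnK
        linear_combination h - m * h1 - k * h0
      rw [this]
      have e0 := L.zsmul_mem hv0 k
      have e1 := L.zsmul_mem hv1 m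
      rw [zsmul_eq_mul] at e0 e1
      exact L.add_mem e1 e0
  refine ⟨b', c', ?_, n / g, div_ne_zero hnK hgK, key⟩
  obtain ⟨m, k, h⟩ := (key _).mp (hL.st _ hv0)
  have h2 : ((-(5 * l) : ℤ) + b' * θ : K) = ((c' * m + k * b' : ℤ) : K) + k * θ := by
    rw [div_mul_eq_mul_div, div_eq_iff hgK] at h
    apply mul_left_cancel₀ hgK
    push_cast
    linear_combination h - θ * h0 - g * hθ
  obtain ⟨h3, h4⟩ := indep2 hσ h2
  subst h4
  exact ⟨-m, by linear_combination -h3⟩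

theorem form2 (hθ : θ ^ 2 = -((5 * l : ℕ) : K)) (hσ : 0 < (σ θ).im) {L : AddSubgroup K} (hL : Lat θ L) :
    ∃ a c : ℤ, 0 < c ∧ c ∣ 5 * a ^ 2 + l ∧ ∃ x : K, x ≠ 0 ∧
      ∀ v, v ∈ L ↔ ∃ m k : ℤ, x * v = 5 * c * m + k * (5 * a + θ) := by
  obtain ⟨b, c, hd, x, hx, key⟩ := form1 hθ hσ hL
  push_cast at hθ
  have hp5 : Prime (5 : ℤ) := by norm_num
  have hl0 : l ≠ 0 := by
    rintro rfl
    have : θ = 0 := by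
      have : θ ^ 2 = 0 := by rw [hθ]; simp
      exact pow_eq_zero_iff (two_ne_zero) |>.mp this
    rw [this] at hσ; simp at hσ
  have hpos : ∀ b : ℤ, 0 < b ^ 2 + 5 * (l:ℤ) := by
    intro b
    have : 0 < (l:ℤ) := by exact_mod_cast Nat.pos_of_ne_zero hl0
    positivity
  -- reduce to 5 ∣ c
  obtain ⟨b, c, hc5, hd, x, hx, key⟩ : ∃ b c : ℤ, 5 ∣ c ∧ c ∣ b ^ 2 + 5 * l ∧ ∃ x : K, x ≠ 0 ∧
      ∀ v, v ∈ L ↔ ∃ m k : ℤ, x * v = c * m + k * (b + θ) := by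
    by_cases h5 : (5:ℤ) ∣ c
    · exact ⟨b, c, h5, hd, x, hx, key⟩
    · obtain ⟨t, ht⟩ : ∃ t : ℤ, 5 ∣ b + t * c := by
        have hcop : IsCoprime c 5 := ((Prime.coprime_iff_not_dvd hp5).mpr h5).symm
        obtain ⟨u, w, huw⟩ := hcop
        exact ⟨-b * u, b * w, by linear_combination b * (1 - huw) + 0 * huw + 0⟩
      obtain ⟨d, hd'⟩ : c ∣ (b + t * c) ^ 2 + 5 * l := by
        have : (b + t * c) ^ 2 + 5 * l = (b ^ 2 + 5 * l) + c * (2 * b * t + t ^ 2 * c) := by ring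
        rw [this]; exact dvd_add hd (Dvd.intro _ rfl)
      have hc0 : c ≠ 0 := by rintro rfl; simp at h5
      have hcK : (c : K) ≠ 0 := by exact_mod_cast hc0
      set b' := b + t * c with hb'
      have hbK : (b' : K) = b + t * c := by rw [hb']; push_cast; ring
      have hd5 : 5 ∣ d := by
        have h1 : (5:ℤ) ∣ c * d := by
          rw [← hd']; exact dvd_add (dvd_pow ht two_ne_zero) (Dvd.intro _ rfl)
        exact (hp5.dvd_or_dvd h1).resolve_left h5
      have hdK : (b' ^ 2 + 5 * l : K) = c * d := by exact_mod_cast hd'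
      have hne : (b' - θ : K) ≠ 0 := by
        intro h
        have := indep (p := b') (q := -1) hσ (by push_cast; linear_combination h)
        omega
      refine ⟨-b', d, hd5, ⟨c, by rw [neg_sq, hd', mul_comm]⟩, x * (b' - θ) / c,
        div_ne_zero (mul_ne_zero hx hne) hcK, fun v => ?_⟩
      rw [key]
      constructor
      · rintro ⟨m, k, h⟩
        refine ⟨k, -(m - t * k), ?_⟩
        rw [div_mul_eq_mul_div, div_eq_iff hcK]
        push_cast
        linear_combination (b' - θ) * h + k * hdK - k * hθ - k * (b' - θ) * hbK
      · rintro ⟨k, m, h⟩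
        refine ⟨-m + t * k, k, ?_⟩
        rw [div_mul_eq_mul_div, div_eq_iff hcK] at h
        apply mul_left_cancel₀ hne
        push_cast at h ⊢
        linear_combination h - k * hdK + k * hθ + k * (b' - θ) * hbK
  -- sign
  obtain ⟨b, c, hcp, hc5, hd, x, hx, key⟩ : ∃ b c : ℤ, 0 < c ∧ 5 ∣ c ∧ c ∣ b ^ 2 + 5 * l ∧ ∃ x : K, x ≠ 0 ∧
      ∀ v, v ∈ L ↔ ∃ m k : ℤ, x * v = c * m + k * (b + θ) := by
    rcases lt_trichotomy c 0 with h | h | h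
    · refine ⟨b, -c, by omega, (dvd_neg).mpr hc5, (neg_dvd).mpr hd, x, hx, fun v => ?_⟩
      rw [key]
      constructor
      · rintro ⟨m, k, h⟩; exact ⟨-m, k, by rw [h]; push_cast; ring⟩
      · rintro ⟨m, k, h⟩; exact ⟨-m, k, by rw [h]; push_cast; ring⟩
    · subst h; have := hpos b; rw [zero_dvd_iff] at hd; omega
    · exact ⟨b, c, h, hc5, hd, x, hx, key⟩
  obtain ⟨c', rfl⟩ := hc5
  have hb5 : (5:ℤ) ∣ b := by
    apply hp5.dvd_of_dvd_pow (n := 2)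
    have h1 : (5:ℤ) ∣ b ^ 2 + 5 * l := (Dvd.intro _ rfl).trans hd
    exact (dvd_add_left (Dvd.intro _ rfl)).mp h1
  obtain ⟨a, rfl⟩ := hb5
  refine ⟨a, c', by omega, ?_, x, hx, fun v => by rw [key]; push_cast; rfl⟩
  obtain ⟨e, he⟩ := hd
  exact ⟨e, by linarith⟩

end
end QH

namespace QH

theorem eq5_of_lattice {l : ℕ} (hl : l.Prime) (hl5 : 5 < l) {z w y : ℂ} (hz : 0 < z.im) (hw : 0 < w.im)
    {a0 b0 c0 a1 b1 c1 : ℤ} (h0 : CM l z a0 b0 c0 (-a0)) (h1 : CM l w a1 b1 c1 (-a1))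
    {a b c d a' b' c' d' : ℤ} (e1 : y = c * w + d) (e2 : y * z = a * w + b)
    (f1 : y * (c' * z + d') = 1) (f2 : y * (a' * z + b') = w) : Eq5 z w := by
  have key : ∀ x y : ℤ, (x * w + y : ℂ) = 0 → x = 0 ∧ y = 0 := by
    intro x y hxy
    have h2 := congrArg Complex.im hxy
    simp at h2
    have hx : x = 0 := by
      rcases h2 with h2 | h2
      · exact h2
      · exact absurd h2 hw.ne'
    subst hx
    simp at hxy
    exact ⟨rfl, hxy⟩
  have key2 : ∀ x y x' y' : ℤ, (x * w + y : ℂ) = x' * w + y' → x = x' ∧ y = y' := by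
    intro x y x' y' h
    have := key (x - x') (y - y') (by push_cast; linear_combination h)
    omega
  obtain ⟨g1, g2⟩ := key2 (c' * a + d' * c) (c' * b + d' * d) 0 1 (by
    push_cast; linear_combination f1 - c' * e2 - d' * e1)
  obtain ⟨g3, g4⟩ := key2 (a' * a + b' * c) (a' * b + b' * d) 1 0 (by
    push_cast; linear_combination f2 - a' * e2 - b' * e1)
  have hdet : (a * d - b * c) * (a' * d' - b' * c') = 1 := by
    linear_combination (c' * b + d' * d) * g3 + g2 - (a' * b + b' * d) * g1
  have hdet0 : 0 ≤ a * d - b * c := by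
    have hre := congrArg Complex.re e2
    have him := congrArg Complex.im e2
    rw [e1] at hre him
    simp at hre him
    have h3 : w.im * ((a * d - b * c : ℤ) : ℝ) = z.im * ((c * w.re + d) ^ 2 + (c * w.im) ^ 2) := by
      push_cast
      linear_combination (-(c * w.re + d)) * him + c * w.im * hre
    have h4 : (0:ℝ) ≤ w.im * ((a * d - b * c : ℤ) : ℝ) := by rw [h3]; positivity
    have h5 := nonneg_of_mul_nonneg_right h4 hw
    exact_mod_cast h5
  have hdet1 : a * d - b * c = 1 := by
    rcases Int.isUnit_iff.mp (IsUnit.of_mul_eq_one _ hdet) with h | h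
    · exact h
    · omega
  -- 5 ∣ c
  have s0 := h0.mu_sq
  have s1 := h1.mu_sq
  obtain ⟨ε, hε⟩ : ∃ ε : ℤ, (5 * c0 * z - 5 * a0 : ℂ) = ε * (5 * c1 * w - 5 * a1) ∧ ε * ε = 1 := by
    rcases sq_eq_sq_iff_eq_or_eq_neg.mp (s0.trans s1.symm) with h | h
    · exact ⟨1, by rw [h]; push_cast; ring, by norm_num⟩
    · exact ⟨-1, by rw [h]; push_cast; ring, by norm_num⟩
  obtain ⟨hε, hε1⟩ := hε
  have h1' := h1.2
  push_cast at h1'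
  obtain ⟨-, g6⟩ := key2 (5 * (c0 * a - a0 * c)) (5 * (c0 * b - a0 * d)) (ε * (5 * c * a1 + 5 * d * c1))
    (ε * (c * b1 - 5 * d * a1)) (by
      push_cast
      linear_combination y * hε - 5 * c0 * e2 + 5 * a0 * e1 + ε * (5 * c1 * w - 5 * a1) * e1 - ε * c * h1')
  have hb1 : ¬ (5:ℤ) ∣ b1 := by
    rintro ⟨k, hk⟩
    have h2 := h1.1
    rw [hk] at h2
    have h3 : (5:ℤ) ∣ l := ⟨-a1 ^ 2 - k * c1, by rw [← h2]; ring⟩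
    have h4 : 5 ∣ l := by exact_mod_cast h3
    have := (Nat.prime_dvd_prime_iff_eq Nat.prime_five hl).mp h4
    omega
  have hp5 : Prime (5 : ℤ) := by norm_num
  have hc5 : (5:ℤ) ∣ c := by
    have : (5:ℤ) ∣ c * b1 := ⟨ε * (c0 * b - a0 * d) + d * a1, by
      linear_combination (-c * b1 + 5 * d * a1) * hε1 - ε * g6⟩
    exact (hp5.dvd_or_dvd this).resolve_right hb1
  obtain ⟨k, rfl⟩ := hc5
  refine ⟨a, b, k, d, by linear_combination hdet1, ?_⟩
  have hy : y ≠ 0 := by rintro rfl; simp at f1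
  have hy' : ((5 * k : ℤ) * w + d : ℂ) ≠ 0 := by rw [← e1]; exact hy
  rw [mb, eq_div_iff (by push_cast at hy' ⊢; exact hy')]
  push_cast at e1 ⊢
  rw [← e1, mul_comm, e2]

section
variable {K : Type*} [Field K] [CharZero K] {θ : K} {l : ℕ} {σ : K →+* ℂ}

/-- `L` is homothetic to `ℤ + ℤ z` -/
def Zr (L : AddSubgroup K) (z : K) : Prop := ∃ x : K, x ≠ 0 ∧ ∀ v, v ∈ L ↔ ∃ m n : ℤ, x * v = m + n * z

theorem s5 (σ : K →+* ℂ) : σ 5 = 5 := map_ofNat σ 5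

def Hom (L L' : AddSubgroup K) : Prop := ∃ x : K, x ≠ 0 ∧ ∀ v, v ∈ L ↔ x * v ∈ L'

theorem Zr.hom {L L' : AddSubgroup K} {z : K} (h : Zr L' z) (hh : Hom L L') : Zr L z := by
  obtain ⟨x, hx, h⟩ := h
  obtain ⟨y, hy, hh⟩ := hh
  refine ⟨x * y, mul_ne_zero hx hy, fun v => ?_⟩
  rw [hh, h]; simp only [mul_assoc]

theorem lat_exists (hθ : θ ^ 2 = -((5 * l : ℕ) : K)) (hσ : 0 < (σ θ).im) {L : AddSubgroup K} (hL : Lat θ L) :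
    ∃ z : K, 0 < (σ z).im ∧ (∃ a b c : ℤ, CM l (σ z) a b c (-a)) ∧ Zr L z := by
  obtain ⟨a, c, hc, ⟨b, hb⟩, x, hx, key⟩ := form2 hθ hσ hL
  have hcK : (c : K) ≠ 0 := by exact_mod_cast hc.ne'
  have h5 : (5 : K) ≠ 0 := by norm_num
  push_cast at hθ
  have hbK : (5 * a ^ 2 + l : K) = c * b := by exact_mod_cast hb
  set z : K := (5 * a + θ) / (5 * c) with hz
  have hz1 : z * (5 * c) = 5 * a + θ := div_mul_cancel₀ _ (mul_ne_zero h5 hcK)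
  have hzσ : σ z * (5 * c) = 5 * a + σ θ := by
    have := congrArg σ hz1
    simpa [s5] using this
  clear_value z
  refine ⟨z, ?_, ⟨a, -b, c, by linarith, ?_⟩, x / (5 * c), div_ne_zero hx (mul_ne_zero h5 hcK), fun v => ?_⟩
  · have := congrArg Complex.im hzσ
    simp at this
    have hcR : (0:ℝ) < c := by exact_mod_cast hc
    rw [← this] at hσ
    have : 0 < (σ z).im * (5 * c) := by simpa using hσ
    exact pos_of_mul_pos_left this (by positivity)
  · have : (5 * a * z + (-b) : K) = z * (5 * c * z + 5 * (-a)) := by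
      apply mul_right_cancel₀ hcK
      apply mul_left_cancel₀ h5
      linear_combination (5 * a - z * (5 * c) - θ) * hz1 + 5 * hbK - hθ
    have := congrArg σ this
    simpa [s5] using this
  · rw [key]
    constructor
    · rintro ⟨m, k, h⟩
      refine ⟨m, k, ?_⟩
      rw [div_mul_eq_mul_div, div_eq_iff (mul_ne_zero h5 hcK)]
      linear_combination h - k * hz1
    · rintro ⟨m, k, h⟩
      refine ⟨m, k, ?_⟩
      rw [div_mul_eq_mul_div, div_eq_iff (mul_ne_zero h5 hcK)] at h
      linear_combination h + k * hz1

theorem lat_of_CM (hl : l.Prime) (hl5 : 5 < l) (hθ : θ ^ 2 = -((5 * l : ℕ) : K)) (hσ : 0 < (σ θ).im) {w : ℂ} (hw : 0 < w.im)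
    {a b c : ℤ} (h : CM l w a b c (-a)) : ∃ z : K, σ z = w ∧ ∃ L : AddSubgroup K, Lat θ L ∧ Zr L z := by
  have hc := h.c_ne hl hl5 hw
  have hcK : (c : K) ≠ 0 := by exact_mod_cast hc
  have hcC : (c : ℂ) ≠ 0 := by exact_mod_cast hc
  have h5 : (5 : K) ≠ 0 := by norm_num
  have hs := h.mu_sq
  have hs2 : (σ θ) ^ 2 = -(5 * l) := by rw [← map_pow, hθ]; simp [s5]
  obtain ⟨ε, hε, hε1⟩ : ∃ ε : ℤ, (5 * c * w - 5 * a : ℂ) = ε * σ θ ∧ ε * ε = 1 := by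
    rcases sq_eq_sq_iff_eq_or_eq_neg.mp (hs.trans hs2.symm) with h | h
    · exact ⟨1, by rw [h]; push_cast; ring, by norm_num⟩
    · exact ⟨-1, by rw [h]; push_cast; ring, by norm_num⟩
  set z : K := (5 * a + ε * θ) / (5 * c) with hz
  have hz1 : z * (5 * c) = 5 * a + ε * θ := div_mul_cancel₀ _ (mul_ne_zero h5 hcK)
  have hzσ : σ z = w := by
    have h1 := congrArg σ hz1
    simp [s5] at h1
    apply mul_right_cancel₀ (mul_ne_zero (by norm_num : (5:ℂ) ≠ 0) hcC)
    linear_combination h1 - hε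
  have h2 : (5 * a * z + b : K) = z * (5 * c * z - 5 * a) := by
    apply σ.injective
    have := h.2
    push_cast at this
    simp only [map_add, map_sub, map_mul, map_ofNat, map_intCast, hzσ]
    linear_combination this
  have hεK : (ε * ε : K) = 1 := by exact_mod_cast hε1
  clear_value z
  let L : AddSubgroup K :=
    { carrier := {v | ∃ m n : ℤ, v = m + n * z}
      zero_mem' := ⟨0, 0, by simp⟩
      add_mem' := by
        rintro _ _ ⟨m, n, rfl⟩ ⟨m', n', rfl⟩
        exact ⟨m + m', n + n', by push_cast; ring⟩
      neg_mem' := by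
        rintro _ ⟨m, n, rfl⟩
        exact ⟨-m, -n, by push_cast; ring⟩ }
  refine ⟨z, hzσ, L, ⟨?_, ?_, ?_⟩, 1, one_ne_zero, fun v => ?_⟩
  · rintro _ ⟨m, n, rfl⟩
    refine ⟨ε * (-5 * a * m + b * n), ε * (5 * c * m + 5 * a * n), ?_⟩
    push_cast
    linear_combination (-(m + n * z) * θ) * hεK + ε * (-(m + n * z)) * hz1 - ε * n * h2
  · exact ⟨1, ⟨1, 0, by simp⟩, one_ne_zero⟩
  · refine ⟨5 * c, by omega, ?_⟩
    rintro _ ⟨m, n, rfl⟩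
    refine ⟨5 * c * m + 5 * a * n, ε * n, ?_⟩
    push_cast
    linear_combination n * hz1
  · rw [one_mul]; rfl

theorem lat_tt (hl : l.Prime) (hl5 : 5 < l) {L : AddSubgroup K} {z w : K} (hz : 0 < (σ z).im) (hw : 0 < (σ w).im)
    {a0 b0 c0 a1 b1 c1 : ℤ} (h0 : CM l (σ z) a0 b0 c0 (-a0)) (h1 : CM l (σ w) a1 b1 c1 (-a1))
    (hLz : Zr L z) (hLw : Zr L w) : tt (σ z) = tt (σ w) := by
  obtain ⟨x, hx, kz⟩ := hLz
  obtain ⟨y, hy, kw⟩ := hLw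
  obtain ⟨d, c, e1⟩ := (kw (1 / x)).mp ((kz _).mpr ⟨1, 0, by rw [mul_one_div_cancel hx]; simp⟩)
  obtain ⟨b, a, e2⟩ := (kw (z / x)).mp ((kz _).mpr ⟨0, 1, by rw [mul_div_cancel₀ _ hx]; simp⟩)
  obtain ⟨d', c', f1⟩ := (kz (1 / y)).mp ((kw _).mpr ⟨1, 0, by rw [mul_one_div_cancel hy]; simp⟩)
  obtain ⟨b', a', f2⟩ := (kz (w / y)).mp ((kw _).mpr ⟨0, 1, by rw [mul_div_cancel₀ _ hy]; simp⟩)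
  apply Eq5.tt hw
  refine eq5_of_lattice hl hl5 (y := σ (y / x)) hz hw h0 h1 (a := a) (b := b) (c := c) (d := d) (a' := a') (b' := b')
    (c' := c') (d' := d') ?_ ?_ ?_ ?_
  · have : y / x = c * w + d := by rw [mul_one_div] at e1; rw [e1]; ring
    rw [this]; simp
  · have : y / x * z = a * w + b := by
      rw [div_mul_eq_mul_div, ← mul_div_assoc] at *; rw [e2]; ring
    rw [← map_mul, this]; simp
  · have : y / x * (c' * z + d') = 1 := by
      have : (c' * z + d' : K) = x * (1 / y) := by rw [f1]; ring
      rw [this]; field_simp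
    have := congrArg σ this
    simpa using this
  · have : y / x * (a' * z + b') = w := by
      have : (a' * z + b' : K) = x * (w / y) := by rw [f2]; ring
      rw [this]; field_simp
    have := congrArg σ this
    simpa using this

theorem lat_hom {L L' : AddSubgroup K} {z w : K} (hz : 0 < (σ z).im) (hw : 0 < (σ w).im)
    (hLz : Zr L z) (hLw : Zr L' w) (h : tt (σ z) = tt (σ w)) : Hom L L' := by
  obtain ⟨a, b, c, d, hd, h⟩ := tt_inj hz hw h
  obtain ⟨x, hx, kz⟩ := hLz
  obtain ⟨y, hy, kw⟩ := hLw
  have hden := den_ne (a := a) (b := b) (c := 5 * c) (d := d) (by omega) hw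
  rw [mb, eq_div_iff hden] at h
  have hK : z * (5 * c * w + d) = a * w + b := by
    apply σ.injective
    push_cast at h
    simpa [s5] using h
  set u : K := 5 * c * w + d with hu
  have hu0 : u ≠ 0 := by
    intro h0
    apply hden
    have := congrArg σ (hu.symm.trans h0)
    push_cast
    simpa [s5] using this
  have hdK : (a * d - b * (5 * c) : K) = 1 := by exact_mod_cast hd
  refine ⟨x * u / y, div_ne_zero (mul_ne_zero hx hu0) hy, fun v => ?_⟩
  have e : y * (x * u / y * v) = u * (x * v) := by field_simp
  rw [kz, kw, e]
  constructor
  · rintro ⟨m, n, hmn⟩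
    refine ⟨m * d + n * b, m * (5 * c) + n * a, ?_⟩
    push_cast
    linear_combination u * hmn + n * hK + m * hu
  · rintro ⟨m, n, hmn⟩
    refine ⟨m * a - n * b, -(m * (5 * c)) + n * d, ?_⟩
    apply mul_left_cancel₀ hu0
    push_cast
    linear_combination hmn - (m + n * w) * hdK - (m * a - n * b) * hu + (m * (5 * c) - n * d) * hK

end
end QH

namespace QH

section
variable {K : Type*} [Field K] [CharZero K] {θ : K} {l : ℕ} {σ : K →+* ℂ}

/-- lattices `L` with `𝓞 L = M` -/
def FF (θ ω : K) (M : AddSubgroup K) : Set (AddSubgroup K) :=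
  {L | Lat θ L ∧ ∀ v, v ∈ M ↔ ∃ u ∈ L, ∃ w ∈ L, v = u + ω * w}

theorem FF_one {M : AddSubgroup K} (hM : Lat θ M) : (FF θ θ M).ncard = 1 := by
  rw [Set.ncard_eq_one]
  refine ⟨M, ?_⟩
  ext L
  rw [Set.mem_singleton_iff]
  constructor
  · rintro ⟨hL, h⟩
    ext v
    rw [h]
    constructor
    · intro hv; exact ⟨v, hv, 0, L.zero_mem, by simp⟩
    · rintro ⟨u, hu, w, hw, rfl⟩
      exact L.add_mem hu (hL.st _ hw)
  · rintro rfl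
    refine ⟨hM, fun v => ⟨fun hv => ⟨v, hv, 0, L.zero_mem, by simp⟩, ?_⟩⟩
    rintro ⟨u, hu, w, hw, rfl⟩
    exact L.add_mem hu (hM.st _ hw)

/-- index two sublattices -/
def sub2 (α β : K) (e f : ℤ) : AddSubgroup K where
  carrier := {v | ∃ m n : ℤ, v = m * α + n * β ∧ 2 ∣ e * m + f * n}
  zero_mem' := ⟨0, 0, by simp, by simp⟩
  add_mem' := by
    rintro _ _ ⟨m, n, rfl, h⟩ ⟨m', n', rfl, h'⟩
    refine ⟨m + m', n + n', by push_cast; ring, ?_⟩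
    obtain ⟨k, hk⟩ := h
    obtain ⟨k', hk'⟩ := h'
    exact ⟨k + k', by linear_combination hk + hk'⟩
  neg_mem' := by
    rintro _ ⟨m, n, rfl, h⟩
    refine ⟨-m, -n, by push_cast; ring, ?_⟩
    obtain ⟨k, hk⟩ := h
    exact ⟨-k, by linear_combination -hk⟩

set_option maxHeartbeats 2000000 in
theorem FF_count (hθ : θ ^ 2 = -((5 * l : ℕ) : K)) (hσ : 0 < (σ θ).im) {ω : K} (hω : 2 * ω = 1 + θ)
    {M : AddSubgroup K} (hM : Lat θ M) (hMω : ∀ v ∈ M, ω * v ∈ M) :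
    (l % 8 = 3 → (FF θ ω M).ncard = 2) ∧ (l % 8 = 7 → (FF θ ω M).ncard = 4) := by
  obtain ⟨z, hz, -, x, hx, key⟩ := lat_exists hθ hσ hM
  push_cast at hθ
  -- basis
  obtain ⟨α, β, hmem, hind⟩ : ∃ α β : K, (∀ v, v ∈ M ↔ ∃ m n : ℤ, v = m * α + n * β) ∧
      ∀ m n m' n' : ℤ, (m * α + n * β : K) = m' * α + n' * β → m = m' ∧ n = n' := by
    refine ⟨1 / x, z / x, fun v => ?_, ?_⟩
    · rw [key]
      constructor
      · rintro ⟨m, n, h⟩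
        refine ⟨m, n, ?_⟩
        apply mul_left_cancel₀ hx
        rw [h]; field_simp
      · rintro ⟨m, n, rfl⟩
        refine ⟨m, n, ?_⟩
        field_simp
    · intro m n m' n' h
      have h2 : (m + n * z : K) = m' + n' * z := by
        have e : ∀ m n : ℤ, (m * (1 / x) + n * (z / x) : K) = (m + n * z) / x := by intro m n; ring
        rw [e, e] at h
        exact (div_left_inj' hx).mp h
      exact indep2 hz h2
  have hM2 : ∀ m n : ℤ, (m * α + n * β : K) ∈ M := fun m n => (hmem _).mpr ⟨m, n, rfl⟩
  have hα : α ∈ M := by simpa using hM2 1 0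
  have hβ : β ∈ M := by simpa using hM2 0 1
  obtain ⟨p, q, hp⟩ := (hmem _).mp (hMω _ hα)
  obtain ⟨r, s, hr⟩ := (hmem _).mp (hMω _ hβ)
  have hωv : ∀ m n : ℤ, ω * (m * α + n * β) = ((m * p + n * r : ℤ) : K) * α + ((m * q + n * s : ℤ) : K) * β := by
    intro m n; push_cast; linear_combination m * hp + n * hr
  have hθω : θ = 2 * ω - 1 := by rw [hω]; ring
  have hq2 : 4 * ω ^ 2 = 4 * ω - 1 - 5 * l := by
    rw [hθω] at hθ; linear_combination hθ
  have hq0 : q ≠ 0 := by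
    rintro rfl
    have hα0 : α ≠ 0 := by
      intro h0; have := (hind 1 0 0 0 (by rw [h0]; simp)).1; omega
    have hωp : ω = p := by
      apply mul_right_cancel₀ hα0
      rw [hp]; simp
    have := indep (p := 1 - 2 * p) (q := 1) hσ (by push_cast; rw [hθω, hωp]; ring)
    omega
  obtain ⟨g1, g2⟩ := hind (4 * (p * p + q * r)) (4 * (p * q + q * s)) (4 * p - 1 - 5 * l) (4 * q) (by
    push_cast
    linear_combination α * hq2 - 4 * (p + ω) * hp - 4 * q * hr + 4 * hp)
  have hps : p + s = 1 := by
    apply mul_left_cancel₀ hq0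
    linarith
  have hqr : 4 * (q * r) = 4 * (p * s) - 1 - 5 * l := by
    have : s = 1 - p := by omega
    subst this
    linear_combination g1
  have hpse : 2 ∣ p * s := by
    have : s = 1 - p := by omega
    subst this
    rcases Int.even_or_odd p with ⟨k, hk⟩ | ⟨k, hk⟩
    · exact ⟨k * (1 - p), by rw [hk]; ring⟩
    · exact ⟨-p * k, by rw [hk]; ring⟩
  have memsub : ∀ e f m n : ℤ, (m * α + n * β : K) ∈ sub2 α β e f ↔ 2 ∣ e * m + f * n := by
    intro e f m n
    constructor
    · rintro ⟨m', n', h, h'⟩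
      obtain ⟨rfl, rfl⟩ := hind _ _ _ _ h
      exact h'
    · intro h; exact ⟨m, n, rfl, h⟩
  have subM : ∀ e f : ℤ, sub2 α β e f ≤ M := by
    rintro e f _ ⟨m, n, rfl, -⟩; exact hM2 m n
  have hLat : ∀ e f : ℤ, Lat θ (sub2 α β e f) := by
    intro e f
    refine ⟨?_, ?_, ?_⟩
    · rintro _ ⟨m, n, rfl, h⟩
      have : θ * (m * α + n * β) = ((2 * (m * p + n * r) - m : ℤ) : K) * α + ((2 * (m * q + n * s) - n : ℤ) : K) * β := by
        have := hωv m n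
        push_cast at this ⊢
        rw [hθω]; linear_combination 2 * this
      rw [this, memsub]
      obtain ⟨k, hk⟩ := h
      exact ⟨e * (m * p + n * r) + f * (m * q + n * s) - k, by linear_combination -hk⟩
    · refine ⟨((2:ℤ):K) * α + ((0:ℤ):K) * β, (memsub e f 2 0).mpr ⟨e, by ring⟩, ?_⟩
      intro h0
      have := (hind 2 0 0 0 (by rw [h0]; simp)).1
      omega
    · obtain ⟨n, hn, h⟩ := hM.fin
      exact ⟨n, hn, fun v hv => h v (subM e f hv)⟩
  have s00 : sub2 α β 0 0 = M := by
    apply le_antisymm (subM 0 0)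
    intro v hv
    obtain ⟨m, n, rfl⟩ := (hmem v).mp hv
    exact (memsub _ _ _ _).mpr (by simp)
  have in00 : sub2 α β 0 0 ∈ FF θ ω M := by
    refine ⟨hLat 0 0, fun v => ?_⟩
    rw [s00]
    exact ⟨fun hv => ⟨v, hv, 0, M.zero_mem, by simp⟩, by
      rintro ⟨u, hu, w, hw, rfl⟩
      exact M.add_mem hu (hMω _ hw)⟩
  have good : ∀ e f m n : ℤ, 2 ∣ e * m + f * n → ¬ 2 ∣ e * (m * p + n * r) + f * (m * q + n * s) →
      sub2 α β e f ∈ FF θ ω M := by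
    intro e f m n h1 h2
    refine ⟨hLat e f, fun v => ⟨fun hv => ?_, ?_⟩⟩
    · obtain ⟨m', n', rfl⟩ := (hmem v).mp hv
      by_cases h3 : 2 ∣ e * m' + f * n'
      · exact ⟨_, (memsub _ _ _ _).mpr h3, 0, AddSubgroup.zero_mem _, by simp⟩
      · refine ⟨((m' - (m * p + n * r) : ℤ) : K) * α + ((n' - (m * q + n * s) : ℤ) : K) * β, (memsub _ _ _ _).mpr ?_, _,
          (memsub e f m n).mpr h1, ?_⟩
        · have e1 : e * (m' - (m * p + n * r)) + f * (n' - (m * q + n * s)) =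
            (e * m' + f * n') - (e * (m * p + n * r) + f * (m * q + n * s)) := by ring
          rw [e1]; omega
        · rw [hωv]; push_cast; ring
    · rintro ⟨u, hu, w, hw, rfl⟩
      exact M.add_mem (subM _ _ hu) (hMω _ (subM _ _ hw))
  have bad : ∀ e f : ℤ, ¬ (2 ∣ e ∧ 2 ∣ f) → (∀ m n : ℤ, 2 ∣ e * m + f * n → 2 ∣ e * (m * p + n * r) + f * (m * q + n * s)) →
      sub2 α β e f ∉ FF θ ω M := by
    rintro e f h0 h ⟨-, h2⟩
    have hle : ∀ v ∈ M, v ∈ sub2 α β e f := by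
      intro v hv
      obtain ⟨u, hu, w, hw, rfl⟩ := (h2 v).mp hv
      refine AddSubgroup.add_mem _ hu ?_
      obtain ⟨m, n, rfl, h3⟩ := hw
      rw [hωv, memsub]
      exact h m n h3
    apply h0
    have h4 := hle _ (hM2 1 0)
    have h5 := hle _ (hM2 0 1)
    rw [memsub] at h4 h5
    simp at h4 h5
    exact ⟨h4, h5⟩
  have i10 : sub2 α β 1 0 ∈ FF θ ω M ↔ ¬ 2 ∣ r := by
    constructor
    · intro h h2
      obtain ⟨k, rfl⟩ := h2
      refine bad 1 0 (by norm_num) ?_ h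
      rintro m n ⟨j, hj⟩
      exact ⟨j * p + n * k, by linear_combination p * hj⟩
    · intro h
      exact good 1 0 0 1 (by norm_num) (by simpa using h)
  have i01 : sub2 α β 0 1 ∈ FF θ ω M ↔ ¬ 2 ∣ q := by
    constructor
    · intro h h2
      obtain ⟨k, rfl⟩ := h2
      refine bad 0 1 (by norm_num) ?_ h
      rintro m n ⟨j, hj⟩
      exact ⟨j * s + m * k, by linear_combination s * hj⟩
    · intro h
      exact good 0 1 1 0 (by norm_num) (by simpa using h)
  have i11 : sub2 α β 1 1 ∈ FF θ ω M ↔ 2 ∣ q + r := by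
    constructor
    · intro h
      by_contra h2
      obtain ⟨k, hk⟩ : 2 ∣ p + q + r + s := by omega
      refine bad 1 1 (by norm_num) ?_ h
      rintro m n ⟨j, hj⟩
      have hn : n = 2 * j - m := by omega
      subst hn
      exact ⟨m * (p + q) + j * (r + s) - m * k, by linear_combination -m * hk⟩
    · intro h
      exact good 1 1 1 1 (by norm_num) (by omega)
  -- classification
  have cls : ∀ L ∈ FF θ ω M, L = sub2 α β 0 0 ∨ L = sub2 α β 1 0 ∨ L = sub2 α β 0 1 ∨ L = sub2 α β 1 1 := by
    rintro L ⟨hL, h⟩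
    have hLM : ∀ v ∈ L, v ∈ M := fun v hv => (h v).mpr ⟨v, hv, 0, L.zero_mem, by simp⟩
    have h2M : ∀ v ∈ M, 2 * v ∈ L := by
      intro v hv
      obtain ⟨u, hu, w, hw, rfl⟩ := (h v).mp hv
      have : 2 * (u + ω * w) = u + u + (w + θ * w) := by linear_combination w * hω
      rw [this]
      exact L.add_mem (L.add_mem hu hu) (L.add_mem hw (hL.st _ hw))
    have hpar : ∀ m n i j : ℤ, ((2 * m + i : ℤ) * α + (2 * n + j : ℤ) * β : K) ∈ L ↔ (i * α + j * β : K) ∈ L := by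
      intro m n i j
      have : ((2 * m + i : ℤ) * α + (2 * n + j : ℤ) * β : K) = 2 * (m * α + n * β) + (i * α + j * β) := by
        push_cast; ring
      rw [this, L.add_mem_cancel_left (h2M _ (hM2 m n))]
    have eqsub : ∀ e f : ℤ, (α ∈ L ↔ 2 ∣ e) → (β ∈ L ↔ 2 ∣ f) → (α + β ∈ L ↔ 2 ∣ e + f) → L = sub2 α β e f := by
      intro e f h1 h2 h3
      ext v
      constructor
      all_goals
        intro hv
        obtain ⟨m, n, rfl⟩ : ∃ m n : ℤ, v = m * α + n * β := by
          first
            | exact (hmem v).mp (hLM v hv)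
            | exact (hmem v).mp (subM _ _ hv)
        revert hv
        rw [memsub]
        obtain ⟨m', i, rfl, hi⟩ : ∃ m' i : ℤ, m = 2 * m' + i ∧ (i = 0 ∨ i = 1) := ⟨m / 2, m % 2, by omega, by omega⟩
        obtain ⟨n', j, rfl, hj⟩ : ∃ m' i : ℤ, n = 2 * m' + i ∧ (i = 0 ∨ i = 1) := ⟨n / 2, n % 2, by omega, by omega⟩
        rw [hpar]
        have e1 : e * (2 * m' + i) + f * (2 * n' + j) = 2 * (e * m' + f * n') + (e * i + f * j) := by ring
        rw [e1, dvd_add_right (Dvd.intro _ rfl)]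
        rcases hi with rfl | rfl <;> rcases hj with rfl | rfl <;> simp [h1, h2, h3]
    have hab : α ∈ L → (α + β ∈ L ↔ β ∈ L) := fun h => L.add_mem_cancel_left h
    have hba : β ∈ L → (α + β ∈ L ↔ α ∈ L) := fun h => L.add_mem_cancel_right h
    by_cases a1 : α ∈ L <;> by_cases a2 : β ∈ L <;> by_cases a3 : α + β ∈ L
    · left; apply eqsub <;> simp [a1, a2, a3]
    · exact absurd ((hab a1).mpr a2) a3
    · exact absurd ((hab a1).mp a3) a2
    · right; right; left; apply eqsub <;> simp [a1, a2, a3]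
    · exact absurd ((hba a2).mp a3) a1
    · right; left; apply eqsub <;> simp [a1, a2, a3]
    · right; right; right; apply eqsub <;> simp [a1, a2, a3]
    · exfalso
      have hev : ∀ m n : ℤ, (m * α + n * β : K) ∈ L → 2 ∣ m ∧ 2 ∣ n := by
        intro m n
        obtain ⟨m', i, rfl, hi⟩ : ∃ m' i : ℤ, m = 2 * m' + i ∧ (i = 0 ∨ i = 1) := ⟨m / 2, m % 2, by omega, by omega⟩
        obtain ⟨n', j, rfl, hj⟩ : ∃ m' i : ℤ, n = 2 * m' + i ∧ (i = 0 ∨ i = 1) := ⟨n / 2, n % 2, by omega, by omega⟩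
        rw [hpar]
        rcases hi with rfl | rfl <;> rcases hj with rfl | rfl <;> simp [a1, a2, a3]
      obtain ⟨u, hu, w, hw, huw⟩ := (h α).mp hα
      obtain ⟨m, n, rfl⟩ := (hmem _).mp (hLM _ hu)
      obtain ⟨m', n', rfl⟩ := (hmem _).mp (hLM _ hw)
      obtain ⟨⟨k1, rfl⟩, ⟨k2, rfl⟩⟩ := hev _ _ hu
      obtain ⟨⟨k3, rfl⟩, ⟨k4, rfl⟩⟩ := hev _ _ hw
      rw [hωv] at huw
      have := (hind 1 0 (2 * k1 + (2 * k3 * p + 2 * k4 * r)) (2 * k2 + (2 * k3 * q + 2 * k4 * s)) (by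
        push_cast at huw ⊢
        linear_combination huw)).1
      have : (2:ℤ) ∣ 1 := ⟨k1 + k3 * p + k4 * r, by linarith⟩
      norm_num at this
  have dist : ∀ e f e' f' : ℤ, sub2 α β e f = sub2 α β e' f' → (2 ∣ e ↔ 2 ∣ e') ∧ (2 ∣ f ↔ 2 ∣ f') := by
    intro e f e' f' h
    constructor
    · have h1 := memsub e f 1 0
      rw [h, memsub] at h1
      simpa using h1.symm
    · have h1 := memsub e f 0 1
      rw [h, memsub] at h1
      simpa using h1.symm
  have d1 : sub2 α β 0 0 ≠ sub2 α β 1 0 := fun h => by have := dist _ _ _ _ h; omega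
  have d2 : sub2 α β 0 0 ≠ sub2 α β 0 1 := fun h => by have := dist _ _ _ _ h; omega
  have d3 : sub2 α β 0 0 ≠ sub2 α β 1 1 := fun h => by have := dist _ _ _ _ h; omega
  have d4 : sub2 α β 1 0 ≠ sub2 α β 0 1 := fun h => by have := dist _ _ _ _ h; omega
  have d5 : sub2 α β 1 0 ≠ sub2 α β 1 1 := fun h => by have := dist _ _ _ _ h; omega
  have d6 : sub2 α β 0 1 ≠ sub2 α β 1 1 := fun h => by have := dist _ _ _ _ h; omega
  constructor
  · intro h8
    have hqr2 : 2 ∣ q * r := by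
      obtain ⟨k, hk⟩ := hpse
      rw [hk] at hqr
      omega
    have hone : ∀ L1 L2 L3 : AddSubgroup K, L1 ∈ FF θ ω M → L2 ∉ FF θ ω M → L3 ∉ FF θ ω M →
        sub2 α β 0 0 ≠ L1 → (∀ L ∈ FF θ ω M, L = sub2 α β 0 0 ∨ L = L1 ∨ L = L2 ∨ L = L3) →
        (FF θ ω M).ncard = 2 := by
      intro L1 L2 L3 h1 h2 h3 h4 h5
      rw [Set.ncard_eq_two]
      refine ⟨_, L1, h4, ?_⟩
      ext L
      constructor
      · intro hL
        rcases h5 L hL with rfl | rfl | rfl | rfl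
        · simp
        · simp
        · exact absurd hL h2
        · exact absurd hL h3
      · rintro (rfl | rfl)
        · exact in00
        · exact h1
    rcases Int.even_or_odd q with hq | hq <;> rcases Int.even_or_odd r with hr' | hr'
    · have e1 := even_iff_two_dvd.mp hq
      have e2 := even_iff_two_dvd.mp hr'
      exact hone (sub2 α β 1 1) (sub2 α β 1 0) (sub2 α β 0 1) (i11.mpr (by omega)) (by rw [i10]; omega) (by rw [i01]; omega) d3
        (fun L hL => by rcases cls L hL with h | h | h | h <;> simp [h])
    · have e1 := even_iff_two_dvd.mp hq
      obtain ⟨k, hk⟩ := hr'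
      exact hone (sub2 α β 1 0) (sub2 α β 1 1) (sub2 α β 0 1) (i10.mpr (by omega)) (by rw [i11]; omega) (by rw [i01]; omega) d1
        (fun L hL => by rcases cls L hL with h | h | h | h <;> simp [h])
    · have e2 := even_iff_two_dvd.mp hr'
      obtain ⟨k, hk⟩ := hq
      exact hone (sub2 α β 0 1) (sub2 α β 1 1) (sub2 α β 1 0) (i01.mpr (by omega)) (by rw [i11]; omega) (by rw [i10]; omega) d2
        (fun L hL => by rcases cls L hL with h | h | h | h <;> simp [h])
    · have := (hq.mul hr')
      rw [← Int.not_even_iff_odd, even_iff_two_dvd] at this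
      exact absurd hqr2 this
  · intro h8
    have hqr2 : ¬ 2 ∣ q * r := by
      obtain ⟨k, hk⟩ := hpse
      rw [hk] at hqr
      omega
    have e1 : ¬ 2 ∣ q := fun h => hqr2 (h.mul_right _)
    have e2 : ¬ 2 ∣ r := fun h => hqr2 (h.mul_left _)
    have hset : FF θ ω M = {sub2 α β 0 0, sub2 α β 1 0, sub2 α β 0 1, sub2 α β 1 1} := by
      ext L
      constructor
      · intro hL; exact cls L hL
      · rintro (rfl | rfl | rfl | rfl)
        · exact in00
        · exact i10.mpr e2
        · exact i01.mpr e1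
        · exact i11.mpr (by omega)
    rw [hset, Set.ncard_insert_of_notMem (by simp [d1, d2, d3]), Set.ncard_insert_of_notMem (by simp [d4, d5]),
      Set.ncard_pair d6]

end
end QH

namespace QH

section
variable {K : Type*} [Field K] [NumberField K] {θ : K} {l : ℕ} {σ : K →+* ℂ}

theorem sig_sq (hθ : θ ^ 2 = -((5 * l : ℕ) : K)) (σ : K →+* ℂ) :
    σ θ ^ 2 = -((5 * l : ℕ) : ℂ) := by
  rw [← map_pow, hθ, map_neg, map_natCast]

theorem sig_re (hl : 5 < l) (hθ : θ ^ 2 = -((5 * l : ℕ) : K)) (σ : K →+* ℂ) :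
    (σ θ).re = 0 ∧ (σ θ).im ^ 2 = 5 * l := by
  have h := sig_sq hθ σ
  have h1 := congrArg Complex.re h
  have h2 := congrArg Complex.im h
  simp [pow_two] at h1 h2
  have h3 : (0 : ℝ) < 5 * l := by positivity
  have h4 : (σ θ).re = 0 := by
    by_contra hne
    have : (σ θ).im = 0 := by
      have : (σ θ).re * (σ θ).im = 0 := by linarith
      rcases mul_eq_zero.mp this with h | h
      · exact absurd h hne
      · exact h
    rw [this] at h1
    nlinarith [sq_nonneg (σ θ).re]
  refine ⟨h4, ?_⟩
  rw [h4] at h1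
  linarith

theorem sig_exists (hl : 5 < l) (hθ : θ ^ 2 = -((5 * l : ℕ) : K)) :
    ∃ σ : K →+* ℂ, 0 < (σ θ).im := by
  obtain ⟨σ⟩ : Nonempty (K →+* ℂ) := inferInstance
  have h := (sig_re hl hθ σ).2
  have h3 : (0 : ℝ) < 5 * l := by positivity
  rcases lt_trichotomy (σ θ).im 0 with h1 | h1 | h1
  · refine ⟨(starRingEnd ℂ).comp σ, ?_⟩
    simp; exact h1
  · rw [h1] at h; norm_num at h; linarith
  · exact ⟨σ, h1⟩

theorem coords (hl : 5 < l) (hθ : θ ^ 2 = -((5 * l : ℕ) : K)) (hK : Module.finrank ℚ K = 2) (v : K) :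
    ∃ u w : ℚ, v = u + w * θ := by
  obtain ⟨σ, hσ⟩ := sig_exists hl hθ
  have hli : LinearIndependent ℚ ![(1 : K), θ] := by
    rw [LinearIndependent.pair_iff]
    intro s t h
    rw [Algebra.smul_def, Algebra.smul_def] at h
    have h2 := congrArg (fun v => (σ v)) h
    simp at h2
    have h3 := congrArg Complex.im h2
    have h4 := congrArg Complex.re h2
    simp at h3 h4
    have ht : t = 0 := by
      rcases h3 with h3 | h3
      · exact h3
      · exact absurd h3 hσ.ne'
    subst ht
    simp at h4
    exact ⟨h4, rfl⟩
  have := hli.span_eq_top_of_card_eq_finrank' (by simp [hK])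
  have hv : v ∈ Submodule.span ℚ (Set.range ![(1 : K), θ]) := by rw [this]; trivial
  simp only [Matrix.range_cons, Matrix.range_empty, Set.union_empty, Set.singleton_union] at hv
  rw [Submodule.mem_span_pair] at hv
  obtain ⟨a, b, h⟩ := hv
  refine ⟨a, b, ?_⟩
  rw [← h, Algebra.smul_def, Algebra.smul_def]
  simp

theorem rat_int {q : ℚ} (h : IsIntegral ℤ ((q : ℚ) : ℂ)) : ∃ n : ℤ, q = n := by
  have h2 : IsIntegral ℤ q := by
    rw [← isIntegral_algebraMap_iff (B := ℂ) (algebraMap ℚ ℂ).injective]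
    simpa using h
  obtain ⟨n, hn⟩ := IsIntegrallyClosed.isIntegral_iff.mp h2
  exact ⟨n, by rw [← hn]; simp⟩

theorem sqf_rat {N : ℕ} (hN : Squarefree N) {t : ℚ} {k : ℤ} (h : (N : ℚ) * t ^ 2 = k) :
    ∃ n : ℤ, t = n := by
  have hd : (t.den : ℚ) ≠ 0 := by exact_mod_cast t.den_nz
  have h1 : (N : ℤ) * t.num ^ 2 = k * (t.den : ℤ) ^ 2 := by
    have h2 : t = t.num / t.den := (Rat.num_div_den t).symm
    rw [h2] at h
    field_simp at h
    rw [mul_comm k]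
    exact_mod_cast h
  have h2 : ((t.den : ℤ)) ^ 2 ∣ N * t.num ^ 2 := ⟨k, by rw [h1]; ring⟩
  have hc : IsCoprime ((t.den : ℤ) ^ 2) (t.num ^ 2) := by
    apply IsCoprime.pow
    rw [Int.isCoprime_iff_gcd_eq_one]
    have := t.reduced
    rw [Int.gcd_comm]
    simpa [Int.gcd, Nat.Coprime] using this
  have h3 := hc.dvd_of_dvd_mul_right h2
  have h4 : t.den * t.den ∣ N := by
    rw [← pow_two]; exact_mod_cast h3
  have h5 := hN _ h4
  rw [Nat.isUnit_iff] at h5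
  exact ⟨t.num, by conv_lhs => rw [← Rat.num_div_den t, h5]; simp⟩

theorem sqf5 (hl : l.Prime) (hl5 : 5 < l) : Squarefree (5 * l) := by
  rw [Nat.squarefree_mul_iff]
  refine ⟨?_, (by norm_num : Nat.Prime 5).squarefree, hl.squarefree⟩
  exact (Nat.coprime_primes (by norm_num) hl).mpr (by omega)

/-- integral elements -/
theorem int_form (hl : l.Prime) (hl5 : 5 < l) (hθ : θ ^ 2 = -((5 * l : ℕ) : K))
    (hK : Module.finrank ℚ K = 2) {x : K} (hx : IsIntegral ℤ x) :
    ∃ s t n : ℤ, 2 * x = s + t * θ ∧ s ^ 2 + 5 * l * t ^ 2 = 4 * n ∧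
      ∀ σ : K →+* ℂ, (n : ℝ) = Complex.normSq (σ x) := by
  obtain ⟨u, w, hv⟩ := coords hl5 hθ hK x
  have hns : ∀ σ : K →+* ℂ, Complex.normSq (σ x) = u ^ 2 + 5 * l * w ^ 2 := by
    intro σ
    have h := sig_re hl5 hθ σ
    rw [hv, Complex.normSq_apply]
    simp
    rw [h.1]
    have := h.2
    linear_combination (w : ℝ) ^ 2 * this
  obtain ⟨σ, hσ⟩ := sig_exists hl5 hθ
  have h1 : IsIntegral ℤ (σ x) := hx.map (σ.toIntAlgHom)
  have h2 : IsIntegral ℤ (starRingEnd ℂ (σ x)) := h1.map ((starRingEnd ℂ).toIntAlgHom)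
  obtain ⟨s, hs⟩ : ∃ s : ℤ, 2 * u = s := by
    apply rat_int
    have e : ((2 * u : ℚ) : ℂ) = σ x + starRingEnd ℂ (σ x) := by
      rw [Complex.add_conj, hv]
      have h := (sig_re hl5 hθ σ).1
      simp [h]
    rw [e]
    exact h1.add h2
  obtain ⟨n, hn⟩ : ∃ n : ℤ, u ^ 2 + 5 * l * w ^ 2 = n := by
    apply rat_int
    have e : ((u ^ 2 + 5 * l * w ^ 2 : ℚ) : ℂ) = σ x * starRingEnd ℂ (σ x) := by
      rw [Complex.mul_conj, hns]
      push_cast; rfl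
    rw [e]
    exact h1.mul h2
  obtain ⟨t, ht⟩ : ∃ t : ℤ, 2 * w = t := by
    apply sqf_rat (sqf5 hl hl5) (k := 4 * n - s ^ 2)
    push_cast
    rw [← hn, ← hs]; ring
  refine ⟨s, t, n, ?_, ?_, ?_⟩
  · have h3 : ((2 * u : ℚ) : K) = s := by rw [hs]; simp
    have h4 : ((2 * w : ℚ) : K) = t := by rw [ht]; simp
    push_cast at h3 h4
    rw [hv, ← h3, ← h4]; ring
  · have : ((s ^ 2 + 5 * l * t ^ 2 : ℤ) : ℚ) = (4 * n : ℤ) := by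
      push_cast
      rw [← hn, ← hs, ← ht]; ring
    exact_mod_cast this
  · intro σ
    rw [hns]
    have : ((u ^ 2 + 5 * l * w ^ 2 : ℚ) : ℝ) = n := by rw [hn]; simp
    rw [← this]; push_cast; rfl

/-- data of an integral generator -/
structure Gen (l : ℕ) (θ ω : K) : Prop where
  int : IsIntegral ℤ ω
  th : IsIntegral ℤ θ
  gen : ∀ x : K, IsIntegral ℤ x → ∃ p q : ℤ, x = p + q * ω
  two : ∀ x : K, IsIntegral ℤ x → ∃ p q : ℤ, 2 * x = p + q * θ
  unit : ∀ x y : K, IsIntegral ℤ x → IsIntegral ℤ y → x * y = 1 → x = 1 ∨ x = -1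

theorem th_int (hθ : θ ^ 2 = -((5 * l : ℕ) : K)) : IsIntegral ℤ θ := by
  apply IsIntegral.of_pow (n := 2) (by norm_num)
  rw [hθ]
  exact (isIntegral_natCast (a := 5 * l)).neg

theorem unit_pm (hl : l.Prime) (hl5 : 5 < l) (hθ : θ ^ 2 = -((5 * l : ℕ) : K))
    (hK : Module.finrank ℚ K = 2) (x y : K) (hx : IsIntegral ℤ x) (hy : IsIntegral ℤ y)
    (h : x * y = 1) : x = 1 ∨ x = -1 := by
  obtain ⟨σ, hσ⟩ := sig_exists hl5 hθ
  obtain ⟨s, t, n, h1, h2, h3⟩ := int_form hl hl5 hθ hK hx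
  obtain ⟨s', t', n', h1', h2', h3'⟩ := int_form hl hl5 hθ hK hy
  have h4 : n * n' = 1 := by
    have : ((n * n' : ℤ) : ℝ) = 1 := by
      push_cast
      rw [h3 σ, h3' σ, ← Complex.normSq_mul, ← map_mul, h]; simp
    exact_mod_cast this
  have hn0 : 0 ≤ n := by
    have : (0 : ℝ) ≤ n := by rw [h3 σ]; exact Complex.normSq_nonneg _
    exact_mod_cast this
  have hn : n = 1 := by
    rcases Int.eq_one_or_neg_one_of_mul_eq_one h4 with h | h
    · exact h
    · omega
  rw [hn] at h2
  have hl5' : (5 : ℤ) < l := by exact_mod_cast hl5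
  have ht : t = 0 := by
    by_contra hne
    have : 1 ≤ t ^ 2 := by
      have := sq_pos_of_ne_zero hne; omega
    nlinarith [sq_nonneg s]
  rw [ht] at h2 h1
  have hs : (s - 2) * (s + 2) = 0 := by linarith
  have h20 : (2 : K) ≠ 0 := two_ne_zero
  rcases mul_eq_zero.mp hs with hs | hs
  · left
    have : s = 2 := by omega
    rw [this] at h1
    apply mul_left_cancel₀ h20
    rw [h1]; simp
  · right
    have : s = -2 := by omega
    rw [this] at h1
    apply mul_left_cancel₀ h20
    rw [h1]; push_cast; simp

theorem gen1 (hl : l.Prime) (hl5 : 5 < l) (h4 : l % 4 = 1) (hθ : θ ^ 2 = -((5 * l : ℕ) : K))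
    (hK : Module.finrank ℚ K = 2) : Gen l θ θ := by
  refine ⟨th_int hθ, th_int hθ, fun x hx => ?_, fun x hx => ?_, unit_pm hl hl5 hθ hK⟩
  · obtain ⟨s, t, n, h1, h2, -⟩ := int_form hl hl5 hθ hK hx
    obtain ⟨k, hk⟩ : ∃ k : ℤ, (l : ℤ) = 4 * k + 1 := ⟨l / 4, by omega⟩
    rw [hk] at h2
    have h20 : (2 : K) ≠ 0 := two_ne_zero
    rcases Int.even_or_odd' s with ⟨s, rfl | rfl⟩ <;> rcases Int.even_or_odd' t with ⟨t, rfl | rfl⟩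
    · refine ⟨s, t, ?_⟩
      apply mul_left_cancel₀ h20
      rw [h1]; push_cast; ring
    all_goals
      ring_nf at h2
      exfalso
      omega
  · obtain ⟨s, t, n, h1, h2, -⟩ := int_form hl hl5 hθ hK hx
    exact ⟨s, t, h1⟩

theorem gen3 (hl : l.Prime) (hl5 : 5 < l) (h4 : l % 4 = 3) (hθ : θ ^ 2 = -((5 * l : ℕ) : K))
    (hK : Module.finrank ℚ K = 2) {ω : K} (hω : 2 * ω = 1 + θ) : Gen l θ ω := by
  have h20 : (2 : K) ≠ 0 := two_ne_zero
  refine ⟨?_, th_int hθ, fun x hx => ?_, fun x hx => ?_, unit_pm hl hl5 hθ hK⟩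
  · obtain ⟨k, hk⟩ : ∃ k : ℕ, 5 * l + 1 = 4 * k := ⟨(5 * l + 1) / 4, by omega⟩
    have hk' : (((5 * l : ℕ) : K) + 1) = 4 * k := by exact_mod_cast hk
    refine ⟨X ^ 2 - X + C (k : ℤ), ?_, ?_⟩
    · monicity!
    · simp
      have : (4 : K) ≠ 0 := by norm_num
      apply mul_left_cancel₀ this
      linear_combination (2 * ω - 1 + θ) * hω + hθ - hk'
  · obtain ⟨s, t, n, h1, h2, -⟩ := int_form hl hl5 hθ hK hx
    have hst : ∃ k, s - t = 2 * k := by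
      obtain ⟨k, hk⟩ : ∃ k : ℤ, (l : ℤ) = 4 * k + 3 := ⟨l / 4, by omega⟩
      rw [hk] at h2
      rcases Int.even_or_odd' s with ⟨s, rfl | rfl⟩ <;> rcases Int.even_or_odd' t with ⟨t, rfl | rfl⟩
      · exact ⟨s - t, by ring⟩
      · ring_nf at h2; exfalso; omega
      · ring_nf at h2; exfalso; omega
      · exact ⟨s - t, by ring⟩
    obtain ⟨k, hk⟩ := hst
    refine ⟨k, t, ?_⟩
    apply mul_left_cancel₀ h20
    have hk' : (s : K) - t = 2 * k := by exact_mod_cast hk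
    linear_combination h1 + hk' - t * hω
  · obtain ⟨s, t, n, h1, h2, -⟩ := int_form hl hl5 hθ hK hx
    exact ⟨s, t, h1⟩

end

end QH

namespace QH

section
variable {K : Type*} [Field K] [NumberField K] {θ ω : K} {l : ℕ} {σ : K →+* ℂ}

open NumberField nonZeroDivisors

/-- image of an ideal in the field -/
def MI (I : Ideal (𝓞 K)) : AddSubgroup K :=
  I.toAddSubgroup.map (algebraMap (𝓞 K) K).toAddMonoidHom

theorem mem_MI {I : Ideal (𝓞 K)} {v : K} : v ∈ MI I ↔ ∃ a ∈ I, algebraMap (𝓞 K) K a = v := Iff.rfl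

theorem MI_smul {I : Ideal (𝓞 K)} {x v : K} (hx : IsIntegral ℤ x) (hv : v ∈ MI I) : x * v ∈ MI I := by
  obtain ⟨a, ha, rfl⟩ := hv
  exact ⟨⟨x, hx⟩ * a, I.mul_mem_left _ ha, map_mul (algebraMap (𝓞 K) K) _ _⟩

theorem MI_lat (hG : Gen l θ ω) {I : Ideal (𝓞 K)} (hI : I ≠ ⊥) : Lat θ (MI I) := by
  refine ⟨fun v hv => MI_smul hG.th hv, ?_, 2, by norm_num, ?_⟩
  · obtain ⟨a, ha, h0⟩ := Submodule.exists_mem_ne_zero_of_ne_bot hI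
    exact ⟨a, ⟨a, ha, rfl⟩, by simpa using h0⟩
  · rintro _ ⟨a, ha, rfl⟩
    have := hG.two _ (NumberField.RingOfIntegers.isIntegral_coe a)
    simpa using this

theorem MI_span {I J : Ideal (𝓞 K)} {x : K} (hx : x ≠ 0) (h : ∀ v, v ∈ MI I ↔ x * v ∈ MI J) :
    FractionalIdeal.spanSingleton (𝓞 K)⁰ x * (I : FractionalIdeal (𝓞 K)⁰ K) = J := by
  ext v
  rw [FractionalIdeal.mem_singleton_mul, FractionalIdeal.mem_coeIdeal]
  constructor
  · rintro ⟨y, hy, rfl⟩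
    rw [FractionalIdeal.mem_coeIdeal] at hy
    exact (h y).mp hy
  · intro hv
    refine ⟨v / x, ?_, by field_simp⟩
    rw [FractionalIdeal.mem_coeIdeal]
    apply (h (v / x)).mpr
    rw [mul_div_cancel₀ _ hx]
    exact hv

theorem MI_of_span {I J : Ideal (𝓞 K)} {x : K} (hx : x ≠ 0)
    (h : FractionalIdeal.spanSingleton (𝓞 K)⁰ x * (I : FractionalIdeal (𝓞 K)⁰ K) = J) (v : K) :
    v ∈ MI I ↔ x * v ∈ MI J := by
  have h1 : x * v ∈ MI J ↔ x * v ∈ (J : FractionalIdeal (𝓞 K)⁰ K) := (FractionalIdeal.mem_coeIdeal _).symm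
  rw [h1, ← h, FractionalIdeal.mem_singleton_mul]
  constructor
  · intro hv
    exact ⟨v, (FractionalIdeal.mem_coeIdeal _).mpr hv, rfl⟩
  · rintro ⟨y, hy, hxy⟩
    rw [mul_left_cancel₀ hx hxy]
    exact (FractionalIdeal.mem_coeIdeal _).mp hy

theorem MI_unit (hG : Gen l θ ω) {I : Ideal (𝓞 K)} (hI : I ≠ ⊥) {x : K} (hx : x ≠ 0)
    (h : ∀ v, v ∈ MI I ↔ x * v ∈ MI I) : x = 1 ∨ x = -1 := by
  have h1 := MI_span hx h
  have hI' : (I : FractionalIdeal (𝓞 K)⁰ K) ≠ 0 := FractionalIdeal.coeIdeal_ne_zero.mpr hI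
  have h2 : FractionalIdeal.spanSingleton (𝓞 K)⁰ x = 1 := by
    apply mul_right_cancel₀ hI'
    rw [h1, one_mul]
  have h3 : x ∈ (1 : FractionalIdeal (𝓞 K)⁰ K) := by
    rw [← h2]; exact FractionalIdeal.mem_spanSingleton_self _ _
  have h4 : (1 : K) ∈ FractionalIdeal.spanSingleton (𝓞 K)⁰ x := by
    rw [h2]; exact FractionalIdeal.one_mem_one _
  obtain ⟨a, ha⟩ := (FractionalIdeal.mem_one_iff _).mp h3
  obtain ⟨b, hb⟩ := (FractionalIdeal.mem_spanSingleton _).mp h4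
  rw [Algebra.smul_def] at hb
  apply hG.unit x (algebraMap _ _ b) ?_ (NumberField.RingOfIntegers.isIntegral_coe b) (by rw [mul_comm, hb])
  rw [← ha]; exact NumberField.RingOfIntegers.isIntegral_coe a

/-- representatives -/
theorem exists_rep (K : Type*) [Field K] [NumberField K] :
    ∃ rep : ClassGroup (𝓞 K) → Ideal (𝓞 K), (∀ C, rep C ≠ ⊥) ∧
      (∀ C C' x, x ≠ 0 → (∀ v, v ∈ MI (rep C) ↔ x * v ∈ MI (rep C')) → C = C') ∧
      (∀ I : Ideal (𝓞 K), I ≠ ⊥ → ∃ C, Hom (MI I) (MI (rep C))) := by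
  choose rep hrep using (ClassGroup.mk0_surjective (R := 𝓞 K))
  refine ⟨fun C => rep C, fun C => nonZeroDivisors.coe_ne_zero _, ?_, ?_⟩
  · intro C C' x hx h
    rw [← hrep C, ← hrep C', ClassGroup.mk0_eq_mk0_iff_exists_fraction_ring K]
    exact ⟨x, hx, MI_span hx h⟩
  · intro I hI
    let I0 : (Ideal (𝓞 K))⁰ := ⟨I, mem_nonZeroDivisors_of_ne_zero hI⟩
    refine ⟨ClassGroup.mk0 I0, ?_⟩
    have := (hrep (ClassGroup.mk0 I0)).symm
    rw [ClassGroup.mk0_eq_mk0_iff_exists_fraction_ring K] at this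
    obtain ⟨x, hx, h⟩ := this
    exact ⟨x, hx, MI_of_span hx h⟩

/-- the saturation -/
def EL (ω : K) (L : AddSubgroup K) : AddSubgroup K where
  carrier := {v | ∃ u ∈ L, ∃ w ∈ L, v = u + ω * w}
  zero_mem' := ⟨0, L.zero_mem, 0, L.zero_mem, by simp⟩
  add_mem' := by
    rintro _ _ ⟨u, hu, w, hw, rfl⟩ ⟨u', hu', w', hw', rfl⟩
    exact ⟨u + u', L.add_mem hu hu', w + w', L.add_mem hw hw', by ring⟩
  neg_mem' := by
    rintro _ ⟨u, hu, w, hw, rfl⟩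
    exact ⟨-u, L.neg_mem hu, -w, L.neg_mem hw, by ring⟩

theorem int_int (p : ℤ) : IsIntegral ℤ (p : K) := by
  have := isIntegral_algebraMap (R := ℤ) (A := K) (x := p)
  simpa using this

theorem int_mul_mem {L : AddSubgroup K} (n : ℤ) {v : K} (hv : v ∈ L) : (n : K) * v ∈ L := by
  rw [← zsmul_eq_mul]; exact L.zsmul_mem hv n

theorem EL_smul (hG : Gen l θ ω) {L : AddSubgroup K} {x v : K} (hx : IsIntegral ℤ x)
    (hv : v ∈ EL ω L) : x * v ∈ EL ω L := by
  have key : ∀ v ∈ EL ω L, ω * v ∈ EL ω L := by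
    rintro _ ⟨u, hu, w, hw, rfl⟩
    obtain ⟨p, q, h⟩ := hG.gen _ (hG.int.mul hG.int)
    refine ⟨p * w, int_mul_mem p hw, u + q * w, L.add_mem hu (int_mul_mem q hw), ?_⟩
    linear_combination w * h
  obtain ⟨p, q, h⟩ := hG.gen _ hx
  have : x * v = p * v + q * (ω * v) := by rw [h]; ring
  rw [this]
  exact AddSubgroup.add_mem _ (int_mul_mem p hv) (int_mul_mem q (key _ hv))

theorem EL_lat (hG : Gen l θ ω) {L : AddSubgroup K} (hL : Lat θ L) : Lat θ (EL ω L) := by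
  refine ⟨fun v hv => EL_smul hG hG.th hv, ?_, ?_⟩
  · obtain ⟨v, hv, h0⟩ := hL.ne
    exact ⟨v, ⟨v, hv, 0, L.zero_mem, by simp⟩, h0⟩
  · obtain ⟨n, hn, h⟩ := hL.fin
    refine ⟨2 * n, by omega, ?_⟩
    rintro _ ⟨u, hu, w, hw, rfl⟩
    obtain ⟨p, q, h1⟩ := h u hu
    have h2 : IsIntegral ℤ ((n : K) * w) := by
      obtain ⟨p, q, h3⟩ := h w hw
      rw [h3]
      exact (int_int p).add ((int_int q).mul hG.th)
    obtain ⟨p', q', h4⟩ := hG.two _ (hG.int.mul h2)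
    refine ⟨2 * p + p', 2 * q + q', ?_⟩
    push_cast
    linear_combination 2 * h1 + h4

/-- stable lattices come from ideals -/
theorem lat_ideal (hG : Gen l θ ω) {L : AddSubgroup K} (hL : Lat θ L)
    (hst : ∀ x v : K, IsIntegral ℤ x → v ∈ L → x * v ∈ L) :
    ∃ I : Ideal (𝓞 K), I ≠ ⊥ ∧ Hom L (MI I) := by
  obtain ⟨n, hn, h⟩ := hL.fin
  have hn' : (n : K) ≠ 0 := by exact_mod_cast hn
  let I : Ideal (𝓞 K) :=
    { carrier := {a | ∃ v ∈ L, (n : K) * v = algebraMap (𝓞 K) K a}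
      zero_mem' := ⟨0, L.zero_mem, by simp⟩
      add_mem' := by
        rintro a b ⟨v, hv, h⟩ ⟨v', hv', h'⟩
        exact ⟨v + v', L.add_mem hv hv', by rw [map_add, ← h, ← h']; ring⟩
      smul_mem' := by
        rintro c a ⟨v, hv, h⟩
        refine ⟨algebraMap (𝓞 K) K c * v, hst _ _ (NumberField.RingOfIntegers.isIntegral_coe c) hv, ?_⟩
        rw [smul_eq_mul, map_mul, ← h]; ring }
  have hIntegral : ∀ v ∈ L, IsIntegral ℤ ((n : K) * v) := by
    intro v hv
    obtain ⟨p, q, h3⟩ := h v hv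
    rw [h3]
    exact (int_int p).add ((int_int q).mul hG.th)
  have hH : ∀ v, v ∈ L ↔ (n : K) * v ∈ MI I := by
    intro v
    constructor
    · intro hv
      exact ⟨⟨(n : K) * v, hIntegral v hv⟩, ⟨v, hv, rfl⟩, rfl⟩
    · rintro ⟨a, ⟨v', hv', h1⟩, h2⟩
      have : (n : K) * v' = n * v := by rw [h1]; exact h2
      rw [← mul_left_cancel₀ hn' this]; exact hv'
  refine ⟨I, ?_, n, hn', hH⟩
  intro hI
  obtain ⟨v, hv, h0⟩ := hL.ne
  obtain ⟨a, ha, h2⟩ := (hH v).mp hv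
  rw [hI] at ha
  have ha' : a = 0 := ha
  rw [ha'] at h2
  have h2' : (n : K) * v = 0 := by rw [← h2]; exact map_zero _
  exact (mul_ne_zero hn' h0) h2'

/-- scaling -/
def scale (x : K) (L : AddSubgroup K) : AddSubgroup K := L.map (AddMonoidHom.mulLeft x)

theorem mem_scale {x : K} {L : AddSubgroup K} {v : K} : v ∈ scale x L ↔ ∃ u ∈ L, x * u = v := Iff.rfl

theorem scale_hom {x : K} (hx : x ≠ 0) (L : AddSubgroup K) : Hom L (scale x L) := by
  refine ⟨x, hx, fun v => ⟨fun hv => ⟨v, hv, rfl⟩, ?_⟩⟩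
  rintro ⟨u, hu, h⟩
  rw [← mul_left_cancel₀ hx h]; exact hu

theorem main_count (hl : l.Prime) (hl5 : 5 < l) (hθ : θ ^ 2 = -((5 * l : ℕ) : K))
    (hσ : 0 < (σ θ).im) (hG : Gen l θ ω) {m : ℕ} (hm : 0 < m)
    (hF : ∀ M : AddSubgroup K, Lat θ M → (∀ v ∈ M, ω * v ∈ M) → (FF θ ω M).ncard = m) :
    (tX l).ncard = NumberField.classNumber K * m := by
  obtain ⟨rep, hr0, hr1, hr2⟩ := exists_rep K
  have hFC : ∀ C, (FF θ ω (MI (rep C))).ncard = m := fun C =>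
    hF _ (MI_lat hG (hr0 C)) (fun v hv => MI_smul hG.int hv)
  have hfin : ∀ C, Finite (FF θ ω (MI (rep C))) := fun C =>
    (Set.finite_of_ncard_pos (by rw [hFC]; exact hm)).to_subtype
  have hz : ∀ p : (Σ C, FF θ ω (MI (rep C))), ∃ z, 0 < (σ z).im ∧
      (∃ a b c, CM l (σ z) a b c (-a)) ∧ Zr p.2.1 z := fun p => lat_exists hθ hσ p.2.2.1
  choose z hz1 hz2 hz3 using hz
  let f : (Σ C, FF θ ω (MI (rep C))) → ℂ := fun p => tt (σ (z p))
  have hinj : Function.Injective f := by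
    rintro ⟨C, L, hL⟩ ⟨C', L', hL'⟩ h
    obtain ⟨x, hx, hxL⟩ := lat_hom (hz1 _) (hz1 _) (hz3 _) (hz3 _) h
    simp only at hxL
    have hM : ∀ v, v ∈ MI (rep C) ↔ x * v ∈ MI (rep C') := by
      intro v
      rw [hL.2, hL'.2]
      constructor
      · rintro ⟨u, hu, w, hw, rfl⟩
        exact ⟨x * u, (hxL _).mp hu, x * w, (hxL _).mp hw, by ring⟩
      · rintro ⟨u, hu, w, hw, h⟩
        refine ⟨u / x, (hxL _).mpr (by rwa [mul_div_cancel₀ _ hx]), w / x,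
          (hxL _).mpr (by rwa [mul_div_cancel₀ _ hx]), ?_⟩
        field_simp
        rw [mul_comm, h]
    have hC := hr1 C C' x hx hM
    subst hC
    have hLL : L = L' := by
      ext v
      rw [hxL]
      rcases MI_unit hG (hr0 C) hx hM with rfl | rfl
      · simp
      · simp
    subst hLL
    rfl
  have hrange : Set.range f = tX l := by
    ext t
    constructor
    · rintro ⟨p, rfl⟩
      exact ⟨σ (z p), hz1 p, hz2 p, rfl⟩
    · rintro ⟨w, hw, ⟨a, b, c, hCM⟩, rfl⟩
      obtain ⟨z0, rfl, L, hL, hLz⟩ := lat_of_CM hl hl5 hθ hσ hw hCM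
      obtain ⟨I, hI, x1, hx1, h1⟩ := lat_ideal hG (EL_lat hG hL) (fun x v hx hv => EL_smul hG hx hv)
      obtain ⟨C, x2, hx2, h2⟩ := hr2 I hI
      set x := x2 * x1 with hxdef
      have hx : x ≠ 0 := mul_ne_zero hx2 hx1
      have h3 : ∀ v, v ∈ EL ω L ↔ x * v ∈ MI (rep C) := by
        intro v; rw [h1, h2, hxdef, mul_assoc]
      have hLF : scale x L ∈ FF θ ω (MI (rep C)) := by
        refine ⟨⟨?_, ?_, ?_⟩, ?_⟩
        · rintro _ ⟨u, hu, rfl⟩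
          exact ⟨θ * u, hL.st _ hu, by simp; ring⟩
        · obtain ⟨v, hv, h0⟩ := hL.ne
          exact ⟨x * v, ⟨v, hv, rfl⟩, mul_ne_zero hx h0⟩
        · obtain ⟨n, hn, h⟩ := (MI_lat hG (hr0 C)).fin
          refine ⟨n, hn, ?_⟩
          rintro _ ⟨u, hu, rfl⟩
          exact h _ ((h3 u).mp ⟨u, hu, 0, L.zero_mem, by simp⟩)
        · intro v
          constructor
          · intro hv
            have : v / x ∈ EL ω L := by rw [h3, mul_div_cancel₀ _ hx]; exact hv
            obtain ⟨u, hu, w, hw, h⟩ := this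
            refine ⟨x * u, ⟨u, hu, rfl⟩, x * w, ⟨w, hw, rfl⟩, ?_⟩
            rw [div_eq_iff hx] at h
            rw [h]; ring
          · rintro ⟨_, ⟨u, hu, rfl⟩, _, ⟨w, hw, rfl⟩, rfl⟩
            have := (h3 (u + ω * w)).mp ⟨u, hu, w, hw, rfl⟩
            simp only [AddMonoidHom.coe_mulLeft]
            convert this using 1; ring
      obtain ⟨a', b', c', hCM'⟩ := hz2 ⟨C, scale x L, hLF⟩
      refine ⟨⟨C, scale x L, hLF⟩, ?_⟩
      exact lat_tt hl hl5 (hz1 _) hw hCM' hCM ((hz3 ⟨C, scale x L, hLF⟩).hom (scale_hom hx L)) hLz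
  rw [← hrange, ← Nat.card_coe_set_eq, Nat.card_range_of_injective hinj, Nat.card_sigma]
  simp only [Nat.card_coe_set_eq, hFC]
  simp [NumberField.classNumber]

end

end QH

/-- Theorem 1.1 A of Morton's paper: for a prime `l > 5`, `l ≡ 2, 3 (mod 5)`, the number `N`
of `a ∈ 𝔽_l` such that `x⁴ + a·x³ + (11a+2)·x² − a·x + 1` is irreducible over `𝔽_l` and
divides the Hasse invariant `Ĥ_{5,l}(x)` satisfies `4N = h(−5l)` if `l ≡ 1 (mod 4)`,
`2N = h(−5l) − 2` if `l ≡ 3 (mod 8)` and `N = h(−5l) − 1` if `l ≡ 7 (mod 8)`. -/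
theorem quartic_factors_of_hasse_invariant_count
    (l : ℕ) (hl : Nat.Prime l) (hl5 : 5 < l)
    (hmod5 : l % 5 = 2 ∨ l % 5 = 3)
    (K : Type) [Field K] [NumberField K] (θ : K)
    (hθ : θ ^ 2 = -((5 * l : ℕ) : K))
    (hK : Module.finrank ℚ K = 2)
    (N : ℕ)
    (hN : N = {a : ZMod l |
        Irreducible (X ^ 4 + C a * X ^ 3 + C (11 * a + 2) * X ^ 2 - C a * X + 1) ∧
        (X ^ 4 + C a * X ^ 3 + C (11 * a + 2) * X ^ 2 - C a * X + 1) ∣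
          hasseInvariant5 l}.ncard) :
    (l % 4 = 1 → 4 * N = NumberField.classNumber K) ∧
    (l % 8 = 3 → (2 * N : ℤ) = (NumberField.classNumber K : ℤ) - 2) ∧
    (l % 8 = 7 → (N : ℤ) = (NumberField.classNumber K : ℤ) - 1) := by
  haveI : Fact l.Prime := ⟨hl⟩
  have hT := QH.tX_count hl5 hmod5
  have hN' : {a : ZMod l | Irreducible (QH.gq a) ∧ QH.gq a ∣ hasseInvariant5 l}.ncard = N := hN.symm
  rw [hN'] at hT
  obtain ⟨σ, hσ⟩ := QH.sig_exists hl5 hθ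
  refine ⟨fun h4 => ?_, fun h8 => ?_, fun h8 => ?_⟩
  · have hc := QH.main_count hl hl5 hθ hσ (QH.gen1 hl hl5 h4 hθ hK) one_pos
      (fun M hM _ => QH.FF_one hM)
    rw [hc, if_neg (by omega)] at hT
    omega
  · obtain ⟨ω, hω⟩ : ∃ ω : K, 2 * ω = 1 + θ := ⟨(1 + θ) / 2, by field_simp⟩
    have hc := QH.main_count hl hl5 hθ hσ (QH.gen3 hl hl5 (by omega) hθ hK hω) two_pos
      (fun M hM h => (QH.FF_count hθ hσ hω hM h).1 h8)
    rw [hc, if_pos (by omega)] at hT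
    omega
  · obtain ⟨ω, hω⟩ : ∃ ω : K, 2 * ω = 1 + θ := ⟨(1 + θ) / 2, by field_simp⟩
    have hc := QH.main_count hl hl5 hθ hσ (QH.gen3 hl hl5 (by omega) hθ hK hω) four_pos
      (fun M hM h => (QH.FF_count hθ hσ hω hM h).2 h8)
    rw [hc, if_pos (by omega)] at hT
    omega
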